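/- Assume Hypotheses (H). Fix θ ∈ (0,1), g ∈ C^{0,θ}([0,T]×ℝ^N), and let f ∈ C_b(ℝ^N) (merely bounded and continuous). Then the Cauchy problem D_t u = 𝒜u + g on (0,T]×ℝ^N, u(0,·)=f, admits a bounded classical solution, i.e. a bounded continuous function u:[0,T]×ℝ^N→ℝ that is continuously differentiable once in t and twice in x on (0,T]×ℝ^N, satisfies the equation there, and satisfies u(0,·)=f. -/

import Mathlib

open Set Filter MeasureTheory Metric
open scoped Topology ENNReal RealInnerProductSpace Classical

noncomputable section

/-- `ℝ^N` with the Euclidean norm. -/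
abbrev ES (N : ℕ) := EuclideanSpace ℝ (Fin N)

/-- First-order partial derivative `D_i f` in the `i`-th coordinate direction. -/
def pd1 {N : ℕ} (f : ES N → ℝ) (i : Fin N) : ES N → ℝ :=
  fun x => fderiv ℝ f x (EuclideanSpace.single i 1)

/-- Second-order partial derivative `D_{ij} f`. -/
def pd2 {N : ℕ} (f : ES N → ℝ) (i j : Fin N) : ES N → ℝ := pd1 (pd1 f j) i

/-- Third-order partial derivative `D_{ijk} f`. -/
def pd3 {N : ℕ} (f : ES N → ℝ) (i j k : Fin N) : ES N → ℝ := pd1 (pd2 f j k) i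

/-- The nonautonomous elliptic operator
`(𝒜 φ)(t,x) = ∑ᵢⱼ qᵢⱼ(t,x) Dᵢⱼφ(x) + ∑ⱼ bⱼ(t,x) Dⱼφ(x) + c(t,x) φ(x)`. -/
def Aop {N : ℕ} (q : ℝ → ES N → Fin N → Fin N → ℝ) (b : ℝ → ES N → Fin N → ℝ)
    (c : ℝ → ES N → ℝ) (φ : ES N → ℝ) (t : ℝ) (x : ES N) : ℝ :=
  (∑ i, ∑ j, q t x i j * pd2 φ i j x) + (∑ j, b t x j * pd1 φ j x) + c t x * φ x

/-- Membership in the parabolic Hölder space `C^{δ/2,δ}([0,T] × B(0,R))`. -/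
def ParabolicHolderOn {N : ℕ} (T δ R : ℝ) (h : ℝ → ES N → ℝ) : Prop :=
  ∃ C : ℝ, ∀ t ∈ Icc (0:ℝ) T, ∀ s ∈ Icc (0:ℝ) T,
    ∀ x ∈ closedBall (0 : ES N) R, ∀ y ∈ closedBall (0 : ES N) R,
      |h t x - h s y| ≤ C * (|t - s| + ‖x - y‖ ^ 2) ^ (δ / 2)

/-- Hypotheses (H) of Lorenzi's paper (smooth unbounded coefficients). -/
structure Hyp (N : ℕ) (T : ℝ) (q : ℝ → ES N → Fin N → Fin N → ℝ)
    (b : ℝ → ES N → Fin N → ℝ) (c : ℝ → ES N → ℝ) where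
  T_pos : 0 < T
  N_pos : 1 ≤ N
  /- (i) smoothness in space and parabolic Hölder regularity up to third-order
     spatial derivatives on `[0,T] × B(0,R)` for every `R`. -/
  δ : ℝ
  δ_mem : δ ∈ Ioo (0:ℝ) 1
  smooth_q : ∀ t ∈ Icc (0:ℝ) T, ∀ i j, ContDiff ℝ 3 fun x => q t x i j
  smooth_b : ∀ t ∈ Icc (0:ℝ) T, ∀ j, ContDiff ℝ 3 fun x => b t x j
  smooth_c : ∀ t ∈ Icc (0:ℝ) T, ContDiff ℝ 3 fun x => c t x
  holder_q : ∀ R > 0, ∀ i j, ParabolicHolderOn T δ R fun t x => q t x i j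
  holder_q1 : ∀ R > 0, ∀ i j k, ParabolicHolderOn T δ R fun t x => pd1 (fun y => q t y i j) k x
  holder_q2 : ∀ R > 0, ∀ i j k l, ParabolicHolderOn T δ R fun t x => pd2 (fun y => q t y i j) k l x
  holder_q3 : ∀ R > 0, ∀ i j k l m, ParabolicHolderOn T δ R fun t x => pd3 (fun y => q t y i j) k l m x
  holder_b : ∀ R > 0, ∀ j, ParabolicHolderOn T δ R fun t x => b t x j
  holder_b1 : ∀ R > 0, ∀ j k, ParabolicHolderOn T δ R fun t x => pd1 (fun y => b t y j) k x
  holder_b2 : ∀ R > 0, ∀ j k l, ParabolicHolderOn T δ R fun t x => pd2 (fun y => b t y j) k l x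
  holder_b3 : ∀ R > 0, ∀ j k l m, ParabolicHolderOn T δ R fun t x => pd3 (fun y => b t y j) k l m x
  holder_c : ∀ R > 0, ParabolicHolderOn T δ R c
  holder_c1 : ∀ R > 0, ∀ k, ParabolicHolderOn T δ R fun t x => pd1 (c t) k x
  holder_c2 : ∀ R > 0, ∀ k l, ParabolicHolderOn T δ R fun t x => pd2 (c t) k l x
  holder_c3 : ∀ R > 0, ∀ k l m, ParabolicHolderOn T δ R fun t x => pd3 (c t) k l m x
  /- (ii) symmetry and (uniform) ellipticity. -/
  q_symm : ∀ t ∈ Icc (0:ℝ) T, ∀ x i j, q t x i j = q t x j i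
  ν : ℝ → ES N → ℝ
  ν₀ : ℝ
  ν₀_pos : 0 < ν₀
  ν_lb : ∀ t ∈ Icc (0:ℝ) T, ∀ x, ν₀ ≤ ν t x
  ellip : ∀ t ∈ Icc (0:ℝ) T, ∀ x, ∀ ξ : ES N, ν t x * ‖ξ‖ ^ 2 ≤ ∑ i, ∑ j, q t x i j * ξ i * ξ j
  /- (iii) growth conditions. -/
  C₁ : ℝ
  C₂ : ℝ
  C₃ : ℝ
  C₁_pos : 0 < C₁
  C₂_pos : 0 < C₂
  C₃_pos : 0 < C₃
  growth_Q : ∀ t ∈ Icc (0:ℝ) T, ∀ x,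
    ‖(EuclideanSpace.equiv (Fin N) ℝ).symm fun i => ∑ j, q t x i j * x j‖
      ≤ C₁ * (1 + ‖x‖ ^ 2) * ν t x
  growth_tr : ∀ t ∈ Icc (0:ℝ) T, ∀ x, (∑ i, q t x i i) ≤ C₂ * (1 + ‖x‖ ^ 2) * ν t x
  growth_b : ∀ t ∈ Icc (0:ℝ) T, ∀ x, (∑ j, b t x j * x j) ≤ C₃ * (1 + ‖x‖ ^ 2) * ν t x
  /- (iv) `c` is bounded from above. -/
  c₀ : ℝ
  c_ub : ∀ t ∈ Icc (0:ℝ) T, ∀ x, c t x ≤ c₀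
  /- (v) bounds on the derivatives of the diffusion coefficients. -/
  K₁ : ℝ
  K₂ : ℝ
  K₃ : ℝ
  K₁_pos : 0 < K₁
  K₂_pos : 0 < K₂
  K₃_pos : 0 < K₃
  dq1_bound : ∀ t ∈ Icc (0:ℝ) T, ∀ x i j k, |pd1 (fun y => q t y i j) k x| ≤ K₁ * ν t x
  dq3_bound : ∀ t ∈ Icc (0:ℝ) T, ∀ x i j k l m, |pd3 (fun y => q t y i j) k l m x| ≤ K₃ * ν t x
  dq2_quad : ∀ t ∈ Icc (0:ℝ) T, ∀ x, ∀ Ξ : Fin N → Fin N → ℝ, (∀ h k, Ξ h k = Ξ k h) →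
    (∑ h, ∑ k, ∑ l, ∑ m, pd2 (fun y => q t y h k) l m x * Ξ h k * Ξ l m)
      ≤ K₂ * ν t x * ∑ h, ∑ k, Ξ h k ^ 2
  /- (vi) dissipativity and bounds on the derivatives of the drift and of `c`. -/
  d : ℝ → ES N → ℝ
  r : ℝ → ES N → ℝ
  ϱ : ℝ → ES N → ℝ
  ϱ₀ : ℝ
  ϱ₀_pos : 0 < ϱ₀
  ϱ_lb : ∀ t ∈ Icc (0:ℝ) T, ∀ x, ϱ₀ ≤ ϱ t x
  L₁ : ℝ
  L₂ : ℝ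
  L₃ : ℝ
  L₁_pos : 0 < L₁
  L₂_pos : 0 < L₂
  L₃_pos : 0 < L₃
  dissip : ∀ t ∈ Icc (0:ℝ) T, ∀ x, ∀ ξ : ES N,
    (∑ i, ∑ j, pd1 (fun y => b t y i) j x * ξ j * ξ i) ≤ d t x * ‖ξ‖ ^ 2
  db2_bound : ∀ t ∈ Icc (0:ℝ) T, ∀ x j k l, |pd2 (fun y => b t y j) k l x| ≤ r t x
  db3_bound : ∀ t ∈ Icc (0:ℝ) T, ∀ x j k l m, |pd3 (fun y => b t y j) k l m x| ≤ r t x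
  dc1_bound : ∀ t ∈ Icc (0:ℝ) T, ∀ x k, |pd1 (c t) k x| ≤ ϱ t x
  dc2_bound : ∀ t ∈ Icc (0:ℝ) T, ∀ x k l, |pd2 (c t) k l x| ≤ ϱ t x
  dc3_bound : ∀ t ∈ Icc (0:ℝ) T, ∀ x k l m, |pd3 (c t) k l m x| ≤ ϱ t x
  funz : ∀ t ∈ Icc (0:ℝ) T, ∀ x, d t x + L₁ * r t x + L₂ * ϱ t x ^ 2 ≤ L₃ * ν t x
  /- (vii) existence of a Lyapunov function. -/
  liap : ∃ φ : ES N → ℝ, ∃ lam : ℝ, 0 < lam ∧ (∀ x, 0 < φ x) ∧ ContDiff ℝ 2 φ ∧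
    Tendsto φ (cocompact (ES N)) atTop ∧
    ∃ M : ℝ, ∀ t ∈ Icc (0:ℝ) T, ∀ x, Aop q b c φ t x - lam * φ x ≤ M

/-- `u` is a bounded classical solution on `[s,τ] × ℝ^N` of the homogeneous Cauchy problem
`D_t u = 𝒜 u`, `u(s,·) = f`: it is bounded and continuous on `[s,τ] × ℝ^N`, continuously
differentiable once in time and twice in space on `(s,τ] × ℝ^N`, satisfies the equation there
and attains the initial datum `f` at time `s`. -/
def IsBCSol {N : ℕ} (q : ℝ → ES N → Fin N → Fin N → ℝ) (b : ℝ → ES N → Fin N → ℝ)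
    (c : ℝ → ES N → ℝ) (s τ : ℝ) (f : ES N → ℝ) (u : ℝ → ES N → ℝ) : Prop :=
  (∃ M, ∀ t ∈ Icc s τ, ∀ x, |u t x| ≤ M) ∧
  ContinuousOn (fun p : ℝ × ES N => u p.1 p.2) (Icc s τ ×ˢ univ) ∧
  (∀ t ∈ Ioc s τ, ContDiff ℝ 2 (u t)) ∧
  (∀ x, ∀ t ∈ Ioc s τ, DifferentiableAt ℝ (fun t' => u t' x) t) ∧
  ContinuousOn (fun p : ℝ × ES N => deriv (fun t' => u t' p.2) p.1) (Ioc s τ ×ˢ univ) ∧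
  (∀ i, ContinuousOn (fun p : ℝ × ES N => pd1 (u p.1) i p.2) (Ioc s τ ×ˢ univ)) ∧
  (∀ i j, ContinuousOn (fun p : ℝ × ES N => pd2 (u p.1) i j p.2) (Ioc s τ ×ˢ univ)) ∧
  (∀ t ∈ Ioc s τ, ∀ x, deriv (fun t' => u t' x) t = Aop q b c (u t) t x) ∧
  (∀ x, u s x = f x)

/-- `u` is a bounded classical solution on `[0,T] × ℝ^N` of the nonhomogeneous Cauchy problem
`D_t u = 𝒜 u + g`, `u(0,·) = f`, continuously differentiable once in time and twice in space
on all of `[0,T] × ℝ^N`. -/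
def IsBCSolInhom {N : ℕ} (q : ℝ → ES N → Fin N → Fin N → ℝ) (b : ℝ → ES N → Fin N → ℝ)
    (c : ℝ → ES N → ℝ) (T : ℝ) (f : ES N → ℝ) (g : ℝ → ES N → ℝ) (u : ℝ → ES N → ℝ) : Prop :=
  (∃ M, ∀ t ∈ Icc (0:ℝ) T, ∀ x, |u t x| ≤ M) ∧
  (∀ t ∈ Icc (0:ℝ) T, ContDiff ℝ 2 (u t)) ∧
  (∀ x, ∀ t ∈ Icc (0:ℝ) T, DifferentiableWithinAt ℝ (fun t' => u t' x) (Icc (0:ℝ) T) t) ∧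
  ContinuousOn (fun p : ℝ × ES N => derivWithin (fun t' => u t' p.2) (Icc (0:ℝ) T) p.1)
    (Icc (0:ℝ) T ×ˢ univ) ∧
  (∀ i, ContinuousOn (fun p : ℝ × ES N => pd1 (u p.1) i p.2) (Icc (0:ℝ) T ×ˢ univ)) ∧
  (∀ i j, ContinuousOn (fun p : ℝ × ES N => pd2 (u p.1) i j p.2) (Icc (0:ℝ) T ×ˢ univ)) ∧
  (∀ t ∈ Icc (0:ℝ) T, ∀ x,
    derivWithin (fun t' => u t' x) (Icc (0:ℝ) T) t = Aop q b c (u t) t x + g t x) ∧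
  (∀ x, u 0 x = f x)

/-- Extended-real sup norm of the `k`-th derivative. -/
def supNormE {N : ℕ} (k : ℕ) (f : ES N → ℝ) : ℝ≥0∞ :=
  ⨆ x : ES N, ENNReal.ofReal ‖iteratedFDeriv ℝ k f x‖

/-- Extended-real `γ`-Hölder seminorm of the `k`-th derivative. -/
def holderSemiE {N : ℕ} (k : ℕ) (γ : ℝ) (f : ES N → ℝ) : ℝ≥0∞ :=
  ⨆ (x : ES N) (y : ES N) (_ : x ≠ y),
    ENNReal.ofReal (‖iteratedFDeriv ℝ k f x - iteratedFDeriv ℝ k f y‖ / ‖x - y‖ ^ γ)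

/-- The `C^α_b(ℝ^N)` norm (valued in `[0,∞]`): sup norms of the derivatives up to order `⌊α⌋`
plus, when `α ∉ ℕ`, the `(α-⌊α⌋)`-Hölder seminorm of the `⌊α⌋`-th order derivatives. -/
def CbNorm {N : ℕ} (α : ℝ) (f : ES N → ℝ) : ℝ≥0∞ :=
  (∑ k ∈ Finset.range (⌊α⌋₊ + 1), supNormE k f) +
    (if (⌊α⌋₊ : ℝ) = α then 0 else holderSemiE ⌊α⌋₊ (α - ⌊α⌋₊) f)

/-- Membership in `C^α_b(ℝ^N)`. -/
def MemCb {N : ℕ} (α : ℝ) (f : ES N → ℝ) : Prop :=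
  ContDiff ℝ (⌊α⌋₊ : ℕ) f ∧ CbNorm α f ≠ ⊤

/-! ### Hölder functions, second-order calculus -/

/-- Linear forms on `ℝ^N`. -/
abbrev V1 (N : ℕ) := ES N →L[ℝ] ℝ

/-- Bilinear forms on `ℝ^N`. -/
abbrev H2 (N : ℕ) := ES N →L[ℝ] ES N →L[ℝ] ℝ

/-- Gradient. -/
abbrev D {N : ℕ} (u : ES N → ℝ) : ES N → V1 N := fderiv ℝ u

/-- Hessian. -/
abbrev D2 {N : ℕ} (u : ES N → ℝ) : ES N → H2 N := fderiv ℝ (fderiv ℝ u)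

/-- Global Hölder condition with exponent `θ` and constant `C`. -/
def Hol {N : ℕ} {F : Type*} [NormedAddCommGroup F] (θ C : ℝ) (f : ES N → F) : Prop :=
  ∀ x y, ‖f x - f y‖ ≤ C * ‖x - y‖ ^ θ

/-- Functions of class `C^{2,θ}` with all bounds controlled by `C`. -/
structure C2b {N : ℕ} (θ C : ℝ) (φ : ES N → ℝ) : Prop where
  cd : ContDiff ℝ 2 φ
  b0 : ∀ x, |φ x| ≤ C
  b1 : ∀ x, ‖D φ x‖ ≤ C
  b2 : ∀ x, ‖D2 φ x‖ ≤ C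
  hol : Hol θ C (D2 φ)

section Holder
variable {N : ℕ} {F : Type*} [NormedAddCommGroup F] {θ C C' : ℝ} {f g : ES N → F}

lemma Hol.mono (h : Hol θ C f) (hC : C ≤ C') : Hol θ C' f := fun x y =>
  (h x y).trans (mul_le_mul_of_nonneg_right hC (by positivity))

lemma Hol.of_forall_gt (h : ∀ e > 0, Hol θ (C + e) f) : Hol θ C f := by
  intro x y
  refine le_of_forall_pos_le_add fun e he => ?_
  have hp : 0 < ‖x - y‖ ^ θ + 1 := by positivity
  have := h (e / (‖x - y‖ ^ θ + 1)) (by positivity) x y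
  have h3 : e / (‖x - y‖ ^ θ + 1) * ‖x - y‖ ^ θ ≤ e := by
    rw [div_mul_eq_mul_div, div_le_iff₀ hp]
    nlinarith [Real.rpow_nonneg (norm_nonneg (x - y)) θ]
  nlinarith

lemma Hol.add (h : Hol θ C f) (h' : Hol θ C' g) : Hol θ (C + C') (fun x => f x + g x) := by
  intro x y
  calc ‖f x + g x - (f y + g y)‖ = ‖(f x - f y) + (g x - g y)‖ := by congr 1; abel
    _ ≤ _ := (norm_add_le _ _).trans (by rw [add_mul]; exact add_le_add (h x y) (h' x y))

lemma Hol.neg (h : Hol θ C f) : Hol θ C (fun x => - f x) := by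
  intro x y
  rw [neg_sub_neg, norm_sub_rev]; exact h x y

lemma Hol.sub (h : Hol θ C f) (h' : Hol θ C' g) : Hol θ (C + C') (fun x => f x - g x) := by
  simpa only [sub_eq_add_neg] using h.add h'.neg

lemma Hol.continuous (h : Hol θ C f) (hθ : 0 < θ) : Continuous f := by
  rw [continuous_iff_continuousAt]
  intro x
  rw [ContinuousAt, tendsto_iff_norm_sub_tendsto_zero]
  have hb : Tendsto (fun y => C * ‖y - x‖ ^ θ) (𝓝 x) (𝓝 0) := by
    have : Continuous fun y : ES N => C * ‖y - x‖ ^ θ :=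
      continuous_const.mul ((continuous_id.sub continuous_const).norm.rpow_const
        (fun _ => Or.inr hθ.le))
    simpa [Real.zero_rpow hθ.ne'] using this.tendsto x
  exact squeeze_zero (fun _ => norm_nonneg _) (fun y => h y x) hb

/-- A bounded Lipschitz function is Hölder of every exponent in `[0,1]`. -/
lemma Hol.of_lip {M L : ℝ} (hθ0 : 0 ≤ θ) (hθ1 : θ ≤ 1) (hM : ∀ x, ‖f x‖ ≤ M) (hL : 0 ≤ L)
    (h : ∀ x y, ‖f x - f y‖ ≤ L * ‖x - y‖) : Hol θ (2 * M + L) f := by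
  intro x y
  have hM0 : 0 ≤ M := (norm_nonneg _).trans (hM x)
  rcases le_total ‖x - y‖ 1 with h1 | h1
  · have : ‖x - y‖ ≤ ‖x - y‖ ^ θ := by
      rcases eq_or_lt_of_le (norm_nonneg (x - y)) with h0 | h0
      · rw [← h0]; positivity
      · exact Real.self_le_rpow_of_le_one h0.le h1 hθ1
    have h2 := Real.rpow_nonneg (norm_nonneg (x - y)) θ
    nlinarith [h x y]
  · have : 1 ≤ ‖x - y‖ ^ θ := Real.one_le_rpow h1 hθ0
    have h3 := (norm_sub_le (f x) (f y)).trans (add_le_add (hM x) (hM y))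
    nlinarith

/-- Bilinear product rule for Hölder functions. -/
lemma Hol.bilin {F₁ F₂ F₃ : Type*} [NormedAddCommGroup F₁] [NormedSpace ℝ F₁]
    [NormedAddCommGroup F₂] [NormedSpace ℝ F₂] [NormedAddCommGroup F₃] [NormedSpace ℝ F₃]
    (Bm : F₁ →L[ℝ] F₂ →L[ℝ] F₃) {f : ES N → F₁} {g : ES N → F₂} {K m₁ c₁ m₂ c₂ : ℝ}
    (hK : ∀ p q, ‖Bm p q‖ ≤ K * ‖p‖ * ‖q‖) (hK0 : 0 ≤ K)
    (hf : ∀ x, ‖f x‖ ≤ m₁) (hf' : Hol θ c₁ f) (hg : ∀ x, ‖g x‖ ≤ m₂) (hg' : Hol θ c₂ g) :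
    Hol θ (K * (m₁ * c₂ + c₁ * m₂)) (fun x => Bm (f x) (g x)) := by
  intro x y
  have h1 : Bm (f x) (g x) - Bm (f y) (g y) = Bm (f x) (g x - g y) + Bm (f x - f y) (g y) := by
    simp
  rw [h1]
  have hm1 : 0 ≤ m₁ := (norm_nonneg _).trans (hf x)
  have hm2 : 0 ≤ m₂ := (norm_nonneg _).trans (hg x)
  have h2 : ‖Bm (f x) (g x - g y)‖ ≤ K * m₁ * (c₂ * ‖x - y‖ ^ θ) :=
    (hK _ _).trans (by gcongr; exact hf x; exact hg' x y)
  have h3 : ‖Bm (f x - f y) (g y)‖ ≤ K * (c₁ * ‖x - y‖ ^ θ) * m₂ := by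
    refine (hK _ _).trans ?_
    have := hf' x y
    have h0 := (norm_nonneg _).trans this
    gcongr
    exact hg y
  refine (norm_add_le _ _).trans ((add_le_add h2 h3).trans (le_of_eq ?_))
  ring

lemma Hol.clm {F₁ F₂ : Type*} [NormedAddCommGroup F₁] [NormedSpace ℝ F₁]
    [NormedAddCommGroup F₂] [NormedSpace ℝ F₂]
    {f : ES N → F₁ →L[ℝ] F₂} {g : ES N → F₁} {m₁ c₁ m₂ c₂ : ℝ}
    (hf : ∀ x, ‖f x‖ ≤ m₁) (hf' : Hol θ c₁ f) (hg : ∀ x, ‖g x‖ ≤ m₂) (hg' : Hol θ c₂ g) :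
    Hol θ (m₁ * c₂ + c₁ * m₂) (fun x => f x (g x)) := by
  simpa using Hol.bilin (ContinuousLinearMap.id ℝ (F₁ →L[ℝ] F₂)) (K := 1)
    (fun p q => by simpa using p.le_opNorm q) zero_le_one hf hf' hg hg'

lemma Hol.smul {F₂ : Type*} [NormedAddCommGroup F₂] [NormedSpace ℝ F₂]
    {f : ES N → ℝ} {g : ES N → F₂} {m₁ c₁ m₂ c₂ : ℝ}
    (hf : ∀ x, ‖f x‖ ≤ m₁) (hf' : Hol θ c₁ f) (hg : ∀ x, ‖g x‖ ≤ m₂) (hg' : Hol θ c₂ g) :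
    Hol θ (m₁ * c₂ + c₁ * m₂) (fun x => f x • g x) := by
  simpa using Hol.bilin (ContinuousLinearMap.lsmul ℝ ℝ) (K := 1)
    (fun p q => by simp [norm_smul]) zero_le_one hf hf' hg hg'

lemma Hol.const_smul {F₂ : Type*} [NormedAddCommGroup F₂] [NormedSpace ℝ F₂]
    {g : ES N → F₂} (a : ℝ) (hg : Hol θ C g) : Hol θ (|a| * C) (fun x => a • g x) := by
  intro x y
  rw [← smul_sub, norm_smul, Real.norm_eq_abs, mul_assoc]
  exact mul_le_mul_of_nonneg_left (hg x y) (abs_nonneg a)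

/-- Cutting off a locally Hölder function. -/
lemma Hol.cut {F₂ : Type*} [NormedAddCommGroup F₂] [NormedSpace ℝ F₂]
    {S : Set (ES N)} {f : ES N → ℝ} {g : ES N → F₂} {m₁ c₁ m₂ c₂ : ℝ} (hm₁ : 0 ≤ m₁) (hm₂ : 0 ≤ m₂)
    (hc₂ : 0 ≤ c₂)
    (hf : ∀ x, ‖f x‖ ≤ m₁) (hf' : Hol θ c₁ f) (hS : ∀ x ∉ S, f x = 0)
    (hg : ∀ x ∈ S, ‖g x‖ ≤ m₂) (hg' : ∀ x ∈ S, ∀ y ∈ S, ‖g x - g y‖ ≤ c₂ * ‖x - y‖ ^ θ) :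
    Hol θ (m₁ * c₂ + c₁ * m₂) (fun x => f x • g x) := by
  have key : ∀ x y, y ∈ S → ‖f x • g x - f y • g y‖ ≤ (m₁ * c₂ + c₁ * m₂) * ‖x - y‖ ^ θ := by
    intro x y hy
    have hr := Real.rpow_nonneg (norm_nonneg (x - y)) θ
    have h0 := (norm_nonneg _).trans (hf' x y)
    have hm2 := (norm_nonneg _).trans (hg y hy)
    have h3 : ‖f x - f y‖ * ‖g y‖ ≤ c₁ * ‖x - y‖ ^ θ * m₂ :=
      mul_le_mul (hf' x y) (hg y hy) (norm_nonneg _) h0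
    by_cases hx : x ∈ S
    · have h1 : f x • g x - f y • g y = f x • (g x - g y) + (f x - f y) • g y := by
        rw [smul_sub, sub_smul]; abel
      rw [h1]
      refine (norm_add_le _ _).trans ?_
      rw [norm_smul, norm_smul]
      have h2 : ‖f x‖ * ‖g x - g y‖ ≤ m₁ * (c₂ * ‖x - y‖ ^ θ) :=
        mul_le_mul (hf x) (hg' x hx y hy) (norm_nonneg _) hm₁
      nlinarith
    · have h1 : f x • g x - f y • g y = (f x - f y) • g y := by
        rw [hS x hx]; simp
      rw [h1, norm_smul]
      have : 0 ≤ m₁ * c₂ * ‖x - y‖ ^ θ := by positivity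
      nlinarith
  intro x y
  by_cases hy : y ∈ S
  · exact key x y hy
  · by_cases hx : x ∈ S
    · have := key y x hx
      rwa [norm_sub_rev, norm_sub_rev y x] at this
    · simp only [hS x hx, hS y hy, zero_smul, sub_self, norm_zero]
      have h0 := (norm_nonneg _).trans (hf' x y)
      have hr := Real.rpow_nonneg (norm_nonneg (x - y)) θ
      have : 0 ≤ m₁ * c₂ * ‖x - y‖ ^ θ := by positivity
      nlinarith

end Holder

section Calculus
variable {N : ℕ}

lemma norm_sub_le_of_fderiv_bound {F : Type*} [NormedAddCommGroup F] [NormedSpace ℝ F]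
    {f : ES N → F} {C : ℝ} (hf : Differentiable ℝ f) (h : ∀ x, ‖fderiv ℝ f x‖ ≤ C) (x y : ES N) :
    ‖f y - f x‖ ≤ C * ‖y - x‖ :=
  convex_univ.norm_image_sub_le_of_norm_fderiv_le (fun z _ => hf z) (fun z _ => h z)
    (mem_univ x) (mem_univ y)

/-- First-order Taylor estimate for a function whose derivative varies by at most `C` on the
segment. -/
lemma taylor_one {F : Type*} [NormedAddCommGroup F] [NormedSpace ℝ F]
    {f : ES N → F} {C : ℝ} (hf : Differentiable ℝ f) (x y : ES N)
    (h : ∀ z, ‖z - x‖ ≤ ‖y - x‖ → ‖fderiv ℝ f z - fderiv ℝ f x‖ ≤ C) :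
    ‖f y - f x - fderiv ℝ f x (y - x)‖ ≤ C * ‖y - x‖ :=
  (convex_closedBall x ‖y - x‖).norm_image_sub_le_of_norm_fderiv_le' (fun z _ => hf z)
    (fun z hz => h z (by simpa [dist_eq_norm] using hz))
    (by simp) (by simp [dist_eq_norm])

lemma C2b.diff {θ C : ℝ} {φ : ES N → ℝ} (h : C2b θ C φ) : Differentiable ℝ φ :=
  h.cd.differentiable (by norm_num)

lemma contDiff_fderiv_of_two {φ : ES N → ℝ} (h : ContDiff ℝ 2 φ) : ContDiff ℝ 1 (fderiv ℝ φ) :=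
  h.fderiv_right (m := 1) (by norm_num)

lemma C2b.diff1 {θ C : ℝ} {φ : ES N → ℝ} (h : C2b θ C φ) : Differentiable ℝ (D φ) :=
  (contDiff_fderiv_of_two h.cd).differentiable (by norm_num)

lemma C2b.nonneg {θ C : ℝ} {φ : ES N → ℝ} (h : C2b θ C φ) : 0 ≤ C :=
  (abs_nonneg _).trans (h.b0 0)

lemma C2b.mono {θ C C' : ℝ} {φ : ES N → ℝ} (h : C2b θ C φ) (hC : C ≤ C') : C2b θ C' φ :=
  ⟨h.cd, fun x => (h.b0 x).trans hC, fun x => (h.b1 x).trans hC, fun x => (h.b2 x).trans hC,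
    h.hol.mono hC⟩

lemma D2_symm {φ : ES N → ℝ} (h : ContDiff ℝ 2 φ) (x v w : ES N) :
    D2 φ x v w = D2 φ x w v := by
  have : IsSymmSndFDerivAt ℝ φ x := h.contDiffAt.isSymmSndFDerivAt (by simp)
  exact this v w

lemma taylor_D2 {φ : ES N → ℝ} {C : ℝ} (hφ : ContDiff ℝ 2 φ) (h : ∀ x, ‖D2 φ x‖ ≤ C)
    (x y : ES N) : |φ y - φ x - D φ x (y - x)| ≤ C * ‖y - x‖ ^ 2 := by
  have hd1 := (contDiff_fderiv_of_two hφ).differentiable (by norm_num)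
  have hC : 0 ≤ C := (norm_nonneg (D2 φ 0)).trans (h 0)
  have := taylor_one (C := C * ‖y - x‖) (hφ.differentiable (by norm_num)) x y (fun z hz =>
    (norm_sub_le_of_fderiv_bound hd1 h x z).trans (by gcongr))
  rw [Real.norm_eq_abs] at this
  nlinarith

lemma taylor_D_hol {φ : ES N → ℝ} {θ C : ℝ} (hθ : 0 ≤ θ) (hC : 0 ≤ C) (hφ : ContDiff ℝ 2 φ)
    (h : Hol θ C (D2 φ)) (x y : ES N) :
    ‖D φ y - D φ x - D2 φ x (y - x)‖ ≤ C * ‖y - x‖ ^ θ * ‖y - x‖ := by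
  have hd1 := (contDiff_fderiv_of_two hφ).differentiable (by norm_num)
  exact taylor_one hd1 x y (fun z hz => (h z x).trans (by gcongr))

/-- One-dimensional second difference bound. -/
lemma second_diff_one_dim {g g' g'' : ℝ → ℝ} {K : ℝ}
    (h1 : ∀ s ∈ Icc (-1 : ℝ) 1, HasDerivAt g (g' s) s)
    (h2 : ∀ s ∈ Icc (-1 : ℝ) 1, HasDerivAt g' (g'' s) s)
    (hK : ∀ s ∈ Icc (-1 : ℝ) 1, |g'' s| ≤ K) : |g 1 + g (-1) - 2 * g 0| ≤ 2 * K := by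
  have hK0 : 0 ≤ K := (abs_nonneg _).trans (hK 0 (by norm_num))
  have hg' : ∀ s ∈ Icc (0 : ℝ) 1, ‖g' s - g' (-s)‖ ≤ 2 * K := by
    intro s hs
    have := (convex_Icc (-1 : ℝ) 1).norm_image_sub_le_of_norm_hasDerivWithin_le
      (f := g') (f' := g'') (C := K) (x := -s) (y := s)
      (fun z hz => (h2 z hz).hasDerivWithinAt) (fun z hz => hK z hz)
      ⟨by linarith [hs.2], by linarith [hs.1]⟩ ⟨by linarith [hs.1], hs.2⟩
    refine this.trans ?_
    have h3 : ‖s - -s‖ ≤ 2 := by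
      rw [Real.norm_eq_abs, abs_le]; constructor <;> linarith [hs.1, hs.2]
    nlinarith
  have := (convex_Icc (0 : ℝ) 1).norm_image_sub_le_of_norm_hasDerivWithin_le
      (f := fun s => g s + g (-s)) (f' := fun s => g' s - g' (-s)) (C := 2 * K) (x := 0) (y := 1)
      (fun z hz => by
        have ha := h1 z ⟨by linarith [hz.1], hz.2⟩
        have hb := (h1 (-z) ⟨by linarith [hz.2], by linarith [hz.1]⟩).comp z (hasDerivAt_neg z)
        exact ((ha.fun_add hb).congr_deriv (by ring)).hasDerivWithinAt) hg'
        (by norm_num) (by norm_num)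
  simp only [neg_zero, sub_zero, norm_one, mul_one, Real.norm_eq_abs] at this
  convert this using 2
  ring

lemma second_diff_bound {φ : ES N → ℝ} {x y k : ES N} {K : ℝ} (hφ : ContDiff ℝ 2 φ) (a : ℝ)
    (p : ℝ) (h : ∀ s ∈ Icc (-1 : ℝ) 1, |D2 φ (x + s • k) k k - a * D2 φ (y + s • k) k k - p| ≤ K) :
    |(φ (x + k) + φ (x - k) - 2 * φ x) - a * (φ (y + k) + φ (y - k) - 2 * φ y) - p| ≤ 2 * K := by
  have hd := hφ.differentiable (by norm_num)
  have hd1 := (contDiff_fderiv_of_two hφ).differentiable (by norm_num)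
  have hl : ∀ (z : ES N) s, HasDerivAt (fun s : ℝ => z + s • k) k s := fun z s => by
    simpa using ((hasDerivAt_id s).smul_const k).const_add z
  have hA : ∀ z s, HasDerivAt (fun s : ℝ => φ (z + s • k)) (D φ (z + s • k) k) s := fun z s =>
    (hd _).hasFDerivAt.comp_hasDerivAt s (hl z s)
  have hB : ∀ z s, HasDerivAt (fun s : ℝ => D φ (z + s • k) k) (D2 φ (z + s • k) k k) s :=
    fun z s => by
      have := ((hd1 _).hasFDerivAt.comp_hasDerivAt s (hl z s)).clm_apply (hasDerivAt_const s k)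
      simpa using this
  have := second_diff_one_dim
    (g := fun s => φ (x + s • k) - a * φ (y + s • k) - p * (s ^ 2 / 2))
    (g' := fun s => D φ (x + s • k) k - a * D φ (y + s • k) k - p * s)
    (g'' := fun s => D2 φ (x + s • k) k k - a * D2 φ (y + s • k) k k - p) (K := K)
    (fun s _ => by
      have h3 := ((hA x s).fun_sub ((hA y s).const_mul a)).fun_sub
        ((((hasDerivAt_id' s).fun_pow 2).div_const 2).const_mul p)
      exact h3.congr_deriv (by simp)) (fun s _ => by
      have h3 := ((hB x s).fun_sub ((hB y s).const_mul a)).fun_sub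
        ((hasDerivAt_id' s).const_mul p)
      exact h3.congr_deriv (by simp)) h
  convert this using 2
  simp only [one_smul, neg_smul, zero_smul, add_zero, ← sub_eq_add_neg]
  ring

lemma second_diff_hol {φ : ES N → ℝ} {θ C : ℝ} (hφ : ContDiff ℝ 2 φ)
    (h : Hol θ C (D2 φ)) (x y k : ES N) :
    |(φ (x + k) + φ (x - k) - 2 * φ x) - (φ (y + k) + φ (y - k) - 2 * φ y)|
      ≤ 2 * C * ‖x - y‖ ^ θ * ‖k‖ ^ 2 := by
  have := second_diff_bound (x := x) (y := y) (k := k) (K := C * ‖x - y‖ ^ θ * ‖k‖ ^ 2)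
    hφ 1 0 (fun s _ => by
      have h1 := h (x + s • k) (y + s • k)
      rw [add_sub_add_right_eq_sub] at h1
      have h2 := (D2 φ (x + s • k) - D2 φ (y + s • k)).le_opNorm₂ k k
      rw [Real.norm_eq_abs] at h2
      simp only [sub_apply] at h2
      rw [one_mul, sub_zero]
      refine h2.trans ?_
      rw [mul_assoc, ← pow_two]
      gcongr)
  simpa [mul_assoc] using this

lemma second_diff_approx {φ : ES N → ℝ} {θ C : ℝ} (hθ : 0 ≤ θ) (hC : 0 ≤ C) (hφ : ContDiff ℝ 2 φ)
    (h : Hol θ C (D2 φ)) (x k : ES N) :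
    |(φ (x + k) + φ (x - k) - 2 * φ x) - D2 φ x k k| ≤ 2 * C * ‖k‖ ^ θ * ‖k‖ ^ 2 := by
  have := second_diff_bound (x := x) (y := x) (k := k) (K := C * ‖k‖ ^ θ * ‖k‖ ^ 2)
    hφ 0 (D2 φ x k k) (fun s hs => by
      have h1 := h (x + s • k) x
      rw [add_sub_cancel_left, norm_smul] at h1
      have hs' : ‖s‖ * ‖k‖ ≤ ‖k‖ := by
        have : ‖s‖ ≤ 1 := by rw [Real.norm_eq_abs, abs_le]; exact hs
        nlinarith [norm_nonneg k]
      have h1' : ‖D2 φ (x + s • k) - D2 φ x‖ ≤ C * ‖k‖ ^ θ := h1.trans (by gcongr)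
      have h2 := (D2 φ (x + s • k) - D2 φ x).le_opNorm₂ k k
      rw [Real.norm_eq_abs] at h2
      simp only [sub_apply] at h2
      rw [zero_mul, sub_zero]
      refine h2.trans ?_
      rw [mul_assoc, ← pow_two]
      gcongr)
  simpa [mul_assoc] using this

lemma norm_le_of_quadratic {H : H2 N} {q : ℝ} (hq : 0 ≤ q) (hs : ∀ v w, H v w = H w v)
    (h : ∀ v, |H v v| ≤ q * ‖v‖ ^ 2) : ‖H‖ ≤ q := by
  have key : ∀ v w : ES N, ‖v‖ ≤ 1 → ‖w‖ ≤ 1 → |H v w| ≤ q := by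
    intro v w hv hw
    have e : H v w = (H (v + w) (v + w) - H (v - w) (v - w)) / 4 := by
      simp only [map_add, map_sub, add_apply, sub_apply,
        hs w v]
      ring
    have p := parallelogram_law_with_norm ℝ v w
    have h1 := abs_le.1 (h (v + w))
    have h2 := abs_le.1 (h (v - w))
    rw [e, abs_le]
    have : ‖v + w‖ ^ 2 + ‖v - w‖ ^ 2 ≤ 4 := by
      nlinarith [norm_nonneg v, norm_nonneg w]
    constructor <;> nlinarith
  refine H.opNorm_le_of_unit_norm hq fun v hv => ?_
  refine (H v).opNorm_le_of_unit_norm hq fun w hw => ?_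
  exact key v w hv.le hw.le

/-- Interpolation for the Hessian. -/
lemma interp_D2 {φ : ES N → ℝ} {θ C M η : ℝ} (hθ : 0 ≤ θ) (hC : 0 ≤ C) (hη : 0 < η)
    (hφ : ContDiff ℝ 2 φ) (h : Hol θ C (D2 φ)) (hM : ∀ x, |φ x| ≤ M) (x : ES N) :
    ‖D2 φ x‖ ≤ 2 * C * η ^ θ + 4 * M / η ^ 2 := by
  have hM0 : 0 ≤ M := (abs_nonneg _).trans (hM 0)
  refine norm_le_of_quadratic (by positivity) (D2_symm hφ x) fun v => ?_
  rcases eq_or_ne v 0 with rfl | hv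
  · simp
  have hv' : 0 < ‖v‖ := norm_pos_iff.2 hv
  set k : ES N := (η / ‖v‖) • v with hk
  have hkn : ‖k‖ = η := by
    rw [hk, norm_smul, Real.norm_eq_abs, abs_of_pos (by positivity)]; field_simp
  have h1 := second_diff_approx hθ hC hφ h x k
  have h2 : D2 φ x k k = (η / ‖v‖) ^ 2 * D2 φ x v v := by
    simp [hk]; ring
  rw [hkn, h2] at h1
  have h3 : |φ (x + k) + φ (x - k) - 2 * φ x| ≤ 4 * M := by
    have := abs_le.1 (hM (x + k)); have := abs_le.1 (hM (x - k)); have := abs_le.1 (hM x)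
    rw [abs_le]; constructor <;> linarith
  have h4 : |(η / ‖v‖) ^ 2 * D2 φ x v v| ≤ 2 * C * η ^ θ * η ^ 2 + 4 * M := by
    have := abs_le.1 h1; have := abs_le.1 h3
    rw [abs_le]; constructor <;> linarith
  rw [abs_mul, abs_of_pos (by positivity : 0 < (η / ‖v‖) ^ 2), div_pow, div_mul_eq_mul_div,
    div_le_iff₀ (by positivity)] at h4
  have h5 : (2 * C * η ^ θ + 4 * M / η ^ 2) * ‖v‖ ^ 2 =
      (2 * C * η ^ θ * η ^ 2 + 4 * M) * ‖v‖ ^ 2 / η ^ 2 := by field_simp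
  rw [h5, le_div_iff₀ (by positivity)]
  linarith

/-- Interpolation for the gradient. -/
lemma interp_D {φ : ES N → ℝ} {K M η : ℝ} (hη : 0 < η)
    (hφ : ContDiff ℝ 2 φ) (h : ∀ x, ‖D2 φ x‖ ≤ K) (hM : ∀ x, |φ x| ≤ M) (x : ES N) :
    ‖D φ x‖ ≤ K * η + 2 * M / η := by
  have hM0 : 0 ≤ M := (abs_nonneg _).trans (hM 0)
  have hK0 : 0 ≤ K := (norm_nonneg (D2 φ 0)).trans (h 0)
  refine ContinuousLinearMap.opNorm_le_of_unit_norm (by positivity) fun v hv => ?_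
  have h1 := taylor_D2 hφ h x (x + η • v)
  rw [add_sub_cancel_left, norm_smul, hv, Real.norm_eq_abs, abs_of_pos hη, map_smul,
    smul_eq_mul, mul_one] at h1
  have h4 : |η * D φ x v| ≤ K * η ^ 2 + 2 * M := by
    have := abs_le.1 h1; have := abs_le.1 (hM x); have := abs_le.1 (hM (x + η • v))
    rw [abs_le]; constructor <;> linarith
  rw [abs_mul, abs_of_pos hη] at h4
  rw [Real.norm_eq_abs]
  have h5 : K * η + 2 * M / η = (K * η ^ 2 + 2 * M) / η := by field_simp
  rw [h5, le_div_iff₀ hη]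
  linarith

end Calculus

/-! ### The Gaussian kernel -/

section Gaussian
variable {N : ℕ}

lemma integrable_exp_neg_sq {b : ℝ} (hb : 0 < b) :
    Integrable (fun z : ES N => Real.exp (-b * ‖z‖ ^ 2)) := by
  apply Integrable.of_integral_ne_zero
  rw [GaussianFourier.integral_rexp_neg_mul_sq_norm hb]
  have := Real.pi_pos
  positivity

lemma integrable_poly_exp (n : ℕ) {b : ℝ} (hb : 0 < b) :
    Integrable (fun z : ES N => (1 + ‖z‖) ^ n * Real.exp (-b * ‖z‖ ^ 2)) := by
  have hi := (integrable_exp_neg_sq (N := N) (half_pos hb)).const_mul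
    (n.factorial * Real.exp (1 + 1 / (2 * b)))
  refine hi.mono' (by fun_prop) (Eventually.of_forall fun z => ?_)
  rw [Real.norm_eq_abs, abs_of_nonneg (by positivity)]
  have h1 := Real.pow_div_factorial_le_exp (x := 1 + ‖z‖) (by positivity) n
  rw [div_le_iff₀ (by positivity)] at h1
  have h2 : Real.exp (1 + ‖z‖) * Real.exp (-b * ‖z‖ ^ 2) ≤
      Real.exp (1 + 1 / (2 * b)) * Real.exp (-(b / 2) * ‖z‖ ^ 2) := by
    rw [← Real.exp_add, ← Real.exp_add, Real.exp_le_exp]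
    have : ‖z‖ ≤ 1 / (2 * b) + b / 2 * ‖z‖ ^ 2 := by
      have h3 : 1 / (2 * b) + b / 2 * ‖z‖ ^ 2 - ‖z‖ = (b * ‖z‖ - 1) ^ 2 / (2 * b) := by
        field_simp; ring
      have : 0 ≤ (b * ‖z‖ - 1) ^ 2 / (2 * b) := by positivity
      linarith
    linarith
  calc (1 + ‖z‖) ^ n * Real.exp (-b * ‖z‖ ^ 2)
      ≤ (Real.exp (1 + ‖z‖) * n.factorial) * Real.exp (-b * ‖z‖ ^ 2) := by gcongr
    _ = n.factorial * (Real.exp (1 + ‖z‖) * Real.exp (-b * ‖z‖ ^ 2)) := by ring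
    _ ≤ n.factorial * (Real.exp (1 + 1 / (2 * b)) * Real.exp (-(b / 2) * ‖z‖ ^ 2)) := by gcongr
    _ = _ := by ring

/-- Unnormalised Gaussian. -/
def gE (z : ES N) : ℝ := Real.exp (-(1 / 4) * ‖z‖ ^ 2)

/-- Normalisation constant. -/
def gZ (N : ℕ) : ℝ := ∫ z : ES N, gE z

/-- Gaussian density with covariance `2 I`. -/
def gG (z : ES N) : ℝ := (gZ N)⁻¹ * gE z

lemma gZ_pos : 0 < gZ N := by
  unfold gZ gE
  rw [GaussianFourier.integral_rexp_neg_mul_sq_norm (by norm_num)]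
  have := Real.pi_pos
  positivity

lemma gE_pos (z : ES N) : 0 < gE z := Real.exp_pos _

lemma gG_pos (z : ES N) : 0 < gG z := mul_pos (inv_pos.2 gZ_pos) (gE_pos z)

lemma contDiff_gG : ContDiff ℝ 2 (gG (N := N)) :=
  contDiff_const.mul ((contDiff_const.mul (contDiff_norm_sq ℝ)).exp)

@[fun_prop] lemma continuous_gG : Continuous (gG (N := N)) := contDiff_gG.continuous

lemma integrable_gG_moment (n : ℕ) : Integrable (fun z : ES N => (1 + ‖z‖) ^ n * gG z) := by
  have := (integrable_poly_exp (N := N) n (b := 1 / 4) (by norm_num)).const_mul (gZ N)⁻¹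
  refine this.congr (Eventually.of_forall fun z => ?_)
  simp only [gG, gE]; ring

lemma integrable_gG : Integrable (gG (N := N)) := by
  simpa using integrable_gG_moment (N := N) 0

lemma integral_gG : ∫ z : ES N, gG z = 1 := by
  unfold gG
  rw [integral_const_mul]
  exact inv_mul_cancel₀ gZ_pos.ne'

lemma fderiv_gG (z k : ES N) : fderiv ℝ gG z k = -(1 / 2) * ⟪z, k⟫ * gG z := by
  have h1 : HasFDerivAt (fun z : ES N => ‖z‖ ^ 2) (2 • (innerSL ℝ z)) z :=
    (hasStrictFDerivAt_norm_sq z).hasFDerivAt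
  have h2 := ((h1.const_mul (-(1 / 4) : ℝ)).exp).const_mul (gZ N)⁻¹
  have h3 : HasFDerivAt gG _ z := h2
  rw [h3.fderiv]
  simp only [gG, gE, smul_apply, innerSL_apply_apply, smul_eq_mul, nsmul_eq_mul]
  push_cast
  ring

lemma gE_add_le (z w : ES N) (hw : ‖w‖ ≤ 1) :
    gE (z + w) ≤ Real.exp 1 * Real.exp (-(1 / 8) * ‖z‖ ^ 2) := by
  unfold gE
  rw [← Real.exp_add, Real.exp_le_exp]
  have h := norm_sub_le (z + w) w
  rw [add_sub_cancel_right] at h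
  have h2 : ‖z‖ ^ 2 ≤ (‖z + w‖ + ‖w‖) ^ 2 := by gcongr
  nlinarith [norm_nonneg w, norm_nonneg (z + w), sq_nonneg (‖z + w‖ - ‖w‖)]

lemma hasDerivAt_gE_line (z k : ES N) (s : ℝ) :
    HasDerivAt (fun s : ℝ => gE (z + s • k)) (-(1 / 2) * ⟪z + s • k, k⟫ * gE (z + s • k)) s := by
  have hl : HasDerivAt (fun s : ℝ => z + s • k) k s := by
    simpa using ((hasDerivAt_id s).smul_const k).const_add z
  have := ((hl.norm_sq).const_mul (-(1 / 4) : ℝ)).exp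
  refine this.congr_deriv ?_
  simp only [gE]; ring

lemma hasDerivAt_gE_line' (z k : ES N) (s : ℝ) :
    HasDerivAt (fun s : ℝ => -(1 / 2) * ⟪z + s • k, k⟫ * gE (z + s • k))
      (((1 / 4) * ⟪z + s • k, k⟫ ^ 2 - (1 / 2) * ‖k‖ ^ 2) * gE (z + s • k)) s := by
  have hl : HasDerivAt (fun s : ℝ => z + s • k) k s := by
    simpa using ((hasDerivAt_id s).smul_const k).const_add z
  have h1 := (hl.inner ℝ (hasDerivAt_const s k)).const_mul (-(1 / 2) : ℝ)
  have := h1.fun_mul (hasDerivAt_gE_line z k s)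
  refine this.congr_deriv ?_
  simp only [inner_zero_right, zero_add, real_inner_self_eq_norm_sq]; ring

lemma gE_diff_le (z k : ES N) (hk : ‖k‖ ≤ 1) :
    |gE (z + k) - gE z| ≤
      ‖k‖ * (Real.exp 1 * ((1 + ‖z‖) * Real.exp (-(1 / 8) * ‖z‖ ^ 2))) := by
  have := (convex_Icc (0 : ℝ) 1).norm_image_sub_le_of_norm_hasDerivWithin_le
      (f := fun s : ℝ => gE (z + s • k)) (x := 0) (y := 1)
      (C := ‖k‖ * (Real.exp 1 * ((1 + ‖z‖) * Real.exp (-(1 / 8) * ‖z‖ ^ 2))))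
      (fun s _ => (hasDerivAt_gE_line z k s).hasDerivWithinAt) (fun s hs => ?_)
      (by norm_num) (by norm_num)
  · simpa using this
  · have hsk : ‖s • k‖ ≤ 1 := by
      rw [norm_smul, Real.norm_eq_abs, abs_of_nonneg hs.1]; nlinarith [hs.2, hs.1, norm_nonneg k]
    have h1 := gE_add_le z (s • k) hsk
    have h2 : |⟪z + s • k, k⟫| ≤ (1 + ‖z‖) * ‖k‖ := by
      refine (abs_real_inner_le_norm _ _).trans ?_
      gcongr
      linarith [norm_add_le z (s • k)]
    rw [Real.norm_eq_abs, abs_mul, abs_mul, abs_of_pos (gE_pos _)]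
    norm_num
    have h3 : 0 < gE (z + s • k) := gE_pos _
    have h4 : 0 ≤ |⟪z + s • k, k⟫| := abs_nonneg _
    calc 1 / 2 * |⟪z + s • k, k⟫| * gE (z + s • k)
        ≤ 1 * ((1 + ‖z‖) * ‖k‖) * (Real.exp 1 * Real.exp (-(1 / 8) * ‖z‖ ^ 2)) := by
          gcongr; norm_num
      _ = _ := by norm_num; ring

lemma gE_second_diff_le (z k : ES N) (hk : ‖k‖ ≤ 1) :
    |gE (z + k) + gE (z - k) - 2 * gE z| ≤
      ‖k‖ ^ 2 * (2 * Real.exp 1 * ((1 + ‖z‖) ^ 2 * Real.exp (-(1 / 8) * ‖z‖ ^ 2))) := by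
  have := second_diff_one_dim
      (K := ‖k‖ ^ 2 * (Real.exp 1 * ((1 + ‖z‖) ^ 2 * Real.exp (-(1 / 8) * ‖z‖ ^ 2))))
      (fun s _ => hasDerivAt_gE_line z k s)
      (fun s _ => hasDerivAt_gE_line' z k s) (fun s hs => ?_)
  · simp only [one_smul, neg_smul, zero_smul, add_zero, ← sub_eq_add_neg] at this
    refine this.trans (le_of_eq (by ring))
  · have hsk : ‖s • k‖ ≤ 1 := by
      have : |s| ≤ 1 := abs_le.2 hs
      rw [norm_smul, Real.norm_eq_abs]; nlinarith [norm_nonneg k]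
    have h1 := gE_add_le z (s • k) hsk
    have h2 : |⟪z + s • k, k⟫| ≤ (1 + ‖z‖) * ‖k‖ := by
      refine (abs_real_inner_le_norm _ _).trans ?_
      gcongr
      linarith [norm_add_le z (s • k)]
    have h2' : ⟪z + s • k, k⟫ ^ 2 ≤ ((1 + ‖z‖) * ‖k‖) ^ 2 := by
      rw [← sq_abs]; gcongr
    rw [abs_mul, abs_of_pos (gE_pos _)]
    have h5 : |(1 / 4) * ⟪z + s • k, k⟫ ^ 2 - (1 / 2) * ‖k‖ ^ 2| ≤ ((1 + ‖z‖) * ‖k‖) ^ 2 := by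
      have : ‖k‖ ^ 2 ≤ ((1 + ‖z‖) * ‖k‖) ^ 2 := by
        gcongr; nlinarith [norm_nonneg z, norm_nonneg k]
      rw [abs_le]; constructor <;> nlinarith [sq_nonneg ⟪z + s • k, k⟫, sq_nonneg ‖k‖]
    calc _ ≤ ((1 + ‖z‖) * ‖k‖) ^ 2 * (Real.exp 1 * Real.exp (-(1 / 8) * ‖z‖ ^ 2)) :=
          mul_le_mul h5 h1 (gE_pos _).le (by positivity)
      _ = _ := by ring

lemma integrable_gG_shift (k : ES N) : Integrable (fun z : ES N => (1 + ‖z‖) * gG (z + k)) := by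
  have h1 := ((integrable_gG_moment (N := N) 1).const_mul (1 + ‖k‖)).comp_add_right k
  refine h1.mono' (by fun_prop) (Eventually.of_forall fun z => ?_)
  have := gG_pos (z + k)
  rw [Real.norm_eq_abs, abs_of_nonneg (by positivity), pow_one, ← mul_assoc]
  gcongr
  have h := norm_sub_le (z + k) k
  rw [add_sub_cancel_right] at h
  nlinarith [norm_nonneg k, norm_nonneg (z + k)]

lemma integral_gG_shift_le (k : ES N) : ∫ z : ES N, (1 + ‖z‖) * gG (z + k) ≤
    (1 + ‖k‖) * ∫ z : ES N, (1 + ‖z‖) * gG z := by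
  have h1 := ((integrable_gG_moment (N := N) 1).const_mul (1 + ‖k‖)).comp_add_right k
  rw [← integral_const_mul]
  simp only [pow_one] at h1
  rw [← integral_add_right_eq_self (μ := volume) (fun z : ES N => (1 + ‖k‖) * ((1 + ‖z‖) * gG z)) k]
  refine integral_mono (integrable_gG_shift k) h1 fun z => ?_
  have := gG_pos (z + k)
  simp only
  rw [← mul_assoc]
  gcongr
  have h := norm_sub_le (z + k) k
  rw [add_sub_cancel_right] at h
  nlinarith [norm_nonneg k, norm_nonneg (z + k)]

/-- `L¹` continuity of translates of the Gaussian. -/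
lemma exists_gG_first_diff (N : ℕ) : ∃ C > 0, ∀ k : ES N,
    ∫ z : ES N, (1 + ‖z‖) * |gG (z + k) - gG z| ≤ C * ‖k‖ := by
  set m := ∫ z : ES N, (1 + ‖z‖) * gG z
  have hm : 0 ≤ m := integral_nonneg fun z => by have := gG_pos z; positivity
  set A : ES N → ℝ := fun z => (gZ N)⁻¹ * (Real.exp 1 *
    ((1 + ‖z‖) ^ 2 * Real.exp (-(1 / 8) * ‖z‖ ^ 2))) with hA
  have hAi : Integrable A := ((integrable_poly_exp 2 (by norm_num)).const_mul _).const_mul _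
  have hZ := gZ_pos (N := N)
  have hA0 : 0 ≤ ∫ z, A z := integral_nonneg fun z => by positivity
  refine ⟨(∫ z, A z) + 3 * m + 1, by positivity, fun k => ?_⟩
  have hki : Integrable fun z : ES N => (1 + ‖z‖) * gG z := by
    simpa using integrable_gG_moment (N := N) 1
  rcases le_total ‖k‖ 1 with hk | hk
  · have : ∫ z : ES N, (1 + ‖z‖) * |gG (z + k) - gG z| ≤ ∫ z, ‖k‖ * A z := by
      refine integral_mono_of_nonneg (Eventually.of_forall fun z => by positivity)
        (hAi.const_mul _) (Eventually.of_forall fun z => ?_)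
      have := gE_diff_le z k hk
      simp only [gG, ← mul_sub, abs_mul, abs_of_pos (inv_pos.2 hZ)]
      calc (1 + ‖z‖) * ((gZ N)⁻¹ * |gE (z + k) - gE z|) ≤ (1 + ‖z‖) * ((gZ N)⁻¹ *
            (‖k‖ * (Real.exp 1 * ((1 + ‖z‖) * Real.exp (-(1 / 8) * ‖z‖ ^ 2))))) := by gcongr
        _ = ‖k‖ * A z := by simp only [hA]; ring
    rw [integral_const_mul] at this
    nlinarith [norm_nonneg k]
  · have : ∫ z : ES N, (1 + ‖z‖) * |gG (z + k) - gG z| ≤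
        ∫ z : ES N, ((1 + ‖z‖) * gG (z + k) + (1 + ‖z‖) * gG z) := by
      refine integral_mono_of_nonneg (Eventually.of_forall fun z => by positivity)
        ((integrable_gG_shift k).add hki) (Eventually.of_forall fun z => ?_)
      simp only [← mul_add]
      gcongr
      rw [abs_le]; constructor <;> linarith [gG_pos z, gG_pos (z + k)]
    rw [integral_add (integrable_gG_shift k) hki] at this
    have h2 := integral_gG_shift_le k
    nlinarith

/-- `L¹` second-order modulus of translates of the Gaussian. -/
lemma exists_gG_second_diff (N : ℕ) : ∃ C > 0, ∀ k : ES N,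
    ∫ z : ES N, (1 + ‖z‖) * |gG (z + k) + gG (z - k) - 2 * gG z| ≤ C * ‖k‖ ^ 2 := by
  set m := ∫ z : ES N, (1 + ‖z‖) * gG z
  have hm : 0 ≤ m := integral_nonneg fun z => by have := gG_pos z; positivity
  set A : ES N → ℝ := fun z => (gZ N)⁻¹ * (2 * Real.exp 1 *
    ((1 + ‖z‖) ^ 3 * Real.exp (-(1 / 8) * ‖z‖ ^ 2))) with hA
  have hAi : Integrable A := ((integrable_poly_exp 3 (by norm_num)).const_mul _).const_mul _
  have hZ := gZ_pos (N := N)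
  have hA0 : 0 ≤ ∫ z, A z := integral_nonneg fun z => by positivity
  refine ⟨(∫ z, A z) + 6 * m + 1, by positivity, fun k => ?_⟩
  have hki : Integrable fun z : ES N => (1 + ‖z‖) * gG z := by
    simpa using integrable_gG_moment (N := N) 1
  rcases le_total ‖k‖ 1 with hk | hk
  · have : ∫ z : ES N, (1 + ‖z‖) * |gG (z + k) + gG (z - k) - 2 * gG z| ≤
        ∫ z, ‖k‖ ^ 2 * A z := by
      refine integral_mono_of_nonneg (Eventually.of_forall fun z => by positivity)
        (hAi.const_mul _) (Eventually.of_forall fun z => ?_)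
      have := gE_second_diff_le z k hk
      have e : gG (z + k) + gG (z - k) - 2 * gG z =
        (gZ N)⁻¹ * (gE (z + k) + gE (z - k) - 2 * gE z) := by simp only [gG]; ring
      simp only [e, abs_mul, abs_of_pos (inv_pos.2 hZ)]
      calc _ ≤ (1 + ‖z‖) * ((gZ N)⁻¹ *
            (‖k‖ ^ 2 * (2 * Real.exp 1 * ((1 + ‖z‖) ^ 2 * Real.exp (-(1 / 8) * ‖z‖ ^ 2))))) := by
              gcongr
        _ = ‖k‖ ^ 2 * A z := by simp only [hA]; ring
    rw [integral_const_mul] at this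
    nlinarith [norm_nonneg k]
  · have hs := integrable_gG_shift (-k)
    simp only [← sub_eq_add_neg] at hs
    have : ∫ z : ES N, (1 + ‖z‖) * |gG (z + k) + gG (z - k) - 2 * gG z| ≤
        ∫ z : ES N, ((1 + ‖z‖) * gG (z + k) + (1 + ‖z‖) * gG (z - k) +
          2 * ((1 + ‖z‖) * gG z)) := by
      refine integral_mono_of_nonneg (Eventually.of_forall fun z => by positivity)
        (((integrable_gG_shift k).add hs).add (hki.const_mul 2)) (Eventually.of_forall fun z => ?_)
      have h0 : |gG (z + k) + gG (z - k) - 2 * gG z| ≤ gG (z + k) + gG (z - k) + 2 * gG z := by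
        rw [abs_le]
        constructor <;> linarith [gG_pos z, gG_pos (z + k), gG_pos (z - k)]
      calc _ ≤ (1 + ‖z‖) * (gG (z + k) + gG (z - k) + 2 * gG z) :=
            mul_le_mul_of_nonneg_left h0 (by positivity)
        _ = _ := by ring
    have h12 : Integrable fun z : ES N => (1 + ‖z‖) * gG (z + k) + (1 + ‖z‖) * gG (z - k) :=
      (integrable_gG_shift k).add hs
    rw [integral_add h12 (hki.const_mul 2),
      integral_add (integrable_gG_shift k) hs, integral_const_mul] at this
    have h2 := integral_gG_shift_le k
    have h3 := integral_gG_shift_le (-k)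
    simp only [← sub_eq_add_neg, norm_neg] at h3
    have : ∫ z : ES N, (1 + ‖z‖) * |gG (z + k) + gG (z - k) - 2 * gG z| ≤ 6 * m * ‖k‖ := by
      nlinarith
    have h4 : ‖k‖ ≤ ‖k‖ ^ 2 := by nlinarith
    nlinarith [mul_nonneg hm (norm_nonneg k), sq_nonneg ‖k‖, mul_le_mul_of_nonneg_left h4 hm]

end Gaussian

set_option maxSynthPendingDepth 3

/-! ### Constant coefficient operators -/

section Elliptic
variable {N : ℕ}

/-- Standard basis vectors. -/
abbrev eb (i : Fin N) : ES N := EuclideanSpace.single i 1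

/-- The functional `H ↦ ∑ a i j * H e_i e_j`. -/
def trL (a : Fin N → Fin N → ℝ) : H2 N →L[ℝ] ℝ :=
  ∑ i, ∑ j, a i j • ((ContinuousLinearMap.apply ℝ ℝ (eb j)).comp
    (ContinuousLinearMap.apply ℝ (V1 N) (eb i)))

lemma trL_apply (a : Fin N → Fin N → ℝ) (H : H2 N) :
    trL a H = ∑ i, ∑ j, a i j * H (eb i) (eb j) := by
  simp [trL, sum_apply]

lemma norm_eb (i : Fin N) : ‖(eb i : ES N)‖ = 1 := by simp [eb]

lemma norm_trL_le {a : Fin N → Fin N → ℝ} {C : ℝ} (hC : 0 ≤ C) (h : ∀ i j, |a i j| ≤ C) :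
    ‖trL a‖ ≤ N ^ 2 * C := by
  refine ContinuousLinearMap.opNorm_le_bound _ (by positivity) fun H => ?_
  rw [trL_apply, Real.norm_eq_abs]
  have h1 : ∀ i j : Fin N, |a i j * H (eb i) (eb j)| ≤ C * ‖H‖ := fun i j => by
    rw [abs_mul]
    have h2 := H.le_opNorm₂ (eb i) (eb j)
    rw [norm_eb, norm_eb, mul_one, mul_one, Real.norm_eq_abs] at h2
    gcongr
    exact h i j
  calc |∑ i, ∑ j, a i j * H (eb i) (eb j)| ≤ ∑ i, ∑ j, |a i j * H (eb i) (eb j)| :=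
        (Finset.abs_sum_le_sum_abs _ _).trans
          (Finset.sum_le_sum fun i _ => Finset.abs_sum_le_sum_abs _ _)
    _ ≤ ∑ _i : Fin N, ∑ _j : Fin N, C * ‖H‖ :=
        Finset.sum_le_sum fun i _ => Finset.sum_le_sum fun j _ => h1 i j
    _ = _ := by simp; ring

/-- Uniformly elliptic symmetric constant second-order operators. -/
def Ell (lam Lam : ℝ) (A : H2 N →L[ℝ] ℝ) : Prop :=
  ∃ a : Fin N → Fin N → ℝ, (∀ i j, a i j = a j i) ∧ (∀ i j, |a i j| ≤ Lam) ∧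
    (∀ ξ : ES N, lam * ‖ξ‖ ^ 2 ≤ ∑ i, ∑ j, a i j * ξ i * ξ j) ∧ A = trL a

lemma bilin_sum_eb (H : H2 N) (v : ES N) :
    H v v = ∑ i, ∑ j, v i * v j * H (eb i) (eb j) := by
  have hv : v = ∑ i, v i • eb i := by
    ext k
    simp [eb, Finset.sum_apply, Pi.single_apply]
  conv_lhs => rw [hv]
  simp only [map_sum, map_smul, sum_apply, smul_apply, smul_eq_mul,
    Finset.mul_sum]
  rw [Finset.sum_comm]
  refine Finset.sum_congr rfl fun i _ => Finset.sum_congr rfl fun j _ => ?_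
  ring

/-- Square root of an elliptic operator. -/
lemma Ell.exists_sqrt {lam Lam : ℝ} (hlam : 0 < lam) (hLam : 0 ≤ Lam) {A : H2 N →L[ℝ] ℝ}
    (h : Ell lam Lam A) :
    ∃ σ τ : ES N →L[ℝ] ES N, (∀ z, σ (τ z) = z) ∧ (∀ z, τ (σ z) = z) ∧
      ‖σ‖ ≤ 1 + N ^ 2 * Lam + 1 / lam ∧ ‖τ‖ ≤ 1 + N ^ 2 * Lam + 1 / lam ∧
      ∀ H : H2 N, A H = ∑ k, H (σ (eb k)) (σ (eb k)) := by
  obtain ⟨a, hs, hb, he, rfl⟩ := h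
  have hpsd : (Matrix.of a).PosSemidef := by
    refine Matrix.PosSemidef.of_dotProduct_mulVec_nonneg ?_ fun ξ => ?_
    · ext i j; simp [hs i j]
    · have := he (WithLp.toLp 2 ξ)
      have h0 : 0 ≤ lam * ‖(WithLp.toLp 2 ξ : ES N)‖ ^ 2 := by positivity
      refine (h0.trans this).trans (le_of_eq ?_)
      simp only [Matrix.mulVec, dotProduct, Finset.mul_sum, star_trivial, Matrix.of_apply]
      refine Finset.sum_congr rfl fun i _ => Finset.sum_congr rfl fun j _ => ?_
      ring
  obtain ⟨B, hB⟩ : ∃ B : Matrix (Fin N) (Fin N) ℝ, Matrix.of a = B.conjTranspose * B := by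
    open scoped MatrixOrder in
    refine ⟨CFC.sqrt (Matrix.of a), ?_⟩
    have h1 : (CFC.sqrt (Matrix.of a)).PosSemidef :=
      Matrix.nonneg_iff_posSemidef.1 (CFC.sqrt_nonneg _)
    rw [h1.isHermitian.eq, CFC.sqrt_mul_sqrt_self (Matrix.of a) hpsd.nonneg]
  have hBa : ∀ i j, a i j = ∑ k, B k i * B k j := fun i j => by
    have := congrFun (congrFun hB i) j
    simpa [Matrix.mul_apply] using this
  set β : ES N →L[ℝ] ES N := Matrix.toEuclideanCLM (𝕜 := ℝ) B with hβ
  have hβa : ∀ ξ : ES N, ∀ k, β ξ k = ∑ i, B k i * ξ i := fun ξ k => by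
    rw [hβ, Matrix.ofLp_toEuclideanCLM]
    rfl
  have hβn : ∀ ξ : ES N, ‖β ξ‖ ^ 2 = ∑ i, ∑ j, a i j * ξ i * ξ j := fun ξ => by
    rw [EuclideanSpace.real_norm_sq_eq]
    simp only [hβa, hBa, pow_two]
    simp only [Finset.sum_mul, Finset.mul_sum]
    rw [Finset.sum_comm]
    refine Finset.sum_congr rfl fun i _ => ?_
    rw [Finset.sum_comm]
    refine Finset.sum_congr rfl fun j _ => Finset.sum_congr rfl fun k _ => ?_
    ring
  have hup : ‖β‖ ≤ 1 + N ^ 2 * Lam := by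
    refine β.opNorm_le_bound (by positivity) fun ξ => ?_
    refine (abs_le_of_sq_le_sq' ?_ (by positivity)).2
    rw [hβn]
    have hx : ∀ i, |ξ i| ≤ ‖ξ‖ := fun i => by simpa using PiLp.norm_apply_le ξ i
    calc ∑ i, ∑ j, a i j * ξ i * ξ j ≤ ∑ _i : Fin N, ∑ _j : Fin N, Lam * ‖ξ‖ ^ 2 := by
          refine Finset.sum_le_sum fun i _ => Finset.sum_le_sum fun j _ => ?_
          refine (le_abs_self _).trans ?_
          rw [abs_mul, abs_mul, mul_assoc, pow_two]
          gcongr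
          exacts [hb i j, hx i, hx j]
      _ = N ^ 2 * Lam * ‖ξ‖ ^ 2 := by simp; ring
      _ ≤ _ := by
          rw [mul_pow]
          gcongr
          have : 0 ≤ N ^ 2 * Lam := by positivity
          nlinarith
  have hlow : ∀ ξ, ‖ξ‖ ≤ (1 + 1 / lam) * ‖β ξ‖ := fun ξ => by
    refine (abs_le_of_sq_le_sq' ?_ (by positivity)).2
    have h1 := he ξ
    rw [← hβn] at h1
    have h2 : ‖ξ‖ ^ 2 ≤ 1 / lam * ‖β ξ‖ ^ 2 := by
      rw [one_div, inv_mul_eq_div, le_div_iff₀ hlam, mul_comm]; exact h1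
    refine h2.trans ?_
    rw [mul_pow]
    gcongr
    have : 0 ≤ 1 / lam := by positivity
    nlinarith
  have hinj : Function.Injective β := by
    rw [injective_iff_map_eq_zero]
    intro ξ hξ
    have := hlow ξ
    rw [hξ, norm_zero, mul_zero] at this
    exact norm_le_zero_iff.1 this
  let e : ES N ≃L[ℝ] ES N :=
    (LinearEquiv.ofInjectiveEndo (β : ES N →ₗ[ℝ] ES N) hinj).toContinuousLinearEquiv
  have hee : ∀ z, e z = β z := fun z => rfl
  have hinv : ‖(e.symm : ES N →L[ℝ] ES N)‖ ≤ 1 + 1 / lam := by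
    refine ContinuousLinearMap.opNorm_le_bound _ (by positivity) fun y => ?_
    have := hlow (e.symm y)
    rwa [← hee, e.apply_symm_apply] at this
  have h1l : 0 ≤ 1 / lam := by positivity
  have h1L : 0 ≤ N ^ 2 * Lam := by positivity
  refine ⟨ContinuousLinearMap.adjoint β,
    ContinuousLinearMap.adjoint (e.symm : ES N →L[ℝ] ES N), ?_, ?_, ?_, ?_, ?_⟩
  · intro z
    refine ext_inner_left ℝ fun v => ?_
    rw [ContinuousLinearMap.adjoint_inner_right, ContinuousLinearMap.adjoint_inner_right]
    exact congrArg (⟪·, z⟫) (e.symm_apply_apply v)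
  · intro z
    refine ext_inner_left ℝ fun v => ?_
    rw [ContinuousLinearMap.adjoint_inner_right, ContinuousLinearMap.adjoint_inner_right]
    exact congrArg (⟪·, z⟫) (e.apply_symm_apply v)
  · rw [LinearIsometryEquiv.norm_map]; linarith
  · rw [LinearIsometryEquiv.norm_map]; linarith
  · intro H
    have hσ : ∀ k i, (ContinuousLinearMap.adjoint β (eb k)) i = B k i := by
      intro k i
      have : (ContinuousLinearMap.adjoint β (eb k)) i =
          ⟪eb i, ContinuousLinearMap.adjoint β (eb k)⟫ := by
        simp [eb, EuclideanSpace.inner_single_left]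
      rw [this, ContinuousLinearMap.adjoint_inner_right]
      simp only [eb, EuclideanSpace.inner_single_right, hβa]
      simp
    simp only [fun k => bilin_sum_eb H (ContinuousLinearMap.adjoint β (eb k)), hσ, trL_apply,
      hBa, Finset.sum_mul]
    conv_rhs => rw [Finset.sum_comm]
    refine Finset.sum_congr rfl fun i _ => ?_
    rw [Finset.sum_comm]

end Elliptic

/-! ### Space-time functions -/

section SpaceTime
variable {N : ℕ} {T θ C : ℝ} {u v : ℝ → ES N → ℝ}

/-- Functions on `[0,T] × ℝ^N`, uniformly `C^{2,θ}` in space and Lipschitz in time. -/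
structure XB (T θ C : ℝ) (u : ℝ → ES N → ℝ) : Prop where
  sp : ∀ t ∈ Icc (0:ℝ) T, C2b θ C (u t)
  tl : ∀ x, ∀ t ∈ Icc (0:ℝ) T, ∀ s ∈ Icc (0:ℝ) T, |u t x - u s x| ≤ C * |t - s|

lemma D_sub {φ ψ : ES N → ℝ} (h : ContDiff ℝ 2 φ) (h' : ContDiff ℝ 2 ψ) :
    D (fun x => φ x - ψ x) = fun x => D φ x - D ψ x :=
  funext fun x => fderiv_fun_sub (h.differentiable (by norm_num) x)
    (h'.differentiable (by norm_num) x)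

lemma D2_sub {φ ψ : ES N → ℝ} (h : ContDiff ℝ 2 φ) (h' : ContDiff ℝ 2 ψ) :
    D2 (fun x => φ x - ψ x) = fun x => D2 φ x - D2 ψ x := by
  show fderiv ℝ (D (fun x => φ x - ψ x)) = _
  rw [D_sub h h']
  exact funext fun x => fderiv_fun_sub
    ((contDiff_fderiv_of_two h).differentiable (by norm_num) x)
    ((contDiff_fderiv_of_two h').differentiable (by norm_num) x)

lemma D_add {φ ψ : ES N → ℝ} (h : ContDiff ℝ 2 φ) (h' : ContDiff ℝ 2 ψ) :
    D (fun x => φ x + ψ x) = fun x => D φ x + D ψ x :=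
  funext fun x => fderiv_fun_add (h.differentiable (by norm_num) x)
    (h'.differentiable (by norm_num) x)

lemma D2_add {φ ψ : ES N → ℝ} (h : ContDiff ℝ 2 φ) (h' : ContDiff ℝ 2 ψ) :
    D2 (fun x => φ x + ψ x) = fun x => D2 φ x + D2 ψ x := by
  show fderiv ℝ (D (fun x => φ x + ψ x)) = _
  rw [D_add h h']
  exact funext fun x => fderiv_fun_add
    ((contDiff_fderiv_of_two h).differentiable (by norm_num) x)
    ((contDiff_fderiv_of_two h').differentiable (by norm_num) x)

lemma D_const_mul {φ : ES N → ℝ} (a : ℝ) (h : ContDiff ℝ 2 φ) :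
    D (fun x => a * φ x) = fun x => a • D φ x :=
  funext fun x => fderiv_const_mul (h.differentiable (by norm_num) x) a

lemma D2_const_mul {φ : ES N → ℝ} (a : ℝ) (h : ContDiff ℝ 2 φ) :
    D2 (fun x => a * φ x) = fun x => a • D2 φ x := by
  show fderiv ℝ (D (fun x => a * φ x)) = _
  rw [D_const_mul a h]
  exact funext fun x => fderiv_fun_const_smul
    ((contDiff_fderiv_of_two h).differentiable (by norm_num) x) a

lemma XB.mono {C' : ℝ} (h : XB T θ C u) (hC : C ≤ C') : XB T θ C' u :=
  ⟨fun t ht => (h.sp t ht).mono hC, fun x t ht s hs => (h.tl x t ht s hs).trans (by gcongr)⟩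

lemma XB.nonneg (hT : 0 ≤ T) (h : XB T θ C u) : 0 ≤ C := (h.sp 0 ⟨le_rfl, hT⟩).nonneg

lemma XB.restrict {T' : ℝ} (h : XB T θ C u) (hT : T' ≤ T) : XB T' θ C u :=
  ⟨fun t ht => h.sp t ⟨ht.1, ht.2.trans hT⟩,
    fun x t ht s hs => h.tl x t ⟨ht.1, ht.2.trans hT⟩ s ⟨hs.1, hs.2.trans hT⟩⟩

lemma XB.add {C' : ℝ} (h : XB T θ C u) (h' : XB T θ C' v) :
    XB T θ (C + C') (fun t x => u t x + v t x) where
  sp t ht := by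
    have h1 := h.sp t ht
    have h2 := h'.sp t ht
    refine ⟨h1.cd.add h2.cd, fun x => ?_, fun x => ?_, fun x => ?_, ?_⟩
    · exact (abs_add_le _ _).trans (add_le_add (h1.b0 x) (h2.b0 x))
    · rw [D_add h1.cd h2.cd]
      exact (norm_add_le _ _).trans (add_le_add (h1.b1 x) (h2.b1 x))
    · rw [D2_add h1.cd h2.cd]
      exact (norm_add_le _ _).trans (add_le_add (h1.b2 x) (h2.b2 x))
    · rw [D2_add h1.cd h2.cd]
      exact h1.hol.add h2.hol
  tl x t ht s hs := by
    calc |u t x + v t x - (u s x + v s x)| = |(u t x - u s x) + (v t x - v s x)| := by ring_nf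
      _ ≤ _ := (abs_add_le _ _).trans (add_le_add (h.tl x t ht s hs) (h'.tl x t ht s hs))
      _ = _ := by ring

/-- Modulus of continuity in time of the gradient. -/
lemma XB.D_time (h : XB T θ C u) {t s : ℝ} (ht : t ∈ Icc (0:ℝ) T) (hs : s ∈ Icc (0:ℝ) T)
    (x : ES N) : ‖D (u t) x - D (u s) x‖ ≤ 4 * C * |t - s| ^ (1 / 2 : ℝ) := by
  have h1 := h.sp t ht
  have h2 := h.sp s hs
  rcases eq_or_ne t s with rfl | hne
  · simp
  have hp : 0 < |t - s| := abs_pos.2 (sub_ne_zero.2 hne)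
  have := interp_D (φ := fun x => u t x - u s x) (K := 2 * C) (M := C * |t - s|)
    (η := |t - s| ^ (1 / 2 : ℝ)) (by positivity) (h1.cd.sub h2.cd) (fun x => by
      rw [D2_sub h1.cd h2.cd]
      exact (norm_sub_le _ _).trans (by linarith [h1.b2 x, h2.b2 x]))
    (fun x => h.tl x t ht s hs) x
  rw [D_sub h1.cd h2.cd] at this
  refine this.trans (le_of_eq ?_)
  have e : |t - s| = |t - s| ^ (1 / 2 : ℝ) * |t - s| ^ (1 / 2 : ℝ) := by
    rw [← Real.rpow_add hp]; norm_num
  have e0 : |t - s| ^ (1 / 2 : ℝ) ≠ 0 := by positivity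
  have : 2 * (C * |t - s|) / |t - s| ^ (1 / 2 : ℝ) = 2 * C * |t - s| ^ (1 / 2 : ℝ) := by
    rw [div_eq_iff e0]
    nth_rw 1 [e]; ring
  rw [this]; ring

/-- Modulus of continuity in time of the Hessian. -/
lemma XB.D2_time (hθ : 0 ≤ θ) (h : XB T θ C u) {t s : ℝ} (ht : t ∈ Icc (0:ℝ) T)
    (hs : s ∈ Icc (0:ℝ) T) (x : ES N) : ‖D2 (u t) x - D2 (u s) x‖ ≤
      4 * C * |t - s| ^ (θ / 4) + 4 * C * |t - s| ^ (1 / 2 : ℝ) := by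
  have h1 := h.sp t ht
  have h2 := h.sp s hs
  have hC := h1.nonneg
  rcases eq_or_ne t s with rfl | hne
  · rw [sub_self, norm_zero]; positivity
  have hp : 0 < |t - s| := abs_pos.2 (sub_ne_zero.2 hne)
  have := interp_D2 (φ := fun x => u t x - u s x) (C := C + C) (M := C * |t - s|)
    (η := |t - s| ^ (1 / 4 : ℝ)) hθ (by positivity) (by positivity) (h1.cd.sub h2.cd) (by
      rw [D2_sub h1.cd h2.cd]
      exact h1.hol.sub h2.hol)
    (fun x => h.tl x t ht s hs) x
  rw [D2_sub h1.cd h2.cd] at this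
  refine this.trans (le_of_eq ?_)
  have e : |t - s| = |t - s| ^ (1 / 2 : ℝ) * (|t - s| ^ (1 / 4 : ℝ)) ^ 2 := by
    rw [← Real.rpow_natCast, ← Real.rpow_mul hp.le, ← Real.rpow_add hp]; norm_num
  have e0 : (|t - s| ^ (1 / 4 : ℝ)) ^ 2 ≠ 0 := by positivity
  have e1 : 4 * (C * |t - s|) / (|t - s| ^ (1 / 4 : ℝ)) ^ 2 = 4 * C * |t - s| ^ (1 / 2 : ℝ) := by
    rw [div_eq_iff e0]
    nth_rw 1 [e]; ring
  rw [e1, ← Real.rpow_mul hp.le, one_div_mul_eq_div]; ring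

lemma XB.continuousOn_time (h : XB T θ C u) (x : ES N) :
    ContinuousOn (fun t => u t x) (Icc 0 T) := by
  intro s hs
  rw [Metric.continuousWithinAt_iff']
  intro e he
  have hC := (h.sp s hs).nonneg
  have h0 : Tendsto (fun t : ℝ => C * |t - s|) (𝓝[Icc 0 T] s) (𝓝 (C * |s - s|)) :=
    (by fun_prop : Continuous fun t : ℝ => C * |t - s|).continuousAt.mono_left nhdsWithin_le_nhds
  rw [sub_self, abs_zero, mul_zero] at h0
  filter_upwards [h0.eventually (gt_mem_nhds he), self_mem_nhdsWithin] with t ht htT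
  rw [Real.dist_eq]
  exact (h.tl x t htT s hs).trans_lt ht

lemma continuousOn_prod_of_modulus {F : Type*} [NormedAddCommGroup F] {f : ℝ → ES N → F}
    {S : Set ℝ} {ω : ℝ → ℝ} (hω : Continuous ω) (hω0 : ω 0 = 0)
    (h1 : ∀ t ∈ S, ∀ s ∈ S, ∀ x, ‖f t x - f s x‖ ≤ ω (|t - s|)) (h2 : ∀ t ∈ S, Continuous (f t)) :
    ContinuousOn (fun p : ℝ × ES N => f p.1 p.2) (S ×ˢ univ) := by
  rintro ⟨s, x⟩ ⟨hs, -⟩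
  rw [ContinuousWithinAt, tendsto_iff_norm_sub_tendsto_zero]
  have e1 : Tendsto (fun p : ℝ × ES N => ω |p.1 - s| + ‖f s p.2 - f s x‖)
      (𝓝[S ×ˢ univ] (s, x)) (𝓝 0) := by
    have hc : Continuous (fun p : ℝ × ES N => ω |p.1 - s| + ‖f s p.2 - f s x‖) := by
      have := h2 s hs
      fun_prop
    have := (hc.tendsto (s, x)).mono_left (nhdsWithin_le_nhds (s := S ×ˢ univ))
    simpa [hω0] using this
  refine squeeze_zero' (Eventually.of_forall fun _ => norm_nonneg _) ?_ e1
  filter_upwards [self_mem_nhdsWithin] with p hp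
  have := h1 p.1 hp.1 s hs p.2
  calc ‖f p.1 p.2 - f s x‖ = ‖(f p.1 p.2 - f s p.2) + (f s p.2 - f s x)‖ := by abel_nf
    _ ≤ _ := (norm_add_le _ _).trans (by gcongr)

lemma XB.continuousOn (h : XB T θ C u) :
    ContinuousOn (fun p : ℝ × ES N => u p.1 p.2) (Icc 0 T ×ˢ univ) :=
  continuousOn_prod_of_modulus (ω := fun r => C * r) (by fun_prop) (by simp)
    (fun t ht s hs x => h.tl x t ht s hs) fun t ht => (h.sp t ht).cd.continuous

lemma XB.continuousOn_D (h : XB T θ C u) :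
    ContinuousOn (fun p : ℝ × ES N => D (u p.1) p.2) (Icc 0 T ×ˢ univ) :=
  continuousOn_prod_of_modulus (ω := fun r => 4 * C * r ^ (1 / 2 : ℝ))
    (continuous_const.mul (Real.continuous_rpow_const (by norm_num))) (by simp)
    (fun t ht s hs x => h.D_time ht hs x) fun t ht => (h.sp t ht).diff1.continuous

lemma XB.continuousOn_D2 (hθ : 0 < θ) (h : XB T θ C u) :
    ContinuousOn (fun p : ℝ × ES N => D2 (u p.1) p.2) (Icc 0 T ×ˢ univ) :=
  continuousOn_prod_of_modulus
    (ω := fun r => 4 * C * r ^ (θ / 4) + 4 * C * r ^ (1 / 2 : ℝ))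
    ((continuous_const.mul (Real.continuous_rpow_const (by positivity))).add
      (continuous_const.mul (Real.continuous_rpow_const (by norm_num))))
    (by simp [Real.zero_rpow (by positivity : θ / 4 ≠ 0)])
    (fun t ht s hs x => h.D2_time hθ.le ht hs x) fun t ht => (h.sp t ht).hol.continuous hθ

/-- Chain rule along a space-time curve. -/
lemma XB.hasDerivAt_curve (h : XB T θ C u) {s d : ℝ} (hs : s ∈ Ioo 0 T) {γ : ℝ → ES N}
    {γ' : ES N} (hγ : HasDerivAt γ γ' s) (hd : HasDerivAt (fun r => u r (γ s)) d s) :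
    HasDerivAt (fun r => u r (γ r)) (d + D (u s) (γ s) γ') s := by
  have hsI := Ioo_subset_Icc_self hs
  have hI : ∀ᶠ r in 𝓝 s, r ∈ Icc 0 T := Icc_mem_nhds hs.1 hs.2
  have e1 : HasDerivAt (fun r => D (u s) (γ s) (γ r)) (D (u s) (γ s) γ') s :=
    (D (u s) (γ s)).hasFDerivAt.comp_hasDerivAt s hγ
  have e2 : HasDerivAt (fun r => u r (γ r) - u r (γ s) - D (u s) (γ s) (γ r - γ s)) 0 s := by
    rw [hasDerivAt_iff_isLittleO]
    have hO : (fun r => γ r - γ s) =O[𝓝 s] fun r => r - s := hγ.isBigO_sub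
    have ho : (fun r => C * ‖γ r - γ s‖ + 4 * C * |r - s| ^ (1 / 2 : ℝ)) =o[𝓝 s]
        fun _ => (1 : ℝ) := by
      rw [Asymptotics.isLittleO_one_iff]
      have h1 : ContinuousAt (fun r => C * ‖γ r - γ s‖) s :=
        continuousAt_const.mul (hγ.continuousAt.sub continuousAt_const).norm
      have h2 : Continuous (fun r => 4 * C * |r - s| ^ (1 / 2 : ℝ)) :=
        continuous_const.mul
          ((Real.continuous_rpow_const (by norm_num)).comp (by fun_prop))
      have := h1.add h2.continuousAt
      simpa [ContinuousAt, Pi.add_def] using this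
    have h3 := ho.mul_isBigO hO.norm_left
    simp only [one_mul] at h3
    refine (Asymptotics.IsBigO.of_bound' ?_).trans_isLittleO h3
    filter_upwards [hI] with r hr
    have t1 := taylor_D2 (h.sp r hr).cd (h.sp r hr).b2 (γ s) (γ r)
    have t2 := h.D_time hr hsI (γ s)
    have t3 := (D (u r) (γ s) - D (u s) (γ s)).le_opNorm (γ r - γ s)
    have hC := (h.sp s hsI).nonneg
    simp only [sub_self, map_zero, smul_zero, sub_zero, Real.norm_eq_abs]
    rw [abs_of_nonneg (by positivity :
      0 ≤ (C * ‖γ r - γ s‖ + 4 * C * |r - s| ^ (1 / 2 : ℝ)) * ‖γ r - γ s‖)]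
    calc |u r (γ r) - u r (γ s) - D (u s) (γ s) (γ r - γ s)|
        = |(u r (γ r) - u r (γ s) - D (u r) (γ s) (γ r - γ s)) +
          (D (u r) (γ s) - D (u s) (γ s)) (γ r - γ s)| := by
          rw [sub_apply]; ring_nf
      _ ≤ C * ‖γ r - γ s‖ ^ 2 + 4 * C * |r - s| ^ (1 / 2 : ℝ) * ‖γ r - γ s‖ := by
          refine (abs_add_le _ _).trans (add_le_add t1 (t3.trans ?_))
          gcongr
      _ = _ := by ring
  have := (e2.fun_add (hd.fun_add e1)).fun_sub (hasDerivAt_const s (D (u s) (γ s) (γ s)))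
  rw [zero_add, sub_zero] at this
  refine this.congr_of_eventuallyEq (Eventually.of_forall fun r => ?_)
  simp only [map_sub]
  ring

end SpaceTime

/-! ### The heat semigroup -/

section Heat
variable {N : ℕ} {T θ C : ℝ} {v : ℝ → ES N → ℝ}

/-- Gaussian averages: the semigroup of a constant coefficient operator. -/
def hP (σ : ES N →L[ℝ] ES N) (r : ℝ) (f : ES N → ℝ) (x : ES N) : ℝ :=
  ∫ z, f (x + Real.sqrt r • σ z) * gG z

lemma integrable_mul_gG {f : ES N → ℝ} {K : ℝ} (hf : Continuous f)
    (h : ∀ z, |f z| ≤ K * (1 + ‖z‖)) : Integrable fun z => f z * gG z := by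
  refine ((integrable_gG_moment (N := N) 1).const_mul K).mono'
    (hf.mul continuous_gG).aestronglyMeasurable (Eventually.of_forall fun z => ?_)
  rw [Real.norm_eq_abs, abs_mul, abs_of_pos (gG_pos z), pow_one, ← mul_assoc]
  exact mul_le_mul_of_nonneg_right (h z) (gG_pos z).le

lemma integrable_mul_gG_of_bdd {f : ES N → ℝ} {K : ℝ} (hf : Continuous f)
    (h : ∀ z, |f z| ≤ K) : Integrable fun z => f z * gG z :=
  integrable_mul_gG hf fun z => (h z).trans (by
    nlinarith [norm_nonneg z, (abs_nonneg _).trans (h z)])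

lemma sum_coord_smul (z : ES N) : z = ∑ i, z i • (eb i : ES N) := by
  ext k
  simp [eb, Finset.sum_apply, Pi.single_apply]

lemma integral_gG_parts {φ : ES N → ℝ} (h : C2b θ C φ) (σ : ES N →L[ℝ] ES N) (ρ : ℝ) (x : ES N) :
    ∫ z, D φ (x + ρ • σ z) (σ z) * gG z =
      2 * ρ * ∫ z, (∑ k, D2 φ (x + ρ • σ z) (σ (eb k)) (σ (eb k))) * gG z := by
  have hc1 : Continuous fun z : ES N => D φ (x + ρ • σ z) :=
    h.diff1.continuous.comp (by fun_prop)
  have hc2 : Continuous fun z : ES N => D2 φ (x + ρ • σ z) :=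
    ((contDiff_fderiv_of_two h.cd).continuous_fderiv (by norm_num)).comp (by fun_prop)
  have hC := h.nonneg
  have b1 : ∀ z w : ES N, |D φ (x + ρ • σ z) w| ≤ C * ‖w‖ := fun z w =>
    ((D φ _).le_opNorm w).trans (by gcongr; exact h.b1 _)
  have b2 : ∀ z w : ES N, |D2 φ (x + ρ • σ z) w w| ≤ C * ‖w‖ * ‖w‖ := fun z w =>
    ((D2 φ _).le_opNorm₂ w w).trans (by gcongr; exact h.b2 _)
  have i0 : ∀ w : ES N, Integrable fun z => D φ (x + ρ • σ z) w * gG z := fun w =>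
    integrable_mul_gG_of_bdd (by fun_prop) fun z => b1 z w
  have i2 : ∀ w : ES N, Integrable fun z => D2 φ (x + ρ • σ z) w w * gG z := fun w =>
    integrable_mul_gG_of_bdd (by fun_prop) fun z => b2 z w
  have i1 : ∀ k, Integrable fun z : ES N => D φ (x + ρ • σ z) (σ (eb k)) * z k * gG z := fun k =>
    integrable_mul_gG (K := C * ‖σ (eb k)‖) (by fun_prop) fun z => by
      rw [abs_mul]
      gcongr
      · exact b1 _ _
      · have : |z k| ≤ ‖z‖ := by simpa using PiLp.norm_apply_le z k
        linarith
  have key : ∀ k, ∫ z : ES N, D φ (x + ρ • σ z) (σ (eb k)) * z k * gG z =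
      2 * ρ * ∫ z, D2 φ (x + ρ • σ z) (σ (eb k)) (σ (eb k)) * gG z := by
    intro k
    have hfd : ∀ z : ES N, HasFDerivAt (fun z => D φ (x + ρ • σ z) (σ (eb k)))
        ((ContinuousLinearMap.apply ℝ ℝ (σ (eb k))).comp
          ((D2 φ (x + ρ • σ z)).comp (ρ • σ))) z := fun z => by
      have e1 : HasFDerivAt (fun z : ES N => x + ρ • σ z) (ρ • σ) z :=
        (σ.hasFDerivAt.const_smul ρ).const_add x
      have e2 := (h.diff1 (x + ρ • σ z)).hasFDerivAt.comp z e1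
      exact (ContinuousLinearMap.apply ℝ ℝ (σ (eb k))).hasFDerivAt.comp z e2
    have hfe : ∀ z : ES N, fderiv ℝ (fun z => D φ (x + ρ • σ z) (σ (eb k))) z (eb k) =
        ρ * D2 φ (x + ρ • σ z) (σ (eb k)) (σ (eb k)) := fun z => by
      rw [(hfd z).fderiv]; simp
    have hge : ∀ z : ES N, fderiv ℝ gG z (eb k) = -(1 / 2) * z k * gG z := fun z => by
      rw [fderiv_gG]; simp [eb, EuclideanSpace.inner_single_right]
    have := integral_mul_fderiv_eq_neg_fderiv_mul_of_integrable (μ := volume) (𝕜 := ℝ)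
      (f := fun z : ES N => D φ (x + ρ • σ z) (σ (eb k))) (g := gG) (v := eb k)
      (by simp only [hfe]
          simpa only [mul_assoc] using (i2 (σ (eb k))).const_mul ρ)
      (by simp only [hge]
          refine ((i1 k).const_mul (-(1 / 2))).congr (Eventually.of_forall fun z => ?_)
          simp only; ring)
      (i0 _) (fun z _ => (hfd z).differentiableAt)
      (fun z _ => contDiff_gG.differentiable (by norm_num) z)
    simp only [hfe, hge, mul_assoc] at this
    rw [integral_const_mul] at this
    have e3 : ∫ z : ES N, D φ (x + ρ • σ z) (σ (eb k)) * (-(1 / 2) * (z k * gG z)) =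
        -(1 / 2) * ∫ z : ES N, D φ (x + ρ • σ z) (σ (eb k)) * z k * gG z := by
      rw [← integral_const_mul]
      congr 1; ext z; ring
    rw [e3] at this
    linarith
  calc ∫ z, D φ (x + ρ • σ z) (σ z) * gG z
      = ∫ z : ES N, ∑ k, D φ (x + ρ • σ z) (σ (eb k)) * z k * gG z := by
        congr 1; ext z
        conv_lhs => rw [show σ z = ∑ k, z k • σ (eb k) by
          conv_lhs => rw [sum_coord_smul z]
          simp]
        rw [map_sum, Finset.sum_mul]
        refine Finset.sum_congr rfl fun k _ => ?_
        rw [show (∑ i, z i • σ (eb i)) = σ z by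
          conv_rhs => rw [sum_coord_smul z]
          simp]
        simp only [map_smul, smul_eq_mul]; ring
    _ = _ := by
        rw [integral_finsetSum _ fun k _ => i1 k]
        simp only [key, Finset.sum_mul]
        rw [integral_finsetSum _ fun k _ => i2 _, Finset.mul_sum]

/-- Duhamel derivative. -/
lemma hasDerivAt_hP (hv : XB T θ C v) {A : H2 N →L[ℝ] ℝ} {σ : ES N →L[ℝ] ES N} (hθ : 0 < θ)
    (hA : ∀ H : H2 N, A H = ∑ k, H (σ (eb k)) (σ (eb k))) {h : ℝ → ES N → ℝ} {Hb : ℝ}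
    (hd : ∀ s ∈ Ioo 0 T, ∀ x, HasDerivAt (fun r => v r x) (A (D2 (v s) x) + h s x) s)
    (hb : ∀ s ∈ Icc 0 T, ∀ x, |h s x| ≤ Hb) (hc : ∀ s ∈ Icc 0 T, Continuous (h s))
    {t : ℝ} (ht : t ≤ T) {s : ℝ} (hs : s ∈ Ioo 0 t) (x : ES N) :
    HasDerivAt (fun s => hP σ (t - s) (v s) x) (hP σ (t - s) (h s) x) s := by
  set ρ : ℝ → ℝ := fun s => Real.sqrt (t - s) with hρ
  set m := (s + t) / 2 with hm
  have hsm : s < m := by rw [hm]; linarith [hs.2]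
  have hmt : m < t := by rw [hm]; linarith [hs.2]
  set κ := Real.sqrt (t - m) with hκ
  have hκ0 : 0 < κ := Real.sqrt_pos.2 (by linarith)
  have hC := hv.nonneg (hs.1.le.trans (hs.2.le.trans ht))
  have hU : Ioo 0 m ∈ 𝓝 s := Ioo_mem_nhds hs.1 hsm
  have hUT : Ioo 0 m ⊆ Ioo 0 T := Ioo_subset_Ioo_right (hmt.le.trans ht)
  have hsT : s ∈ Ioo 0 T := hUT ⟨hs.1, hsm⟩
  have hsI := Ioo_subset_Icc_self hsT
  have hρd : ∀ r ∈ Ioo 0 m, HasDerivAt ρ (-(1 / (2 * ρ r))) r := fun r hr => by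
    have h0 : t - r ≠ 0 := by linarith [hr.2]
    have := ((hasDerivAt_id r).const_sub t).sqrt h0
    refine this.congr_deriv ?_
    simp only [id, hρ]; ring
  have hρκ : ∀ r ∈ Ioo 0 m, κ ≤ ρ r := fun r hr => Real.sqrt_le_sqrt (by linarith [hr.2])
  have hv2 : ∀ r ∈ Icc 0 T, Continuous (D2 (v r)) := fun r hr => (hv.sp r hr).hol.continuous hθ
  have key := hasDerivAt_integral_of_dominated_loc_of_deriv_le (μ := (volume : Measure (ES N)))
    (𝕜 := ℝ) (F := fun r z => v r (x + ρ r • σ z) * gG z) (x₀ := s) hU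
    (F' := fun r z => (A (D2 (v r) (x + ρ r • σ z)) + h r (x + ρ r • σ z) +
      D (v r) (x + ρ r • σ z) (-(1 / (2 * ρ r)) • σ z)) * gG z)
    (bound := fun z => (‖A‖ * C + Hb + C * (1 / (2 * κ) * ‖σ‖)) * ((1 + ‖z‖) ^ 1 * gG z))
    ?_ ?_ ?_ ?_ ?_ ?_
  · refine key.2.congr_deriv ?_
    have i1 : Integrable fun z => A (D2 (v s) (x + ρ s • σ z)) * gG z :=
      integrable_mul_gG_of_bdd (K := ‖A‖ * C)
        (A.continuous.comp ((hv2 s hsI).comp (by fun_prop))) fun z =>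
        (A.le_opNorm _).trans (by gcongr; exact (hv.sp s hsI).b2 _)
    have i2 : Integrable fun z => h s (x + ρ s • σ z) * gG z :=
      integrable_mul_gG_of_bdd (K := Hb) ((hc s hsI).comp (by fun_prop)) fun z => hb s hsI _
    have i3 : Integrable fun z => D (v s) (x + ρ s • σ z) (σ z) * gG z :=
      integrable_mul_gG (K := C * ‖σ‖)
        (((hv.sp s hsI).diff1.continuous.comp (by fun_prop)).clm_apply σ.continuous) fun z => by
        refine ((D (v s) _).le_opNorm _).trans ?_
        have e1 := (hv.sp s hsI).b1 (x + ρ s • σ z)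
        calc ‖D (v s) (x + ρ s • σ z)‖ * ‖σ z‖ ≤ C * (‖σ‖ * ‖z‖) := by
              gcongr; exact σ.le_opNorm z
          _ ≤ _ := by nlinarith [norm_nonneg σ, norm_nonneg z, mul_nonneg hC (norm_nonneg σ)]
    have hρ0 : ρ s ≠ 0 := (hκ0.trans_le (hρκ s ⟨hs.1, hsm⟩)).ne'
    have e := integral_gG_parts (hv.sp s hsI) σ (ρ s) x
    simp only [← hA] at e
    have e' : ∀ z, (A (D2 (v s) (x + ρ s • σ z)) + h s (x + ρ s • σ z) +
        D (v s) (x + ρ s • σ z) (-(1 / (2 * ρ s)) • σ z)) * gG z =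
        A (D2 (v s) (x + ρ s • σ z)) * gG z + h s (x + ρ s • σ z) * gG z +
          -(1 / (2 * ρ s)) * (D (v s) (x + ρ s • σ z) (σ z) * gG z) := fun z => by
      rw [map_smul, smul_eq_mul]; ring
    simp only [e']
    have i12 : Integrable fun z => A (D2 (v s) (x + ρ s • σ z)) * gG z +
        h s (x + ρ s • σ z) * gG z := i1.add i2
    rw [integral_add i12 (i3.const_mul _), integral_add i1 i2, integral_const_mul, e]
    unfold hP
    field_simp
    ring
  · filter_upwards [hU] with r hr
    exact (((hv.sp r (Ioo_subset_Icc_self (hUT hr))).cd.continuous.comp (by fun_prop)).mul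
      continuous_gG).aestronglyMeasurable
  · exact integrable_mul_gG_of_bdd (K := C) ((hv.sp s hsI).cd.continuous.comp (by fun_prop))
      fun z => (hv.sp s hsI).b0 _
  · refine Continuous.aestronglyMeasurable
      (Continuous.mul (Continuous.add (Continuous.add ?_ ?_) ?_)
      continuous_gG)
    · exact A.continuous.comp ((hv2 s hsI).comp (by fun_prop))
    · exact (hc s hsI).comp (by fun_prop)
    · exact ((hv.sp s hsI).diff1.continuous.comp (by fun_prop)).clm_apply (by fun_prop)
  · refine Eventually.of_forall fun z r hr => ?_
    have hrI := Ioo_subset_Icc_self (hUT hr)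
    rw [norm_mul, Real.norm_of_nonneg (gG_pos z).le, ← mul_assoc]
    refine mul_le_mul_of_nonneg_right ?_ (gG_pos z).le
    have e1 : |A (D2 (v r) (x + ρ r • σ z))| ≤ ‖A‖ * C :=
      (A.le_opNorm _).trans (by gcongr; exact (hv.sp r hrI).b2 _)
    have e2 := hb r hrI (x + ρ r • σ z)
    have e3 : |D (v r) (x + ρ r • σ z) (-(1 / (2 * ρ r)) • σ z)| ≤
        C * (1 / (2 * κ) * ‖σ‖) * ‖z‖ := by
      refine ((D (v r) _).le_opNorm _).trans ?_
      have hb1 := (hv.sp r hrI).b1 (x + ρ r • σ z)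
      have hρ1 := hρκ r hr
      have : ‖-(1 / (2 * ρ r)) • σ z‖ ≤ 1 / (2 * κ) * (‖σ‖ * ‖z‖) := by
        rw [norm_smul, norm_neg, Real.norm_of_nonneg (by positivity)]
        gcongr
        exact σ.le_opNorm z
      calc ‖D (v r) (x + ρ r • σ z)‖ * ‖-(1 / (2 * ρ r)) • σ z‖
          ≤ C * (1 / (2 * κ) * (‖σ‖ * ‖z‖)) := by gcongr
        _ = _ := by ring
    rw [Real.norm_eq_abs, pow_one]
    have n0 : 0 ≤ ‖A‖ * C + Hb := by
      have := (abs_nonneg _).trans e2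
      positivity
    have n1 : 0 ≤ C * (1 / (2 * κ) * ‖σ‖) := by positivity
    have n2 := norm_nonneg z
    refine (abs_add_three _ _ _).trans ((add_le_add (add_le_add e1 e2) e3).trans ?_)
    nlinarith [mul_nonneg n0 n2]
  · exact (integrable_gG_moment 1).const_mul _
  · refine Eventually.of_forall fun z r hr => ?_
    have hγ : HasDerivAt (fun r => x + ρ r • σ z) (-(1 / (2 * ρ r)) • σ z) r :=
      ((hρd r hr).smul_const (σ z)).const_add x
    exact (hv.hasDerivAt_curve (hUT hr) hγ (hd r (hUT hr) _)).mul_const _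

lemma continuousOn_hP (hv : XB T θ C v) (σ : ES N →L[ℝ] ES N) {t : ℝ} (ht : t ≤ T) (x : ES N) :
    ContinuousOn (fun s => hP σ (t - s) (v s) x) (Icc 0 t) := by
  rcases lt_or_ge t 0 with h0 | h0
  · simp [Icc_eq_empty (not_le.2 h0)]
  have hI : ∀ s ∈ Icc 0 t, s ∈ Icc 0 T := fun s hs => ⟨hs.1, hs.2.trans ht⟩
  refine continuousOn_of_dominated (bound := fun z => C * gG z) ?_ ?_ ?_ ?_
  · intro s hs
    exact (((hv.sp s (hI s hs)).cd.continuous.comp (by fun_prop)).mul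
      continuous_gG).aestronglyMeasurable
  · intro s hs
    refine Eventually.of_forall fun z => ?_
    rw [norm_mul, Real.norm_of_nonneg (gG_pos z).le]
    exact mul_le_mul_of_nonneg_right ((hv.sp s (hI s hs)).b0 _) (gG_pos z).le
  · exact integrable_gG.const_mul C
  · refine Eventually.of_forall fun z => ContinuousOn.mul ?_ continuousOn_const
    refine hv.continuousOn.comp (f := fun s => (s, x + Real.sqrt (t - s) • σ z)) ?_
      fun s hs => ⟨hI s hs, mem_univ _⟩
    exact (by fun_prop : Continuous fun s => (s, x + Real.sqrt (t - s) • σ z)).continuousOn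

end Heat

/-! ### Schauder estimate for constant coefficients -/

section SchauderConst
variable {N : ℕ} {T θ C : ℝ} {v : ℝ → ES N → ℝ}

/-- Second difference. -/
def sd (φ : ES N → ℝ) (k x : ES N) : ℝ := φ (x + k) + φ (x - k) - 2 * φ x

lemma hP_zero (σ : ES N →L[ℝ] ES N) (f : ES N → ℝ) (x : ES N) : hP σ 0 f x = f x := by
  simp [hP, integral_const_mul, integral_gG]

lemma hP_shift {σ τ : ES N →L[ℝ] ES N} (h : ∀ z, σ (τ z) = z) {r : ℝ} (hr : 0 < r)
    (f : ES N → ℝ) (x k : ES N) :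
    hP σ r f (x + k) =
      ∫ z, f (x + Real.sqrt r • σ z) * gG (z - (1 / Real.sqrt r) • τ k) := by
  have hs : Real.sqrt r ≠ 0 := (Real.sqrt_pos.2 hr).ne'
  rw [← integral_add_right_eq_self _ ((1 / Real.sqrt r) • τ k)]
  unfold hP
  congr 1; ext z
  rw [add_sub_cancel_right, map_add, map_smul, h, smul_add, smul_smul, mul_one_div_cancel hs,
    one_smul]
  congr 2; abel

lemma integrable_mul_gG_shift {f : ES N → ℝ} {M : ℝ} (hf : Continuous f) (hM : ∀ x, |f x| ≤ M)
    (w : ES N) : Integrable fun z => f z * gG (z + w) := by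
  refine ((integrable_gG_shift w).const_mul M).mono'
    (hf.mul (continuous_gG.comp (by fun_prop))).aestronglyMeasurable
    (Eventually.of_forall fun z => ?_)
  have hM0 := (abs_nonneg _).trans (hM z)
  rw [Real.norm_eq_abs, abs_mul, abs_of_pos (gG_pos _), ← mul_assoc]
  refine mul_le_mul_of_nonneg_right ((hM z).trans ?_) (gG_pos _).le
  nlinarith [norm_nonneg z]

lemma hol_kernel_bound {φ : ES N → ℝ} {G S : ℝ} (hθ0 : 0 ≤ θ) (hθ1 : θ ≤ 1) (hφ : Hol θ G φ)
    (hG : 0 ≤ G) {σ : ES N →L[ℝ] ES N} (hσ : ‖σ‖ ≤ S) {r : ℝ} (hr : 0 ≤ r) (x z : ES N) :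
    |φ (x + Real.sqrt r • σ z) - φ x| ≤ G * (1 + S) * r ^ (θ / 2) * (1 + ‖z‖) := by
  have hS : 0 ≤ S := (norm_nonneg _).trans hσ
  have h1 := hφ (x + Real.sqrt r • σ z) x
  rw [add_sub_cancel_left, norm_smul, Real.norm_of_nonneg (Real.sqrt_nonneg r),
    Real.mul_rpow (Real.sqrt_nonneg r) (norm_nonneg _), Real.sqrt_eq_rpow, ← Real.rpow_mul hr,
    one_div_mul_eq_div, ← Real.sqrt_eq_rpow] at h1
  have h2 : ‖σ z‖ ^ θ ≤ (1 + S) * (1 + ‖z‖) := by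
    have e1 : ‖σ z‖ ≤ S * ‖z‖ := (σ.le_opNorm z).trans (by gcongr)
    have e2 : ‖σ z‖ ^ θ ≤ (1 + ‖σ z‖) ^ θ :=
      Real.rpow_le_rpow (norm_nonneg _) (by linarith) hθ0
    have e3 : (1 + ‖σ z‖) ^ θ ≤ (1 + ‖σ z‖) ^ (1 : ℝ) :=
      Real.rpow_le_rpow_of_exponent_le (by linarith [norm_nonneg (σ z)]) hθ1
    rw [Real.rpow_one] at e3
    nlinarith [norm_nonneg z]
  refine h1.trans ?_
  calc G * (r ^ (θ / 2) * ‖σ z‖ ^ θ) ≤ G * (r ^ (θ / 2) * ((1 + S) * (1 + ‖z‖))) := by gcongr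
    _ = _ := by ring

lemma rpow_half_div_sqrt {r : ℝ} (hr : 0 < r) (a : ℝ) :
    r ^ a / Real.sqrt r = r ^ (a - 1 / 2) := by
  rw [Real.sqrt_eq_rpow, Real.rpow_sub hr]

lemma norm_one_div_sqrt_smul_le {τ : ES N →L[ℝ] ES N} {S r : ℝ} (hτ : ‖τ‖ ≤ S) (k : ES N) :
    ‖(1 / Real.sqrt r) • τ k‖ ≤ S * ‖k‖ / Real.sqrt r := by
  rw [norm_smul, Real.norm_of_nonneg (by positivity), one_div_mul_eq_div]
  gcongr
  exact (τ.le_opNorm k).trans (by gcongr)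

/-- Smoothing: second differences. -/
lemma exists_sd_hP_bound (N : ℕ) {θ S : ℝ} (hθ0 : 0 ≤ θ) (hθ1 : θ ≤ 1) (hS : 0 ≤ S) :
    ∃ K > 0, ∀ (σ τ : ES N →L[ℝ] ES N), (∀ z, σ (τ z) = z) → ‖σ‖ ≤ S → ‖τ‖ ≤ S →
      ∀ (φ : ES N → ℝ) (G M : ℝ), 0 ≤ G → Continuous φ → Hol θ G φ → (∀ x, |φ x| ≤ M) →
      ∀ r > 0, ∀ x k, |sd (hP σ r φ) k x| ≤ K * G * ‖k‖ ^ 2 * r ^ (θ / 2 - 1) := by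
  obtain ⟨C, hC, hG2⟩ := exists_gG_second_diff N
  refine ⟨(1 + S) * C * (S ^ 2 + 1), by positivity, ?_⟩
  intro σ τ hστ hσ hτ φ G M hG hc hφ hM r hr x k
  set w := (1 / Real.sqrt r) • τ k with hw
  have hc' : Continuous fun z => φ (x + Real.sqrt r • σ z) := hc.comp (by fun_prop)
  have e1 : hP σ r φ (x + k) = ∫ z, φ (x + Real.sqrt r • σ z) * gG (z + -w) := by
    rw [hP_shift hστ hr]; simp only [sub_eq_add_neg, hw]
  have e2 : hP σ r φ (x - k) = ∫ z, φ (x + Real.sqrt r • σ z) * gG (z + w) := by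
    rw [sub_eq_add_neg, hP_shift hστ hr]; simp [hw]
  have i0 : ∀ w, Integrable fun z => φ (x + Real.sqrt r • σ z) * gG (z + w) :=
    integrable_mul_gG_shift hc' fun z => hM _
  have j0 : ∀ w : ES N, Integrable fun z : ES N => gG (z + w) := fun w =>
    integrable_gG.comp_add_right w
  have i1 : Integrable fun z => φ (x + Real.sqrt r • σ z) * gG z := by simpa using i0 0
  have j1 : ∫ z : ES N, (gG (z + -w) + gG (z + w) - 2 * gG z) = 0 := by
    have a1 : Integrable fun z : ES N => gG (z + -w) + gG (z + w) := (j0 _).add (j0 _)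
    rw [integral_sub a1 (integrable_gG.const_mul 2), integral_add (j0 _) (j0 _),
      integral_const_mul, integral_add_right_eq_self (fun z : ES N => gG z),
      integral_add_right_eq_self (fun z : ES N => gG z), integral_gG]
    norm_num
  have j2 : Integrable fun z : ES N => (gG (z + -w) + gG (z + w) - 2 * gG z) :=
    ((j0 _).add (j0 _)).sub (integrable_gG.const_mul 2)
  have e3 : sd (hP σ r φ) k x =
      ∫ z, (φ (x + Real.sqrt r • σ z) - φ x) * (gG (z + -w) + gG (z + w) - 2 * gG z) := by
    have i12 : Integrable fun z => φ (x + Real.sqrt r • σ z) * gG (z + -w) +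
      φ (x + Real.sqrt r • σ z) * gG (z + w) := (i0 _).add (i0 _)
    have i3 : Integrable fun z =>
        φ (x + Real.sqrt r • σ z) * (gG (z + -w) + gG (z + w) - 2 * gG z) :=
      (i12.sub (i1.const_mul 2)).congr (Eventually.of_forall fun z => by
        simp only [Pi.sub_apply]; ring)
    simp only [sub_mul]
    rw [integral_sub i3 (j2.const_mul _), integral_const_mul, j1, mul_zero, sub_zero]
    unfold sd
    rw [e1, e2]
    unfold hP
    rw [← integral_const_mul, ← integral_add (i0 _) (i0 _), ← integral_sub i12 (i1.const_mul 2)]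
    congr 1; ext z; ring
  set Q := G * (1 + S) * r ^ (θ / 2) with hQ
  have hQ0 : 0 ≤ Q := by positivity
  have jj : Integrable fun z : ES N => Q * ((1 + ‖z‖) * |gG (z + w) + gG (z - w) - 2 * gG z|) := by
    refine Integrable.const_mul ?_ Q
    have a1 : Integrable fun z : ES N => (1 + ‖z‖) * gG (z + w) + (1 + ‖z‖) * gG (z + -w) +
        2 * ((1 + ‖z‖) ^ 1 * gG z) :=
      ((integrable_gG_shift w).add (integrable_gG_shift (-w))).add
        ((integrable_gG_moment 1).const_mul 2)
    refine a1.mono' ?_ (Eventually.of_forall fun z => ?_)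
    · have := continuous_gG (N := N)
      exact Continuous.aestronglyMeasurable (by fun_prop)
    · rw [Real.norm_of_nonneg (by positivity), pow_one, ← sub_eq_add_neg]
      have h1 := gG_pos (z + w)
      have h2 := gG_pos (z - w)
      have h3 := gG_pos z
      have : |gG (z + w) + gG (z - w) - 2 * gG z| ≤ gG (z + w) + gG (z - w) + 2 * gG z := by
        rw [abs_le]; constructor <;> linarith
      calc (1 + ‖z‖) * |gG (z + w) + gG (z - w) - 2 * gG z|
          ≤ (1 + ‖z‖) * (gG (z + w) + gG (z - w) + 2 * gG z) := by gcongr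
        _ = _ := by ring
  have e4 : |sd (hP σ r φ) k x| ≤ Q * (C * ‖w‖ ^ 2) := by
    rw [e3, ← Real.norm_eq_abs]
    refine (norm_integral_le_of_norm_le jj (Eventually.of_forall fun z => ?_)).trans ?_
    · rw [norm_mul, ← mul_assoc, Real.norm_eq_abs, Real.norm_eq_abs, ← sub_eq_add_neg,
        add_comm (gG (z - w))]
      gcongr
      exact hol_kernel_bound hθ0 hθ1 hφ hG hσ hr.le x z
    · rw [integral_const_mul]
      exact mul_le_mul_of_nonneg_left (hG2 w) hQ0
  refine e4.trans ?_
  have hw2 : ‖w‖ ^ 2 ≤ (S ^ 2 + 1) * ‖k‖ ^ 2 / r := by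
    have := norm_one_div_sqrt_smul_le (r := r) hτ k
    calc ‖w‖ ^ 2 ≤ (S * ‖k‖ / Real.sqrt r) ^ 2 := by gcongr
      _ = S ^ 2 * ‖k‖ ^ 2 / r := by rw [div_pow, Real.sq_sqrt hr.le, mul_pow]
      _ ≤ _ := by gcongr; linarith
  calc Q * (C * ‖w‖ ^ 2) ≤ Q * (C * ((S ^ 2 + 1) * ‖k‖ ^ 2 / r)) := by gcongr
    _ = _ := by
      rw [hQ, Real.rpow_sub_one hr.ne']; ring

/-- Smoothing: first differences. -/
lemma exists_diff_hP_bound (N : ℕ) {θ S : ℝ} (hθ0 : 0 ≤ θ) (hθ1 : θ ≤ 1) (hS : 0 ≤ S) :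
    ∃ K > 0, ∀ (σ τ : ES N →L[ℝ] ES N), (∀ z, σ (τ z) = z) → ‖σ‖ ≤ S → ‖τ‖ ≤ S →
      ∀ (φ : ES N → ℝ) (G M : ℝ), 0 ≤ G → Continuous φ → Hol θ G φ → (∀ x, |φ x| ≤ M) →
      ∀ r > 0, ∀ x k, |hP σ r φ (x + k) - hP σ r φ x| ≤ K * G * ‖k‖ * r ^ (θ / 2 - 1 / 2) := by
  obtain ⟨C, hC, hG1⟩ := exists_gG_first_diff N
  refine ⟨(1 + S) * C * (S + 1), by positivity, ?_⟩
  intro σ τ hστ hσ hτ φ G M hG hc hφ hM r hr x k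
  set w := -((1 / Real.sqrt r) • τ k) with hw
  have hc' : Continuous fun z => φ (x + Real.sqrt r • σ z) := hc.comp (by fun_prop)
  have e1 : hP σ r φ (x + k) = ∫ z, φ (x + Real.sqrt r • σ z) * gG (z + w) := by
    rw [hP_shift hστ hr]; simp only [sub_eq_add_neg, hw]
  have i0 : ∀ w, Integrable fun z => φ (x + Real.sqrt r • σ z) * gG (z + w) :=
    integrable_mul_gG_shift hc' fun z => hM _
  have i1 : Integrable fun z => φ (x + Real.sqrt r • σ z) * gG z := by simpa using i0 0
  have j0 : Integrable fun z : ES N => gG (z + w) := integrable_gG.comp_add_right w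
  have j1 : ∫ z : ES N, (gG (z + w) - gG z) = 0 := by
    rw [integral_sub j0 integrable_gG, integral_add_right_eq_self (fun z : ES N => gG z), sub_self]
  have j2 : Integrable fun z : ES N => gG (z + w) - gG z := j0.sub integrable_gG
  have e3 : hP σ r φ (x + k) - hP σ r φ x =
      ∫ z, (φ (x + Real.sqrt r • σ z) - φ x) * (gG (z + w) - gG z) := by
    have i3 : Integrable fun z => φ (x + Real.sqrt r • σ z) * (gG (z + w) - gG z) := by
      simp only [mul_sub]; exact (i0 w).sub i1
    simp only [sub_mul _ _ (gG _ - gG _)]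
    rw [integral_sub i3 (j2.const_mul _), integral_const_mul, j1, mul_zero,
      sub_zero, e1]
    unfold hP
    rw [← integral_sub (i0 w) i1]
    congr 1; ext z; ring
  set Q := G * (1 + S) * r ^ (θ / 2) with hQ
  have hQ0 : 0 ≤ Q := by positivity
  have jj : Integrable fun z : ES N => Q * ((1 + ‖z‖) * |gG (z + w) - gG z|) := by
    refine Integrable.const_mul ?_ Q
    have a1 : Integrable fun z : ES N => (1 + ‖z‖) * gG (z + w) + ((1 + ‖z‖) ^ 1 * gG z) :=
      (integrable_gG_shift w).add (integrable_gG_moment 1)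
    refine a1.mono' ?_ (Eventually.of_forall fun z => ?_)
    · have := continuous_gG (N := N)
      exact Continuous.aestronglyMeasurable (by fun_prop)
    · rw [Real.norm_of_nonneg (by positivity), pow_one]
      have h1 := gG_pos (z + w)
      have h3 := gG_pos z
      have : |gG (z + w) - gG z| ≤ gG (z + w) + gG z := by
        rw [abs_le]; constructor <;> linarith
      calc (1 + ‖z‖) * |gG (z + w) - gG z| ≤ (1 + ‖z‖) * (gG (z + w) + gG z) := by gcongr
        _ = _ := by ring
  have e4 : |hP σ r φ (x + k) - hP σ r φ x| ≤ Q * (C * ‖w‖) := by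
    rw [e3, ← Real.norm_eq_abs]
    refine (norm_integral_le_of_norm_le jj (Eventually.of_forall fun z => ?_)).trans ?_
    · rw [norm_mul, ← mul_assoc, Real.norm_eq_abs, Real.norm_eq_abs]
      gcongr
      exact hol_kernel_bound hθ0 hθ1 hφ hG hσ hr.le x z
    · rw [integral_const_mul]
      exact mul_le_mul_of_nonneg_left (hG1 w) hQ0
  refine e4.trans ?_
  have hw2 : ‖w‖ ≤ (S + 1) * ‖k‖ / Real.sqrt r := by
    rw [hw, norm_neg]
    refine (norm_one_div_sqrt_smul_le (r := r) hτ k).trans ?_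
    gcongr; linarith
  calc Q * (C * ‖w‖) ≤ Q * (C * ((S + 1) * ‖k‖ / Real.sqrt r)) := by gcongr
    _ = _ := by
      rw [hQ, ← rpow_half_div_sqrt hr]; ring

lemma sub_le_of_deriv_le_rpow {Φ Φ' : ℝ → ℝ} {s₀ t K θ : ℝ} (hθ : 0 < θ) (hst : s₀ ≤ t)
    (hc : ContinuousOn Φ (Icc s₀ t)) (hd : ∀ s ∈ Ioo s₀ t, HasDerivAt Φ (Φ' s) s)
    (hb : ∀ s ∈ Ioo s₀ t, Φ' s ≤ K * (t - s) ^ (θ / 2 - 1)) :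
    Φ t - Φ s₀ ≤ 2 / θ * K * (t - s₀) ^ (θ / 2) := by
  have hB : ∀ s ∈ Ioo s₀ t, HasDerivAt (fun s => 2 / θ * K * (t - s) ^ (θ / 2))
      (-(K * (t - s) ^ (θ / 2 - 1))) s := fun s hs => by
    have h0 : t - s ≠ 0 := by linarith [hs.2]
    have := ((((hasDerivAt_id s).const_sub t).rpow_const (p := θ / 2) (Or.inl h0))).const_mul
      (2 / θ * K)
    refine this.congr_deriv ?_
    simp only [id]; field_simp
  have hder : ∀ s ∈ interior (Icc s₀ t),
      HasDerivAt (fun s => Φ s + 2 / θ * K * (t - s) ^ (θ / 2))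
      (Φ' s + -(K * (t - s) ^ (θ / 2 - 1))) s := fun s hs => by
    rw [interior_Icc] at hs
    exact (hd s hs).fun_add (hB s hs)
  have hanti : AntitoneOn (fun s => Φ s + 2 / θ * K * (t - s) ^ (θ / 2)) (Icc s₀ t) := by
    refine antitoneOn_of_deriv_nonpos (convex_Icc _ _) (hc.add ?_) ?_ ?_
    · exact (continuous_const.mul ((Real.continuous_rpow_const (by positivity)).comp
        (by fun_prop))).continuousOn
    · exact fun s hs => (hder s hs).differentiableAt.differentiableWithinAt
    · intro s hs
      rw [(hder s hs).deriv]
      rw [interior_Icc] at hs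
      linarith [hb s hs]
  have := hanti (left_mem_Icc.2 hst) (right_mem_Icc.2 hst) hst
  simp only [sub_self, Real.zero_rpow (by positivity : θ / 2 ≠ 0), mul_zero, add_zero] at this
  linarith

lemma abs_sub_le_of_deriv_le_rpow {Φ Φ' : ℝ → ℝ} {s₀ t K θ : ℝ} (hθ : 0 < θ) (hst : s₀ ≤ t)
    (hc : ContinuousOn Φ (Icc s₀ t)) (hd : ∀ s ∈ Ioo s₀ t, HasDerivAt Φ (Φ' s) s)
    (hb : ∀ s ∈ Ioo s₀ t, |Φ' s| ≤ K * (t - s) ^ (θ / 2 - 1)) :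
    |Φ t - Φ s₀| ≤ 2 / θ * K * (t - s₀) ^ (θ / 2) := by
  have h1 := sub_le_of_deriv_le_rpow hθ hst hc hd fun s hs => (abs_le.1 (hb s hs)).2
  have h2 := sub_le_of_deriv_le_rpow (K := K) hθ hst hc.neg (fun s hs => (hd s hs).neg)
    fun s hs => by linarith [(abs_le.1 (hb s hs)).1]
  rw [abs_le]
  constructor
  · simp only [Pi.neg_apply] at h2; linarith
  · exact h1

lemma norm_D2_sub_le_of_sd {φ : ES N → ℝ} {Q : ℝ} (hθ : 0 < θ) (h : C2b θ C φ) (hQ : 0 ≤ Q)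
    (x y : ES N) (hs : ∀ k, |sd φ k x - sd φ k y| ≤ Q * ‖k‖ ^ 2) : ‖D2 φ x - D2 φ y‖ ≤ Q := by
  refine norm_le_of_quadratic hQ (fun v w => by simp only [sub_apply, D2_symm h.cd _ v w])
    fun k => ?_
  have hC := h.nonneg
  have key : ∀ e > 0, |(D2 φ x - D2 φ y) k k| ≤
      Q * ‖k‖ ^ 2 + 4 * C * (e * ‖k‖) ^ θ * ‖k‖ ^ 2 := fun e he => by
    have a1 := second_diff_approx hθ.le hC h.cd h.hol x (e • k)
    have a2 := second_diff_approx hθ.le hC h.cd h.hol y (e • k)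
    have a3 := hs (e • k)
    unfold sd at a3
    simp only [map_smul, smul_apply, smul_eq_mul, norm_smul, Real.norm_of_nonneg he.le, mul_pow]
      at a1 a2 a3
    rw [sub_apply, sub_apply]
    have e2 : 0 < e ^ 2 := by positivity
    rw [← mul_le_mul_iff_right₀ e2]
    rw [abs_le] at a1 a2 a3
    rw [← abs_of_pos e2, ← abs_mul, abs_of_pos e2, abs_le]
    constructor <;> nlinarith
  have hl : Tendsto (fun e : ℝ => Q * ‖k‖ ^ 2 + 4 * C * (e * ‖k‖) ^ θ * ‖k‖ ^ 2) (𝓝[>] 0)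
      (𝓝 (Q * ‖k‖ ^ 2)) := by
    have hc : Continuous (fun e : ℝ => Q * ‖k‖ ^ 2 + 4 * C * (e * ‖k‖) ^ θ * ‖k‖ ^ 2) := by
      have := (Real.continuous_rpow_const hθ.le).comp (by fun_prop : Continuous fun e => e * ‖k‖)
      exact continuous_const.add ((continuous_const.mul this).mul continuous_const)
    have := hc.tendsto 0
    simp only [zero_mul, Real.zero_rpow hθ.ne', mul_zero, add_zero] at this
    exact this.mono_left nhdsWithin_le_nhds
  exact ge_of_tendsto hl (by filter_upwards [self_mem_nhdsWithin] with e he using key e he)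

lemma abs_sd_le {φ : ES N → ℝ} {M : ℝ} (h : ∀ x, |φ x| ≤ M) (k x : ES N) :
    |sd φ k x| ≤ 4 * M := by
  have h1 := abs_le.1 (h (x + k))
  have h2 := abs_le.1 (h (x - k))
  have h3 := abs_le.1 (h x)
  unfold sd
  rw [abs_le]
  constructor <;> linarith [h1.1, h1.2, h2.1, h2.2, h3.1, h3.2]

lemma hP_sd {φ : ES N → ℝ} {M : ℝ} (σ : ES N →L[ℝ] ES N) (hφ : Continuous φ)
    (h : ∀ x, |φ x| ≤ M) (r : ℝ) (k x : ES N) : hP σ r (sd φ k) x = sd (hP σ r φ) k x := by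
  have i0 : ∀ y, Integrable fun z => φ (y + Real.sqrt r • σ z) * gG z := fun y =>
    integrable_mul_gG_of_bdd (hφ.comp (by fun_prop)) fun z => h _
  have i12 : Integrable fun z => φ (x + k + Real.sqrt r • σ z) * gG z +
      φ (x - k + Real.sqrt r • σ z) * gG z := (i0 _).add (i0 _)
  unfold sd hP
  rw [← integral_const_mul, ← integral_add (i0 _) (i0 _), ← integral_sub i12 ((i0 _).const_mul 2)]
  congr 1; ext z
  rw [add_right_comm x k, sub_add_eq_add_sub x k]; ring

/-- A priori Hölder bound of the Hessian for solutions of constant coefficient equations. -/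
theorem schauder_const (N : ℕ) {θ lam Lam : ℝ} (hθ0 : 0 < θ) (hθ1 : θ < 1) (hlam : 0 < lam)
    (hLam : 0 ≤ Lam) :
    ∃ K > 0, ∀ A : H2 N →L[ℝ] ℝ, Ell lam Lam A → ∀ (T : ℝ) (v h : ℝ → ES N → ℝ) (C G Hb : ℝ),
      XB T θ C v → (∀ x, v 0 x = 0) → 0 ≤ G →
      (∀ s ∈ Ioo 0 T, ∀ x, HasDerivAt (fun r => v r x) (A (D2 (v s) x) + h s x) s) →
      (∀ s ∈ Icc 0 T, ∀ x, |h s x| ≤ Hb) → (∀ s ∈ Icc 0 T, Hol θ G (h s)) →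
      ∀ t ∈ Icc 0 T, Hol θ (K * G) (D2 (v t)) := by
  set S := 1 + N ^ 2 * Lam + 1 / lam with hS
  have hS0 : 0 ≤ S := by positivity
  obtain ⟨K1, hK1, hk1⟩ := exists_diff_hP_bound N hθ0.le hθ1.le hS0
  obtain ⟨K2, hK2, hk2⟩ := exists_sd_hP_bound N hθ0.le hθ1.le hS0
  obtain ⟨l, hl, hl1⟩ : ∃ l : ℝ, 0 < l ∧ 2 * K1 * l ^ (θ / 2 - 1 / 2) ≤ 1 / 2 := by
    have h0 : Tendsto (fun l : ℝ => 2 * K1 * l ^ (-(1 / 2 - θ / 2))) atTop (𝓝 (2 * K1 * 0)) :=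
      (tendsto_rpow_neg_atTop (by linarith)).const_mul _
    rw [mul_zero] at h0
    obtain ⟨l, h1, h2⟩ := ((h0.eventually (ge_mem_nhds (by norm_num : (0:ℝ) < 1 / 2))).and
      (eventually_gt_atTop 0)).exists
    exact ⟨l, h2, by rwa [neg_sub] at h1⟩
  set K0 := 4 / θ * K2 * l ^ (θ / 2) with hK0
  have hK0p : 0 < K0 := by positivity
  refine ⟨2 * K0, by positivity, ?_⟩
  intro A hA T v h C G Hb hv hv0 hG hd hb hh t ht
  obtain ⟨σ, τ, hστ, -, hσ, hτ, hAσ⟩ := hA.exists_sqrt hlam hLam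
  have hC := hv.nonneg (ht.1.trans ht.2)
  have hhc : ∀ s ∈ Icc 0 T, Continuous (h s) := fun s hs => (hh s hs).continuous hθ0
  have step : ∀ N0, 0 ≤ N0 → (∀ t ∈ Icc 0 T, Hol θ N0 (D2 (v t))) →
      ∀ t ∈ Icc 0 T, Hol θ (N0 / 2 + K0 * G) (D2 (v t)) := by
    intro N0 hN0 hN t ht x y
    rcases eq_or_ne x y with rfl | hxy
    · rw [sub_self, norm_zero]; positivity
    have hdp : 0 < ‖x - y‖ := norm_pos_iff.2 (sub_ne_zero.2 hxy)
    set d := ‖x - y‖ with hd'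
    refine norm_D2_sub_le_of_sd hθ0 (hv.sp t ht) (by positivity) x y fun k => ?_
    set r := l * d ^ 2 with hr
    have hrp : 0 < r := by positivity
    set s₀ := max 0 (t - r) with hs₀
    have hs0t : s₀ ≤ t := max_le ht.1 (by linarith)
    have hs0 : 0 ≤ s₀ := le_max_left _ _
    have hs0T : s₀ ∈ Icc 0 T := ⟨hs0, hs0t.trans ht.2⟩
    have hΦ : ∀ x, |sd (v t) k x - hP σ (t - s₀) (sd (v s₀) k) x| ≤
        2 / θ * (K2 * G * ‖k‖ ^ 2) * r ^ (θ / 2) := by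
      intro x
      have := abs_sub_le_of_deriv_le_rpow (Φ := fun s => sd (hP σ (t - s) (v s)) k x)
        (Φ' := fun s => sd (hP σ (t - s) (h s)) k x) (K := K2 * G * ‖k‖ ^ 2) hθ0 hs0t ?_ ?_ ?_
      · simp only [sub_self] at this
        rw [hP_sd σ (hv.sp s₀ hs0T).cd.continuous (hv.sp s₀ hs0T).b0]
        have e : sd (hP σ 0 (v t)) k x = sd (v t) k x := by simp [sd, hP_zero]
        rw [e] at this
        refine this.trans ?_
        have : t - s₀ ≤ r := by linarith [le_max_right 0 (t - r)]
        have : 0 ≤ t - s₀ := by linarith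
        gcongr
      · have hm : Icc s₀ t ⊆ Icc 0 t := Icc_subset_Icc_left hs0
        exact (((continuousOn_hP hv σ ht.2 _).add (continuousOn_hP hv σ ht.2 _)).sub
          (continuousOn_const.mul (continuousOn_hP hv σ ht.2 _))).mono hm
      · intro s hs
        have hs' : s ∈ Ioo 0 t := ⟨hs0.trans_lt hs.1, hs.2⟩
        have hD := fun x => hasDerivAt_hP hv hθ0 hAσ hd hb hhc ht.2 hs' x
        exact ((hD _).add (hD _)).sub ((hD _).const_mul 2)
      · intro s hs
        have hsT : s ∈ Icc 0 T := ⟨hs0.trans hs.1.le, hs.2.le.trans ht.2⟩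
        exact hk2 σ τ hστ hσ hτ (h s) G Hb hG (hhc s hsT) (hh s hsT) (hb s hsT) (t - s)
          (by linarith [hs.2]) x k
    have hΨ : |hP σ (t - s₀) (sd (v s₀) k) x - hP σ (t - s₀) (sd (v s₀) k) y| ≤
        1 / 2 * N0 * ‖k‖ ^ 2 * d ^ θ := by
      rcases le_or_gt (t - r) 0 with h0 | h0
      · have : s₀ = 0 := max_eq_left h0
        have e : sd (v s₀) k = fun _ => 0 := by
          ext x; simp [sd, this, hv0]
        rw [e]
        simp only [hP, zero_mul, integral_zero, sub_self, abs_zero]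
        positivity
      · have hsr : t - s₀ = r := by rw [hs₀, max_eq_right h0.le]; ring
        rw [hsr]
        have h1 : Hol θ (2 * N0 * ‖k‖ ^ 2) (sd (v s₀) k) := fun x y => by
          refine (second_diff_hol (hv.sp s₀ hs0T).cd (hN s₀ hs0T) x y k).trans (le_of_eq ?_)
          ring
        have := hk1 σ τ hστ hσ hτ (sd (v s₀) k) (2 * N0 * ‖k‖ ^ 2) (4 * C) (by positivity)
          (h1.continuous hθ0) h1 (abs_sd_le (hv.sp s₀ hs0T).b0 k) r hrp y (x - y)
        rw [add_sub_cancel] at this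
        refine this.trans ?_
        have e2 : (d ^ 2) ^ (θ / 2 - 1 / 2) = d ^ (((2:ℕ):ℝ) * (θ / 2 - 1 / 2)) := by
          rw [← Real.rpow_natCast, ← Real.rpow_mul hdp.le]
        rw [← hd', hr, Real.mul_rpow hl.le (by positivity), e2]
        have e : d * d ^ (((2:ℕ):ℝ) * (θ / 2 - 1 / 2)) = d ^ θ := by
          nth_rw 1 [← Real.rpow_one d]
          rw [← Real.rpow_add hdp]
          congr 1; push_cast; ring
        calc K1 * (2 * N0 * ‖k‖ ^ 2) * d *
              (l ^ (θ / 2 - 1 / 2) * d ^ (((2:ℕ):ℝ) * (θ / 2 - 1 / 2)))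
            = 2 * K1 * l ^ (θ / 2 - 1 / 2) * (N0 * ‖k‖ ^ 2 *
              (d * d ^ (((2:ℕ):ℝ) * (θ / 2 - 1 / 2)))) := by ring
          _ ≤ 1 / 2 * (N0 * ‖k‖ ^ 2 * d ^ θ) := by
              rw [e]; gcongr
          _ = _ := by ring
    have hrθ : r ^ (θ / 2) = l ^ (θ / 2) * d ^ θ := by
      rw [hr, Real.mul_rpow hl.le (by positivity), ← Real.rpow_natCast, ← Real.rpow_mul hdp.le]
      congr 2; push_cast; ring
    have a1 := hΦ x
    have a2 := hΦ y
    rw [hrθ] at a1 a2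
    have e0 : 2 / θ * (K2 * G * ‖k‖ ^ 2) * (l ^ (θ / 2) * d ^ θ) =
        1 / 2 * K0 * G * d ^ θ * ‖k‖ ^ 2 := by rw [hK0]; ring
    rw [e0] at a1 a2
    rw [abs_le] at a1 a2 hΨ ⊢
    constructor <;> nlinarith
  have iter : ∀ n : ℕ, ∀ t ∈ Icc 0 T, Hol θ (C / 2 ^ n + 2 * K0 * G) (D2 (v t)) := by
    intro n
    induction n with
    | zero =>
      intro t ht
      refine (hv.sp t ht).hol.mono ?_
      have : 0 ≤ 2 * K0 * G := by positivity
      simp; linarith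
    | succ n ih =>
      intro t ht
      refine (step _ (by positivity) ih t ht).mono (le_of_eq ?_)
      rw [pow_succ]; field_simp; ring
  refine Hol.of_forall_gt fun e he => ?_
  have hlim : Tendsto (fun n : ℕ => C / 2 ^ n) atTop (𝓝 0) :=
    tendsto_const_nhds.div_atTop (tendsto_pow_atTop_atTop_of_one_lt (by norm_num))
  obtain ⟨n, hn⟩ := (hlim.eventually (ge_mem_nhds he)).exists
  exact (iter n t ht).mono (by linarith)

end SchauderConst

/-! ### Products, and the equation satisfied by a localised solution -/

section Product
variable {N : ℕ} {θ : ℝ}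

lemma D_mul {ζ φ : ES N → ℝ} (hζ : ContDiff ℝ 2 ζ) (hφ : ContDiff ℝ 2 φ) :
    D (fun x => ζ x * φ x) = fun x => ζ x • D φ x + φ x • D ζ x := by
  ext1 x
  exact fderiv_fun_mul (hζ.differentiable (by norm_num) x) (hφ.differentiable (by norm_num) x)

lemma D2_mul {ζ φ : ES N → ℝ} (hζ : ContDiff ℝ 2 ζ) (hφ : ContDiff ℝ 2 φ) :
    D2 (fun x => ζ x * φ x) = fun x => ζ x • D2 φ x + (D ζ x).smulRight (D φ x) +
      (φ x • D2 ζ x + (D φ x).smulRight (D ζ x)) := by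
  ext1 x
  have d0 := hζ.differentiable (by norm_num) x
  have d0' := hφ.differentiable (by norm_num) x
  have d1 := (contDiff_fderiv_of_two hζ).differentiable (by norm_num) x
  have d1' := (contDiff_fderiv_of_two hφ).differentiable (by norm_num) x
  change fderiv ℝ (D _) x = _
  rw [D_mul hζ hφ, fderiv_fun_add (d0.fun_smul d1') (d0'.fun_smul d1), fderiv_fun_smul d0 d1',
    fderiv_fun_smul d0' d1]

lemma norm_smulRight_le (p q : V1 N) : ‖p.smulRight q‖ ≤ ‖p‖ * ‖q‖ :=
  (ContinuousLinearMap.norm_smulRight_apply p q).le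

lemma Hol.smulRight {p q : ES N → V1 N} {m₁ c₁ m₂ c₂ : ℝ}
    (hf : ∀ x, ‖p x‖ ≤ m₁) (hf' : Hol θ c₁ p) (hg : ∀ x, ‖q x‖ ≤ m₂) (hg' : Hol θ c₂ q) :
    Hol θ (m₁ * c₂ + c₁ * m₂) (fun x => (p x).smulRight (q x)) := by
  have := Hol.bilin (K := 1) (ContinuousLinearMap.smulRightL ℝ (ES N) (V1 N))
    (fun p q => by
      rw [one_mul]; exact norm_smulRight_le p q) zero_le_one hf hf' hg hg'
  rw [one_mul] at this
  exact this

lemma C2b.hol0 {C : ℝ} {φ : ES N → ℝ} (h : C2b θ C φ) (h0 : 0 ≤ θ) (h1 : θ ≤ 1) :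
    Hol θ (3 * C) φ :=
  (Hol.of_lip h0 h1 h.b0 h.nonneg fun x y => norm_sub_le_of_fderiv_bound h.diff h.b1 y x).mono
    (by linarith)

lemma C2b.hol1 {C : ℝ} {φ : ES N → ℝ} (h : C2b θ C φ) (h0 : 0 ≤ θ) (h1 : θ ≤ 1) :
    Hol θ (3 * C) (D φ) :=
  (Hol.of_lip h0 h1 h.b1 h.nonneg fun x y => norm_sub_le_of_fderiv_bound h.diff1 h.b2 y x).mono
    (by linarith)

lemma C2b.mul {C C' : ℝ} {ζ φ : ES N → ℝ} (h0 : 0 ≤ θ) (h1 : θ ≤ 1) (hζ : C2b θ C ζ)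
    (hφ : C2b θ C' φ) : C2b θ (20 * C * C') (fun x => ζ x * φ x) := by
  have hC := hζ.nonneg
  have hC' := hφ.nonneg
  have hp := mul_nonneg hC hC'
  refine ⟨hζ.cd.mul hφ.cd, fun x => ?_, fun x => ?_, fun x => ?_, ?_⟩
  · rw [abs_mul]
    exact (mul_le_mul (hζ.b0 x) (hφ.b0 x) (abs_nonneg _) hC).trans (by linarith)
  · rw [D_mul hζ.cd hφ.cd]
    have e1 := mul_le_mul (hζ.b0 x) (hφ.b1 x) (norm_nonneg _) hC
    have e2 := mul_le_mul (hφ.b0 x) (hζ.b1 x) (norm_nonneg _) hC'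
    refine (norm_add_le _ _).trans ?_
    rw [norm_smul, norm_smul, Real.norm_eq_abs, Real.norm_eq_abs]
    linarith
  · rw [D2_mul hζ.cd hφ.cd]
    have e1 := mul_le_mul (hζ.b0 x) (hφ.b2 x) (norm_nonneg _) hC
    have e2 := mul_le_mul (hφ.b0 x) (hζ.b2 x) (norm_nonneg _) hC'
    have e3 := mul_le_mul (hζ.b1 x) (hφ.b1 x) (norm_nonneg _) hC
    have e4 := norm_smulRight_le (D ζ x) (D φ x)
    have e5 := norm_smulRight_le (D φ x) (D ζ x)
    refine (norm_add_le _ _).trans ?_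
    have e6 := norm_add_le (ζ x • D2 φ x) ((D ζ x).smulRight (D φ x))
    have e7 := norm_add_le (φ x • D2 ζ x) ((D φ x).smulRight (D ζ x))
    rw [norm_smul, Real.norm_eq_abs] at e6 e7
    linarith
  · rw [D2_mul hζ.cd hφ.cd]
    have a1 := hζ.hol0 h0 h1
    have a2 := hφ.hol0 h0 h1
    have a3 := hζ.hol1 h0 h1
    have a4 := hφ.hol1 h0 h1
    refine (((Hol.smul hζ.b0 a1 hφ.b2 hφ.hol).add (Hol.smulRight hζ.b1 a3 hφ.b1 a4)).add
      ((Hol.smul hφ.b0 a2 hζ.b2 hζ.hol).add (Hol.smulRight hφ.b1 a4 hζ.b1 a3))).mono ?_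
    linarith

/-- The operator with Hessian, gradient and zero-order coefficients `A`, `B`, `c`. -/
def LA (A : ℝ → ES N → H2 N →L[ℝ] ℝ) (B : ℝ → ES N → V1 N →L[ℝ] ℝ) (c : ℝ → ES N → ℝ)
    (φ : ES N → ℝ) (t : ℝ) (x : ES N) : ℝ :=
  A t x (D2 φ x) + B t x (D φ x) + c t x * φ x

/-- `u` solves `D_t u = LA u + h` on `(0,T) × ℝ^N`. -/
def Solves (T : ℝ) (A : ℝ → ES N → H2 N →L[ℝ] ℝ) (B : ℝ → ES N → V1 N →L[ℝ] ℝ)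
    (c h : ℝ → ES N → ℝ) (u : ℝ → ES N → ℝ) : Prop :=
  ∀ t ∈ Ioo 0 T, ∀ x, HasDerivAt (fun r => u r x) (LA A B c (u t) t x + h t x) t

/-- Right-hand side of the constant coefficient equation for the localised function
`τ ζ w`. -/
def locRhs (A : ES N → H2 N →L[ℝ] ℝ) (B : ES N → V1 N →L[ℝ] ℝ) (c h : ES N → ℝ)
    (A0 : H2 N →L[ℝ] ℝ) (ζ w : ES N → ℝ) (a a' : ℝ) (x : ES N) : ℝ :=
  a' * (ζ x * w x) + a * (ζ x * (A x - A0) (D2 w x) + ζ x * B x (D w x) + ζ x * (c x * w x) +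
    ζ x * h x - A0 ((D ζ x).smulRight (D w x) + (D w x).smulRight (D ζ x)) -
    w x * A0 (D2 ζ x))

lemma hol_on_clm {F : Type*} [NormedAddCommGroup F] [NormedSpace ℝ F] {S : Set (ES N)}
    {f : ES N → F →L[ℝ] ℝ} {g : ES N → F} {m₁ c₁ m₂ c₂ : ℝ} (hm₁ : 0 ≤ m₁)
    (hf : ∀ x ∈ S, ‖f x‖ ≤ m₁) (hf' : ∀ x ∈ S, ∀ y ∈ S, ‖f x - f y‖ ≤ c₁ * ‖x - y‖ ^ θ)
    (hg : ∀ x, ‖g x‖ ≤ m₂) (hg' : Hol θ c₂ g) :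
    ∀ x ∈ S, ∀ y ∈ S, ‖f x (g x) - f y (g y)‖ ≤ (m₁ * c₂ + c₁ * m₂) * ‖x - y‖ ^ θ := by
  intro x hx y hy
  have e : f x (g x) - f y (g y) = f x (g x - g y) + (f x - f y) (g y) := by
    rw [map_sub, sub_apply]; ring
  rw [e]
  refine (norm_add_le _ _).trans ?_
  have e1 := ((f x).le_opNorm (g x - g y)).trans
    (mul_le_mul (hf x hx) (hg' x y) (norm_nonneg _) hm₁)
  have e2 := ((f x - f y).le_opNorm (g y)).trans
    (mul_le_mul (hf' x hx y hy) (hg y) (norm_nonneg _) ((norm_nonneg _).trans (hf' x hx y hy)))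
  nlinarith

lemma locRhs_estimate {S : Set (ES N)} {A : ES N → H2 N →L[ℝ] ℝ} {B : ES N → V1 N →L[ℝ] ℝ}
    {c h : ES N → ℝ} {A0 : H2 N →L[ℝ] ℝ} {ζ w : ES N → ℝ} {a a' C L ε P G n : ℝ}
    (h0 : 0 ≤ θ) (h1 : θ ≤ 1)
    (hC : 1 ≤ C) (hL : 1 ≤ L) (hε : 0 ≤ ε) (hε1 : ε ≤ 1) (hP : 0 ≤ P) (hG : 0 ≤ G) (hn : 0 ≤ n)
    (hA0 : ‖A0‖ ≤ C) (ha : |a| ≤ 1) (ha' : |a'| ≤ L)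
    (hζ : C2b θ L ζ) (hζ1 : ∀ x, |ζ x| ≤ 1) (hζS : ∀ x ∉ S, ζ x = 0) (hζh : Hol θ L ζ)
    (hζh1 : Hol θ L (D ζ))
    (hA : ∀ x ∈ S, ‖A x - A0‖ ≤ ε) (hA' : ∀ x ∈ S, ∀ y ∈ S, ‖A x - A y‖ ≤ C * ‖x - y‖ ^ θ)
    (hB : ∀ x ∈ S, ‖B x‖ ≤ C) (hB' : ∀ x ∈ S, ∀ y ∈ S, ‖B x - B y‖ ≤ C * ‖x - y‖ ^ θ)
    (hc : ∀ x ∈ S, |c x| ≤ C) (hc' : ∀ x ∈ S, ∀ y ∈ S, |c x - c y| ≤ C * ‖x - y‖ ^ θ)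
    (hh : ∀ x ∈ S, |h x| ≤ G) (hh' : ∀ x ∈ S, ∀ y ∈ S, |h x - h y| ≤ G * ‖x - y‖ ^ θ)
    (hw : ContDiff ℝ 2 w)
    (w0 : ∀ x, |w x| ≤ P) (w1 : ∀ x, ‖D w x‖ ≤ P) (w2 : ∀ x, ‖D2 w x‖ ≤ P)
    (hw2 : Hol θ n (D2 w)) :
    (∀ x, |locRhs A B c h A0 ζ w a a' x| ≤ 30 * C * L ^ 2 * (P + G)) ∧
      Hol θ (ε * n + 30 * C * L ^ 2 * (P + G)) (locRhs A B c h A0 ζ w a a') := by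
  have hwd : Differentiable ℝ w := hw.differentiable (by norm_num)
  have hwd1 : Differentiable ℝ (D w) := (contDiff_fderiv_of_two hw).differentiable (by norm_num)
  have hw0 : Hol θ (3 * P) w := (Hol.of_lip h0 h1 w0 hP fun x y =>
    norm_sub_le_of_fderiv_bound hwd w1 y x).mono (by linarith)
  have hw1 : Hol θ (3 * P) (D w) := (Hol.of_lip h0 h1 w1 hP fun x y =>
    norm_sub_le_of_fderiv_bound hwd1 w2 y x).mono (by linarith)
  have hC0 : 0 ≤ C := by linarith
  have hL0 : 0 ≤ L := by linarith
  have hLL : L ≤ L ^ 2 := by nlinarith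
  have hCP : 0 ≤ C * P := by positivity
  have hCLP : C * P ≤ C * P * L := by nlinarith
  have hCLP2 : C * P * L ≤ C * P * L ^ 2 := by gcongr
  have hLP2 : L ^ 2 * P ≤ C * P * L ^ 2 := by nlinarith [mul_nonneg (sq_nonneg L) hP]
  have hLP3 : L * P ≤ C * P * L := by nlinarith [mul_nonneg hL0 hP]
  have hPC : P ≤ C * P := by nlinarith
  have hεP : ε * P ≤ P := by nlinarith
  have hLG : L * G ≤ C * G * L ^ 2 := by
    have : G ≤ C * G := by nlinarith
    calc L * G ≤ L ^ 2 * (C * G) := by gcongr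
      _ = _ := by ring
  have hGL : G ≤ L * G := by nlinarith
  have hLεP : L * (ε * P) ≤ L * P := by gcongr
  constructor
  · intro x
    have key : ∀ {y m : ℝ}, 0 ≤ m → (x ∈ S → |y| ≤ m) → |ζ x * y| ≤ m := by
      intro y m hm hy
      by_cases hx : x ∈ S
      · rw [abs_mul]
        exact (mul_le_mul (hζ1 x) (hy hx) (abs_nonneg _) zero_le_one).trans (by linarith)
      · rw [hζS x hx]; simpa using hm
    have b0 : |ζ x * w x| ≤ P := key hP fun _ => w0 x
    have b1 : |ζ x * (A x - A0) (D2 w x)| ≤ P := key hP fun hx =>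
      (((A x - A0).le_opNorm _).trans
        (mul_le_mul (hA x hx) (w2 x) (norm_nonneg _) hε)).trans hεP
    have b2 : |ζ x * B x (D w x)| ≤ C * P := key hCP fun hx =>
      ((B x).le_opNorm _).trans (mul_le_mul (hB x hx) (w1 x) (norm_nonneg _) hC0)
    have b3 : |ζ x * (c x * w x)| ≤ C * P := key hCP fun hx => by
      rw [abs_mul]; exact mul_le_mul (hc x hx) (w0 x) (abs_nonneg _) hC0
    have b4 : |ζ x * h x| ≤ G := key hG (hh x)
    have b5 : |A0 ((D ζ x).smulRight (D w x) + (D w x).smulRight (D ζ x))| ≤ C * (2 * (L * P)) := by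
      refine (A0.le_opNorm _).trans (mul_le_mul hA0 ?_ (norm_nonneg _) hC0)
      have e1 := (norm_smulRight_le (D ζ x) (D w x)).trans
        (mul_le_mul (hζ.b1 x) (w1 x) (norm_nonneg _) hL0)
      have e2 := (norm_smulRight_le (D w x) (D ζ x)).trans
        (mul_le_mul (w1 x) (hζ.b1 x) (norm_nonneg _) hP)
      refine (norm_add_le _ _).trans ?_
      linarith
    have b6 : |w x * A0 (D2 ζ x)| ≤ P * (C * L) := by
      rw [abs_mul]
      exact mul_le_mul (w0 x) ((A0.le_opNorm _).trans
        (mul_le_mul hA0 (hζ.b2 x) (norm_nonneg _) hC0)) (abs_nonneg _) hP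
    have b7 : |a' * (ζ x * w x)| ≤ L * P := by
      rw [abs_mul]; exact mul_le_mul ha' b0 (abs_nonneg _) hL0
    unfold locRhs
    refine (abs_add_le _ _).trans ?_
    rw [abs_mul a]
    have b8 : |a| * |ζ x * (A x - A0) (D2 w x) + ζ x * B x (D w x) + ζ x * (c x * w x) +
        ζ x * h x - A0 ((D ζ x).smulRight (D w x) + (D w x).smulRight (D ζ x)) -
        w x * A0 (D2 ζ x)| ≤ 1 * (P + C * P + C * P + G + C * (2 * (L * P)) + P * (C * L)) := by
      refine mul_le_mul ha ?_ (abs_nonneg _) zero_le_one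
      rw [abs_le] at *
      constructor <;> linarith
    nlinarith
  · have t0 : Hol θ (4 * L ^ 2 * P) (fun x => a' * (ζ x * w x)) := by
      refine (Hol.const_smul a' (Hol.smul hζ1 hζh w0 hw0)).mono ?_
      have : |a'| * (1 * (3 * P) + L * P) ≤ L * (1 * (3 * P) + L * P) := by gcongr
      nlinarith
    have t1 : Hol θ (1 * (ε * n + C * P) + L * (ε * P)) (fun x => ζ x * (A x - A0) (D2 w x)) :=
      Hol.cut zero_le_one (mul_nonneg hε hP) (by positivity) hζ1 hζh hζS
        (fun x hx => ((A x - A0).le_opNorm _).trans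
          (mul_le_mul (hA x hx) (w2 x) (norm_nonneg _) hε))
        (hol_on_clm (f := fun x => A x - A0) hε hA
          (fun x hx y hy => by rw [sub_sub_sub_cancel_right]; exact hA' x hx y hy) w2 hw2)
    have t2 : Hol θ (1 * (C * (3 * P) + C * P) + L * (C * P)) (fun x => ζ x * B x (D w x)) :=
      Hol.cut zero_le_one hCP (by positivity) hζ1 hζh hζS
        (fun x hx => ((B x).le_opNorm _).trans
          (mul_le_mul (hB x hx) (w1 x) (norm_nonneg _) hC0))
        (hol_on_clm hC0 hB hB' w1 hw1)
    have t3 : Hol θ (1 * (C * (3 * P) + C * P) + L * (C * P)) (fun x => ζ x * (c x * w x)) := by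
      refine Hol.cut zero_le_one hCP (by positivity) hζ1 hζh hζS
        (fun x hx => ?_) fun x hx y hy => ?_
      · rw [norm_mul]; exact mul_le_mul (hc x hx) (w0 x) (abs_nonneg _) hC0
      · have e : c x * w x - c y * w y = c x * (w x - w y) + (c x - c y) * w y := by ring
        rw [e]
        refine (norm_add_le _ _).trans ?_
        rw [norm_mul, norm_mul]
        have e1 := mul_le_mul (hc x hx) (hw0 x y) (norm_nonneg _) hC0
        have e2 := mul_le_mul (hc' x hx y hy) (w0 y) (abs_nonneg _)
          ((abs_nonneg _).trans (hc' x hx y hy))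
        simp only [Real.norm_eq_abs] at *
        nlinarith
    have t4 : Hol θ (1 * G + L * G) (fun x => ζ x * h x) :=
      Hol.cut zero_le_one hG hG hζ1 hζh hζS hh hh'
    have t5 : Hol θ (C * ((L * (3 * P) + L * P) + (P * L + 3 * P * L)))
        (fun x => A0 ((D ζ x).smulRight (D w x) + (D w x).smulRight (D ζ x))) := by
      have := (Hol.smulRight hζ.b1 hζh1 w1 hw1).add (Hol.smulRight w1 hw1 hζ.b1 hζh1)
      intro x y
      rw [← map_sub]
      refine (A0.le_opNorm _).trans ?_
      rw [mul_assoc]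
      exact mul_le_mul hA0 (this x y) (norm_nonneg _) hC0
    have t6 : Hol θ (P * (C * L) + 3 * P * (C * L)) (fun x => w x * A0 (D2 ζ x)) := by
      refine Hol.smul w0 hw0 (fun x => (A0.le_opNorm _).trans
        (mul_le_mul hA0 (hζ.b2 x) (norm_nonneg _) hC0)) fun x y => ?_
      rw [← map_sub]
      refine (A0.le_opNorm _).trans ?_
      rw [mul_assoc]
      exact mul_le_mul hA0 (hζ.hol x y) (norm_nonneg _) hC0
    have tt := t0.add (Hol.const_smul a (((((t1.add t2).add t3).add t4).sub t5).sub t6))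
    have tt' : Hol θ _ (locRhs A B c h A0 ζ w a a') := fun x y => by
      have := tt x y
      simp only [smul_eq_mul] at this
      exact this
    clear tt t0 t1 t2 t3 t4 t5 t6
    refine tt'.mono ?_
    have hs : |a| * (1 * (ε * n + C * P) + L * (ε * P) +
        (1 * (C * (3 * P) + C * P) + L * (C * P)) + (1 * (C * (3 * P) + C * P) + L * (C * P)) +
        (1 * G + L * G) + C * ((L * (3 * P) + L * P) + (P * L + 3 * P * L)) +
        (P * (C * L) + 3 * P * (C * L))) ≤ 1 * (1 * (ε * n + C * P) + L * (ε * P) +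
        (1 * (C * (3 * P) + C * P) + L * (C * P)) + (1 * (C * (3 * P) + C * P) + L * (C * P)) +
        (1 * G + L * G) + C * ((L * (3 * P) + L * P) + (P * L + 3 * P * L)) +
        (P * (C * L) + 3 * P * (C * L))) := by
      gcongr
    refine (add_le_add le_rfl hs).trans ?_
    linarith

end Product

/-! ### Cutoff functions -/

section Cutoff
variable {N : ℕ} {θ : ℝ}

lemma C2b.of_iteratedFDeriv {ζ : ES N → ℝ} {K : ℝ} (h0 : 0 ≤ θ) (h1 : θ ≤ 1)
    (hζ : ContDiff ℝ 3 ζ) (hK : ∀ n ≤ 3, ∀ x, ‖iteratedFDeriv ℝ n ζ x‖ ≤ K) :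
    C2b θ (3 * K) ζ := by
  have k0 : ∀ x, |ζ x| ≤ K := fun x => by
    have := hK 0 (by norm_num) x
    rwa [norm_iteratedFDeriv_zero] at this
  have k1 : ∀ x, ‖D ζ x‖ ≤ K := fun x => by
    have := hK 1 (by norm_num) x
    rwa [← norm_iteratedFDeriv_fderiv, norm_iteratedFDeriv_zero] at this
  have k2 : ∀ x, ‖D2 ζ x‖ ≤ K := fun x => by
    have := hK 2 (by norm_num) x
    rwa [← norm_iteratedFDeriv_fderiv, ← norm_iteratedFDeriv_fderiv,
      norm_iteratedFDeriv_zero] at this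
  have k3 : ∀ x, ‖fderiv ℝ (D2 ζ) x‖ ≤ K := fun x => by
    have := hK 3 le_rfl x
    rwa [← norm_iteratedFDeriv_fderiv, ← norm_iteratedFDeriv_fderiv, ← norm_iteratedFDeriv_fderiv,
      norm_iteratedFDeriv_zero] at this
  have hK0 : 0 ≤ K := (abs_nonneg _).trans (k0 0)
  have hd : ContDiff ℝ 1 (D2 ζ) :=
    (hζ.fderiv_right (m := 2) (by norm_num)).fderiv_right (by norm_num)
  refine ⟨hζ.of_le (by norm_num), fun x => (k0 x).trans (by linarith),
    fun x => (k1 x).trans (by linarith), fun x => (k2 x).trans (by linarith), ?_⟩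
  refine (Hol.of_lip h0 h1 k2 hK0 fun x y =>
    norm_sub_le_of_fderiv_bound (hd.differentiable (by norm_num)) k3 y x).mono (by linarith)

lemma exists_smoothTransition_bound : ∃ Q ≥ 1, ∀ n ≤ 3, ∀ s,
    ‖iteratedFDeriv ℝ n Real.smoothTransition s‖ ≤ Q := by
  have h1 : ∀ n : ℕ, ∃ Q, ∀ s, ‖iteratedFDeriv ℝ n Real.smoothTransition s‖ ≤ Q := by
    intro n
    have hc : Continuous (iteratedFDeriv ℝ n Real.smoothTransition) :=
      (Real.smoothTransition.contDiff (n := n)).continuous_iteratedFDeriv le_rfl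
    obtain ⟨Q, hQ⟩ := (isCompact_Icc (a := (0:ℝ)) (b := 1)).exists_bound_of_continuousOn
      hc.continuousOn
    have hconst : ∀ (a : ℝ) (s : ℝ), |a| ≤ 1 → ‖iteratedFDeriv ℝ n (fun _ : ℝ => a) s‖ ≤ 1 := by
      intro a s ha
      rcases Nat.eq_zero_or_pos n with rfl | hn
      · rwa [norm_iteratedFDeriv_zero]
      · rw [iteratedFDeriv_const_of_ne (by omega)]; simp
    refine ⟨max Q 1, fun s => ?_⟩
    by_cases hs : s ∈ Icc (0:ℝ) 1
    · exact (hQ s hs).trans (le_max_left _ _)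
    · refine le_trans ?_ (le_max_right _ _)
      rcases not_and_or.1 hs with h | h
      · have e : Real.smoothTransition =ᶠ[𝓝 s] fun _ => 0 := by
          filter_upwards [Iio_mem_nhds (not_le.1 h)] with y hy
          exact Real.smoothTransition.zero_of_nonpos (le_of_lt hy)
        rw [(e.iteratedFDeriv ℝ n).eq_of_nhds]
        exact hconst 0 s (by simp)
      · have e : Real.smoothTransition =ᶠ[𝓝 s] fun _ => 1 := by
          filter_upwards [Ioi_mem_nhds (not_le.1 h)] with y hy
          exact Real.smoothTransition.one_of_one_le (le_of_lt hy)
        rw [(e.iteratedFDeriv ℝ n).eq_of_nhds]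
        exact hconst 1 s (by simp)
  choose Q hQ using h1
  refine ⟨1 + |Q 0| + |Q 1| + |Q 2| + |Q 3|, ?_, fun n hn s => (hQ n s).trans ?_⟩
  · have := abs_nonneg (Q 0); have := abs_nonneg (Q 1); have := abs_nonneg (Q 2)
    have := abs_nonneg (Q 3); linarith
  · have := abs_nonneg (Q 0); have := abs_nonneg (Q 1); have := abs_nonneg (Q 2)
    have := abs_nonneg (Q 3); have := le_abs_self (Q n)
    interval_cases n <;> linarith

/-- Radial cutoff, equal to `1` where `‖x - x0‖² ≤ ρ - 1/k` and to `0` where `‖x - x0‖² ≥ ρ`. -/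
def cutX (k ρ : ℝ) (x0 : ES N) (x : ES N) : ℝ :=
  Real.smoothTransition (k * (ρ - ‖x - x0‖ ^ 2))

lemma cutX_le_one (k ρ : ℝ) (x0 x : ES N) : |cutX k ρ x0 x| ≤ 1 := by
  rw [cutX, abs_of_nonneg (Real.smoothTransition.nonneg _)]
  exact Real.smoothTransition.le_one _

lemma cutX_eq_zero {k ρ : ℝ} (hk : 0 ≤ k) {x0 x : ES N} (h : ρ ≤ ‖x - x0‖ ^ 2) :
    cutX k ρ x0 x = 0 :=
  Real.smoothTransition.zero_of_nonpos (mul_nonpos_of_nonneg_of_nonpos hk (by linarith))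

lemma cutX_eq_one {k ρ : ℝ} {x0 x : ES N} (h : 1 ≤ k * (ρ - ‖x - x0‖ ^ 2)) :
    cutX k ρ x0 x = 1 :=
  Real.smoothTransition.one_of_one_le h

lemma contDiff_cutX (k ρ : ℝ) (x0 : ES N) {n : ℕ} : ContDiff ℝ n (cutX k ρ x0) :=
  (Real.smoothTransition.contDiff (n := n)).comp
    (contDiff_const.mul (contDiff_const.sub ((contDiff_id.sub contDiff_const).norm_sq ℝ)))

lemma norm_iteratedFDeriv_quad (k ρ : ℝ) {r : ℝ} (hk : 0 ≤ k) (hr : 0 ≤ r) (x0 x : ES N)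
    (hx : ‖x - x0‖ ≤ r) (n : ℕ) (hn : 1 ≤ n) (hn3 : n ≤ 3) :
    ‖iteratedFDeriv ℝ n (fun x => k * (ρ - ‖x - x0‖ ^ 2)) x‖ ≤ (1 + 2 * k * (1 + r)) ^ n := by
  have hD : 1 ≤ 1 + 2 * k * (1 + r) := by have : 0 ≤ 2 * k * (1 + r) := by positivity
                                          linarith
  have f1 : fderiv ℝ (fun x => k * (ρ - ‖x - x0‖ ^ 2)) =
      fun x => (-(2 * k)) • innerSL ℝ (x - x0) := by
    ext1 x
    have h1 := ((hasFDerivAt_id x).sub_const x0).norm_sq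
    simp only [id_eq] at h1
    rw [((h1.const_sub ρ).const_mul k).fderiv]
    ext v
    simp; ring
  have f2 : fderiv ℝ (fun x : ES N => (-(2 * k)) • innerSL ℝ (x - x0)) =
      fun _ => (-(2 * k)) • innerSL ℝ := by
    ext1 x
    exact (((innerSL ℝ (E := ES N)).hasFDerivAt.comp x
      ((hasFDerivAt_id x).sub_const x0)).const_smul (-(2 * k))).fderiv
  refine le_trans ?_ (le_self_pow₀ hD (by omega))
  obtain ⟨m, rfl⟩ : ∃ m, n = m + 1 := ⟨n - 1, by omega⟩
  rw [← norm_iteratedFDeriv_fderiv, f1]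
  rcases Nat.eq_zero_or_pos m with rfl | hm
  · rw [norm_iteratedFDeriv_zero, norm_smul, innerSL_apply_norm, norm_neg,
      Real.norm_of_nonneg (by positivity)]
    nlinarith
  · obtain ⟨m, rfl⟩ : ∃ l, m = l + 1 := ⟨m - 1, by omega⟩
    rw [← norm_iteratedFDeriv_fderiv, f2]
    rcases Nat.eq_zero_or_pos m with rfl | hm
    · rw [norm_iteratedFDeriv_zero, norm_smul, norm_neg,
        Real.norm_of_nonneg (by positivity)]
      have : ‖innerSL ℝ (E := ES N)‖ ≤ 1 :=
        ContinuousLinearMap.opNorm_le_bound _ zero_le_one fun v => by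
          rw [innerSL_apply_norm, one_mul]
      nlinarith [mul_nonneg hk hr]
    · rw [iteratedFDeriv_const_of_ne (by omega)]
      simpa using zero_le_one.trans hD

lemma cutX_C2b {Q : ℝ} (hQ : ∀ n ≤ 3, ∀ s, ‖iteratedFDeriv ℝ n Real.smoothTransition s‖ ≤ Q)
    (hQ1 : 1 ≤ Q) (h0 : 0 ≤ θ) (h1 : θ ≤ 1) {k ρ r : ℝ} (hk : 0 ≤ k) (hr : 0 ≤ r)
    (hρ : ρ ≤ r ^ 2) (x0 : ES N) :
    C2b θ (18 * Q * (1 + 2 * k * (1 + r)) ^ 3) (cutX k ρ x0) := by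
  have hD : 1 ≤ 1 + 2 * k * (1 + r) := by have : 0 ≤ 2 * k * (1 + r) := by positivity
                                          linarith
  have key := C2b.of_iteratedFDeriv (K := 6 * Q * (1 + 2 * k * (1 + r)) ^ 3) h0 h1
    (contDiff_cutX k ρ x0 (n := 3)) ?_
  · exact key.mono (by linarith)
  intro n hn x
  by_cases hx : ‖x - x0‖ ≤ r
  · have := norm_iteratedFDeriv_comp_le (𝕜 := ℝ) (n := n) (N := 3) (g := Real.smoothTransition)
      (f := fun x => k * (ρ - ‖x - x0‖ ^ 2)) (Real.smoothTransition.contDiff (n := (3:ℕ)))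
      (contDiff_const.mul (contDiff_const.sub ((contDiff_id.sub contDiff_const).norm_sq ℝ)))
      (by exact_mod_cast hn) x (C := Q) (D := 1 + 2 * k * (1 + r))
      (fun i hi => hQ i (by omega) _)
      (fun i hi hi' => norm_iteratedFDeriv_quad k ρ hk hr x0 x hx i hi (by omega))
    refine this.trans ?_
    have e1 : (n.factorial : ℝ) ≤ 6 := by
      interval_cases n <;> norm_num [Nat.factorial]
    have e2 : (1 + 2 * k * (1 + r)) ^ n ≤ (1 + 2 * k * (1 + r)) ^ 3 := pow_le_pow_right₀ hD hn
    gcongr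
  · have e : cutX k ρ x0 =ᶠ[𝓝 x] fun _ => 0 := by
      have ho : IsOpen {y : ES N | r < ‖y - x0‖} :=
        isOpen_lt continuous_const (by fun_prop)
      filter_upwards [ho.mem_nhds (not_le.1 hx)] with y hy
      refine cutX_eq_zero hk (hρ.trans ?_)
      have : r < ‖y - x0‖ := hy
      gcongr
    rw [(e.iteratedFDeriv ℝ n).eq_of_nhds]
    have : iteratedFDeriv ℝ n (fun _ : ES N => (0:ℝ)) x = 0 := by simp
    rw [this, norm_zero]
    positivity

lemma loc_eq {A : ES N → H2 N →L[ℝ] ℝ} {B : ES N → V1 N →L[ℝ] ℝ}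
    {c h : ES N → ℝ} (A0 : H2 N →L[ℝ] ℝ) {ζ u w : ES N → ℝ} {a a' : ℝ} {x : ES N}
    (hζ : ContDiff ℝ 2 ζ) (hu : ContDiff ℝ 2 u) (ha : a = 0 → a' = 0)
    (hx : a = 0 ∨ w =ᶠ[𝓝 x] u ∨ ζ =ᶠ[𝓝 x] fun _ => 0) :
    a' * (ζ x * u x) + a * (ζ x * (A x (D2 u x) + B x (D u x) + c x * u x + h x)) =
      A0 (D2 (fun y => a * (ζ y * u y)) x) + locRhs A B c h A0 ζ w a a' x := by
  have eD : D2 (fun y => a * (ζ y * u y)) x = a • (ζ x • D2 u x + (D ζ x).smulRight (D u x) +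
      (u x • D2 ζ x + (D u x).smulRight (D ζ x))) := by
    rw [D2_const_mul a (hζ.mul hu), D2_mul hζ hu]
  rw [eD, locRhs]
  rcases hx with h0 | hw | hz
  · rw [ha h0, h0]; simp
  · have e0 : w x = u x := hw.eq_of_nhds
    have e1 : D w x = D u x := hw.fderiv_eq
    have e2 : D2 w x = D2 u x := hw.fderiv.fderiv_eq
    rw [e0, e1, e2]
    simp only [map_smul, map_add, sub_apply, smul_eq_mul]
    ring
  · have e0 : ζ x = 0 := hz.eq_of_nhds
    have e1 : D ζ x = 0 := by rw [D, hz.fderiv_eq]; simp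
    have e2 : D2 ζ x = 0 := by rw [D2, hz.fderiv.fderiv_eq]; simp
    rw [e0, e1, e2]
    simp

end Cutoff

/-! ### Interior Schauder estimates -/

section Interior
variable {N : ℕ} {θ : ℝ}

lemma C2b_of_interp {φ : ES N → ℝ} {n M η : ℝ} (h0 : 0 ≤ θ) (hn : 0 ≤ n) (hM : 0 ≤ M)
    (hη : 0 < η) (hη1 : η ≤ 1)
    (hφ : ContDiff ℝ 2 φ) (h : Hol θ n (D2 φ)) (hb : ∀ x, |φ x| ≤ M) :
    (∀ x, |φ x| ≤ 2 * n * η ^ θ + 6 * M / η ^ 2) ∧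
    (∀ x, ‖D φ x‖ ≤ 2 * n * η ^ θ + 6 * M / η ^ 2) ∧
    (∀ x, ‖D2 φ x‖ ≤ 2 * n * η ^ θ + 6 * M / η ^ 2) := by
  have e1 := interp_D2 h0 hn hη hφ h hb
  have e2 := fun x => interp_D one_pos hφ e1 hb x
  have p1 : 0 ≤ 2 * n * η ^ θ := by positivity
  have p2 : M ≤ M / η ^ 2 := le_div_self hM (by positivity) (pow_le_one₀ hη.le hη1)
  have p3 : 6 * M / η ^ 2 = 6 * (M / η ^ 2) := by ring
  have p4 : 4 * M / η ^ 2 = 4 * (M / η ^ 2) := by ring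
  rw [p3]
  rw [p4] at e1 e2
  refine ⟨fun x => (hb x).trans (by linarith), fun x => (e2 x).trans (by linarith),
    fun x => (e1 x).trans (by linarith)⟩

/-- The constant coefficient equation satisfied by the localisation `τ ζ u`, with bounds for its
right-hand side in terms of a less localised function `w`. -/
lemma localised_equation {T : ℝ} {S : Set (ES N)} {A : ℝ → ES N → H2 N →L[ℝ] ℝ}
    {B : ℝ → ES N → V1 N →L[ℝ] ℝ} {c h : ℝ → ES N → ℝ} {A0 : H2 N →L[ℝ] ℝ} {ζ : ES N → ℝ}
    {τ τ' : ℝ → ℝ} {u w : ℝ → ES N → ℝ} {C L ε M G n Cu η : ℝ}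
    (h0 : 0 ≤ θ) (h1 : θ ≤ 1)
    (hC : 1 ≤ C) (hL : 1 ≤ L) (hε : 0 ≤ ε) (hε1 : ε ≤ 1) (hM : 0 ≤ M) (hG : 0 ≤ G) (hn : 0 ≤ n)
    (hη : 0 < η) (hη1 : η ≤ 1)
    (hA0 : ‖A0‖ ≤ C) (hτ : ∀ t, |τ t| ≤ 1) (hτ' : ∀ t, |τ' t| ≤ L)
    (hτd : ∀ t, HasDerivAt τ (τ' t) t) (hτ0 : ∀ t, τ t = 0 → τ' t = 0)
    (hζ : C2b θ L ζ) (hζ1 : ∀ x, |ζ x| ≤ 1) (hζS : ∀ x ∉ S, ζ x = 0) (hζh : Hol θ L ζ)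
    (hζh1 : Hol θ L (D ζ))
    (hco : ∀ t ∈ Icc 0 T, τ t ≠ 0 → (∀ x ∈ S, ‖A t x - A0‖ ≤ ε ∧ ‖B t x‖ ≤ C ∧ |c t x| ≤ C ∧
      |h t x| ≤ G) ∧ ∀ x ∈ S, ∀ y ∈ S, ‖A t x - A t y‖ ≤ C * ‖x - y‖ ^ θ ∧
      ‖B t x - B t y‖ ≤ C * ‖x - y‖ ^ θ ∧ |c t x - c t y| ≤ C * ‖x - y‖ ^ θ ∧
      |h t x - h t y| ≤ G * ‖x - y‖ ^ θ)
    (hu : XB T θ Cu u) (hs : Solves T A B c h u)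
    (hw : ∀ t ∈ Icc 0 T, ContDiff ℝ 2 (w t)) (hwM : ∀ t ∈ Icc 0 T, ∀ x, |w t x| ≤ M)
    (hw2 : ∀ t ∈ Icc 0 T, Hol θ n (D2 (w t)))
    (hag : ∀ t ∈ Icc 0 T, τ t ≠ 0 → ∀ x, w t =ᶠ[𝓝 x] u t ∨ ζ =ᶠ[𝓝 x] fun _ => 0) :
    ∃ H : ℝ → ES N → ℝ,
      (∀ t ∈ Ioo 0 T, ∀ x, HasDerivAt (fun r => τ r * (ζ x * u r x))
        (A0 (D2 (fun y => τ t * (ζ y * u t y)) x) + H t x) t) ∧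
      (∀ t ∈ Icc 0 T, ∀ x, |H t x| ≤
        30 * C * L ^ 2 * (2 * n * η ^ θ + 6 * M / η ^ 2 + G)) ∧
      (∀ t ∈ Icc 0 T, Hol θ (ε * n + 30 * C * L ^ 2 * (2 * n * η ^ θ + 6 * M / η ^ 2 + G))
        (H t)) := by
  refine ⟨fun t => locRhs (A t) (B t) (c t) (h t) A0 ζ (w t) (τ t) (τ' t), ?_, ?_⟩
  · intro t ht x
    have ht' : t ∈ Icc 0 T := Ioo_subset_Icc_self ht
    have e := loc_eq A0 (A := A t) (B := B t) (c := c t) (h := h t) (w := w t) (x := x) hζ.cd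
      (hu.sp t ht').cd (hτ0 t) (by
        by_cases hz : τ t = 0
        · exact Or.inl hz
        · exact Or.inr (hag t ht' hz x))
    rw [← e]
    exact (hτd t).fun_mul ((hs t ht x).const_mul (ζ x))
  · have hP : 0 ≤ 2 * n * η ^ θ + 6 * M / η ^ 2 := by positivity
    have key : ∀ t ∈ Icc 0 T, (∀ x, |locRhs (A t) (B t) (c t) (h t) A0 ζ (w t) (τ t) (τ' t) x| ≤
        30 * C * L ^ 2 * (2 * n * η ^ θ + 6 * M / η ^ 2 + G)) ∧
        Hol θ (ε * n + 30 * C * L ^ 2 * (2 * n * η ^ θ + 6 * M / η ^ 2 + G))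
          (locRhs (A t) (B t) (c t) (h t) A0 ζ (w t) (τ t) (τ' t)) := by
      intro t ht
      by_cases hz : τ t = 0
      · have e : ∀ x, locRhs (A t) (B t) (c t) (h t) A0 ζ (w t) (τ t) (τ' t) x = 0 := fun x => by
          rw [locRhs, hτ0 t hz, hz]; ring
        have hpos : 0 ≤ 30 * C * L ^ 2 * (2 * n * η ^ θ + 6 * M / η ^ 2 + G) := by positivity
        refine ⟨fun x => ?_, fun x y => ?_⟩
        · rw [e, abs_zero]; exact hpos
        · rw [e, e, sub_zero, norm_zero]
          have : 0 ≤ ε * n := by positivity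
          exact mul_nonneg (by linarith) (by positivity)
      · obtain ⟨c1, c2⟩ := hco t ht hz
        obtain ⟨w0, w1, w2⟩ := C2b_of_interp h0 hn hM hη hη1 (hw t ht) (hw2 t ht) (hwM t ht)
        exact locRhs_estimate h0 h1 hC hL hε hε1 hP hG hn hA0 (hτ t) (hτ' t) hζ hζ1 hζS hζh hζh1
          (fun x hx => (c1 x hx).1) (fun x hx y hy => (c2 x hx y hy).1)
          (fun x hx => (c1 x hx).2.1) (fun x hx y hy => (c2 x hx y hy).2.1)
          (fun x hx => (c1 x hx).2.2.1) (fun x hx y hy => (c2 x hx y hy).2.2.1)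
          (fun x hx => (c1 x hx).2.2.2) (fun x hx y hy => (c2 x hx y hy).2.2.2)
          (hw t ht) w0 w1 w2 (hw2 t ht)
    exact ⟨fun t ht => (key t ht).1, fun t ht => (key t ht).2⟩

lemma nested_iteration {V : ℕ → ℝ → Prop} {a b C S : ℝ} (hb : 1 ≤ b)
    (hab : a * b ≤ 1 / 2) (hC : 0 ≤ C) (hS : 0 ≤ S)
    (hmono : ∀ k n m, n ≤ m → V k n → V k m)
    (h0 : ∀ k, V k (b ^ k * C))
    (hstep : ∀ k n, 0 ≤ n → V (k + 1) n → V k (a * n + b ^ k * S)) (j : ℕ) :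
    ∀ k, V k (b ^ k * (C / 2 ^ j + 2 * S)) := by
  induction j with
  | zero =>
    intro k
    refine hmono _ _ _ ?_ (h0 k)
    gcongr
    simpa using hS
  | succ j ih =>
    intro k
    refine hmono _ _ _ ?_ (hstep k _ (by positivity) (ih (k + 1)))
    have hbk : 0 ≤ b ^ k := by positivity
    have e : a * (b ^ (k + 1) * (C / 2 ^ j + 2 * S)) = b ^ k * (a * b * (C / 2 ^ j + 2 * S)) := by
      rw [pow_succ]; ring
    rw [e, ← mul_add]
    refine mul_le_mul_of_nonneg_left ?_ hbk
    have : a * b * (C / 2 ^ j + 2 * S) ≤ 1 / 2 * (C / 2 ^ j + 2 * S) := by gcongr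
    have e2 : C / 2 ^ (j + 1) = 1 / 2 * (C / 2 ^ j) := by rw [pow_succ]; field_simp
    rw [e2]
    linarith

/-- Cutoff in time. -/
def cutT (k s t : ℝ) : ℝ := Real.smoothTransition (k * (t - s))

lemma cutT_le_one (k s t : ℝ) : |cutT k s t| ≤ 1 := by
  rw [cutT, abs_of_nonneg (Real.smoothTransition.nonneg _)]
  exact Real.smoothTransition.le_one _

lemma cutT_eq_zero_iff {k s t : ℝ} (hk : 0 < k) : cutT k s t = 0 ↔ t ≤ s := by
  rw [cutT, Real.smoothTransition.zero_iff_nonpos, mul_nonpos_iff]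
  constructor
  · rintro (⟨_, h⟩ | ⟨h, _⟩) <;> linarith
  · intro h; exact Or.inl ⟨hk.le, by linarith⟩

lemma hasDerivAt_cutT (k s t : ℝ) :
    HasDerivAt (cutT k s) (deriv Real.smoothTransition (k * (t - s)) * k) t := by
  have h1 : HasDerivAt (fun t => k * (t - s)) k t := by
    simpa using ((hasDerivAt_id t).sub_const s).const_mul k
  exact HasDerivAt.comp t
    (((Real.smoothTransition.contDiff (n := 1)).differentiable (by norm_num) _).hasDerivAt) h1

lemma deriv_cutT_of_eq_zero {k s t : ℝ} (h : cutT k s t = 0) :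
    deriv Real.smoothTransition (k * (t - s)) * k = 0 := by
  have hmin : IsLocalMin Real.smoothTransition (k * (t - s)) :=
    Eventually.of_forall fun y => by
      change Real.smoothTransition _ ≤ _
      rw [show Real.smoothTransition (k * (t - s)) = 0 from h]
      exact Real.smoothTransition.nonneg _
  rw [hmin.deriv_eq_zero, zero_mul]

lemma abs_deriv_cutT_le {Q : ℝ}
    (hQ : ∀ n ≤ 3, ∀ s, ‖iteratedFDeriv ℝ n Real.smoothTransition s‖ ≤ Q) {k : ℝ} (hk : 0 ≤ k)
    (s t : ℝ) : |deriv Real.smoothTransition (k * (t - s)) * k| ≤ Q * k := by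
  rw [abs_mul, abs_of_nonneg hk]
  have := hQ 1 (by norm_num) (k * (t - s))
  rw [norm_iteratedFDeriv_eq_norm_iteratedDeriv, iteratedDeriv_one] at this
  exact mul_le_mul_of_nonneg_right this hk

lemma XB.cut {T Cu L k s : ℝ} {u : ℝ → ES N → ℝ} {ζ : ES N → ℝ} (h0 : 0 ≤ θ) (h1 : θ ≤ 1)
    (hT : 0 ≤ T) (hu : XB T θ Cu u) (hL : 0 ≤ L) (hζ : C2b θ L ζ) (hζ1 : ∀ x, |ζ x| ≤ 1)
    (hd : ∀ t, |deriv Real.smoothTransition (k * (t - s)) * k| ≤ L) :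
    XB T θ ((20 * L + 1) * Cu) (fun t x => cutT k s t * (ζ x * u t x)) := by
  have hCu := hu.nonneg hT
  have hLC : 0 ≤ L * Cu := by positivity
  refine ⟨fun t ht => ?_, fun x t ht s' hs' => ?_⟩
  · have hm := C2b.mul h0 h1 hζ (hu.sp t ht)
    have e1 : |cutT k s t| ≤ 1 := cutT_le_one k s t
    have key : ∀ z : ℝ, 0 ≤ z → z ≤ 20 * L * Cu → |cutT k s t| * z ≤ (20 * L + 1) * Cu :=
      fun z hz hz' => (mul_le_mul e1 hz' hz zero_le_one).trans (by linarith)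
    refine ⟨contDiff_const.mul hm.cd, fun x => ?_, fun x => ?_, fun x => ?_, ?_⟩
    · rw [abs_mul]; exact key _ (abs_nonneg _) (hm.b0 x)
    · rw [D_const_mul _ hm.cd, norm_smul]; exact key _ (norm_nonneg _) (hm.b1 x)
    · rw [D2_const_mul _ hm.cd, norm_smul]; exact key _ (norm_nonneg _) (hm.b2 x)
    · rw [D2_const_mul _ hm.cd]
      exact (Hol.const_smul _ hm.hol).mono (key _ hm.nonneg le_rfl)
  · have e : cutT k s t * (ζ x * u t x) - cutT k s s' * (ζ x * u s' x) =
        ζ x * (cutT k s t * (u t x - u s' x) + (cutT k s t - cutT k s s') * u s' x) := by ring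
    have e2 : |cutT k s t - cutT k s s'| ≤ L * |t - s'| := by
      have := Convex.norm_image_sub_le_of_norm_hasDerivWithin_le (𝕜 := ℝ) (s := univ)
        (f := cutT k s) (C := L) (fun t _ => (hasDerivAt_cutT k s t).hasDerivWithinAt)
        (fun t _ => hd t) convex_univ (mem_univ s') (mem_univ t)
      simpa using this
    rw [e, abs_mul]
    refine (mul_le_mul (hζ1 x) (abs_add_le _ _) (abs_nonneg _) zero_le_one).trans ?_
    rw [abs_mul, abs_mul, one_mul]
    have e3 := mul_le_mul (cutT_le_one k s t) (hu.tl x t ht s' hs') (abs_nonneg _) zero_le_one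
    have e4 := mul_le_mul e2 ((hu.sp s' hs').b0 x) (abs_nonneg _) (by positivity)
    have : 0 ≤ L * Cu * |t - s'| := by positivity
    linarith

end Interior

section InteriorEstimate
variable {N : ℕ} {θ : ℝ}

/-- Bounds for the coefficients and the right-hand side on `S` at a fixed time. -/
structure CoefOn (θ C G : ℝ) (S : Set (ES N)) (A : ES N → H2 N →L[ℝ] ℝ)
    (B : ES N → V1 N →L[ℝ] ℝ) (c h : ES N → ℝ) : Prop where
  bB : ∀ x ∈ S, ‖B x‖ ≤ C
  bc : ∀ x ∈ S, |c x| ≤ C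
  bh : ∀ x ∈ S, |h x| ≤ G
  hA : ∀ x ∈ S, ∀ y ∈ S, ‖A x - A y‖ ≤ C * ‖x - y‖ ^ θ
  hB : ∀ x ∈ S, ∀ y ∈ S, ‖B x - B y‖ ≤ C * ‖x - y‖ ^ θ
  hc : ∀ x ∈ S, ∀ y ∈ S, |c x - c y| ≤ C * ‖x - y‖ ^ θ
  hh : ∀ x ∈ S, ∀ y ∈ S, |h x - h y| ≤ G * ‖x - y‖ ^ θ

lemma two_pow_mul_half_pow (k : ℕ) : (2:ℝ) ^ k * (1 / 2) ^ (k + 1) = 1 / 2 := by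
  rw [pow_succ, ← mul_assoc, ← mul_pow]; norm_num

lemma exists_rpow_eq {a θ : ℝ} (hθ : 0 < θ) (ha : 0 < a) (ha1 : a ≤ 1) :
    ∃ m, 0 < m ∧ m ≤ 1 ∧ m ^ θ = a :=
  ⟨a ^ (1 / θ), Real.rpow_pos_of_pos ha _, Real.rpow_le_one ha.le ha1 (by positivity), by
    rw [← Real.rpow_mul ha.le, one_div_mul_cancel hθ.ne', Real.rpow_one]⟩

set_option maxHeartbeats 4000000 in
/-- Interior Schauder estimate: a solution with finite norms is, locally, controlled by its sup
norm and the right-hand side. -/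
theorem interior_estimate (N : ℕ) {θ lam C : ℝ} (hθ0 : 0 < θ) (hθ1 : θ < 1) (hlam : 0 < lam)
    (hC : 1 ≤ C) : ∃ ε > 0, ∀ r > 0, ∀ κ > 0, ∃ K > 0, ∀ (T σ M G Cu : ℝ)
      (u : ℝ → ES N → ℝ) (A : ℝ → ES N → H2 N →L[ℝ] ℝ) (B : ℝ → ES N → V1 N →L[ℝ] ℝ)
      (c h : ℝ → ES N → ℝ) (A0 : H2 N →L[ℝ] ℝ) (x0 : ES N), 0 ≤ T → 0 ≤ M → 0 ≤ G →
      XB T θ Cu u → Solves T A B c h u → (∀ t ∈ Icc 0 T, ∀ x, |u t x| ≤ M) → Ell lam C A0 →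
      (∀ t ∈ Icc 0 T, σ - κ ≤ t → (∀ x ∈ closedBall x0 r, ‖A t x - A0‖ ≤ ε) ∧
        CoefOn θ C G (closedBall x0 r) (A t) (B t) (c t) (h t)) →
      ((∀ x, u 0 x = 0) ∨ κ ≤ σ) →
      ∃ v, XB T θ (K * (M + G)) v ∧ ∀ t ∈ Icc 0 T, σ ≤ t → ∀ x ∈ closedBall x0 (r / 2),
        v t x = u t x := by
  obtain ⟨Q, hQ1, hQ⟩ := exists_smoothTransition_bound
  obtain ⟨KS, hKS0, hKS⟩ := schauder_const N hθ0 hθ1 hlam (zero_le_one.trans hC)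
  obtain ⟨m, hm0, hm1, hm⟩ := exists_rpow_eq hθ0 (a := 1 / 64) (by norm_num) (by norm_num)
  set C1 : ℝ := (N ^ 2 + 1) * C with hC1
  have hC1' : 1 ≤ C1 := by
    have : (0:ℝ) ≤ N ^ 2 * C := by positivity
    rw [hC1]; linarith
  have hCC1 : C ≤ C1 := by
    have : (0:ℝ) ≤ N ^ 2 * C := by positivity
    rw [hC1]; linarith
  set b : ℝ := 64 / m ^ 2 with hb
  have hb64 : 64 ≤ b := by
    rw [hb, le_div_iff₀ (by positivity)]
    linarith [pow_le_one₀ hm0.le hm1 (n := 2)]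
  have hbpos : 0 < b := by linarith
  set ε : ℝ := min 1 (1 / (4 * KS * b)) with hε
  have hε0 : 0 < ε := lt_min one_pos (by positivity)
  have hε1 : ε ≤ 1 := min_le_left _ _
  have hεb : KS * ε * b ≤ 1 / 4 := by
    have : ε ≤ 1 / (4 * KS * b) := min_le_right _ _
    rw [le_div_iff₀ (by positivity)] at this
    linarith
  refine ⟨ε, hε0, fun r hr κ hκ => ?_⟩
  set Λ : ℝ := 54 * Q * (1 + 2 * (4 / r ^ 2) * (1 + r)) ^ 3 + 4 * Q / κ with hΛ
  have hΛ1 : 1 ≤ Λ := by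
    have e1 : 1 ≤ (1 + 2 * (4 / r ^ 2) * (1 + r)) ^ 3 := one_le_pow₀ (by
      have : 0 ≤ 2 * (4 / r ^ 2) * (1 + r) := by positivity
      linarith)
    have e2 : 0 ≤ 4 * Q / κ := by positivity
    have e3 := one_le_mul_of_one_le_of_one_le hQ1 e1
    rw [hΛ, mul_assoc]
    linarith
  obtain ⟨η, hη0, hη1, hη⟩ := exists_rpow_eq hθ0 (a := ε / (60 * C1 * Λ ^ 2)) (by positivity) (by
    rw [div_le_one (by positivity)]
    have := one_le_mul_of_one_le_of_one_le hC1' (one_le_pow₀ hΛ1 (n := 2))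
    linarith)
  set S : ℝ := KS * (30 * C1 * Λ ^ 2 * (6 / η ^ 2)) with hS
  have hS0 : 0 ≤ S := by positivity
  set n1 : ℝ := b * (2 * S) with hn1
  set K : ℝ := 2 * (2 * S) + 6 + C1 * (2 * (2 * S) + 6) + 30 * C1 * Λ ^ 2 * (2 * n1 + 6) with hK
  have hn10 : 0 ≤ n1 := by positivity
  refine ⟨K, by positivity, ?_⟩
  intro T σ M G Cu u A B c h A0 x0 hT hM hG hu hs huM hE hco h0σ
  clear_value C1 b ε Λ S n1 K
  have hMG : 0 ≤ M + G := by linarith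
  have hA0 : ‖A0‖ ≤ C1 := by
    obtain ⟨a, -, ha, -, rfl⟩ := hE
    exact (norm_trL_le (by linarith) ha).trans (by rw [hC1]; linarith)
  -- the nested cutoffs
  set kx : ℕ → ℝ := fun k => 4 / r ^ 2 * 2 ^ k with hkx
  set kt : ℕ → ℝ := fun k => 4 / κ * 2 ^ k with hkt
  set ρ : ℕ → ℝ := fun k => r ^ 2 * (1 - (1 / 2) ^ (k + 1)) with hρ
  set s : ℕ → ℝ := fun k => σ - κ * (1 - (1 / 2) ^ (k + 1)) with hsd
  set ζ : ℕ → ES N → ℝ := fun k => cutX (kx k) (ρ k) x0 with hζd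
  set τ : ℕ → ℝ → ℝ := fun k => cutT (kt k) (s k) with hτd
  set v : ℕ → ℝ → ES N → ℝ := fun k t x => τ k t * (ζ k x * u t x) with hv
  have hkx0 : ∀ k, 0 ≤ kx k := fun k => by positivity
  have hkt0 : ∀ k, 0 < kt k := fun k => by positivity
  have h2k : ∀ k : ℕ, (1:ℝ) ≤ 2 ^ k := fun k => one_le_pow₀ (by norm_num)
  have h8 : ∀ k : ℕ, (8:ℝ) ^ k = (2 ^ k) ^ 3 := fun k => by
    rw [← pow_mul, mul_comm, pow_mul]; norm_num
  have hL1 : ∀ k : ℕ, 1 ≤ Λ * 8 ^ k := fun k =>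
    one_le_mul_of_one_le_of_one_le hΛ1 (one_le_pow₀ (by norm_num))
  have hζC : ∀ k, C2b θ (Λ * 8 ^ k / 3) (ζ k) := by
    intro k
    refine (cutX_C2b hQ hQ1 hθ0.le hθ1.le (hkx0 k) hr.le ?_ x0).mono ?_
    · have : 0 ≤ r ^ 2 * (1 / 2 : ℝ) ^ (k + 1) := by positivity
      simp only [hρ]; linarith
    · have e1 : 1 + 2 * kx k * (1 + r) ≤ 2 ^ k * (1 + 2 * (4 / r ^ 2) * (1 + r)) := by
        have := h2k k
        simp only [hkx]; linarith
      calc 18 * Q * (1 + 2 * kx k * (1 + r)) ^ 3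
          ≤ 18 * Q * (2 ^ k * (1 + 2 * (4 / r ^ 2) * (1 + r))) ^ 3 := by
            have : 0 ≤ kx k := hkx0 k
            gcongr
        _ = (Λ - 4 * Q / κ) * 8 ^ k / 3 := by rw [mul_pow, h8, hΛ]; ring
        _ ≤ _ := by
            have : 0 ≤ 4 * Q / κ := by positivity
            gcongr; linarith
  have hζC' : ∀ k, C2b θ (Λ * 8 ^ k) (ζ k) := fun k => (hζC k).mono (by
    have := hL1 k; linarith)
  have hτb : ∀ k t, |deriv Real.smoothTransition (kt k * (t - s k)) * kt k| ≤ Λ * 8 ^ k := by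
    intro k t
    refine (abs_deriv_cutT_le hQ (hkt0 k).le _ _).trans ?_
    have e1 : (2:ℝ) ^ k ≤ 8 ^ k := by gcongr; norm_num
    have e2 : 0 ≤ 54 * Q * (1 + 2 * (4 / r ^ 2) * (1 + r)) ^ 3 := by positivity
    calc Q * kt k = 4 * Q / κ * 2 ^ k := by simp only [hkt]; ring
      _ ≤ Λ * 8 ^ k := by
        have : 0 ≤ 4 * Q / κ := by positivity
        gcongr; rw [hΛ]; linarith
  have hvX : ∀ k, XB T θ (b ^ k * (21 * Λ * Cu)) (v k) := by
    intro k
    have hCu := hu.nonneg hT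
    refine (XB.cut hθ0.le hθ1.le hT hu (zero_le_one.trans (hL1 k)) (hζC' k)
      (cutX_le_one _ _ _) (hτb k)).mono ?_
    have e1 : (8:ℝ) ^ k ≤ b ^ k := by gcongr; linarith
    have := hL1 k
    calc (20 * (Λ * 8 ^ k) + 1) * Cu ≤ 21 * (Λ * 8 ^ k) * Cu := by gcongr; linarith
      _ = 8 ^ k * (21 * Λ * Cu) := by ring
      _ ≤ _ := by gcongr
  have hvM : ∀ k, ∀ t ∈ Icc 0 T, ∀ x, |v k t x| ≤ M := by
    intro k t ht x
    simp only [hv]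
    rw [abs_mul, abs_mul]
    calc |τ k t| * (|ζ k x| * |u t x|) ≤ 1 * (1 * M) := by
          gcongr
          · exact cutT_le_one _ _ _
          · exact cutX_le_one _ _ _ x
          · exact huM t ht x
      _ = M := by ring
  have hv0 : ∀ k x, v k 0 x = 0 := by
    intro k x
    rcases h0σ with h | h
    · simp [hv, h]
    · have : τ k 0 = 0 := by
        rw [hτd, cutT_eq_zero_iff (hkt0 k)]
        have : 0 ≤ κ * (1 / 2 : ℝ) ^ (k + 1) := by positivity
        simp only [hsd]; linarith
      simp [hv, this]
  -- agreement of consecutive localisations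
  have hag : ∀ k, ∀ t ∈ Icc 0 T, τ k t ≠ 0 → ∀ x,
      v (k + 1) t =ᶠ[𝓝 x] u t ∨ ζ k =ᶠ[𝓝 x] fun _ => 0 := by
    intro k t ht hτt x
    have hst : s k < t := by
      rw [Ne, hτd, cutT_eq_zero_iff (hkt0 k)] at hτt; exact not_le.1 hτt
    have hp := two_pow_mul_half_pow k
    have hτ1 : τ (k + 1) t = 1 := by
      refine Real.smoothTransition.one_of_one_le ?_
      have e : kt (k + 1) * (s k - s (k + 1)) = 2 := by
        simp only [hkt, hsd]
        have : 4 / κ * 2 ^ (k + 1) * (σ - κ * (1 - (1 / 2) ^ (k + 1)) -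
          (σ - κ * (1 - (1 / 2) ^ (k + 1 + 1)))) = 4 * (κ / κ) * (2 ^ k * (1 / 2) ^ (k + 1)) := by
          rw [pow_succ (2:ℝ) k, pow_succ _ (k + 1)]; ring
        rw [this, hp, div_self hκ.ne']; norm_num
      have := mul_pos (hkt0 (k + 1)) (sub_pos.2 hst)
      linarith
    by_cases hx : ‖x - x0‖ ^ 2 ≤ ρ k
    · left
      have ho : IsOpen {y : ES N | 1 < kx (k + 1) * (ρ (k + 1) - ‖y - x0‖ ^ 2)} :=
        isOpen_lt continuous_const (by fun_prop)
      have hx' : x ∈ {y : ES N | 1 < kx (k + 1) * (ρ (k + 1) - ‖y - x0‖ ^ 2)} := by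
        have e : kx (k + 1) * (ρ (k + 1) - ρ k) = 2 := by
          simp only [hkx, hρ]
          have : 4 / r ^ 2 * 2 ^ (k + 1) * (r ^ 2 * (1 - (1 / 2) ^ (k + 1 + 1)) -
            r ^ 2 * (1 - (1 / 2) ^ (k + 1))) =
              4 * (r ^ 2 / r ^ 2) * (2 ^ k * (1 / 2) ^ (k + 1)) := by
            rw [pow_succ (2:ℝ) k, pow_succ _ (k + 1)]; ring
          rw [this, hp, div_self (by positivity)]; norm_num
        have := mul_nonneg (hkx0 (k + 1)) (sub_nonneg.2 hx)
        simp only [mem_ofPred_eq]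
        linarith
      filter_upwards [ho.mem_nhds hx'] with y hy
      have hζ1 : ζ (k + 1) y = 1 := cutX_eq_one (le_of_lt hy)
      simp only [hv]
      rw [hτ1, hζ1]; ring
    · right
      have ho : IsOpen {y : ES N | ρ k < ‖y - x0‖ ^ 2} := isOpen_lt continuous_const (by fun_prop)
      filter_upwards [ho.mem_nhds (not_le.1 hx)] with y hy
      exact cutX_eq_zero (hkx0 k) (le_of_lt hy)
  have hloc : ∀ k n η, 0 ≤ n → 0 < η → η ≤ 1 → (∀ t ∈ Icc 0 T, Hol θ n (D2 (v (k + 1) t))) →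
      ∃ H : ℝ → ES N → ℝ,
      (∀ t ∈ Ioo 0 T, ∀ x, HasDerivAt (fun r => v k r x) (A0 (D2 (v k t) x) + H t x) t) ∧
      (∀ t ∈ Icc 0 T, ∀ x, |H t x| ≤
        30 * C1 * (Λ * 8 ^ k) ^ 2 * (2 * n * η ^ θ + 6 * M / η ^ 2 + G)) ∧
      (∀ t ∈ Icc 0 T, Hol θ (ε * n + 30 * C1 * (Λ * 8 ^ k) ^ 2 *
        (2 * n * η ^ θ + 6 * M / η ^ 2 + G)) (H t)) := by
    intro k n η hn hη hη1 hV
    refine localised_equation (S := closedBall x0 r) hθ0.le hθ1.le hC1' (hL1 k) hε0.le hε1 hM hG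
      hn hη hη1 hA0 (fun t => cutT_le_one _ _ t) (hτb k) (fun t => hasDerivAt_cutT _ _ t)
      (fun t ht => deriv_cutT_of_eq_zero ht) (hζC' k) (cutX_le_one _ _ _) ?_ ?_ ?_ ?_ hu hs
      (fun t ht => ((hvX (k + 1)).sp t ht).cd) (hvM (k + 1)) hV (hag k)
    · intro x hx
      refine cutX_eq_zero (hkx0 k) ?_
      rw [mem_closedBall, dist_eq_norm, not_le] at hx
      have e1 : r ^ 2 ≤ ‖x - x0‖ ^ 2 := by gcongr
      have : 0 ≤ r ^ 2 * (1 / 2 : ℝ) ^ (k + 1) := by positivity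
      simp only [hρ]; linarith
    · exact ((hζC k).hol0 hθ0.le hθ1.le).mono (by linarith)
    · exact ((hζC k).hol1 hθ0.le hθ1.le).mono (by linarith)
    · intro t ht hτt
      have hst : s k < t := by
        rw [Ne, cutT_eq_zero_iff (hkt0 k)] at hτt; exact not_le.1 hτt
      have hσt : σ - κ ≤ t := by
        have : 0 ≤ κ * (1 / 2 : ℝ) ^ (k + 1) := by positivity
        simp only [hsd] at hst; linarith
      obtain ⟨c1, c2⟩ := hco t ht hσt
      exact ⟨fun x hx => ⟨c1 x hx, (c2.bB x hx).trans hCC1, (c2.bc x hx).trans hCC1, c2.bh x hx⟩,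
        fun x hx y hy => ⟨(c2.hA x hx y hy).trans (by gcongr),
          (c2.hB x hx y hy).trans (by gcongr), (c2.hc x hx y hy).trans (by gcongr),
          c2.hh x hx y hy⟩⟩
  have hmain : ∀ j k, ∀ t ∈ Icc 0 T,
      Hol θ (b ^ k * (21 * Λ * Cu / 2 ^ j + 2 * (S * (M + G)))) (D2 (v k t)) := by
    have hCu := hu.nonneg hT
    intro j
    refine nested_iteration (V := fun k n => ∀ t ∈ Icc 0 T, Hol θ n (D2 (v k t)))
      (a := KS * (2 * ε)) (by linarith) (by linarith) (by positivity) (by positivity)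
      (fun k n m hnm hV t ht => (hV t ht).mono hnm)
      (fun k t ht => ((hvX k).sp t ht).hol) ?_ j
    intro k n hn hV t ht
    have hηk0 : 0 < η * m ^ k := by positivity
    have hηk1 : η * m ^ k ≤ 1 := mul_le_one₀ hη1 (by positivity) (pow_le_one₀ hm0.le hm1)
    obtain ⟨H, hd, hb1, hb2⟩ := hloc k n (η * m ^ k) hn hηk0 hηk1 hV
    have := hKS A0 hE T (v k) H _ _ _ (hvX k) (hv0 k) (by positivity) hd hb1 hb2 t ht
    refine this.mono ?_
    have e0 : (Λ * 8 ^ k) ^ 2 = Λ ^ 2 * 64 ^ k := by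
      rw [mul_pow, ← pow_mul, mul_comm k, pow_mul]; norm_num
    have e1 : (η * m ^ k) ^ θ = ε / (60 * C1 * Λ ^ 2) * (1 / 64) ^ k := by
      have e : (m ^ k) ^ θ = (m ^ θ) ^ k := by
        rw [← Real.rpow_natCast, ← Real.rpow_natCast, ← Real.rpow_mul hm0.le,
          ← Real.rpow_mul hm0.le, mul_comm]
      rw [Real.mul_rpow hη0.le (by positivity), hη, e, hm]
    have e2 : 30 * C1 * (Λ * 8 ^ k) ^ 2 * (2 * n * (η * m ^ k) ^ θ) = ε * n := by
      have : (64:ℝ) ^ k * (1 / 64) ^ k = 1 := by rw [← mul_pow]; norm_num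
      rw [e0, e1]
      calc _ = (ε * n) * ((60 * C1 * Λ ^ 2) / (60 * C1 * Λ ^ 2)) * (64 ^ k * (1 / 64) ^ k) := by
            ring
        _ = ε * n := by rw [this, div_self (by positivity)]; ring
    have hηk2 : (η * m ^ k) ^ 2 ≤ 1 := pow_le_one₀ hηk0.le hηk1
    have e3 : 6 * M / (η * m ^ k) ^ 2 + G ≤ 6 / (η * m ^ k) ^ 2 * (M + G) := by
      have : 1 ≤ 1 / (η * m ^ k) ^ 2 := by rw [le_div_iff₀ (by positivity)]; linarith
      have e : 6 / (η * m ^ k) ^ 2 = 6 * (1 / (η * m ^ k) ^ 2) := by ring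
      have e' : 6 * M / (η * m ^ k) ^ 2 = 6 * (1 / (η * m ^ k) ^ 2) * M := by ring
      rw [e, e']
      have := mul_le_mul_of_nonneg_left this hG
      linarith
    have e4 : (Λ * 8 ^ k) ^ 2 * (6 / (η * m ^ k) ^ 2) = b ^ k * (Λ ^ 2 * (6 / η ^ 2)) := by
      rw [e0, hb, div_pow, mul_pow, ← pow_mul, ← pow_mul, mul_comm 2 k]
      field_simp
    calc KS * (ε * n + 30 * C1 * (Λ * 8 ^ k) ^ 2 *
          (2 * n * (η * m ^ k) ^ θ + 6 * M / (η * m ^ k) ^ 2 + G))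
        = KS * (ε * n + 30 * C1 * (Λ * 8 ^ k) ^ 2 * (2 * n * (η * m ^ k) ^ θ) +
            30 * C1 * (Λ * 8 ^ k) ^ 2 * (6 * M / (η * m ^ k) ^ 2 + G)) := by ring
      _ ≤ KS * (ε * n + ε * n +
            30 * C1 * (Λ * 8 ^ k) ^ 2 * (6 / (η * m ^ k) ^ 2 * (M + G))) := by
          rw [e2]; gcongr
      _ = KS * (ε * n + ε * n +
            30 * C1 * ((Λ * 8 ^ k) ^ 2 * (6 / (η * m ^ k) ^ 2)) * (M + G)) := by ring
      _ = _ := by rw [e4, hS]; ring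
  have hlim : ∀ k, ∀ t ∈ Icc 0 T, Hol θ (b ^ k * (2 * S) * (M + G)) (D2 (v k t)) := by
    intro k t ht
    refine Hol.of_forall_gt fun e he => ?_
    have hl : Tendsto (fun j : ℕ => b ^ k * (21 * Λ * Cu / 2 ^ j)) atTop (𝓝 (b ^ k * 0)) :=
      (tendsto_const_nhds.div_atTop (tendsto_pow_atTop_atTop_of_one_lt (by norm_num))).const_mul _
    rw [mul_zero] at hl
    obtain ⟨j, hj⟩ := (hl.eventually (ge_mem_nhds he)).exists
    exact (hmain j k t ht).mono (by linarith)
  have hV1 : ∀ t ∈ Icc 0 T, Hol θ (n1 * (M + G)) (D2 (v 1 t)) := fun t ht => by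
    simpa [hn1] using hlim 1 t ht
  have hV0 : ∀ t ∈ Icc 0 T, Hol θ (2 * S * (M + G)) (D2 (v 0 t)) := fun t ht => by
    simpa using hlim 0 t ht
  obtain ⟨H, hd, hb1, -⟩ := hloc 0 _ 1 (by positivity) one_pos le_rfl hV1
  have hsup : ∀ t ∈ Icc 0 T, (∀ x, |v 0 t x| ≤ (2 * (2 * S) + 6) * (M + G)) ∧
      (∀ x, ‖D (v 0 t) x‖ ≤ (2 * (2 * S) + 6) * (M + G)) ∧
      (∀ x, ‖D2 (v 0 t) x‖ ≤ (2 * (2 * S) + 6) * (M + G)) := by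
    intro t ht
    have e : 2 * (2 * S * (M + G)) * 1 ^ θ + 6 * M / 1 ^ 2 ≤ (2 * (2 * S) + 6) * (M + G) := by
      rw [Real.one_rpow]; linarith
    obtain ⟨w0, w1, w2⟩ := C2b_of_interp hθ0.le (by positivity) hM one_pos le_rfl
      ((hvX 0).sp t ht).cd (hV0 t ht) (hvM 0 t ht)
    exact ⟨fun x => (w0 x).trans e, fun x => (w1 x).trans e, fun x => (w2 x).trans e⟩
  have hK1 : 2 * (2 * S) + 6 ≤ K := by
    have : 0 ≤ C1 * (2 * (2 * S) + 6) + 30 * C1 * Λ ^ 2 * (2 * n1 + 6) := by positivity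
    rw [hK]; linarith
  have hK2 : C1 * (2 * (2 * S) + 6) + 30 * C1 * Λ ^ 2 * (2 * n1 + 6) ≤ K := by
    rw [hK]; linarith
  refine ⟨v 0, ⟨fun t ht => ?_, fun x t ht t' ht' => ?_⟩, ?_⟩
  · obtain ⟨w0, w1, w2⟩ := hsup t ht
    exact ⟨((hvX 0).sp t ht).cd, fun x => (w0 x).trans (by gcongr),
      fun x => (w1 x).trans (by gcongr), fun x => (w2 x).trans (by gcongr),
      (hV0 t ht).mono (by gcongr; linarith)⟩
  · have hbd : ∀ t ∈ Ioo 0 T, |A0 (D2 (v 0 t) x) + H t x| ≤ K * (M + G) := by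
      intro t ht
      have ht' : t ∈ Icc 0 T := Ioo_subset_Icc_self ht
      refine (abs_add_le _ _).trans ?_
      have e1 : |A0 (D2 (v 0 t) x)| ≤ C1 * ((2 * (2 * S) + 6) * (M + G)) :=
        (A0.le_opNorm _).trans (mul_le_mul hA0 ((hsup t ht').2.2 x) (norm_nonneg _) (by linarith))
      have e2 := hb1 t ht' x
      rw [Real.one_rpow] at e2
      calc _ ≤ C1 * ((2 * (2 * S) + 6) * (M + G)) + 30 * C1 * (Λ * 8 ^ 0) ^ 2 *
            (2 * (n1 * (M + G)) * 1 + 6 * M / 1 ^ 2 + G) := add_le_add e1 e2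
        _ ≤ C1 * ((2 * (2 * S) + 6) * (M + G)) + 30 * C1 * (Λ * 8 ^ 0) ^ 2 *
            ((2 * n1 + 6) * (M + G)) := by
            gcongr; linarith
        _ = (C1 * (2 * (2 * S) + 6) + 30 * C1 * Λ ^ 2 * (2 * n1 + 6)) * (M + G) := by ring
        _ ≤ _ := by gcongr
    wlog htt : t' ≤ t generalizing t t'
    · rw [abs_sub_comm, abs_sub_comm t]
      exact this t' ht' t ht (le_of_not_ge htt)
    rcases htt.eq_or_lt with rfl | hlt
    · simp
    have hcont : ContinuousOn (fun r => v 0 r x) (Icc t' t) :=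
      ((hvX 0).continuousOn_time x).mono (Icc_subset_Icc ht'.1 ht.2)
    obtain ⟨ξ, hξ, hξe⟩ := exists_hasDerivAt_eq_slope (fun r => v 0 r x) _ hlt hcont
      (fun r hr => hd r ⟨ht'.1.trans_lt hr.1, hr.2.trans_le ht.2⟩ x)
    have := hbd ξ ⟨ht'.1.trans_lt hξ.1, hξ.2.trans_le ht.2⟩
    rw [hξe, abs_div, div_le_iff₀ (abs_pos.2 (by linarith))] at this
    exact this
  · intro t ht hσt x hx
    have e1 : τ 0 t = 1 := by
      refine Real.smoothTransition.one_of_one_le ?_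
      simp only [hkt, hsd]
      have : 4 / κ * 2 ^ 0 * (t - (σ - κ * (1 - (1 / 2) ^ (0 + 1)))) =
        4 / κ * (t - σ) + 2 * (κ / κ) := by ring
      rw [this, div_self hκ.ne']
      have : 0 ≤ 4 / κ * (t - σ) := mul_nonneg (by positivity) (by linarith)
      linarith
    have e2 : ζ 0 x = 1 := by
      refine cutX_eq_one ?_
      rw [mem_closedBall, dist_eq_norm] at hx
      have hx2 : ‖x - x0‖ ^ 2 ≤ (r / 2) ^ 2 := by gcongr
      have : kx 0 * (ρ 0 - (r / 2) ^ 2) = r ^ 2 / r ^ 2 := by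
        simp only [hkx, hρ]; ring
      rw [div_self (by positivity)] at this
      have := hkx0 0
      nlinarith
    simp only [hv]
    rw [e1, e2]; ring

end InteriorEstimate

/-! ### Maximum principles -/

section MaxPrinciple
variable {N : ℕ} {θ : ℝ}

lemma nonneg_of_hasDerivAt_of_le {f : ℝ → ℝ} {t w' : ℝ} (hd : HasDerivAt f w' t) (ht : 0 < t)
    (hf : ∀ r ∈ Ioo 0 t, f r ≤ f t) : 0 ≤ w' := by
  have h1 := (hasDerivWithinAt_iff_tendsto_slope' (s := Iio t) (notMem_Iio.2 le_rfl)).1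
    hd.hasDerivWithinAt
  refine ge_of_tendsto h1 ?_
  filter_upwards [Ioo_mem_nhdsLT ht] with r hr
  rw [slope_def_field]
  exact div_nonneg_of_nonpos (by linarith [hf r hr]) (by linarith [hr.2])

lemma D2_nonpos_of_isLocalMax {φ : ES N → ℝ} (hφ : ContDiff ℝ 2 φ) {x : ES N}
    (h : IsLocalMax φ x) (ξ : ES N) : D2 φ x ξ ξ ≤ 0 := by
  by_contra! hpos
  set γ : ℝ → ES N := fun s => x + s • ξ with hγ
  have hγd : ∀ s, HasDerivAt γ ξ s := fun s => by
    simpa [hγ] using ((hasDerivAt_id s).smul_const ξ).const_add x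
  have hγ0 : γ 0 = x := by simp [hγ]
  have hd1 : ∀ s, HasDerivAt (fun s => φ (γ s)) (D φ (γ s) ξ) s := fun s =>
    (hφ.differentiable (by norm_num) (γ s)).hasFDerivAt.comp_hasDerivAt s (hγd s)
  have hd2 : ∀ s, HasDerivAt (fun s => D φ (γ s) ξ) (D2 φ (γ s) ξ ξ) s := fun s => by
    have := ((contDiff_fderiv_of_two hφ).differentiable (by norm_num)
      (γ s)).hasFDerivAt.comp_hasDerivAt s (hγd s)
    simpa using this.clm_apply (hasDerivAt_const s ξ)
  have e1 : deriv (fun s => φ (γ s)) = fun s => D φ (γ s) ξ := funext fun s => (hd1 s).deriv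
  have e2 : deriv (deriv fun s => φ (γ s)) 0 = D2 φ x ξ ξ := by rw [e1, (hd2 0).deriv, hγ0]
  have hmax : IsLocalMax (fun s => φ (γ s)) 0 := by
    have hc : Tendsto γ (𝓝 0) (𝓝 x) := by simpa [hγ0] using (hγd 0).continuousAt.tendsto
    have := hc.eventually h
    simpa [IsLocalMax, IsMaxFilter, hγ0] using this
  have hmin : IsLocalMin (fun s => φ (γ s)) 0 :=
    isLocalMin_of_deriv_deriv_pos (by rw [e2]; exact hpos) hmax.deriv_eq_zero
      (hd1 0).continuousAt
  have hconst : (fun s => φ (γ s)) =ᶠ[𝓝 0] fun _ => φ (γ 0) := by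
    filter_upwards [hmax, hmin] with s h1 h2
    exact le_antisymm h1 h2
  have h0 : deriv (deriv fun s => φ (γ s)) 0 = 0 := by
    rw [hconst.deriv.deriv_eq]; simp
  linarith

lemma Ell.nonpos {lam Lam : ℝ} (hlam : 0 < lam) (hLam : 0 ≤ Lam) {A : H2 N →L[ℝ] ℝ}
    (h : Ell lam Lam A) {H : H2 N} (hH : ∀ ξ, H ξ ξ ≤ 0) : A H ≤ 0 := by
  obtain ⟨σ, τ, -, -, -, -, hA⟩ := h.exists_sqrt hlam hLam
  rw [hA]
  exact Finset.sum_nonpos fun k _ => hH _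

/-- Parabolic maximum principle on a cylinder. -/
theorem max_principle {T R : ℝ} {x0 : ES N} {w : ℝ → ES N → ℝ}
    (hc : ContinuousOn (fun p : ℝ × ES N => w p.1 p.2) (Icc 0 T ×ˢ closedBall x0 R))
    (h0 : ∀ x ∈ closedBall x0 R, w 0 x ≤ 0)
    (hb : ∀ t ∈ Icc 0 T, ∀ x ∈ sphere x0 R, w t x ≤ 0)
    (hd2 : ∀ t ∈ Ioo 0 T, ContDiff ℝ 2 (w t))
    (hi : ∀ t ∈ Ioo 0 T, ∀ x ∈ ball x0 R, 0 < w t x → D (w t) x = 0 →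
      (∀ ξ, D2 (w t) x ξ ξ ≤ 0) → ∃ w' < 0, HasDerivAt (fun r => w r x) w' t) :
    ∀ t ∈ Icc 0 T, ∀ x ∈ closedBall x0 R, w t x ≤ 0 := by
  have key : ∀ t ∈ Ico 0 T, ∀ x ∈ closedBall x0 R, w t x ≤ 0 := by
    intro t1 ht1 x1 hx1
    by_contra! hpos
    have hK : IsCompact (Icc 0 t1 ×ˢ closedBall x0 R) :=
      isCompact_Icc.prod (isCompact_closedBall x0 R)
    obtain ⟨⟨t, x⟩, ⟨ht, hx⟩, hmax⟩ := hK.exists_isMaxOn ⟨(t1, x1), ⟨⟨ht1.1, le_rfl⟩, hx1⟩⟩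
      (hc.mono (prod_mono (Icc_subset_Icc_right ht1.2.le) le_rfl))
    simp only at ht hx
    have hmax' : ∀ s ∈ Icc 0 t1, ∀ y ∈ closedBall x0 R, w s y ≤ w t x := fun s hs y hy =>
      hmax (a := (s, y)) ⟨hs, hy⟩
    have hwp : 0 < w t x := hpos.trans_le (hmax' t1 ⟨ht1.1, le_rfl⟩ x1 hx1)
    have ht0 : 0 < t := lt_of_le_of_ne ht.1 fun h => by
      have := h0 x hx; rw [h] at this; linarith
    have htT : t < T := ht.2.trans_lt ht1.2
    have hxb : x ∈ ball x0 R := by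
      rw [mem_ball]
      refine lt_of_le_of_ne hx fun h => ?_
      have := hb t ⟨ht0.le, htT.le⟩ x h
      linarith
    have hloc : IsLocalMax (w t) x := by
      filter_upwards [isOpen_ball.mem_nhds hxb] with y hy
      exact hmax' t ht y (ball_subset_closedBall hy)
    obtain ⟨w', hw', hd⟩ := hi t ⟨ht0, htT⟩ x hxb hwp hloc.fderiv_eq_zero
      (D2_nonpos_of_isLocalMax (hd2 t ⟨ht0, htT⟩) hloc)
    have := nonneg_of_hasDerivAt_of_le hd ht0 fun r hr =>
      hmax' r ⟨hr.1.le, hr.2.le.trans ht.2⟩ x hx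
    linarith
  intro t ht x hx
  rcases ht.2.eq_or_lt with rfl | h
  · rcases ht.1.eq_or_lt with h | hT
    · rw [← h]; exact h0 x hx
    have hc1 : ContinuousOn (fun r => w r x) (Icc 0 t) :=
      hc.comp (f := fun r => (r, x)) (by fun_prop) fun r hr => ⟨hr, hx⟩
    have := (hc1 t ⟨hT.le, le_rfl⟩).mono (Ioo_subset_Icc_self (a := (0:ℝ)) (b := t))
    have hne : (𝓝[Ioo 0 t] t).NeBot := right_nhdsWithin_Ioo_neBot hT
    refine le_of_tendsto this ?_
    filter_upwards [self_mem_nhdsWithin] with r hr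
    exact key r ⟨hr.1.le, hr.2⟩ x hx
  · exact key t ⟨ht.1, h⟩ x hx

/-- The squared distance to `x0`. -/
def sqd (x0 x : ES N) : ℝ := ‖x - x0‖ ^ 2

lemma contDiff_sqd (x0 : ES N) {n : WithTop ℕ∞} : ContDiff ℝ n (sqd x0) :=
  (contDiff_id.sub contDiff_const).norm_sq ℝ

lemma D_sqd (x0 : ES N) : D (sqd x0) = fun x => (2:ℝ) • innerSL ℝ (x - x0) := by
  funext x
  have h1 := ((hasFDerivAt_id x).sub_const x0).norm_sq
  refine h1.fderiv.trans ?_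
  ext; simp

lemma norm_D_sqd_le (x0 x : ES N) : ‖D (sqd x0) x‖ ≤ 2 * ‖x - x0‖ := by
  rw [D_sqd, norm_smul, innerSL_apply_norm]; simp

lemma norm_D2_sqd_le (x0 x : ES N) : ‖D2 (sqd x0) x‖ ≤ 2 := by
  have h : HasFDerivAt (D (sqd x0)) ((2:ℝ) • (innerSL ℝ : H2 N)) x := by
    rw [D_sqd]
    exact ((innerSL ℝ : H2 N).hasFDerivAt.comp x ((hasFDerivAt_id x).sub_const x0)).const_smul (2:ℝ)
  rw [D2, h.fderiv, norm_smul]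
  have : ‖(innerSL ℝ : H2 N)‖ ≤ 1 := ContinuousLinearMap.opNorm_le_bound _ zero_le_one fun v => by
    rw [innerSL_apply_norm, one_mul]
  simpa using mul_le_mul_of_nonneg_left this (by norm_num : (0:ℝ) ≤ 2)

/-- Comparison of a solution with a quadratic barrier on a ball. -/
theorem barrier {T R Cu CA CB : ℝ} {x0 : ES N} {u : ℝ → ES N → ℝ}
    {A : ℝ → ES N → H2 N →L[ℝ] ℝ} {B : ℝ → ES N → V1 N →L[ℝ] ℝ} {c h : ℝ → ES N → ℝ}
    {a a' p p' q q' : ℝ → ℝ} (hu : XB T θ Cu u) (hs : Solves T A B c h u)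
    (ha : ∀ t, HasDerivAt a (a' t) t) (hp : ∀ t, HasDerivAt p (p' t) t)
    (hq : ∀ t, HasDerivAt q (q' t) t) (hq0 : ∀ t, 0 ≤ q t)
    (hE : ∀ t ∈ Ioo 0 T, ∀ x ∈ ball x0 R, (∃ lam Lam, 0 < lam ∧ 0 ≤ Lam ∧ Ell lam Lam (A t x)) ∧
      ‖A t x‖ ≤ CA ∧ ‖B t x‖ ≤ CB)
    (h0 : ∀ x ∈ closedBall x0 R, a 0 * u 0 x ≤ p 0 + q 0 * ‖x - x0‖ ^ 2)
    (hb : ∀ t ∈ Icc 0 T, ∀ x ∈ sphere x0 R, a t * u t x ≤ p t + q t * ‖x - x0‖ ^ 2)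
    (hi : ∀ t ∈ Ioo 0 T, ∀ x ∈ ball x0 R, p t + q t * ‖x - x0‖ ^ 2 < a t * u t x →
      a' t * u t x + a t * (c t x * u t x + h t x) + q t * (2 * CA + 2 * CB * ‖x - x0‖) <
        p' t + q' t * ‖x - x0‖ ^ 2) :
    ∀ t ∈ Icc 0 T, ∀ x ∈ closedBall x0 R, a t * u t x ≤ p t + q t * ‖x - x0‖ ^ 2 := by
  have hdiff := fun (t : ℝ) (ht : t ∈ Icc 0 T) => (hu.sp t ht).cd
  have hac : Continuous a := continuous_iff_continuousAt.2 fun t => (ha t).continuousAt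
  have hpc : Continuous p := continuous_iff_continuousAt.2 fun t => (hp t).continuousAt
  have hqc : Continuous q := continuous_iff_continuousAt.2 fun t => (hq t).continuousAt
  have key := max_principle (T := T) (R := R) (x0 := x0)
    (w := fun t x => a t * u t x - (p t + q t * sqd x0 x)) ?_ ?_ ?_ ?_ ?_
  · intro t ht x hx
    have := key t ht x hx
    simp only [sqd] at this
    linarith
  · have h1 : ContinuousOn (fun p : ℝ × ES N => u p.1 p.2) (Icc 0 T ×ˢ closedBall x0 R) :=
      hu.continuousOn.mono (prod_mono le_rfl (subset_univ _))
    have h2 : Continuous fun z : ℝ × ES N => a z.1 := hac.comp continuous_fst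
    have h3 : Continuous fun z : ℝ × ES N => p z.1 + q z.1 * sqd x0 z.2 :=
      (hpc.comp continuous_fst).add ((hqc.comp continuous_fst).mul
        ((contDiff_sqd x0 (n := 0)).continuous.comp continuous_snd))
    exact (h2.continuousOn.mul h1).sub h3.continuousOn
  · intro x hx; have := h0 x hx; simp only [sqd]; linarith
  · intro t ht x hx; have := hb t ht x hx; simp only [sqd]; linarith
  · intro t ht
    exact (contDiff_const.mul (hdiff t (Ioo_subset_Icc_self ht))).sub
      (contDiff_const.add (contDiff_const.mul (contDiff_sqd x0)))
  · intro t ht x hx hpos hD hD2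
    have hut := hdiff t (Ioo_subset_Icc_self ht)
    have hau : ContDiff ℝ 2 fun y => a t * u t y := contDiff_const.mul hut
    have hqs : ContDiff ℝ 2 fun y => q t * sqd x0 y := contDiff_const.mul (contDiff_sqd x0)
    have hpq : ContDiff ℝ 2 fun y => p t + q t * sqd x0 y := contDiff_const.add hqs
    have eD : D (fun y => a t * u t y - (p t + q t * sqd x0 y)) x =
        a t • D (u t) x - q t • D (sqd x0) x := by
      rw [D_sub hau hpq, D_const_mul _ hut]
      simp only [D, fderiv_const_add]
      congr 1
      exact congrFun (D_const_mul (q t) (contDiff_sqd x0)) x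
    have eD2 : D2 (fun y => a t * u t y - (p t + q t * sqd x0 y)) x =
        a t • D2 (u t) x - q t • D2 (sqd x0) x := by
      rw [D2_sub hau hpq, D2_const_mul _ hut]
      have : D2 (fun y => p t + q t * sqd x0 y) = D2 (fun y => q t * sqd x0 y) := by
        rw [D2, D2]; congr 1; funext y; simp only [fderiv_const_add]
      rw [this, D2_const_mul _ (contDiff_sqd x0)]
    obtain ⟨⟨lam, Lam, hlam, hLam, hEll⟩, hA, hB⟩ := hE t ht x hx
    have e1 := hEll.nonpos hlam hLam hD2
    rw [eD] at hD
    have e2 := congrArg (B t x) hD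
    rw [eD2] at e1
    rw [map_sub, map_smul, map_smul, smul_eq_mul, smul_eq_mul] at e1 e2
    rw [map_zero] at e2
    have e3 : A t x (D2 (sqd x0) x) ≤ 2 * CA := by
      refine (le_abs_self _).trans (((A t x).le_opNorm _).trans ?_)
      have := mul_le_mul hA (norm_D2_sqd_le x0 x) (norm_nonneg _) ((norm_nonneg _).trans hA)
      linarith
    have e4 : B t x (D (sqd x0) x) ≤ 2 * CB * ‖x - x0‖ := by
      refine (le_abs_self _).trans (((B t x).le_opNorm _).trans ?_)
      have := mul_le_mul hB (norm_D_sqd_le x0 x) (norm_nonneg _) ((norm_nonneg _).trans hB)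
      linarith
    refine ⟨_, ?_, ((ha t).fun_mul (hs t ht x)).fun_sub
      ((hp t).fun_add ((hq t).mul_const (sqd x0 x)))⟩
    have e5 := hi t ht x hx (by simp only [sqd] at hpos; linarith)
    have e6 := mul_le_mul_of_nonneg_left e3 (hq0 t)
    have e7 := mul_le_mul_of_nonneg_left e4 (hq0 t)
    simp only [LA, sqd]
    linarith

/-- Global sup bound for bounded solutions. -/
theorem sup_bound_one_sided {T Cu C M G μ : ℝ} {u : ℝ → ES N → ℝ}
    {A : ℝ → ES N → H2 N →L[ℝ] ℝ} {B : ℝ → ES N → V1 N →L[ℝ] ℝ} {c h : ℝ → ES N → ℝ}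
    (hC : 0 ≤ C) (hM : 0 ≤ M) (hG : 0 ≤ G) (hμ : 0 ≤ μ)
    (hu : XB T θ Cu u) (hs : Solves T A B c h u)
    (hE : ∀ t ∈ Icc 0 T, ∀ x, (∃ lam Lam, 0 < lam ∧ 0 ≤ Lam ∧ Ell lam Lam (A t x)) ∧
      ‖A t x‖ ≤ C ∧ ‖B t x‖ ≤ C)
    (hc : ∀ t ∈ Icc 0 T, ∀ x, c t x ≤ μ) (hh : ∀ t ∈ Icc 0 T, ∀ x, h t x ≤ G)
    (h0 : ∀ x, u 0 x ≤ M) : ∀ t ∈ Icc 0 T, ∀ x, u t x ≤ Real.exp (μ * T) * (M + T * G) := by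
  intro t ht x
  have hT : 0 ≤ T := ht.1.trans ht.2
  have hCu := hu.nonneg hT
  have hexp : ∀ (k s : ℝ), HasDerivAt (fun s => Real.exp (k * s)) (k * Real.exp (k * s)) s :=
    fun k s => by
      simpa [mul_comm] using ((hasDerivAt_id s).const_mul k).exp
  have key : ∀ ε > 0, Real.exp (-μ * t) * u t x ≤
      M + G * t + ε * (Real.exp ((3 * C + 1) * t) * (1 + ‖x‖ ^ 2)) := by
    intro ε hε
    set R : ℝ := 1 + ‖x‖ + Cu / ε with hR
    have hR1 : ‖x‖ + Cu / ε + 1 ≤ R := by rw [hR]; linarith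
    have hCε : 0 ≤ Cu / ε := by positivity
    have := barrier (T := T) (R := R) (CA := C) (CB := C) (x0 := 0) (u := u) (A := A) (B := B)
      (c := c) (h := h) (a := fun s => Real.exp (-μ * s)) (a' := fun s => -μ * Real.exp (-μ * s))
      (p := fun s => M + G * s + ε * Real.exp ((3 * C + 1) * s))
      (p' := fun s => G + ε * ((3 * C + 1) * Real.exp ((3 * C + 1) * s)))
      (q := fun s => ε * Real.exp ((3 * C + 1) * s))
      (q' := fun s => ε * ((3 * C + 1) * Real.exp ((3 * C + 1) * s))) hu hs (hexp _)
      (fun s => by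
        have h1 : HasDerivAt (fun s => M + G * s) G s := by
          simpa using ((hasDerivAt_id s).const_mul G).const_add M
        exact h1.fun_add ((hexp _ s).const_mul ε))
      (fun s => (hexp _ s).const_mul ε) (fun s => by positivity)
      (fun s hs y _ => hE s (Ioo_subset_Icc_self hs) y) ?_ ?_ ?_ t ht x ?_
    · simp only [sub_zero] at this
      linarith
    · intro y _
      have : 0 ≤ ε * ‖y‖ ^ 2 := by positivity
      simp only [mul_zero, Real.exp_zero, sub_zero]
      linarith [h0 y]
    · intro s hs y hy
      have hyR : ‖y‖ = R := by simpa using hy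
      have e1 : Real.exp (-μ * s) * u s y ≤ Cu := by
        have h1 : Real.exp (-μ * s) ≤ 1 := Real.exp_le_one_iff.2 (by nlinarith [hs.1])
        calc _ ≤ Real.exp (-μ * s) * Cu := by
              gcongr; exact (le_abs_self _).trans ((hu.sp s hs).b0 y)
          _ ≤ 1 * Cu := by gcongr
          _ = Cu := one_mul _
      have e2 : 1 ≤ Real.exp ((3 * C + 1) * s) :=
        Real.one_le_exp (mul_nonneg (by linarith) hs.1)
      have e3 : Cu ≤ ε * R ^ 2 := by
        have h1 : Cu / ε ≤ R := by linarith [norm_nonneg x]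
        have h2 : 1 ≤ R := by linarith [norm_nonneg x]
        have h3 : Cu / ε ≤ R ^ 2 := by nlinarith
        rw [div_le_iff₀ hε] at h3
        linarith
      have e4 : ε * R ^ 2 ≤ ε * Real.exp ((3 * C + 1) * s) * R ^ 2 := by
        have : 0 ≤ ε * R ^ 2 := by positivity
        nlinarith
      have e5 : 0 ≤ ε * Real.exp ((3 * C + 1) * s) := by positivity
      have e6 : 0 ≤ G * s := mul_nonneg hG hs.1
      simp only [sub_zero, hyR]
      linarith
    · intro s hs y _ hlt
      have hs' : s ∈ Icc 0 T := Ioo_subset_Icc_self hs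
      simp only [sub_zero] at hlt ⊢
      have hX : 0 < Real.exp (-μ * s) := Real.exp_pos _
      have hX1 : Real.exp (-μ * s) ≤ 1 := Real.exp_le_one_iff.2 (by nlinarith [hs.1])
      have hZ : 0 < ε * Real.exp ((3 * C + 1) * s) := by positivity
      have hup : 0 < u s y := by
        have : 0 < Real.exp (-μ * s) * u s y := by
          have : 0 ≤ G * s := mul_nonneg hG hs.1.le
          have : 0 ≤ ε * Real.exp ((3 * C + 1) * s) * ‖y‖ ^ 2 := by positivity
          linarith
        exact (mul_pos_iff_of_pos_left hX).1 this
      have e1 : Real.exp (-μ * s) * ((c s y - μ) * u s y) ≤ 0 :=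
        mul_nonpos_of_nonneg_of_nonpos hX.le
          (mul_nonpos_of_nonpos_of_nonneg (by linarith [hc s hs' y]) hup.le)
      have e2 : Real.exp (-μ * s) * h s y ≤ G :=
        (mul_le_mul_of_nonneg_left (hh s hs' y) hX.le).trans (by nlinarith)
      have e3 : ε * Real.exp ((3 * C + 1) * s) * (2 * C + 2 * C * ‖y‖) <
          ε * Real.exp ((3 * C + 1) * s) * ((3 * C + 1) * (1 + ‖y‖ ^ 2)) := by
        refine mul_lt_mul_of_pos_left ?_ hZ
        have : 2 * ‖y‖ ≤ 1 + ‖y‖ ^ 2 := by nlinarith [sq_nonneg (‖y‖ - 1)]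
        have h2 := mul_le_mul_of_nonneg_left this hC
        have : 0 ≤ C * ‖y‖ ^ 2 := by positivity
        nlinarith [sq_nonneg ‖y‖]
      linarith
    · simp only [mem_closedBall, dist_zero_right]
      linarith
  have hlim : Real.exp (-μ * t) * u t x ≤ M + G * t := by
    set Y := Real.exp ((3 * C + 1) * t) * (1 + ‖x‖ ^ 2) with hY
    have hY0 : 0 < Y := by positivity
    refine le_of_forall_pos_le_add fun e he => ?_
    have := key (e / Y) (by positivity)
    rwa [div_mul_cancel₀ _ hY0.ne'] at this
  have e1 : u t x = Real.exp (μ * t) * (Real.exp (-μ * t) * u t x) := by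
    rw [← mul_assoc, ← Real.exp_add]; simp
  rw [e1]
  calc _ ≤ Real.exp (μ * t) * (M + G * t) := by gcongr
    _ ≤ Real.exp (μ * T) * (M + T * G) := by
      have h2 : G * t ≤ T * G := by nlinarith [ht.2]
      have h3 : 0 ≤ G * t := mul_nonneg hG ht.1
      have h4 : t ≤ T := ht.2
      gcongr

lemma Solves.neg {T : ℝ} {A : ℝ → ES N → H2 N →L[ℝ] ℝ} {B : ℝ → ES N → V1 N →L[ℝ] ℝ}
    {c h u : ℝ → ES N → ℝ} (hs : Solves T A B c h u) :
    Solves T A B c (fun t x => - h t x) (fun t x => - u t x) := by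
  intro t ht x
  refine ((hs t ht x).fun_neg).congr_deriv ?_
  have e1 : D (fun y => - u t y) x = - D (u t) x := fderiv_fun_neg
  have e2 : D2 (fun y => - u t y) x = - D2 (u t) x := by
    have : D (fun y => - u t y) = fun y => - D (u t) y := funext fun y => fderiv_fun_neg
    rw [D2]
    change fderiv ℝ (D fun y => - u t y) x = _
    rw [this]
    exact fderiv_fun_neg
  simp only [LA]
  rw [e1, e2, map_neg, map_neg]
  ring

lemma XB.neg {T C : ℝ} {u : ℝ → ES N → ℝ} (h : XB T θ C u) : XB T θ C (fun t x => - u t x) := by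
  have e1 : ∀ t, D (fun y => - u t y) = fun y => - D (u t) y :=
    fun t => funext fun y => fderiv_fun_neg
  have e2 : ∀ t, D2 (fun y => - u t y) = fun y => - D2 (u t) y := fun t => by
    change fderiv ℝ (D fun y => - u t y) = _
    rw [e1]
    exact funext fun y => fderiv_fun_neg
  refine ⟨fun t ht => ⟨(h.sp t ht).cd.neg, fun x => ?_, fun x => ?_, fun x => ?_, ?_⟩,
    fun x t ht s hs => ?_⟩
  · rw [abs_neg]; exact (h.sp t ht).b0 x
  · rw [e1, norm_neg]; exact (h.sp t ht).b1 x
  · rw [e2, norm_neg]; exact (h.sp t ht).b2 x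
  · rw [e2]; exact (h.sp t ht).hol.neg
  · rw [← neg_sub', abs_neg]; exact h.tl x t ht s hs

theorem sup_bound {T Cu C M G μ : ℝ} {u : ℝ → ES N → ℝ}
    {A : ℝ → ES N → H2 N →L[ℝ] ℝ} {B : ℝ → ES N → V1 N →L[ℝ] ℝ} {c h : ℝ → ES N → ℝ}
    (hC : 0 ≤ C) (hM : 0 ≤ M) (hG : 0 ≤ G) (hμ : 0 ≤ μ)
    (hu : XB T θ Cu u) (hs : Solves T A B c h u)
    (hE : ∀ t ∈ Icc 0 T, ∀ x, (∃ lam Lam, 0 < lam ∧ 0 ≤ Lam ∧ Ell lam Lam (A t x)) ∧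
      ‖A t x‖ ≤ C ∧ ‖B t x‖ ≤ C)
    (hc : ∀ t ∈ Icc 0 T, ∀ x, c t x ≤ μ) (hh : ∀ t ∈ Icc 0 T, ∀ x, |h t x| ≤ G)
    (h0 : ∀ x, |u 0 x| ≤ M) : ∀ t ∈ Icc 0 T, ∀ x, |u t x| ≤ Real.exp (μ * T) * (M + T * G) := by
  intro t ht x
  rw [abs_le']
  exact ⟨sup_bound_one_sided hC hM hG hμ hu hs hE hc (fun t ht x => (abs_le'.1 (hh t ht x)).1)
      (fun x => (abs_le'.1 (h0 x)).1) t ht x,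
    sup_bound_one_sided hC hM hG hμ hu.neg hs.neg hE hc (fun t ht x => (abs_le'.1 (hh t ht x)).2)
      (fun x => (abs_le'.1 (h0 x)).2) t ht x⟩

end MaxPrinciple

section GlobalEstimate
variable {N : ℕ} {θ : ℝ}

lemma abs_sub_le_of_hasDerivAt {f f' : ℝ → ℝ} {a b K : ℝ} (hc : ContinuousOn f (Icc a b))
    (hd : ∀ t ∈ Ioo a b, HasDerivAt f (f' t) t) (hb : ∀ t ∈ Ioo a b, |f' t| ≤ K) :
    ∀ t ∈ Icc a b, ∀ s ∈ Icc a b, |f t - f s| ≤ K * |t - s| := by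
  intro t ht s hs
  wlog hst : s ≤ t generalizing t s
  · rw [abs_sub_comm, abs_sub_comm t]
    exact this s hs t ht (le_of_not_ge hst)
  rcases hst.eq_or_lt with rfl | hlt
  · simp
  obtain ⟨ξ, hξ, hξe⟩ := exists_hasDerivAt_eq_slope f f' hlt
    (hc.mono (Icc_subset_Icc hs.1 ht.2))
    (fun r hr => hd r ⟨hs.1.trans_lt hr.1, hr.2.trans_le ht.2⟩)
  have := hb ξ ⟨hs.1.trans_lt hξ.1, hξ.2.trans_le ht.2⟩
  rwa [hξe, abs_div, div_le_iff₀ (abs_pos.2 (by linarith))] at this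

/-- Globally bounded, uniformly elliptic, Hölder continuous coefficients. -/
structure GCoef (T θ β lam C : ℝ) (A : ℝ → ES N → H2 N →L[ℝ] ℝ)
    (B : ℝ → ES N → V1 N →L[ℝ] ℝ) (c : ℝ → ES N → ℝ) : Prop where
  ell : ∀ t ∈ Icc 0 T, ∀ x, Ell lam C (A t x)
  bB : ∀ t ∈ Icc 0 T, ∀ x, ‖B t x‖ ≤ C
  bc : ∀ t ∈ Icc 0 T, ∀ x, |c t x| ≤ C
  hA : ∀ t ∈ Icc 0 T, Hol θ C (A t)
  hB : ∀ t ∈ Icc 0 T, Hol θ C (B t)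
  hc : ∀ t ∈ Icc 0 T, Hol θ C (c t)
  tA : ∀ x, ∀ t ∈ Icc 0 T, ∀ s ∈ Icc 0 T, ‖A t x - A s x‖ ≤ C * |t - s| ^ β
  tB : ∀ x, ∀ t ∈ Icc 0 T, ∀ s ∈ Icc 0 T, ‖B t x - B s x‖ ≤ C * |t - s| ^ β
  tc : ∀ x, ∀ t ∈ Icc 0 T, ∀ s ∈ Icc 0 T, |c t x - c s x| ≤ C * |t - s| ^ β

lemma Ell.norm_le {lam C : ℝ} {A : H2 N →L[ℝ] ℝ} (hC : 0 ≤ C) (h : Ell lam C A) :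
    ‖A‖ ≤ N ^ 2 * C := by
  obtain ⟨a, -, ha, -, rfl⟩ := h
  exact norm_trL_le hC ha

lemma abs_LA_le {A : ℝ → ES N → H2 N →L[ℝ] ℝ} {B : ℝ → ES N → V1 N →L[ℝ] ℝ} {c : ℝ → ES N → ℝ}
    {φ : ES N → ℝ} {t CA C K : ℝ} {x : ES N} (hA : ‖A t x‖ ≤ CA) (hB : ‖B t x‖ ≤ C)
    (hc : |c t x| ≤ C) (h0 : |φ x| ≤ K) (h1 : ‖D φ x‖ ≤ K) (h2 : ‖D2 φ x‖ ≤ K) :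
    |LA A B c φ t x| ≤ (CA + 2 * C) * K := by
  have hK := (norm_nonneg _).trans h1
  have e1 : |A t x (D2 φ x)| ≤ CA * K := ((A t x).le_opNorm _).trans (by
    have := (norm_nonneg _).trans hA
    gcongr)
  have e2 : |B t x (D φ x)| ≤ C * K := ((B t x).le_opNorm _).trans (by
    have := (norm_nonneg _).trans hB
    gcongr)
  have e3 : |c t x * φ x| ≤ C * K := by
    rw [abs_mul]
    have := (abs_nonneg _).trans hc
    gcongr
  calc _ ≤ |A t x (D2 φ x)| + |B t x (D φ x)| + |c t x * φ x| := abs_add_three _ _ _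
    _ ≤ _ := by linarith

theorem global_estimate (N : ℕ) {θ β lam C T : ℝ} (hθ0 : 0 < θ) (hθ1 : θ < 1) (hβ : 0 < β)
    (hlam : 0 < lam) (hC : 1 ≤ C) (hT : 0 ≤ T) : ∃ K > 0, ∀ (G Cu : ℝ)
      (u : ℝ → ES N → ℝ) (A : ℝ → ES N → H2 N →L[ℝ] ℝ) (B : ℝ → ES N → V1 N →L[ℝ] ℝ)
      (c h : ℝ → ES N → ℝ), 0 ≤ G → GCoef T θ β lam C A B c →
      (∀ t ∈ Icc 0 T, ∀ x, |h t x| ≤ G) → (∀ t ∈ Icc 0 T, Hol θ G (h t)) →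
      XB T θ Cu u → Solves T A B c h u → (∀ x, u 0 x = 0) → XB T θ (K * G) u := by
  obtain ⟨ε, hε, hI⟩ := interior_estimate N hθ0 hθ1 hlam hC
  have hCp : 0 < C := by linarith
  obtain ⟨r, hr0, -, hr⟩ := exists_rpow_eq hθ0 (a := min 1 (ε / (2 * C)))
    (lt_min one_pos (by positivity)) (min_le_left _ _)
  obtain ⟨κ, hκ0, -, hκ⟩ := exists_rpow_eq hβ (a := min 1 (ε / (2 * C)))
    (lt_min one_pos (by positivity)) (min_le_left _ _)
  have hrε : C * r ^ θ ≤ ε / 2 := by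
    rw [hr]
    calc _ ≤ C * (ε / (2 * C)) := by gcongr; exact min_le_right _ _
      _ = _ := by field_simp
  have hκε : C * κ ^ β ≤ ε / 2 := by
    rw [hκ]
    calc _ ≤ C * (ε / (2 * C)) := by gcongr; exact min_le_right _ _
      _ = _ := by field_simp
  obtain ⟨K0, hK0, hK⟩ := hI r hr0 κ hκ0
  set M0 : ℝ := Real.exp (C * T) * T
  have hM0 : 0 ≤ M0 := by positivity
  set K' : ℝ := K0 * (M0 + 1) with hK'
  have hK'0 : 0 < K' := by positivity
  have hrp : 0 < (r / 2) ^ θ := by positivity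
  refine ⟨K' + 2 * K' / (r / 2) ^ θ + (N ^ 2 * C + 2 * C) * K' + 1, by positivity, ?_⟩
  intro G Cu u A B c h hG hco hh hhol hu hs hu0
  have hM : ∀ t ∈ Icc 0 T, ∀ x, |u t x| ≤ M0 * G := by
    intro t ht x
    have hNC : (0:ℝ) ≤ N ^ 2 * C := by positivity
    have := sup_bound (C := N ^ 2 * C + C) (M := 0) (G := G) (μ := C) (by positivity) le_rfl hG
      hCp.le hu hs (fun t ht x => ⟨⟨lam, C, hlam, hCp.le, hco.ell t ht x⟩,
        ((hco.ell t ht x).norm_le hCp.le).trans (by linarith),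
        (hco.bB t ht x).trans (by linarith)⟩)
      (fun t ht x => (le_abs_self _).trans (hco.bc t ht x)) hh (fun x => by simp [hu0]) t ht x
    calc _ ≤ _ := this
      _ = _ := by simp only [M0]; ring
  have key : ∀ t0 ∈ Icc 0 T, ∀ x0, ∃ φ : ES N → ℝ, C2b θ (K' * G) φ ∧
      ∀ x ∈ ball x0 (r / 2), u t0 x = φ x ∧ D (u t0) x = D φ x ∧ D2 (u t0) x = D2 φ x := by
    intro t0 ht0 x0
    obtain ⟨v, hv, hvu⟩ := hK t0 t0 (M0 * G) G Cu u A B c h (A t0 x0) x0 ht0.1 (by positivity) hG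
      (hu.restrict ht0.2) (fun t ht => hs t ⟨ht.1, ht.2.trans_le ht0.2⟩)
      (fun t ht => hM t ⟨ht.1, ht.2.trans ht0.2⟩) (hco.ell t0 ht0 x0) (by
        intro t ht htκ
        have htT : t ∈ Icc 0 T := ⟨ht.1, ht.2.trans ht0.2⟩
        refine ⟨fun x hx => ?_, fun x _ => hco.bB t htT x, fun x _ => hco.bc t htT x,
          fun x _ => hh t htT x, fun x _ y _ => hco.hA t htT x y, fun x _ y _ => hco.hB t htT x y,
          fun x _ y _ => hco.hc t htT x y, fun x _ y _ => hhol t htT x y⟩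
        rw [mem_closedBall, dist_eq_norm] at hx
        calc ‖A t x - A t0 x0‖ = ‖(A t x - A t x0) + (A t x0 - A t0 x0)‖ := by abel_nf
          _ ≤ C * r ^ θ + C * κ ^ β := by
            refine (norm_add_le _ _).trans (add_le_add ?_ ?_)
            · exact (hco.hA t htT x x0).trans (by gcongr)
            · refine (hco.tA x0 t htT t0 ht0).trans ?_
              have : |t - t0| ≤ κ := by rw [abs_le]; constructor <;> linarith [ht.2]
              gcongr
          _ ≤ ε := by linarith) (Or.inl hu0)
    have ht0' : t0 ∈ Icc 0 t0 := ⟨ht0.1, le_rfl⟩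
    refine ⟨v t0, (hv.sp t0 ht0').mono (by simp only [hK']; apply le_of_eq; ring), fun x hx => ?_⟩
    have he : u t0 =ᶠ[𝓝 x] v t0 := by
      filter_upwards [isOpen_ball.mem_nhds hx] with y hy
      exact (hvu t0 ht0' le_rfl y (ball_subset_closedBall hy)).symm
    exact ⟨he.eq_of_nhds, he.fderiv_eq, he.fderiv.fderiv_eq⟩
  have hb : ∀ t ∈ Icc 0 T, ∀ x, |u t x| ≤ K' * G ∧ ‖D (u t) x‖ ≤ K' * G ∧
      ‖D2 (u t) x‖ ≤ K' * G := by
    intro t ht x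
    obtain ⟨φ, hφ, he⟩ := key t ht x
    obtain ⟨e0, e1, e2⟩ := he x (mem_ball_self (by positivity))
    rw [e0, e1, e2]
    exact ⟨hφ.b0 x, hφ.b1 x, hφ.b2 x⟩
  have q1 : 0 ≤ 2 * K' / (r / 2) ^ θ := by positivity
  have q2 : 0 ≤ (N ^ 2 * C + 2 * C) * K' := by positivity
  have hle : K' * G ≤ (K' + 2 * K' / (r / 2) ^ θ + (N ^ 2 * C + 2 * C) * K' + 1) * G := by
    gcongr; linarith
  refine ⟨fun t ht => ⟨(hu.sp t ht).cd, fun x => (hb t ht x).1.trans hle,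
    fun x => (hb t ht x).2.1.trans hle, fun x => (hb t ht x).2.2.trans hle, fun x y => ?_⟩,
    fun x => ?_⟩
  · rcases lt_or_ge ‖x - y‖ (r / 2) with hxy | hxy
    · obtain ⟨φ, hφ, he⟩ := key t ht y
      rw [(he x (by rwa [mem_ball, dist_eq_norm])).2.2,
        (he y (mem_ball_self (by positivity))).2.2]
      exact (hφ.hol x y).trans (by gcongr)
    · have e1 : 2 * (K' * G) ≤ 2 * K' / (r / 2) ^ θ * G * ‖x - y‖ ^ θ := by
        calc 2 * (K' * G) = 2 * K' / (r / 2) ^ θ * G * (r / 2) ^ θ := by field_simp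
          _ ≤ _ := by gcongr
      refine (norm_sub_le _ _).trans ((add_le_add (hb t ht x).2.2 (hb t ht y).2.2).trans ?_)
      have e2 : 0 ≤ (K' + (N ^ 2 * C + 2 * C) * K' + 1) * G * ‖x - y‖ ^ θ := by positivity
      nlinarith
  · refine abs_sub_le_of_hasDerivAt (hu.continuousOn_time x) (fun t ht => hs t ht x)
      fun t ht => ?_
    have ht' := Ioo_subset_Icc_self ht
    obtain ⟨b0, b1, b2⟩ := hb t ht' x
    have e1 := abs_LA_le ((hco.ell t ht' x).norm_le hCp.le) (hco.bB t ht' x) (hco.bc t ht' x)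
      b0 b1 b2
    refine (abs_add_le _ _).trans ((add_le_add e1 (hh t ht' x)).trans ?_)
    have e2 : 0 ≤ (K' + 2 * K' / (r / 2) ^ θ) * G := by positivity
    linarith

end GlobalEstimate

section Closure
variable {N : ℕ} {θ : ℝ}

lemma tendsto_clm_apply {ι E F : Type*} [NormedAddCommGroup E] [NormedSpace ℝ E]
    [NormedAddCommGroup F] [NormedSpace ℝ F] {l : Filter ι} {L : ι → E →L[ℝ] F} {L0 : E →L[ℝ] F}
    {v : ι → E} {v0 : E} (hL : Tendsto L l (𝓝 L0)) (hv : Tendsto v l (𝓝 v0)) :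
    Tendsto (fun i => L i (v i)) l (𝓝 (L0 v0)) :=
  (isBoundedBilinearMap_apply.continuous.tendsto (L0, v0)).comp (hL.prodMk_nhds hv)

lemma hasFDerivAt_of_remainder {E F : Type*} [NormedAddCommGroup E] [NormedSpace ℝ E]
    [NormedAddCommGroup F] [NormedSpace ℝ F] {f : E → F} {f' : E →L[ℝ] F} {x : E} {ω : ℝ → ℝ}
    (hω : ContinuousAt ω 0) (hω0 : ω 0 = 0)
    (h : ∀ y, ‖f y - f x - f' (y - x)‖ ≤ ω ‖y - x‖ * ‖y - x‖) : HasFDerivAt f f' x := by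
  rw [hasFDerivAt_iff_isLittleO]
  have ho : (fun y => ω ‖y - x‖) =o[𝓝 x] fun _ => (1:ℝ) := by
    rw [Asymptotics.isLittleO_one_iff, ← hω0]
    refine hω.tendsto.comp ?_
    have : Continuous fun y : E => ‖y - x‖ := by fun_prop
    simpa using this.tendsto x
  have h3 := ho.mul_isBigO (Asymptotics.isBigO_refl (fun y => ‖y - x‖) (𝓝 x))
  simp only [one_mul] at h3
  refine (Asymptotics.IsBigO.of_bound' (Eventually.of_forall fun y => ?_)).trans_isLittleO
    h3.of_norm_right
  exact (h y).trans (le_abs_self _)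

/-- A second-order jet with Taylor estimates comes from a `C^{2,θ}` function. -/
lemma C2b.of_jet (hθ : 0 < θ) {C : ℝ} {φ : ES N → ℝ} {p : ES N → V1 N} {H : ES N → H2 N}
    (b0 : ∀ x, |φ x| ≤ C) (b1 : ∀ x, ‖p x‖ ≤ C) (b2 : ∀ x, ‖H x‖ ≤ C) (hH : Hol θ C H)
    (t0 : ∀ x y, |φ y - φ x - p x (y - x)| ≤ C * ‖y - x‖ ^ 2)
    (t1 : ∀ x y, ‖p y - p x - H x (y - x)‖ ≤ C * ‖y - x‖ ^ θ * ‖y - x‖) :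
    C2b θ C φ ∧ D φ = p ∧ D2 φ = H := by
  have d0 : ∀ x, HasFDerivAt φ (p x) x := fun x =>
    hasFDerivAt_of_remainder (ω := fun r => C * r) (by fun_prop) (by simp) fun y =>
      (t0 x y).trans (le_of_eq (by ring))
  have d1 : ∀ x, HasFDerivAt p (H x) x := fun x =>
    hasFDerivAt_of_remainder (ω := fun r => C * r ^ θ)
      (continuous_const.mul (Real.continuous_rpow_const hθ.le)).continuousAt
      (by simp [Real.zero_rpow hθ.ne']) (t1 x)
  have e0 : D φ = p := funext fun x => (d0 x).fderiv
  have e1 : D2 φ = H := by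
    show fderiv ℝ (D φ) = H
    rw [e0]
    exact funext fun x => (d1 x).fderiv
  refine ⟨⟨?_, b0, fun x => by rw [e0]; exact b1 x, fun x => by rw [e1]; exact b2 x, by rwa [e1]⟩,
    e0, e1⟩
  have c1 : ContDiff ℝ 1 p :=
    contDiff_one_iff_hasFDerivAt.2 ⟨H, hH.continuous hθ, d1⟩
  rw [show (2 : WithTop ℕ∞) = 1 + 1 by norm_num, contDiff_succ_iff_fderiv]
  refine ⟨fun x => (d0 x).differentiableAt, by simp, ?_⟩
  show ContDiff ℝ 1 (D φ)
  rwa [e0]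

lemma Ultrafilter.exists_tendsto_of_bdd {ι E : Type*} [NormedAddCommGroup E] [ProperSpace E]
    (U : Ultrafilter ι) {f : ι → E} {C : ℝ} (h : ∀ n, ‖f n‖ ≤ C) :
    ∃ l, Tendsto f U (𝓝 l) := by
  obtain ⟨l, -, hl⟩ := (isCompact_closedBall (0:E) C).ultrafilter_le_nhds (U.map f) (by
    rw [Ultrafilter.coe_map, le_principal_iff, Filter.mem_map]
    exact Filter.univ_mem' fun n => by simpa using h n)
  exact ⟨l, hl⟩

/-- Compactness of bounded sets of `C^{2,θ}` under locally uniform `C²` convergence. -/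
lemma C2b.exists_tendsto {ι : Type*} (U : Ultrafilter ι) (hθ : 0 < θ) {C : ℝ}
    {φ : ι → ES N → ℝ} (h : ∀ n, C2b θ C (φ n)) : ∃ ψ, C2b θ C ψ ∧ ∀ x,
      Tendsto (fun n => φ n x) U (𝓝 (ψ x)) ∧ Tendsto (fun n => D (φ n) x) U (𝓝 (D ψ x)) ∧
      Tendsto (fun n => D2 (φ n) x) U (𝓝 (D2 ψ x)) := by
  have : ProperSpace (V1 N) := FiniteDimensional.proper ℝ _
  have : ProperSpace (H2 N) := FiniteDimensional.proper ℝ _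
  choose ψ hψ using fun x => U.exists_tendsto_of_bdd (f := fun n => φ n x) (fun n => (h n).b0 x)
  choose p hp using fun x => U.exists_tendsto_of_bdd (f := fun n => D (φ n) x)
    (fun n => (h n).b1 x)
  choose H hH using fun x => U.exists_tendsto_of_bdd (f := fun n => D2 (φ n) x)
    (fun n => (h n).b2 x)
  obtain ⟨n0⟩ : Nonempty ι := U.neBot.nonempty
  have hC := (h n0).nonneg
  obtain ⟨e0, e1, e2⟩ := C2b.of_jet hθ (φ := ψ) (p := p) (H := H) (C := C)
    (fun x => le_of_tendsto (hψ x).abs (Eventually.of_forall fun n => (h n).b0 x))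
    (fun x => le_of_tendsto (hp x).norm (Eventually.of_forall fun n => (h n).b1 x))
    (fun x => le_of_tendsto (hH x).norm (Eventually.of_forall fun n => (h n).b2 x))
    (fun x y => le_of_tendsto ((hH x).sub (hH y)).norm
      (Eventually.of_forall fun n => (h n).hol x y))
    (fun x y => le_of_tendsto (((hψ y).sub (hψ x)).sub
        (tendsto_clm_apply (hp x) tendsto_const_nhds)).abs
      (Eventually.of_forall fun n => taylor_D2 (h n).cd (h n).b2 x y))
    (fun x y => le_of_tendsto (((hp y).sub (hp x)).sub
        (tendsto_clm_apply (hH x) tendsto_const_nhds)).norm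
      (Eventually.of_forall fun n => taylor_D_hol hθ.le hC (h n).cd (h n).hol x y))
  exact ⟨ψ, e0, fun x => ⟨hψ x, by rw [e1]; exact hp x, by rw [e2]; exact hH x⟩⟩

/-- Pointwise convergence together with the first two space derivatives. -/
def XTendsto {ι : Type*} (T : ℝ) (l : Filter ι) (u : ι → ℝ → ES N → ℝ) (v : ℝ → ES N → ℝ) : Prop :=
  ∀ t ∈ Icc 0 T, ∀ x, Tendsto (fun n => u n t x) l (𝓝 (v t x)) ∧
    Tendsto (fun n => D (u n t) x) l (𝓝 (D (v t) x)) ∧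
    Tendsto (fun n => D2 (u n t) x) l (𝓝 (D2 (v t) x))

lemma XB.exists_tendsto {ι : Type*} (U : Ultrafilter ι) (hθ : 0 < θ) {T C : ℝ}
    {u : ι → ℝ → ES N → ℝ} (h : ∀ n, XB T θ C (u n)) : ∃ v, XB T θ C v ∧ XTendsto T U u v := by
  have : ∀ t, ∃ ψ : ES N → ℝ, t ∈ Icc 0 T → C2b θ C ψ ∧ ∀ x,
      Tendsto (fun n => u n t x) U (𝓝 (ψ x)) ∧ Tendsto (fun n => D (u n t) x) U (𝓝 (D ψ x)) ∧
      Tendsto (fun n => D2 (u n t) x) U (𝓝 (D2 ψ x)) := by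
    intro t
    by_cases ht : t ∈ Icc 0 T
    · obtain ⟨ψ, h1, h2⟩ := C2b.exists_tendsto U hθ fun n => (h n).sp t ht
      exact ⟨ψ, fun _ => ⟨h1, h2⟩⟩
    · exact ⟨0, fun h => absurd h ht⟩
  choose v hv using this
  refine ⟨v, ⟨fun t ht => (hv t ht).1, fun x t ht s hs => ?_⟩, fun t ht x => (hv t ht).2 x⟩
  exact le_of_tendsto (((hv t ht).2 x).1.sub ((hv s hs).2 x).1).abs
    (Eventually.of_forall fun n => (h n).tl x t ht s hs)

lemma tendsto_prod_of_modulus {ι F : Type*} [NormedAddCommGroup F] {l : Filter ι} {f : ι → ℝ → F}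
    {S : Set ℝ} {t0 : ℝ} {a : F} {ω : ℝ → ℝ} (hω : Continuous ω) (hω0 : ω 0 = 0) (hS : S ∈ 𝓝 t0)
    (h1 : ∀ n, ∀ t ∈ S, ‖f n t - f n t0‖ ≤ ω |t - t0|)
    (h2 : Tendsto (fun n => f n t0) l (𝓝 a)) :
    Tendsto (fun p : ι × ℝ => f p.1 p.2) (l ×ˢ 𝓝 t0) (𝓝 a) := by
  rw [tendsto_iff_norm_sub_tendsto_zero]
  have e1 : Tendsto (fun p : ι × ℝ => ω |p.2 - t0| + ‖f p.1 t0 - a‖) (l ×ˢ 𝓝 t0) (𝓝 (0 + 0)) := by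
    refine Tendsto.add ?_ ((tendsto_iff_norm_sub_tendsto_zero.1 h2).comp tendsto_fst)
    have : Continuous fun t => ω |t - t0| := by fun_prop
    have h3 := this.tendsto t0
    rw [sub_self, abs_zero, hω0] at h3
    exact h3.comp tendsto_snd
  rw [add_zero] at e1
  refine squeeze_zero' (Eventually.of_forall fun _ => norm_nonneg _) ?_ e1
  filter_upwards [tendsto_snd.eventually hS] with p hp
  calc ‖f p.1 p.2 - a‖ = ‖(f p.1 p.2 - f p.1 t0) + (f p.1 t0 - a)‖ := by abel_nf
    _ ≤ _ := (norm_add_le _ _).trans (by gcongr; exact h1 _ _ hp)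

/-- Passing to the limit in the equation at a point. -/
lemma XTendsto.hasDerivAt {ι : Type*} {l : Filter ι} [l.NeBot] (hθ : 0 < θ) {T C a b t0 h0 : ℝ}
    {u : ι → ℝ → ES N → ℝ} {v : ℝ → ES N → ℝ} {A : ℝ → ES N → H2 N →L[ℝ] ℝ}
    {B : ℝ → ES N → V1 N →L[ℝ] ℝ} {c : ℝ → ES N → ℝ} {h : ι → ℝ → ℝ} {x : ES N}
    (hu : ∀ n, XB T θ C (u n)) (hv : XTendsto T l u v) (ha : 0 ≤ a) (hb : b ≤ T)
    (ht0 : t0 ∈ Ioo a b) (hs : ∀ᶠ n in l, ∀ t ∈ Ioo a b,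
      HasDerivAt (fun r => u n r x) (LA A B c (u n t) t x + h n t) t)
    (hA : ContinuousAt (fun t => A t x) t0) (hB : ContinuousAt (fun t => B t x) t0)
    (hc : ContinuousAt (fun t => c t x) t0)
    (hh : Tendsto (fun p : ι × ℝ => h p.1 p.2) (l ×ˢ 𝓝 t0) (𝓝 h0)) :
    HasDerivAt (fun r => v r x) (LA A B c (v t0) t0 x + h0) t0 := by
  have hsub : Ioo a b ⊆ Icc 0 T := fun t ht => ⟨ha.trans ht.1.le, ht.2.le.trans hb⟩
  have hS : Ioo a b ∈ 𝓝 t0 := isOpen_Ioo.mem_nhds ht0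
  obtain ⟨l0, l1, l2⟩ := hv t0 (hsub ht0) x
  have j0 : Tendsto (fun p : ι × ℝ => u p.1 p.2 x) (l ×ˢ 𝓝 t0) (𝓝 (v t0 x)) :=
    tendsto_prod_of_modulus (f := fun n t => u n t x) (ω := fun r => C * r) (by fun_prop) (by simp)
      hS (fun n t ht => (hu n).tl x t (hsub ht) t0 (hsub ht0)) l0
  have j1 : Tendsto (fun p : ι × ℝ => D (u p.1 p.2) x) (l ×ˢ 𝓝 t0) (𝓝 (D (v t0) x)) :=
    tendsto_prod_of_modulus (f := fun n t => D (u n t) x) (ω := fun r => 4 * C * r ^ (1 / 2 : ℝ))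
      (continuous_const.mul (Real.continuous_rpow_const (by norm_num))) (by simp)
      hS (fun n t ht => (hu n).D_time (hsub ht) (hsub ht0) x) l1
  have j2 : Tendsto (fun p : ι × ℝ => D2 (u p.1 p.2) x) (l ×ˢ 𝓝 t0) (𝓝 (D2 (v t0) x)) :=
    tendsto_prod_of_modulus (f := fun n t => D2 (u n t) x)
      (ω := fun r => 4 * C * r ^ (θ / 4) + 4 * C * r ^ (1 / 2 : ℝ))
      ((continuous_const.mul (Real.continuous_rpow_const (by positivity))).add
        (continuous_const.mul (Real.continuous_rpow_const (by norm_num))))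
      (by simp [Real.zero_rpow (by positivity : θ / 4 ≠ 0)])
      hS (fun n t ht => (hu n).D2_time hθ.le (hsub ht) (hsub ht0) x) l2
  have j : Tendsto (fun p : ι × ℝ => LA A B c (u p.1 p.2) p.2 x + h p.1 p.2) (l ×ˢ 𝓝 t0)
      (𝓝 (LA A B c (v t0) t0 x + h0)) :=
    (((tendsto_clm_apply (hA.tendsto.comp tendsto_snd) j2).add
      (tendsto_clm_apply (hB.tendsto.comp tendsto_snd) j1)).add
      ((hc.tendsto.comp tendsto_snd).mul j0)).add hh
  refine hasDerivAt_of_tendstoUniformlyOnFilter (l := l) (f := fun n r => u n r x)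
    (f' := fun n t => LA A B c (u n t) t x + h n t)
    (g' := fun _ => LA A B c (v t0) t0 x + h0) ?_ ?_ ?_
  · rw [Metric.tendstoUniformlyOnFilter_iff]
    intro e he
    filter_upwards [Metric.tendsto_nhds.1 j e he] with p hp
    rw [dist_comm]; exact hp
  · filter_upwards [hs.prod_mk hS] with p hp
    exact hp.1 p.2 hp.2
  · filter_upwards [hS] with t ht
    exact (hv t (hsub ht) x).1

end Closure

section Laplace
variable {N : ℕ} {θ : ℝ}

/-- The Laplacian as a functional of the Hessian. -/
def lapL (N : ℕ) : H2 N →L[ℝ] ℝ := trL fun i j => if i = j then 1 else 0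

lemma lapL_apply (H : H2 N) : lapL N H = ∑ k, H (eb k) (eb k) := by
  simp [lapL, trL_apply]

lemma ell_lapL : Ell 1 1 (lapL N) := by
  refine ⟨_, fun i j => by simp [eq_comm], fun i j => by split_ifs <;> simp, fun ξ => ?_, rfl⟩
  rw [EuclideanSpace.norm_sq_eq]
  simp [sq]

/-- Averages of `C^{2,θ}` functions. -/
lemma C2b.integral {X : Type*} [MeasurableSpace X] {μ : Measure X} [IsFiniteMeasure μ] (hθ : 0 < θ)
    {C : ℝ} {Ψ : X → ES N → ℝ} (h : ∀ s, C2b θ C (Ψ s))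
    (m0 : ∀ x, AEStronglyMeasurable (fun s => Ψ s x) μ)
    (m1 : ∀ x, AEStronglyMeasurable (fun s => D (Ψ s) x) μ)
    (m2 : ∀ x, AEStronglyMeasurable (fun s => D2 (Ψ s) x) μ) :
    C2b θ (C * μ.real univ) (fun x => ∫ s, Ψ s x ∂μ) ∧
      (D fun x => ∫ s, Ψ s x ∂μ) = (fun x => ∫ s, D (Ψ s) x ∂μ) ∧
      (D2 fun x => ∫ s, Ψ s x ∂μ) = fun x => ∫ s, D2 (Ψ s) x ∂μ := by
  have i0 : ∀ x, Integrable (fun s => Ψ s x) μ := fun x =>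
    (integrable_const C).mono' (m0 x) (Eventually.of_forall fun s => (h s).b0 x)
  have i1 : ∀ x, Integrable (fun s => D (Ψ s) x) μ := fun x =>
    (integrable_const C).mono' (m1 x) (Eventually.of_forall fun s => (h s).b1 x)
  have i2 : ∀ x, Integrable (fun s => D2 (Ψ s) x) μ := fun x =>
    (integrable_const C).mono' (m2 x) (Eventually.of_forall fun s => (h s).b2 x)
  have bd : ∀ {F : Type _} [NormedAddCommGroup F] [NormedSpace ℝ F] {f : X → F} {a : ℝ},
      (∀ s, ‖f s‖ ≤ C * a) → ‖∫ s, f s ∂μ‖ ≤ C * μ.real univ * a := fun hf =>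
    (norm_integral_le_of_norm_le_const (Eventually.of_forall hf)).trans (le_of_eq (by ring))
  refine C2b.of_jet hθ (fun x => ?_) (fun x => ?_) (fun x => ?_) (fun x y => ?_) (fun x y => ?_)
    (fun x y => ?_)
  · simpa using bd (f := fun s => Ψ s x) (a := 1) fun s => by simpa using (h s).b0 x
  · simpa using bd (f := fun s => D (Ψ s) x) (a := 1) fun s => by simpa using (h s).b1 x
  · simpa using bd (f := fun s => D2 (Ψ s) x) (a := 1) fun s => by simpa using (h s).b2 x
  · rw [← integral_sub (i2 x) (i2 y)]
    exact bd fun s => (h s).hol x y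
  · rw [ContinuousLinearMap.integral_apply (i1 x), ← integral_sub (i0 y) (i0 x),
      ← integral_sub (f := fun s => Ψ s y - Ψ s x) ((i0 y).sub (i0 x))
        ((i1 x).apply_continuousLinearMap _), ← Real.norm_eq_abs]
    exact bd fun s => taylor_D2 (h s).cd (h s).b2 x y
  · rw [ContinuousLinearMap.integral_apply (i2 x), ← integral_sub (i1 y) (i1 x),
      ← integral_sub (f := fun s => D (Ψ s) y - D (Ψ s) x) ((i1 y).sub (i1 x))
        ((i2 x).apply_continuousLinearMap _), mul_assoc]
    exact bd fun s => by
      rw [← mul_assoc]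
      exact taylor_D_hol hθ.le (h s).nonneg (h s).cd (h s).hol x y

lemma C2b.translate {C : ℝ} {φ : ES N → ℝ} (h : C2b θ C φ) (w : ES N) :
    C2b θ C (fun x => φ (x + w)) ∧ (D fun x => φ (x + w)) = (fun x => D φ (x + w)) ∧
      (D2 fun x => φ (x + w)) = fun x => D2 φ (x + w) := by
  have e1 : (D fun x => φ (x + w)) = fun x => D φ (x + w) := funext fun x => fderiv_comp_add_right w
  have e2 : (D2 fun x => φ (x + w)) = fun x => D2 φ (x + w) := by
    show fderiv ℝ (D fun x => φ (x + w)) = _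
    rw [e1]
    exact funext fun x => fderiv_comp_add_right w
  refine ⟨⟨h.cd.comp (contDiff_id.add contDiff_const), fun x => h.b0 _, fun x => ?_, fun x => ?_,
    fun x y => ?_⟩, e1, e2⟩
  · rw [e1]; exact h.b1 _
  · rw [e2]; exact h.b2 _
  · rw [e2]; simpa using h.hol (x + w) (y + w)

/-- Joint continuity from continuity in time and a uniform Hölder condition in space. -/
lemma continuous_uncurry_of_hol {F : Type*} [NormedAddCommGroup F] (hθ : 0 < θ) {C : ℝ}
    {f : ℝ → ES N → F} (h : ∀ t, Hol θ C (f t)) (hc : ∀ x, Continuous fun t => f t x) :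
    Continuous fun p : ℝ × ES N => f p.1 p.2 := by
  rw [continuous_iff_continuousAt]
  rintro ⟨t, x⟩
  rw [ContinuousAt, tendsto_iff_norm_sub_tendsto_zero]
  have e1 : Tendsto (fun p : ℝ × ES N => C * ‖p.2 - x‖ ^ θ + ‖f p.1 x - f t x‖) (𝓝 (t, x))
      (𝓝 0) := by
    have hr : Continuous fun r : ℝ => r ^ θ := Real.continuous_rpow_const hθ.le
    have := hc x
    have h2 : Continuous (fun p : ℝ × ES N => C * ‖p.2 - x‖ ^ θ + ‖f p.1 x - f t x‖) := by
      refine (continuous_const.mul (hr.comp (by fun_prop))).add (by fun_prop)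
    simpa [Real.zero_rpow hθ.ne'] using h2.tendsto (t, x)
  refine squeeze_zero (fun _ => norm_nonneg _) (fun p => ?_) e1
  calc ‖f p.1 p.2 - f t x‖ = ‖(f p.1 p.2 - f p.1 x) + (f p.1 x - f t x)‖ := by abel_nf
    _ ≤ _ := (norm_add_le _ _).trans (by gcongr; exact h p.1 _ _)

/-- Time-continuous families of functions bounded in `C^{2,θ}`. -/
structure SB (θ G : ℝ) (h : ℝ → ES N → ℝ) : Prop where
  sp : ∀ t, C2b θ G (h t)
  c0 : ∀ x, Continuous fun t => h t x
  c1 : ∀ x, Continuous fun t => D (h t) x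
  c2 : ∀ x, Continuous fun t => D2 (h t) x

/-- The Gaussian measure with density `gG`. -/
def gM (N : ℕ) : Measure (ES N) := volume.withDensity fun z => ENNReal.ofReal (gG z)

instance : IsFiniteMeasure (gM N) := isFiniteMeasure_withDensity_ofReal integrable_gG.2

lemma hP_eq (σ : ES N →L[ℝ] ES N) (r : ℝ) (f : ES N → ℝ) (x : ES N) :
    hP σ r f x = ∫ z, f (x + Real.sqrt r • σ z) ∂gM N := by
  rw [gM, integral_withDensity_eq_integral_toReal_smul (by fun_prop)
    (Eventually.of_forall fun _ => ENNReal.ofReal_lt_top)]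
  refine integral_congr_ae (Eventually.of_forall fun z => ?_)
  simp only [ENNReal.toReal_ofReal (gG_pos z).le, smul_eq_mul, mul_comm]

lemma gM_real_univ : (gM N).real univ = 1 := by
  have h := hP_eq (N := N) 0 0 (fun _ => 1) 0
  simp only [hP, one_mul, integral_gG, integral_const, smul_eq_mul, mul_one] at h
  exact h.symm

lemma continuous_avg {F : Type*} [NormedAddCommGroup F] [NormedSpace ℝ F]
    {ψ : ℝ → ES N → F} {K : ℝ} (hψ : Continuous fun p : ℝ × ES N => ψ p.1 p.2)
    (hK : ∀ t x, ‖ψ t x‖ ≤ K) (σ : ES N →L[ℝ] ES N) (x : ES N) :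
    Continuous fun p : ℝ × ℝ => ∫ z, ψ p.2 (x + Real.sqrt (p.1 - p.2) • σ z) ∂gM N := by
  refine continuous_of_dominated (bound := fun _ => K) (fun p => ?_)
    (fun p => Eventually.of_forall fun z => hK _ _) (integrable_const K)
    (Eventually.of_forall fun z => ?_)
  · exact (hψ.comp (by fun_prop : Continuous fun z : ES N =>
      (p.2, x + Real.sqrt (p.1 - p.2) • σ z))).aestronglyMeasurable
  · exact hψ.comp (by fun_prop : Continuous fun p : ℝ × ℝ =>
      (p.2, x + Real.sqrt (p.1 - p.2) • σ z))

lemma continuous_hP {ψ : ℝ → ES N → ℝ} {K : ℝ} (hψ : Continuous fun p : ℝ × ES N => ψ p.1 p.2)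
    (hK : ∀ t x, |ψ t x| ≤ K) (σ : ES N →L[ℝ] ES N) (x : ES N) :
    Continuous fun p : ℝ × ℝ => hP σ (p.1 - p.2) (ψ p.2) x := by
  simp only [hP_eq]
  exact continuous_avg hψ hK σ x

lemma C2b.hP (hθ : 0 < θ) {C : ℝ} {φ : ES N → ℝ} (h : C2b θ C φ) (σ : ES N →L[ℝ] ES N) (r : ℝ) :
    C2b θ C (hP σ r φ) ∧ D (hP σ r φ) = (fun x => ∫ z, D φ (x + Real.sqrt r • σ z) ∂gM N) ∧
      D2 (hP σ r φ) = fun x => ∫ z, D2 φ (x + Real.sqrt r • σ z) ∂gM N := by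
  have c1 := h.diff1.continuous
  have c2 := h.hol.continuous hθ
  have c0 := h.cd.continuous
  have e : _root_.hP σ r φ = fun x => ∫ z, φ (x + Real.sqrt r • σ z) ∂gM N :=
    funext fun x => hP_eq σ r φ x
  have := C2b.integral (μ := gM N) (Ψ := fun z x => φ (x + Real.sqrt r • σ z)) hθ
    (fun z => (h.translate _).1)
    (fun x => (by fun_prop : Continuous fun z : ES N => _).aestronglyMeasurable)
    (fun x => by
      simp only [(h.translate _).2.1]
      exact (c1.comp (by fun_prop)).aestronglyMeasurable)
    (fun x => by
      simp only [(h.translate _).2.2]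
      exact (c2.comp (by fun_prop)).aestronglyMeasurable)
  rw [gM_real_univ, mul_one] at this
  simp only [(h.translate _).2.1, (h.translate _).2.2] at this
  rwa [e]

/-- Integral form of the heat equation. -/
lemma hP_sub_eq_integral (hθ : 0 < θ) {C : ℝ} {φ : ES N → ℝ} (h : C2b θ C φ) {s t : ℝ} (hst : s ≤ t)
    (x : ES N) : hP (.id ℝ _) (t - s) φ x - φ x =
      ∫ τ in s..t, hP (.id ℝ _) (τ - s) (fun y => lapL N (D2 φ y)) x := by
  have hc2 : Continuous (D2 φ) := h.hol.continuous hθ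
  have hb : ∀ y, |lapL N (D2 φ y)| ≤ ‖lapL N‖ * C := fun y =>
    ((lapL N).le_opNorm _).trans (by gcongr; exact h.b2 y)
  have k0 : Continuous fun p : ℝ × ℝ => hP (.id ℝ _) (p.1 - p.2) φ x :=
    continuous_hP (ψ := fun _ => φ) (h.cd.continuous.comp continuous_snd) (fun _ => h.b0) _ x
  have k1 : Continuous fun p : ℝ × ℝ => hP (.id ℝ _) (p.1 - p.2) (fun y => lapL N (D2 φ y)) x :=
    continuous_hP (ψ := fun _ y => lapL N (D2 φ y))
      ((lapL N).continuous.comp (hc2.comp continuous_snd)) (fun _ => hb) _ x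
  rw [intervalIntegral.integral_eq_sub_of_hasDerivAt_of_le hst
    (f := fun τ => hP (.id ℝ _) (τ - s) φ x)
    (f' := fun τ => hP (.id ℝ _) (τ - s) (fun y => lapL N (D2 φ y)) x)
    (k0.comp (by fun_prop : Continuous fun τ : ℝ => (τ, s))).continuousOn (fun τ hτ => ?_)
    ((k1.comp (by fun_prop : Continuous fun τ : ℝ => (τ, s))).intervalIntegrable _ _)]
  · rw [sub_self, hP_zero]
  · have hX : XB (τ - s + 1) θ C (fun _ => φ) := ⟨fun _ _ => h, fun y a _ b _ => by
      rw [sub_self, abs_zero]; exact mul_nonneg h.nonneg (abs_nonneg _)⟩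
    have := hasDerivAt_hP hX (A := lapL N) (σ := .id ℝ _) hθ (fun H => by simp [lapL_apply])
      (h := fun _ y => -(lapL N (D2 φ y))) (Hb := ‖lapL N‖ * C)
      (fun r _ y => by simpa using hasDerivAt_const r (φ y))
      (fun _ _ y => by rw [abs_neg]; exact hb y)
      (fun _ _ => ((lapL N).continuous.comp hc2).neg) (t := τ - s + 1) le_rfl (s := 1)
      ⟨one_pos, by linarith [hτ.1]⟩ x
    have h2 : HasDerivAt (fun r : ℝ => τ - s + 1 - (r - s)) (-1) τ := by
      simpa using ((hasDerivAt_id τ).sub_const s).const_sub (τ - s + 1)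
    have h3 := HasDerivAt.comp τ (by
      rw [show τ - s + 1 - (τ - s) = 1 by ring]; exact this) h2
    refine (h3.congr_of_eventuallyEq (Eventually.of_forall fun r => ?_)).congr_deriv ?_
    · simp only [Function.comp]
      congr 1; ring
    · rw [show τ - s + 1 - 1 = τ - s by ring]
      simp [hP, integral_neg]

lemma integral_triangle_swap {E : ℝ → ℝ → ℝ} (hE : Continuous fun p : ℝ × ℝ => E p.1 p.2) {t : ℝ}
    (ht : 0 ≤ t) : ∫ s in (0:ℝ)..t, ∫ τ in s..t, E τ s =
      ∫ τ in (0:ℝ)..t, ∫ s in (0:ℝ)..τ, E τ s := by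
  set S : Set (ℝ × ℝ) := {p | p.1 < p.2}
  have hS : MeasurableSet S := measurableSet_lt measurable_fst measurable_snd
  set F : ℝ × ℝ → ℝ := S.indicator fun p => E p.2 p.1 with hF
  have e1 : ∀ s ∈ Ioc 0 t, ∫ τ in s..t, E τ s = ∫ τ in Ioc 0 t, F (s, τ) := by
    intro s hs
    have : (fun τ => F (s, τ)) = (Ioi s).indicator fun τ => E τ s := by
      ext τ; simp [hF, S, indicator]
    rw [this, setIntegral_indicator measurableSet_Ioi, intervalIntegral.integral_of_le hs.2,
      Ioc_inter_Ioi, sup_of_le_right hs.1.le]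
  have e2 : ∀ τ ∈ Ioc 0 t, ∫ s in (0:ℝ)..τ, E τ s = ∫ s in Ioc 0 t, F (s, τ) := by
    intro τ hτ
    have : (fun s => F (s, τ)) = (Iio τ).indicator fun s => E τ s := by
      ext s; simp [hF, S, indicator]
    rw [this, setIntegral_indicator measurableSet_Iio, intervalIntegral.integral_of_le hτ.1.le,
      integral_Ioc_eq_integral_Ioo]
    congr 2
    ext s
    simp only [mem_inter_iff, mem_Ioc, mem_Ioo, mem_Iio]
    constructor
    · rintro ⟨h1, h2⟩; exact ⟨⟨h1, h2.le.trans hτ.2⟩, h2⟩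
    · rintro ⟨h1, h2⟩; exact ⟨h1.1, h2⟩
  rw [intervalIntegral.integral_of_le ht, intervalIntegral.integral_of_le ht,
    setIntegral_congr_fun measurableSet_Ioc e1, setIntegral_congr_fun measurableSet_Ioc e2]
  refine integral_integral_swap (f := fun s τ => F (s, τ)) ?_
  have hc : Continuous fun p : ℝ × ℝ => E p.2 p.1 := hE.comp continuous_swap
  have : IntegrableOn (fun p : ℝ × ℝ => E p.2 p.1) (Icc 0 t ×ˢ Icc 0 t) (volume.prod volume) :=
    hc.continuousOn.integrableOn_compact (isCompact_Icc.prod isCompact_Icc)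
  have h2 := (this.mono_set (prod_mono Ioc_subset_Icc_self Ioc_subset_Icc_self)).indicator hS
  rwa [IntegrableOn, ← Measure.prod_restrict] at h2

lemma exists_heat_solution (hθ0 : 0 < θ) (hθ1 : θ < 1) {T G : ℝ} (hT : 0 ≤ T) {h : ℝ → ES N → ℝ}
    (hh : SB θ G h) : ∃ Cu u, XB T θ Cu u ∧
      Solves T (fun _ _ => lapL N) (fun _ _ => 0) (fun _ _ => 0) h u ∧ ∀ x, u 0 x = 0 := by
  have hG := (hh.sp 0).nonneg
  have j0 : Continuous fun p : ℝ × ES N => h p.1 p.2 :=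
    continuous_uncurry_of_hol hθ0 (fun t => (hh.sp t).hol0 hθ0.le hθ1.le) hh.c0
  have j1 : Continuous fun p : ℝ × ES N => D (h p.1) p.2 :=
    continuous_uncurry_of_hol hθ0 (fun t => (hh.sp t).hol1 hθ0.le hθ1.le) hh.c1
  have j2 : Continuous fun p : ℝ × ES N => D2 (h p.1) p.2 :=
    continuous_uncurry_of_hol hθ0 (fun t => (hh.sp t).hol) hh.c2
  set u : ℝ → ES N → ℝ := fun t x => ∫ s in Ioc 0 t, hP (.id ℝ _) (t - s) (h s) x with hu
  have key : ∀ t, C2b θ (G * (volume.restrict (Ioc 0 t)).real univ) (u t) ∧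
      D2 (u t) = fun x => ∫ s in Ioc 0 t, D2 (hP (.id ℝ _) (t - s) (h s)) x := by
    intro t
    have := C2b.integral (μ := volume.restrict (Ioc 0 t)) hθ0
      (Ψ := fun s => hP (.id ℝ _) (t - s) (h s))
      (fun s => ((hh.sp s).hP hθ0 _ _).1)
      (fun x => ((continuous_hP j0 (fun t => (hh.sp t).b0) _ x).comp
        (by fun_prop : Continuous fun s : ℝ => (t, s))).aestronglyMeasurable)
      (fun x => by
        simp only [((hh.sp _).hP hθ0 _ _).2.1]
        exact ((continuous_avg j1 (fun t => (hh.sp t).b1) _ x).comp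
          (by fun_prop : Continuous fun s : ℝ => (t, s))).aestronglyMeasurable)
      (fun x => by
        simp only [((hh.sp _).hP hθ0 _ _).2.2]
        exact ((continuous_avg j2 (fun t => (hh.sp t).b2) _ x).comp
          (by fun_prop : Continuous fun s : ℝ => (t, s))).aestronglyMeasurable)
    exact ⟨this.1, this.2.2⟩
  have hvol : ∀ t ∈ Icc 0 T, (volume.restrict (Ioc 0 t)).real univ ≤ T := by
    intro t ht
    simp [Measure.real, ht.1, ht.2]
  have hsp : ∀ t ∈ Icc 0 T, C2b θ (G * T) (u t) := fun t ht =>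
    (key t).1.mono (mul_le_mul_of_nonneg_left (hvol t ht) hG)
  set E : ES N → ℝ → ℝ → ℝ := fun x τ s => hP (.id ℝ _) (τ - s) (fun y => lapL N (D2 (h s) y)) x
  have hE : ∀ x, Continuous fun p : ℝ × ℝ => E x p.1 p.2 := fun x =>
    continuous_hP (ψ := fun s y => lapL N (D2 (h s) y)) ((lapL N).continuous.comp j2)
      (K := ‖lapL N‖ * G) (fun t y => ((lapL N).le_opNorm _).trans (by
        gcongr; exact (hh.sp t).b2 y)) _ x
  have hlap : ∀ t, 0 ≤ t → ∀ x, lapL N (D2 (u t) x) = ∫ s in (0:ℝ)..t, E x t s := by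
    intro t ht x
    rw [(key t).2, intervalIntegral.integral_of_le ht]
    have hI : Continuous fun s : ℝ => D2 (hP (.id ℝ _) (t - s) (h s)) x := by
      simp only [((hh.sp _).hP hθ0 _ _).2.2]
      exact (continuous_avg j2 (fun t => (hh.sp t).b2) _ x).comp
          (by fun_prop : Continuous fun s : ℝ => (t, s))
    rw [← ContinuousLinearMap.integral_comp_comm _ hI.integrableOn_Ioc]
    refine integral_congr_ae (Eventually.of_forall fun s => ?_)
    simp only [((hh.sp _).hP hθ0 _ _).2.2, E, hP_eq]
    refine (ContinuousLinearMap.integral_comp_comm _ ?_).symm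
    have : Continuous fun z : ES N =>
        D2 (h s) (x + Real.sqrt (t - s) • (ContinuousLinearMap.id ℝ _) z) :=
      ((hh.sp s).hol.continuous hθ0).comp (by fun_prop)
    exact (integrable_const G).mono' this.aestronglyMeasurable
      (Eventually.of_forall fun z => (hh.sp s).b2 _)
  set W : ES N → ℝ → ℝ := fun x τ => h τ x + ∫ s in (0:ℝ)..τ, E x τ s
  have hW : ∀ x, Continuous (W x) := fun x => (hh.c0 x).add
    (intervalIntegral.continuous_parametric_intervalIntegral_of_continuous (f := E x)
      (hE x) continuous_id)
  have huW : ∀ t, 0 ≤ t → ∀ x, u t x = ∫ τ in (0:ℝ)..t, W x τ := by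
    intro t ht x
    have c1 : Continuous fun τ => ∫ s in (0:ℝ)..τ, E x τ s :=
      intervalIntegral.continuous_parametric_intervalIntegral_of_continuous (f := E x)
      (hE x) continuous_id
    rw [intervalIntegral.integral_add ((hh.c0 x).intervalIntegrable _ _)
      (c1.intervalIntegrable _ _), ← integral_triangle_swap (hE x) ht]
    have c2 : Continuous fun s => ∫ τ in s..t, E x τ s := by
      simp only [fun s => intervalIntegral.integral_symm (f := fun τ => E x τ s) (μ := volume) t s]
      exact (intervalIntegral.continuous_parametric_intervalIntegral_of_continuous
        (f := fun s τ => E x τ s) ((hE x).comp continuous_swap) continuous_id).neg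
    rw [← intervalIntegral.integral_add ((hh.c0 x).intervalIntegrable _ _)
      (c2.intervalIntegrable _ _), hu]
    simp only
    rw [← intervalIntegral.integral_of_le ht]
    refine intervalIntegral.integral_congr fun s hs => ?_
    rw [uIcc_of_le ht] at hs
    have := hP_sub_eq_integral hθ0 (hh.sp s) hs.2 x
    simp only [E]
    linarith
  have hd : ∀ t ∈ Ioo 0 T, ∀ x, HasDerivAt (fun r => u r x) (W x t) t := by
    intro t ht x
    refine ((hW x).integral_hasStrictDerivAt 0 t).hasDerivAt.congr_of_eventuallyEq ?_
    filter_upwards [lt_mem_nhds ht.1] with r hr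
    exact huW r hr.le x
  have hWe : ∀ t, 0 ≤ t → ∀ x, W x t = lapL N (D2 (u t) x) + h t x := by
    intro t ht x
    rw [hlap t ht x]
    exact add_comm _ _
  have hWb : ∀ t ∈ Icc 0 T, ∀ x, |W x t| ≤ ‖lapL N‖ * (G * T) + G := by
    intro t ht x
    rw [hWe t ht.1 x]
    refine (abs_add_le _ _).trans (add_le_add (((lapL N).le_opNorm _).trans ?_) ((hh.sp t).b0 x))
    gcongr
    exact (hsp t ht).b2 x
  have q1 : 0 ≤ ‖lapL N‖ * (G * T) := by positivity
  have q2 : 0 ≤ G * T := by positivity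
  refine ⟨G * T + (‖lapL N‖ * (G * T) + G), u, ⟨fun t ht => (hsp t ht).mono (by linarith),
    fun x t ht s hs => ?_⟩, fun t ht x => ?_, fun x => by simp [hu]⟩
  · have hc : ContinuousOn (fun r => u r x) (Icc 0 T) :=
      (intervalIntegral.continuous_primitive (fun a b => (hW x).intervalIntegrable a b)
        0).continuousOn.congr fun r hr => huW r hr.1 x
    refine (abs_sub_le_of_hasDerivAt hc (fun r hr => hd r hr x)
      (fun r hr => hWb r (Ioo_subset_Icc_self hr) x) t ht s hs).trans ?_
    exact mul_le_mul_of_nonneg_right (by linarith) (abs_nonneg _)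
  · refine (hd t ht x).congr_deriv ?_
    rw [hWe t ht.1.le x]
    simp [LA]

end Laplace

section Mollifier
variable {N : ℕ} {θ : ℝ} {E : Type*} [NormedAddCommGroup E] [NormedSpace ℝ E]

lemma norm_integral_smul_le_of_support {f : ES N → ℝ} {M B : ℝ} (hM : ∀ z, |f z| ≤ M)
    {F : ES N → E} (hB : ∀ z, ‖F z‖ ≤ B) {x y : ES N}
    (h0 : ∀ z, 1 < ‖z - x‖ → 1 < ‖z - y‖ → F z = 0) :
    ‖∫ z, f z • F z‖ ≤ 2 * volume.real (closedBall (0 : ES N) 1) * M * B := by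
  have hM0 : 0 ≤ M := (abs_nonneg _).trans (hM 0)
  have hB0 : 0 ≤ B := (norm_nonneg _).trans (hB 0)
  have hv : ∀ w : ES N, volume.real (closedBall w 1) = volume.real (closedBall (0 : ES N) 1) :=
    fun w => by rw [measureReal_def, measureReal_def, Measure.addHaar_closedBall_center]
  rw [← setIntegral_eq_integral_of_forall_compl_eq_zero (s := closedBall x 1 ∪ closedBall y 1)]
  · refine (norm_setIntegral_le_of_norm_le_const (C := M * B) ?_ fun z _ => ?_).trans ?_
    · exact (measure_union_lt_top measure_closedBall_lt_top measure_closedBall_lt_top)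
    · rw [norm_smul, Real.norm_eq_abs]
      exact mul_le_mul (hM z) (hB z) (norm_nonneg _) hM0
    · have := measureReal_union_le (μ := volume) (closedBall x 1) (closedBall y 1)
      rw [hv x, hv y] at this
      calc M * B * volume.real (closedBall x 1 ∪ closedBall y 1)
          ≤ M * B * (volume.real (closedBall (0 : ES N) 1) +
            volume.real (closedBall (0 : ES N) 1)) := by gcongr
        _ = _ := by ring
  · intro z hz
    simp only [mem_union, mem_closedBall, dist_eq_norm, not_or, not_le] at hz
    rw [h0 z hz.1 hz.2, smul_zero]

/-- Smooth mollification kernels with support in `closedBall 0 ρ`. -/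
structure Moll (θ ρ C : ℝ) (k : ES N → ℝ) : Prop where
  sm : C2b θ C k
  nn : ∀ x, 0 ≤ k x
  int1 : ∫ x, k x = 1
  supp : tsupport k ⊆ closedBall 0 ρ

lemma exists_moll (N : ℕ) (h0 : 0 ≤ θ) (h1 : θ ≤ 1) {ρ : ℝ} (hρ : 0 < ρ) :
    ∃ C, ∃ k : ES N → ℝ, Moll θ ρ C k := by
  let φ : ContDiffBump (0 : ES N) := ⟨ρ / 2, ρ, by positivity, by linarith⟩
  have hcd : ContDiff ℝ 3 (φ.normed volume) := φ.contDiff_normed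
  have hcs : HasCompactSupport (φ.normed volume) := φ.hasCompactSupport_normed
  have hb : ∀ n : ℕ, ∃ K, n ≤ 3 → ∀ x, ‖iteratedFDeriv ℝ n (φ.normed volume) x‖ ≤ K := by
    intro n
    by_cases hn : n ≤ 3
    · obtain ⟨K, hK⟩ := (hcs.iteratedFDeriv (𝕜 := ℝ) n).exists_bound_of_continuous
        (hcd.continuous_iteratedFDeriv (by exact_mod_cast hn))
      exact ⟨K, fun _ => hK⟩
    · exact ⟨0, fun h => absurd h hn⟩
  choose K hK using hb
  refine ⟨_, φ.normed volume, C2b.of_iteratedFDeriv (K := max (max (K 0) (K 1)) (max (K 2) (K 3)))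
    h0 h1 hcd fun n hn x => (hK n hn x).trans ?_, φ.nonneg_normed, φ.integral_normed, ?_⟩
  · interval_cases n <;> simp
  · rw [φ.tsupport_normed_eq]

variable {ρ C M : ℝ} {k f : ES N → ℝ}

/-- Convolution of `f` with the kernel `F`. -/
def kInt (f : ES N → ℝ) (F : ES N → E) (x : ES N) : E := ∫ z, f z • F (x - z)

lemma kernel_integrable {F : ES N → E} (hf : Continuous f) (hF : Continuous F)
    (hs : HasCompactSupport F) (x : ES N) : Integrable fun z => f z • F (x - z) := by
  refine Continuous.integrable_of_hasCompactSupport (by fun_prop) ?_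
  exact (hs.comp_homeomorph (Homeomorph.subLeft x)).smul_left

lemma Moll.vanish (h : Moll θ ρ C k) (hρ : ρ ≤ 1) {w : ES N} (hw : 1 < ‖w‖) :
    k w = 0 ∧ D k w = 0 ∧ D2 k w = 0 := by
  have e0 : w ∉ tsupport k := fun hm => by
    have := h.supp hm
    rw [mem_closedBall_zero_iff] at this
    linarith
  have e1 : w ∉ tsupport (D k) := fun hm => e0 (tsupport_fderiv_subset ℝ hm)
  have e2 : w ∉ tsupport (D2 k) := fun hm => e1 (tsupport_fderiv_subset ℝ hm)
  exact ⟨image_eq_zero_of_notMem_tsupport e0, image_eq_zero_of_notMem_tsupport e1,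
    image_eq_zero_of_notMem_tsupport e2⟩

lemma Moll.compact (h : Moll θ ρ C k) :
    HasCompactSupport k ∧ HasCompactSupport (D k) ∧ HasCompactSupport (D2 k) := by
  have hk : HasCompactSupport k :=
    HasCompactSupport.of_support_subset_isCompact (isCompact_closedBall 0 ρ)
      ((subset_tsupport k).trans h.supp)
  exact ⟨hk, hk.fderiv ℝ, (hk.fderiv ℝ).fderiv ℝ⟩

lemma Moll.C2b_kInt (h : Moll θ ρ C k) (hθ0 : 0 < θ) (hρ : ρ ≤ 1)
    (hf : Continuous f) (hM : ∀ x, |f x| ≤ M) :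
    C2b θ (2 * volume.real (closedBall (0 : ES N) 1) * M * C) (kInt f k) ∧
      D (kInt f k) = kInt f (D k) ∧ D2 (kInt f k) = kInt f (D2 k) := by
  have k0 : Continuous k := h.sm.cd.continuous
  have k1 : Continuous (D k) := h.sm.diff1.continuous
  have k2 : Continuous (D2 k) := h.sm.hol.continuous hθ0
  obtain ⟨s0, s1, s2⟩ := h.compact
  have i0 := kernel_integrable hf k0 s0
  have i1 := kernel_integrable hf k1 s1
  have i2 := kernel_integrable hf k2 s2
  have hv : ∀ {x z : ES N}, 1 < ‖z - x‖ → k (x - z) = 0 ∧ D k (x - z) = 0 ∧ D2 k (x - z) = 0 :=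
    fun hz => h.vanish hρ (by rwa [norm_sub_rev])
  set V := volume.real (closedBall (0 : ES N) 1)
  refine C2b.of_jet hθ0 (fun x => ?_) (fun x => ?_) (fun x => ?_) (fun x y => ?_)
    (fun x y => ?_) fun x y => ?_
  · exact norm_integral_smul_le_of_support hM (fun z => h.sm.b0 (x - z)) (x := x) (y := x)
      fun z hz _ => (hv hz).1
  · exact norm_integral_smul_le_of_support hM (fun z => h.sm.b1 (x - z)) (x := x) (y := x)
      fun z hz _ => (hv hz).2.1
  · exact norm_integral_smul_le_of_support hM (fun z => h.sm.b2 (x - z)) (x := x) (y := x)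
      fun z hz _ => (hv hz).2.2
  · rw [kInt, kInt, ← integral_sub (i2 x) (i2 y)]
    simp only [← smul_sub]
    refine (norm_integral_smul_le_of_support hM (B := C * ‖x - y‖ ^ θ) (fun z => ?_) (x := x)
      (y := y) fun z hz hz' => ?_).trans (le_of_eq (by ring))
    · simpa using h.sm.hol (x - z) (y - z)
    · rw [(hv hz).2.2, (hv hz').2.2, sub_self]
  · rw [kInt, kInt, kInt, ContinuousLinearMap.integral_apply (i1 x), ← integral_sub (i0 y) (i0 x),
      ← integral_sub
        (f := fun z => f z • k (y - z) - f z • k (x - z)) ((i0 y).sub (i0 x))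
        ((i1 x).apply_continuousLinearMap _)]
    simp only [smul_apply, ← smul_sub, ← Real.norm_eq_abs]
    refine (norm_integral_smul_le_of_support hM (B := C * ‖y - x‖ ^ 2) (fun z => ?_) (x := x)
      (y := y) fun z hz hz' => ?_).trans (le_of_eq (by ring))
    · simpa using taylor_D2 h.sm.cd h.sm.b2 (x - z) (y - z)
    · rw [(hv hz).1, (hv hz).2.1, (hv hz').1]; simp
  · rw [kInt, kInt, kInt, ContinuousLinearMap.integral_apply (i2 x), ← integral_sub (i1 y) (i1 x),
      ← integral_sub
        (f := fun z => f z • D k (y - z) - f z • D k (x - z)) ((i1 y).sub (i1 x))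
        ((i2 x).apply_continuousLinearMap _)]
    simp only [smul_apply, ← smul_sub]
    refine (norm_integral_smul_le_of_support hM (B := C * ‖y - x‖ ^ θ * ‖y - x‖) (fun z => ?_)
      (x := x) (y := y) fun z hz hz' => ?_).trans (le_of_eq (by ring))
    · simpa using taylor_D_hol hθ0.le h.sm.nonneg h.sm.cd h.sm.hol (x - z) (y - z)
    · rw [(hv hz).2.1, (hv hz).2.2, (hv hz').2.1]; simp

lemma continuous_kInt_time {f : ℝ → ES N → ℝ} {F : ES N → E} (hF : Continuous F)
    (hs : HasCompactSupport F) (hf : ∀ t, Continuous (f t)) (hM : ∀ t x, |f t x| ≤ M)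
    (hc : ∀ x, Continuous fun t => f t x) (x : ES N) : Continuous fun t => kInt (f t) F x := by
  refine continuous_of_dominated (bound := fun z => M • ‖F (x - z)‖) (fun t => ?_) (fun t =>
    Eventually.of_forall fun z => ?_) ?_ (Eventually.of_forall fun z => ?_)
  · exact (by fun_prop : Continuous fun z => f t z • F (x - z)).aestronglyMeasurable
  · rw [norm_smul, smul_eq_mul]
    exact mul_le_mul_of_nonneg_right (hM t z) (norm_nonneg _)
  · exact kernel_integrable (f := fun _ => M) continuous_const hF.norm hs.norm x
  · exact (hc z).smul continuous_const

lemma Moll.kInt_eq (x : ES N) : kInt f k x = ∫ z, k z * f (x - z) := by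
  rw [kInt, ← integral_sub_left_eq_self (fun z => k z * f (x - z)) volume x]
  simp [mul_comm]

lemma Moll.integrable (h : Moll θ ρ C k) : Integrable k :=
  h.sm.cd.continuous.integrable_of_hasCompactSupport h.compact.1

lemma Moll.integrable_mul (h : Moll θ ρ C k) (hf : Continuous f) (x : ES N) :
    Integrable fun z => k z * f (x - z) :=
  Continuous.integrable_of_hasCompactSupport
    (h.sm.cd.continuous.mul (hf.comp (by fun_prop))) h.compact.1.mul_right

lemma Moll.abs_le (h : Moll θ ρ C k) {F : ES N → ℝ} {B : ℝ}
    (hB : ∀ z ∈ closedBall 0 ρ, |F z| ≤ B) : |∫ z, k z * F z| ≤ B := by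
  have : ‖∫ z, k z * F z‖ ≤ ∫ z, k z * B := by
    refine norm_integral_le_of_norm_le (h.integrable.mul_const B) (Eventually.of_forall fun z => ?_)
    rw [norm_mul, Real.norm_of_nonneg (h.nn z)]
    by_cases hz : z ∈ closedBall 0 ρ
    · exact mul_le_mul_of_nonneg_left (hB z hz) (h.nn z)
    · rw [image_eq_zero_of_notMem_tsupport fun hm => hz (h.supp hm)]
      simp
  rwa [integral_mul_const, h.int1, one_mul] at this

lemma Moll.kInt_abs_le (h : Moll θ ρ C k) (hM : ∀ x, |f x| ≤ M) (x : ES N) : |kInt f k x| ≤ M := by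
  rw [Moll.kInt_eq]
  exact h.abs_le fun z _ => hM _

lemma Moll.kInt_hol (h : Moll θ ρ C k) (hf : Continuous f) {α G : ℝ} (hG : Hol α G f) :
    Hol α G (kInt f k) := by
  intro x y
  rw [Moll.kInt_eq, Moll.kInt_eq, ← integral_sub (h.integrable_mul hf x) (h.integrable_mul hf y)]
  simp only [← mul_sub]
  exact h.abs_le fun z _ => by simpa using hG (x - z) (y - z)

lemma Moll.abs_kInt_sub_le (h : Moll θ ρ C k) (hf : Continuous f) {B : ℝ} {x : ES N}
    (hB : ∀ y ∈ closedBall x ρ, |f y - f x| ≤ B) : |kInt f k x - f x| ≤ B := by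
  have e : f x = ∫ z, k z * f x := by rw [integral_mul_const, h.int1, one_mul]
  rw [Moll.kInt_eq]
  rw [e, ← integral_sub (h.integrable_mul hf x) (h.integrable.mul_const _)]
  simp only [← mul_sub]
  refine h.abs_le fun z hz => hB _ ?_
  simpa [dist_eq_norm] using hz

end Mollifier

section Continuity
variable {N : ℕ} {T θ β lam C G K : ℝ} {A : ℝ → ES N → H2 N →L[ℝ] ℝ}
  {B : ℝ → ES N → V1 N →L[ℝ] ℝ} {c h : ℝ → ES N → ℝ}

/-- Right-hand sides bounded and `θ`-Hölder in space with constant `G`, continuous in time. -/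
structure YB (T θ G : ℝ) (h : ℝ → ES N → ℝ) : Prop where
  b : ∀ t ∈ Icc 0 T, ∀ x, |h t x| ≤ G
  hol : ∀ t ∈ Icc 0 T, Hol θ G (h t)
  tc : ∀ x, ContinuousOn (fun t => h t x) (Icc 0 T)

lemma continuousOn_of_rpow_modulus {F : Type*} [NormedAddCommGroup F] {f : ℝ → F} {S : Set ℝ}
    (hβ : 0 < β) (h : ∀ t ∈ S, ∀ s ∈ S, ‖f t - f s‖ ≤ C * |t - s| ^ β) : ContinuousOn f S := by
  intro s hs
  rw [ContinuousWithinAt, tendsto_iff_norm_sub_tendsto_zero]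
  have hc : Continuous fun t : ℝ => C * |t - s| ^ β :=
    continuous_const.mul ((Real.continuous_rpow_const hβ.le).comp (by fun_prop))
  have h0 : Tendsto (fun t : ℝ => C * |t - s| ^ β) (𝓝[S] s) (𝓝 0) := by
    have := (hc.tendsto s).mono_left (nhdsWithin_le_nhds (s := S))
    simpa [Real.zero_rpow hβ.ne'] using this
  exact squeeze_zero' (Eventually.of_forall fun _ => norm_nonneg _)
    (eventually_nhdsWithin_of_forall fun t ht => h t ht s hs) h0

lemma GCoef.continuousOn_LA (hg : GCoef T θ β lam C A B c) (hθ : 0 < θ) (hβ : 0 < β)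
    {z : ℝ → ES N → ℝ} (hz : XB T θ K z) (x : ES N) :
    ContinuousOn (fun t => LA A B c (z t) t x) (Icc 0 T) := by
  have hm : ContinuousOn (fun t : ℝ => (t, x)) (Icc 0 T) := by fun_prop
  have hm' : MapsTo (fun t : ℝ => (t, x)) (Icc 0 T) (Icc 0 T ×ˢ univ) := fun t ht => ⟨ht, trivial⟩
  exact (((continuousOn_of_rpow_modulus hβ (hg.tA x)).clm_apply
    ((hz.continuousOn_D2 hθ).comp hm hm')).add
    ((continuousOn_of_rpow_modulus hβ (hg.tB x)).clm_apply (hz.continuousOn_D.comp hm hm'))).add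
    ((continuousOn_of_rpow_modulus hβ (hg.tc x)).mul (hz.continuousOn_time x))

lemma GCoef.yb (hg : GCoef T θ β lam C A B c) (hC : 0 ≤ C) (hθ0 : 0 < θ) (hθ1 : θ < 1) (hβ : 0 < β)
    {z : ℝ → ES N → ℝ} (hz : XB T θ K z) :
    YB T θ ((2 * N ^ 2 + 9) * C * K) fun t x => LA A B c (z t) t x := by
  refine ⟨fun t ht x => ?_, fun t ht => ?_, hg.continuousOn_LA hθ0 hβ hz⟩
  · have hs := hz.sp t ht
    refine (abs_LA_le ((hg.ell t ht x).norm_le hC) (hg.bB t ht x) (hg.bc t ht x) (hs.b0 x)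
      (hs.b1 x) (hs.b2 x)).trans ?_
    have := hs.nonneg
    have : 0 ≤ C * K := by positivity
    have : 0 ≤ N ^ 2 * (C * K) := by positivity
    linarith
  · have hs := hz.sp t ht
    have hK := hs.nonneg
    have h1 := Hol.clm (fun x => (hg.ell t ht x).norm_le hC) (hg.hA t ht) hs.b2 hs.hol
    have h2 := Hol.clm (hg.bB t ht) (hg.hB t ht) hs.b1 (hs.hol1 hθ0.le hθ1.le)
    have h3 := Hol.smul (hg.bc t ht) (hg.hc t ht) hs.b0 (hs.hol0 hθ0.le hθ1.le)
    refine Hol.mono ((h1.add h2).add h3) ?_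
    have : 0 ≤ N ^ 2 * (C * K) := by positivity
    linarith

lemma exists_limit_solution (hT : 0 ≤ T) (hθ : 0 < θ) (hβ : 0 < β)
    (hg : GCoef T θ β lam C A B c) {u : ℕ → ℝ → ES N → ℝ} {hn : ℕ → ℝ → ES N → ℝ} {e : ℕ → ℝ}
    (hu : ∀ n, XB T θ K (u n)) (hs : ∀ n, Solves T A B c (hn n) (u n)) (h0 : ∀ n x, u n 0 x = 0)
    (he : ∀ n, ∀ t ∈ Icc 0 T, ∀ x, |hn n t x - h t x| ≤ e n) (he0 : Tendsto e atTop (𝓝 0))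
    (hc : ∀ x, ContinuousOn (fun t => h t x) (Icc 0 T)) :
    ∃ v, XB T θ K v ∧ Solves T A B c h v ∧ ∀ x, v 0 x = 0 := by
  obtain ⟨v, hv, hl⟩ := XB.exists_tendsto (Filter.hyperfilter ℕ) hθ hu
  refine ⟨v, hv, fun t ht x => ?_, fun x => ?_⟩
  · have hI : Icc 0 T ∈ 𝓝 t := Icc_mem_nhds ht.1 ht.2
    refine XTendsto.hasDerivAt (h := fun n t => hn n t x) hθ hu hl le_rfl le_rfl ht
      (Eventually.of_forall fun n s hs' => hs n s hs' x)
      ((continuousOn_of_rpow_modulus hβ (hg.tA x)).continuousAt hI)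
      ((continuousOn_of_rpow_modulus hβ (hg.tB x)).continuousAt hI)
      ((continuousOn_of_rpow_modulus hβ (hg.tc x)).continuousAt hI) ?_
    rw [tendsto_iff_norm_sub_tendsto_zero]
    have e1 : Tendsto (fun p : ℕ × ℝ => e p.1 + ‖h p.2 x - h t x‖)
        ((Filter.hyperfilter ℕ : Filter ℕ) ×ˢ 𝓝 t) (𝓝 (0 + 0)) :=
      ((he0.mono_left Nat.hyperfilter_le_atTop).comp tendsto_fst).add
        ((tendsto_iff_norm_sub_tendsto_zero.1 ((hc x).continuousAt hI).tendsto).comp tendsto_snd)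
    rw [add_zero] at e1
    refine squeeze_zero' (Eventually.of_forall fun _ => norm_nonneg _) ?_ e1
    filter_upwards [tendsto_snd.eventually hI] with p hp
    calc ‖hn p.1 p.2 x - h t x‖ = ‖(hn p.1 p.2 x - h p.2 x) + (h p.2 x - h t x)‖ := by abel_nf
      _ ≤ _ := (norm_add_le _ _).trans (by gcongr; exact he p.1 p.2 hp x)
  · have := (hl 0 ⟨le_rfl, hT⟩ x).1
    simp only [h0] at this
    exact tendsto_nhds_unique this tendsto_const_nhds

/-- Solvability of the problem with zero initial datum, with a `C^{2,θ}` estimate. -/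
def Solvable (T θ K : ℝ) (A : ℝ → ES N → H2 N →L[ℝ] ℝ) (B : ℝ → ES N → V1 N →L[ℝ] ℝ)
    (c : ℝ → ES N → ℝ) : Prop :=
  ∀ G h, 0 ≤ G → YB T θ G h →
    ∃ u, XB T θ (K * G) u ∧ Solves T A B c h u ∧ ∀ x, u 0 x = 0

lemma gcoef_lapL (hC : 1 ≤ C) (hl : lam ≤ 1) :
    GCoef (N := N) T θ β lam C (fun _ _ => lapL N) (fun _ _ => 0) fun _ _ => 0 := by
  have hC0 : 0 ≤ C := by linarith
  have e1 : Ell lam C (lapL N) := by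
    obtain ⟨a, h1, h2, h3, h4⟩ := ell_lapL (N := N)
    exact ⟨a, h1, fun i j => (h2 i j).trans hC, fun ξ => le_trans (by gcongr) (h3 ξ), h4⟩
  constructor <;> intros <;> first
    | exact e1
    | (intro x y; simp only [sub_self, norm_zero]; positivity)
    | (simp only [sub_self, norm_zero, abs_zero]; positivity)

lemma abs_clamp_sub_le {t s : ℝ} : |max 0 (min t T) - max 0 (min s T)| ≤ |t - s| :=
  (abs_max_sub_max_le_max _ _ _ _).trans (by
    rw [sub_self, abs_zero]
    refine max_le (abs_nonneg _) ((abs_min_sub_min_le_max _ _ _ _).trans ?_)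
    simp)

lemma clamp_mem (hT : 0 ≤ T) (t : ℝ) : max 0 (min t T) ∈ Icc 0 T :=
  ⟨le_max_left _ _, max_le hT (min_le_right _ _)⟩

lemma clamp_eq {t : ℝ} (ht : t ∈ Icc 0 T) : max 0 (min t T) = t := by
  rw [min_eq_left ht.2, max_eq_right ht.1]

lemma solvable_lapL (N : ℕ) (hθ0 : 0 < θ) (hθ1 : θ < 1) (hT : 0 ≤ T) :
    ∃ K, Solvable (N := N) T θ K (fun _ _ => lapL N) (fun _ _ => 0) fun _ _ => 0 := by
  obtain ⟨K, hK, hE⟩ := global_estimate N hθ0 hθ1 (β := 1) one_pos (lam := 1) one_pos (C := 1)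
    le_rfl hT
  refine ⟨K, fun G h hG hh => ?_⟩
  set p : ℝ → ℝ := fun t => max 0 (min t T) with hp
  have hpc : Continuous p := by fun_prop
  have hpI : ∀ t, p t ∈ Icc 0 T := clamp_mem hT
  have hfc : ∀ t, Continuous (h (p t)) := fun t => (hh.hol _ (hpI t)).continuous hθ0
  have hft : ∀ x, Continuous fun t => h (p t) x := fun x =>
    (hh.tc x).comp_continuous hpc hpI
  have hρ : ∀ n : ℕ, (0:ℝ) < 1 / ((n:ℝ) + 1) := fun n => by positivity
  have hρ1 : ∀ n : ℕ, (1:ℝ) / ((n:ℝ) + 1) ≤ 1 := fun n => by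
    rw [div_le_one (by positivity)]; linarith [n.cast_nonneg (α := ℝ)]
  choose Ck k hk using fun n : ℕ => exists_moll N hθ0.le hθ1.le (hρ n)
  have hSB : ∀ n, ∃ Cn, SB θ Cn fun t => kInt (h (p t)) (k n) := by
    intro n
    have hj := fun t => (hk n).C2b_kInt hθ0 (hρ1 n) (hfc t) fun x => hh.b _ (hpI t) x
    obtain ⟨s0, s1, s2⟩ := (hk n).compact
    refine ⟨_, fun t => (hj t).1, fun x => ?_, fun x => ?_, fun x => ?_⟩
    · exact continuous_kInt_time (hk n).sm.cd.continuous s0 hfc (fun t x => hh.b _ (hpI t) x) hft x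
    · simp only [(hj _).2.1]
      exact continuous_kInt_time (hk n).sm.diff1.continuous s1 hfc
        (fun t x => hh.b _ (hpI t) x) hft x
    · simp only [(hj _).2.2]
      exact continuous_kInt_time ((hk n).sm.hol.continuous hθ0) s2 hfc
        (fun t x => hh.b _ (hpI t) x) hft x
  choose Cn hCn using hSB
  choose Cu u hu hs h0 using fun n => exists_heat_solution hθ0 hθ1 hT (hCn n)
  refine exists_limit_solution (u := u) (hn := fun n t => kInt (h (p t)) (k n))
    (e := fun n => G * (1 / ((n:ℝ) + 1)) ^ θ) hT hθ0 one_pos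
    (gcoef_lapL le_rfl le_rfl) (fun n => ?_) hs h0 (fun n t ht x => ?_) ?_ hh.tc
  · exact hE G _ _ _ _ _ _ hG (gcoef_lapL le_rfl le_rfl)
      (fun t _ x => (hk n).kInt_abs_le (fun x => hh.b _ (hpI t) x) x)
      (fun t _ => (hk n).kInt_hol (hfc t) (hh.hol _ (hpI t))) (hu n) (hs n) (h0 n)
  · have e : p t = t := clamp_eq ht
    show |kInt (h (p t)) (k n) x - h t x| ≤ _
    rw [e]
    refine (hk n).abs_kInt_sub_le ((hh.hol t ht).continuous hθ0) fun y hy =>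
      (hh.hol t ht y x).trans ?_
    gcongr
    rwa [mem_closedBall, dist_eq_norm] at hy
  · have : Tendsto (fun n : ℕ => G * (1 / ((n:ℝ) + 1)) ^ θ) atTop (𝓝 (G * 0 ^ θ)) :=
      (tendsto_one_div_add_atTop_nhds_zero_nat.rpow_const (Or.inr hθ0.le)).const_mul G
    rwa [Real.zero_rpow hθ0.ne', mul_zero] at this

lemma Ell.mix {a : H2 N →L[ℝ] ℝ} {τ : ℝ} (h : Ell lam C a) (hC : 1 ≤ C) (hl : lam ≤ 1)
    (h0 : 0 ≤ τ) (h1 : τ ≤ 1) : Ell lam C ((1 - τ) • lapL N + τ • a) := by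
  obtain ⟨p, p1, p2, p3, rfl⟩ := h
  obtain ⟨q, q1, q2, q3, hq⟩ := ell_lapL (N := N)
  rw [hq]
  refine ⟨fun i j => (1 - τ) * q i j + τ * p i j, fun i j => ?_, fun i j => ?_,
    fun ξ => ?_, ?_⟩
  · show (1 - τ) * q i j + τ * p i j = (1 - τ) * q j i + τ * p j i
    rw [p1 i j, q1 i j]
  · refine (abs_add_le _ _).trans ?_
    rw [abs_mul, abs_mul, abs_of_nonneg h0, abs_of_nonneg (sub_nonneg.2 h1)]
    have := mul_le_mul_of_nonneg_left ((q2 i j).trans hC) (sub_nonneg.2 h1)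
    have := mul_le_mul_of_nonneg_left (p2 i j) h0
    linarith
  · have e : ∑ i, ∑ j, ((1 - τ) * q i j + τ * p i j) * ξ i * ξ j =
        (1 - τ) * ∑ i, ∑ j, q i j * ξ i * ξ j + τ * ∑ i, ∑ j, p i j * ξ i * ξ j := by
      simp only [Finset.mul_sum, ← Finset.sum_add_distrib]
      exact Finset.sum_congr rfl fun i _ => Finset.sum_congr rfl fun j _ => by ring
    rw [e]
    have := mul_le_mul_of_nonneg_left (p3 ξ) h0
    have h4 : lam * ‖ξ‖ ^ 2 ≤ 1 * ‖ξ‖ ^ 2 := by gcongr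
    have := mul_le_mul_of_nonneg_left (h4.trans (q3 ξ)) (sub_nonneg.2 h1)
    linarith
  · ext H
    simp only [add_apply, smul_apply, smul_eq_mul, trL_apply, Finset.mul_sum,
      ← Finset.sum_add_distrib]
    exact Finset.sum_congr rfl fun i _ => Finset.sum_congr rfl fun j _ => by ring

/-- Convex combination of the Laplacian and of a second order coefficient. -/
def mixA (τ : ℝ) (A : ℝ → ES N → H2 N →L[ℝ] ℝ) : ℝ → ES N → H2 N →L[ℝ] ℝ :=
  fun t x => (1 - τ) • lapL N + τ • A t x

lemma LA_mix (τ : ℝ) (φ : ES N → ℝ) (t : ℝ) (x : ES N) :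
    LA (mixA τ A) (fun t x => τ • B t x) (fun t x => τ * c t x) φ t x =
      (1 - τ) * LA (fun _ _ => lapL N) (fun _ _ => 0) (fun _ _ => 0) φ t x +
        τ * LA A B c φ t x := by
  simp only [LA, mixA, add_apply, smul_apply, smul_eq_mul, zero_apply]
  ring

lemma mixA_sub (τ t s : ℝ) (x y : ES N) :
    mixA τ A t x - mixA τ A s y = τ • (A t x - A s y) := by
  ext H
  simp only [mixA, add_apply, sub_apply, smul_apply, smul_eq_mul]
  ring

lemma GCoef.mix {τ : ℝ} (h : GCoef T θ β lam C A B c) (hC : 1 ≤ C) (hl : lam ≤ 1) (h0 : 0 ≤ τ)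
    (h1 : τ ≤ 1) :
    GCoef T θ β lam C (mixA τ A) (fun t x => τ • B t x) (fun t x => τ * c t x) := by
  have hs : ∀ {r s : ℝ}, r ≤ s → 0 ≤ r → τ * r ≤ s := fun hr h => by nlinarith
  refine ⟨fun t ht x => (h.ell t ht x).mix hC hl h0 h1, fun t ht x => ?_, fun t ht x => ?_,
    fun t ht x y => ?_, fun t ht x y => ?_, fun t ht x y => ?_, fun x t ht s hs' => ?_,
    fun x t ht s hs' => ?_, fun x t ht s hs' => ?_⟩
  · rw [norm_smul, Real.norm_of_nonneg h0]
    exact hs (h.bB t ht x) (norm_nonneg _)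
  · rw [abs_mul, abs_of_nonneg h0]
    exact hs (h.bc t ht x) (abs_nonneg _)
  · rw [mixA_sub, norm_smul, Real.norm_of_nonneg h0]
    exact hs (h.hA t ht x y) (norm_nonneg _)
  · rw [← smul_sub, norm_smul, Real.norm_of_nonneg h0]
    exact hs (h.hB t ht x y) (norm_nonneg _)
  · rw [← mul_sub, norm_mul, Real.norm_of_nonneg h0]
    exact hs (h.hc t ht x y) (norm_nonneg _)
  · rw [mixA_sub, norm_smul, Real.norm_of_nonneg h0]
    exact hs (h.tA x t ht s hs') (norm_nonneg _)
  · rw [← smul_sub, norm_smul, Real.norm_of_nonneg h0]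
    exact hs (h.tB x t ht s hs') (norm_nonneg _)
  · rw [← mul_sub, abs_mul, abs_of_nonneg h0]
    exact hs (h.tc x t ht s hs') (abs_nonneg _)

lemma YB.sub {G' : ℝ} {k : ℝ → ES N → ℝ} (h1 : YB T θ G h) (h2 : YB T θ G' k) :
    YB T θ (G + G') fun t x => h t x - k t x :=
  ⟨fun t ht x => (abs_sub _ _).trans (add_le_add (h1.b t ht x) (h2.b t ht x)),
    fun t ht => (h1.hol t ht).sub (h2.hol t ht), fun x => (h1.tc x).sub (h2.tc x)⟩

lemma YB.const_mul (a : ℝ) (h1 : YB T θ G h) : YB T θ (|a| * G) fun t x => a * h t x :=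
  ⟨fun t ht x => by
    rw [abs_mul]; exact mul_le_mul_of_nonneg_left (h1.b t ht x) (abs_nonneg _),
    fun t ht => (h1.hol t ht).const_smul a, fun x => (h1.tc x).const_mul a⟩

lemma YB.mono {G' : ℝ} (h1 : YB T θ G h) (hG : G ≤ G') : YB T θ G' h :=
  ⟨fun t ht x => (h1.b t ht x).trans hG, fun t ht => (h1.hol t ht).mono hG, h1.tc⟩

/-- Perturbation step: solvability is stable under small perturbations of the operator. -/
lemma exists_solution_of_perturbation (hT : 0 ≤ T) (hθ : 0 < θ) (hβ : 0 < β) (hK : 0 < K)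
    {A' : ℝ → ES N → H2 N →L[ℝ] ℝ} {B' : ℝ → ES N → V1 N →L[ℝ] ℝ} {c' : ℝ → ES N → ℝ}
    (hS : Solvable T θ K A B c) (hg : GCoef T θ β lam C A' B' c')
    (hp : ∀ G z, XB T θ G z →
      YB T θ (G / (2 * K)) fun t x => LA A' B' c' (z t) t x - LA A B c (z t) t x)
    (hG : 0 ≤ G) (hh : YB T θ G h) :
    ∃ u, XB T θ (2 * K * G) u ∧ Solves T A' B' c' h u ∧ ∀ x, u 0 x = 0 := by
  have step : ∀ n : ℕ, ∃ u e, XB T θ (2 * K * G * (1 - (1 / 2) ^ n)) u ∧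
      YB T θ (G * (1 / 2) ^ n) e ∧ Solves T A' B' c' (fun t x => h t x - e t x) u ∧
      ∀ x, u 0 x = 0 := by
    intro n
    induction n with
    | zero =>
      have hz : ∀ C : ℝ, D (fun _ : ES N => (0:ℝ)) = 0 ∧ D2 (fun _ : ES N => (0:ℝ)) = 0 := by
        intro C
        have e1 : D (fun _ : ES N => (0:ℝ)) = 0 := by
          funext x; simp [D]
        refine ⟨e1, ?_⟩
        show fderiv ℝ (D fun _ : ES N => (0:ℝ)) = 0
        rw [e1]; funext x; simp
      have hz1 := (hz 0).1
      have hz2 := (hz 0).2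
      refine ⟨fun _ _ => 0, h, ⟨fun t _ => ⟨contDiff_const, fun x => by simp, fun x => ?_,
        fun x => ?_, fun x y => ?_⟩, fun x t _ s _ => by simp⟩, by simpa using hh,
        fun t ht x => ?_, fun x => rfl⟩
      · rw [hz1]; simp
      · rw [hz2]; simp
      · rw [hz2]; simp
      · simp only [LA, hz1, hz2, sub_self, Pi.zero_apply, map_zero, mul_zero, add_zero]
        exact hasDerivAt_const t (0:ℝ)
    | succ n ih =>
      obtain ⟨u, e, hu, he, hs, h0⟩ := ih
      obtain ⟨z, hz, hzs, hz0⟩ := hS _ e (by positivity) he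
      refine ⟨fun t x => u t x + z t x, fun t x => LA A' B' c' (z t) t x - LA A B c (z t) t x,
        (hu.add hz).mono (le_of_eq (by ring)), (hp _ z hz).mono (le_of_eq ?_), fun t ht x => ?_,
        fun x => by simp only [h0, hz0, add_zero]⟩
      · field_simp
        ring
      · have htI := Ioo_subset_Icc_self ht
        refine ((hs t ht x).fun_add (hzs t ht x)).congr_deriv ?_
        simp only [LA, D_add (hu.sp t htI).cd (hz.sp t htI).cd,
          D2_add (hu.sp t htI).cd (hz.sp t htI).cd, map_add]
        ring
  choose u e hu he hs h0 using step
  have hKG : 0 ≤ 2 * K * G := by positivity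
  refine exists_limit_solution (e := fun n => G * (1 / 2) ^ n) hT hθ hβ hg
    (fun n => (hu n).mono ?_) hs h0 (fun n t ht x => ?_) ?_ hh.tc
  · refine mul_le_of_le_one_right hKG ?_
    have : (0:ℝ) ≤ (1 / 2) ^ n := by positivity
    linarith
  · rw [sub_sub_cancel_left, abs_neg]
    exact (he n).b t ht x
  · have := (tendsto_pow_atTop_nhds_zero_of_lt_one (r := (1 / 2 : ℝ)) (by norm_num)
      (by norm_num)).const_mul G
    rwa [mul_zero] at this

theorem solvable_of_gcoef (hθ0 : 0 < θ) (hθ1 : θ < 1) (hβ : 0 < β) (hlam : 0 < lam) (hl : lam ≤ 1)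
    (hC : 1 ≤ C) (hT : 0 ≤ T) (hg : GCoef T θ β lam C A B c) : ∃ K, Solvable T θ K A B c := by
  obtain ⟨K0, hK0⟩ := solvable_lapL N hθ0 hθ1 hT
  obtain ⟨K, hK, hE⟩ := global_estimate N hθ0 hθ1 hβ hlam hC hT
  have hC0 : 0 ≤ C := by linarith
  have up : ∀ {A B c} {K' : ℝ}, GCoef (N := N) T θ β lam C A B c →
      (∀ G h, 0 ≤ G → YB T θ G h →
        ∃ u, XB T θ (K' * G) u ∧ Solves T A B c h u ∧ ∀ x, u 0 x = 0) →
      Solvable T θ K A B c := by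
    intro A B c K' hg hS G h hG hh
    obtain ⟨u, hu, hs, h0⟩ := hS G h hG hh
    exact ⟨u, hE G _ u A B c h hG hg hh.b hh.hol hu hs h0, hs, h0⟩
  set P := (2 * (N:ℝ) ^ 2 + 9) * C with hP
  have hP0 : 0 < P := by positivity
  obtain ⟨m, hm⟩ := exists_nat_gt (4 * P * K)
  have hm0 : (0:ℝ) < m := lt_trans (by positivity) hm
  have step : ∀ k : ℕ, k ≤ m → Solvable T θ K (mixA ((k:ℝ) / m) A)
      (fun t x => ((k:ℝ) / m) • B t x) (fun t x => ((k:ℝ) / m) * c t x) := by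
    intro k
    induction k with
    | zero =>
      intro _
      refine up (K' := K0) (hg.mix hC hl (by simp) (by simp)) ?_
      have e : mixA 0 A = fun _ _ => lapL N := by
        funext t x; simp [mixA]
      simp only [Nat.cast_zero, zero_div, e, zero_smul, zero_mul]
      exact hK0
    | succ k ih =>
      intro hk
      have h1 : ((k + 1 : ℕ):ℝ) / m ≤ 1 := (div_le_one hm0).2 (by exact_mod_cast hk)
      have hg' := hg.mix hC hl (τ := ((k + 1 : ℕ):ℝ) / m) (by positivity) h1
      refine up (K' := 2 * K) hg' fun G h hG hh =>
        exists_solution_of_perturbation hT hθ0 hβ hK (ih (by omega)) hg' (fun G z hz => ?_) hG hh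
      have e : ∀ t x, LA (mixA (((k + 1 : ℕ):ℝ) / m) A) (fun t x => (((k + 1 : ℕ):ℝ) / m) • B t x)
          (fun t x => (((k + 1 : ℕ):ℝ) / m) * c t x) (z t) t x -
          LA (mixA ((k:ℝ) / m) A) (fun t x => ((k:ℝ) / m) • B t x)
          (fun t x => ((k:ℝ) / m) * c t x) (z t) t x = (1 / m : ℝ) * (LA A B c (z t) t x -
            LA (fun _ _ => lapL N) (fun _ _ => 0) (fun _ _ => 0) (z t) t x) := by
        intro t x
        rw [LA_mix, LA_mix]
        push_cast
        field_simp
        ring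
      simp only [e]
      have hG' := hz.nonneg hT
      refine (((hg.yb hC0 hθ0 hθ1 hβ hz).sub ((gcoef_lapL (β := β) hC hl).yb hC0 hθ0 hθ1 hβ
        hz)).const_mul _).mono ?_
      rw [← hP, abs_of_pos (by positivity), one_div_mul_eq_div, div_le_div_iff₀ hm0 (by positivity)]
      have := mul_le_mul_of_nonneg_right hm.le hG'
      linarith
  refine ⟨K, ?_⟩
  have := step m le_rfl
  have e : mixA 1 A = A := by
    funext t x; simp [mixA]
  simpa only [div_self hm0.ne', one_smul, one_mul, e] using this

end Continuity

section Local
variable {N : ℕ} {T θ β lam C R G M : ℝ} {A : ℝ → ES N → H2 N →L[ℝ] ℝ}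
  {B : ℝ → ES N → V1 N →L[ℝ] ℝ} {c h : ℝ → ES N → ℝ}

/-- Uniform ellipticity, boundedness and Hölder regularity of the coefficients on a ball. -/
structure LCoef (T θ β lam R C : ℝ) (A : ℝ → ES N → H2 N →L[ℝ] ℝ)
    (B : ℝ → ES N → V1 N →L[ℝ] ℝ) (c : ℝ → ES N → ℝ) : Prop where
  ell : ∀ t ∈ Icc 0 T, ∀ x ∈ closedBall 0 R, Ell lam C (A t x)
  bB : ∀ t ∈ Icc 0 T, ∀ x ∈ closedBall 0 R, ‖B t x‖ ≤ C
  bc : ∀ t ∈ Icc 0 T, ∀ x ∈ closedBall 0 R, |c t x| ≤ C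
  hA : ∀ t ∈ Icc 0 T, ∀ x ∈ closedBall 0 R, ∀ y ∈ closedBall 0 R,
    ‖A t x - A t y‖ ≤ C * ‖x - y‖ ^ θ
  hB : ∀ t ∈ Icc 0 T, ∀ x ∈ closedBall 0 R, ∀ y ∈ closedBall 0 R,
    ‖B t x - B t y‖ ≤ C * ‖x - y‖ ^ θ
  hc : ∀ t ∈ Icc 0 T, ∀ x ∈ closedBall 0 R, ∀ y ∈ closedBall 0 R,
    |c t x - c t y| ≤ C * ‖x - y‖ ^ θ
  tA : ∀ x ∈ closedBall 0 R, ∀ t ∈ Icc 0 T, ∀ s ∈ Icc 0 T, ‖A t x - A s x‖ ≤ C * |t - s| ^ β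
  tB : ∀ x ∈ closedBall 0 R, ∀ t ∈ Icc 0 T, ∀ s ∈ Icc 0 T, ‖B t x - B s x‖ ≤ C * |t - s| ^ β
  tc : ∀ x ∈ closedBall 0 R, ∀ t ∈ Icc 0 T, ∀ s ∈ Icc 0 T, |c t x - c s x| ≤ C * |t - s| ^ β

lemma LCoef.cut (hL : LCoef T θ β lam R C A B c) (hC : 1 ≤ C) (hl : lam ≤ 1) {Q : ℝ}
    {χ : ES N → ℝ} (hχ0 : ∀ x, 0 ≤ χ x) (hχ1 : ∀ x, χ x ≤ 1) (hχ : Hol θ Q χ) (hQ : 0 ≤ Q)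
    (hS : ∀ x ∉ closedBall 0 R, χ x = 0) :
    GCoef T θ β lam (C + Q * (2 * N ^ 2 * C + C)) (fun t x => (1 - χ x) • lapL N + χ x • A t x)
      (fun t x => χ x • B t x) fun t x => χ x * c t x := by
  have hC0 : 0 ≤ C := by linarith
  have hCC : C ≤ C + Q * (2 * N ^ 2 * C + C) := le_add_of_nonneg_right (by positivity)
  have hCC' : 1 * C + Q * C ≤ C + Q * (2 * N ^ 2 * C + C) := by
    have : 0 ≤ Q * (2 * N ^ 2 * C) := by positivity
    linarith
  have hab : ∀ x, ‖χ x‖ ≤ 1 := fun x => by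
    rw [Real.norm_of_nonneg (hχ0 x)]; exact hχ1 x
  have hsm : ∀ {F : Type} [NormedAddCommGroup F] [NormedSpace ℝ F] (x : ES N) (v : F) {r : ℝ},
      0 ≤ r → (x ∈ closedBall 0 R → ‖v‖ ≤ r) → ‖χ x • v‖ ≤ r := by
    intro F _ _ x v r hr hv
    by_cases hx : x ∈ closedBall 0 R
    · rw [norm_smul]
      exact (mul_le_mul (hab x) (hv hx) (norm_nonneg _) zero_le_one).trans_eq (one_mul r)
    · rw [hS x hx, zero_smul, norm_zero]; exact hr
  have hlE : Ell lam (1:ℝ) (lapL N) := by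
    obtain ⟨a, h1, h2, h3, h4⟩ := ell_lapL (N := N)
    exact ⟨a, h1, h2, fun ξ => le_trans (by gcongr) (h3 ξ), h4⟩
  have hlap : ‖lapL N‖ ≤ N ^ 2 * C :=
    (ell_lapL.norm_le zero_le_one).trans (by gcongr)
  have hEll : ∀ {A0 : H2 N →L[ℝ] ℝ} {C C' : ℝ}, C ≤ C' → Ell lam C A0 → Ell lam C' A0 := by
    rintro A0 C C' hc ⟨a, h1, h2, h3, h4⟩
    exact ⟨a, h1, fun i j => (h2 i j).trans hc, h3, h4⟩
  have eA : ∀ t x, (1 - χ x) • lapL N + χ x • A t x = lapL N + χ x • (A t x - lapL N) := by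
    intro t x
    ext H
    simp only [add_apply, sub_apply, smul_apply, smul_eq_mul]
    ring
  refine ⟨fun t ht x => ?_, fun t ht x => ?_, fun t ht x => ?_, fun t ht => ?_, fun t ht => ?_,
    fun t ht => ?_, fun x t ht s hs => ?_, fun x t ht s hs => ?_, fun x t ht s hs => ?_⟩
  · by_cases hx : x ∈ closedBall 0 R
    · exact ((hEll hCC (hL.ell t ht x hx)).mix (hC.trans hCC) hl (hχ0 x) (hχ1 x))
    · simp only [hS x hx, sub_zero, one_smul, zero_smul, add_zero]
      exact hEll (hC.trans hCC) hlE
  · exact (hsm x _ hC0 (hL.bB t ht x)).trans hCC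
  · exact (hsm x (c t x) hC0 (hL.bc t ht x)).trans hCC
  · have := Hol.cut (S := closedBall 0 R) (g := fun x => A t x - lapL N) (m₂ := 2 * N ^ 2 * C)
      (c₂ := C) zero_le_one (by positivity) hC0 hab hχ hS (fun x hx => ?_) (fun x hx y hy => ?_)
    · intro x y
      simp only [eA, add_sub_add_left_eq_sub]
      refine (this x y).trans ?_
      gcongr
      · exact (one_mul C).le
      · linarith
    · refine (norm_sub_le _ _).trans ?_
      have := (hL.ell t ht x hx).norm_le hC0
      linarith
    · rw [sub_sub_sub_cancel_right]
      exact hL.hA t ht x hx y hy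
  · exact (Hol.cut zero_le_one hC0 hC0 hab hχ hS (hL.bB t ht) (hL.hB t ht)).mono hCC'
  · exact (Hol.cut zero_le_one hC0 hC0 hab hχ hS (hL.bc t ht) (hL.hc t ht)).mono hCC'
  · have e : (1 - χ x) • lapL N + χ x • A t x - ((1 - χ x) • lapL N + χ x • A s x) =
        χ x • (A t x - A s x) := by
      ext H
      simp only [add_apply, sub_apply, smul_apply, smul_eq_mul]
      ring
    rw [e]
    exact (hsm x _ (by positivity) fun hx => hL.tA x hx t ht s hs).trans (by gcongr)
  · rw [← smul_sub]
    exact (hsm x _ (by positivity) fun hx => hL.tB x hx t ht s hs).trans (by gcongr)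
  · rw [← mul_sub]
    exact (hsm x (c t x - c s x) (by positivity) fun hx => hL.tc x hx t ht s hs).trans (by gcongr)

/-- Approximate solutions: the equation holds on a large ball, and the initial datum is attained
there up to a small error, with a uniform sup bound. -/
lemma exists_approx (hθ0 : 0 < θ) (hθ1 : θ < 1) (hβ : 0 < β) (hlam : 0 < lam) (hl : lam ≤ 1)
    (hC : 1 ≤ C) (hT : 0 ≤ T) (hR : 0 ≤ R) (hL : LCoef T θ β lam (R + 1) C A B c) {μ : ℝ}
    (hμ : 0 ≤ μ) (hcμ : ∀ t ∈ Icc 0 T, ∀ x, c t x ≤ μ) (hG : 0 ≤ G) (hh : YB T θ G h)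
    {f : ES N → ℝ} (hf : Continuous f) (hM : ∀ x, |f x| ≤ M) {ε : ℝ} (hε : 0 < ε) :
    ∃ A' B' c' u, (∀ t, ∀ x ∈ closedBall 0 R, A' t x = A t x ∧ B' t x = B t x ∧ c' t x = c t x) ∧
      (∃ Cu, XB T θ Cu u) ∧ Solves T A' B' c' h u ∧
      (∀ t ∈ Icc 0 T, ∀ x, |u t x| ≤ Real.exp (μ * T) * (M + T * G)) ∧
      ∀ x ∈ closedBall 0 R, |u 0 x - f x| ≤ ε := by
  have hM0 : 0 ≤ M := (abs_nonneg _).trans (hM 0)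
  have hPS : ProperSpace (ES N) := FiniteDimensional.proper ℝ _
  obtain ⟨Q, hQ1, hQ⟩ := exists_smoothTransition_bound
  set χ : ES N → ℝ := cutX 1 ((R + 1) ^ 2) 0 with hχ
  have hχC : C2b θ _ χ := cutX_C2b hQ hQ1 hθ0.le hθ1.le zero_le_one (by positivity : 0 ≤ R + 1)
    le_rfl 0
  have hχ0 : ∀ x, 0 ≤ χ x := fun x => Real.smoothTransition.nonneg _
  have hχ1 : ∀ x, χ x ≤ 1 := fun x => (le_abs_self _).trans (cutX_le_one _ _ _ _)
  have hχz : ∀ x ∉ closedBall (0 : ES N) (R + 1), χ x = 0 := by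
    intro x hx
    rw [mem_closedBall, dist_eq_norm, not_le] at hx
    exact cutX_eq_zero zero_le_one (by gcongr)
  have hχo : ∀ x ∈ closedBall (0 : ES N) R, χ x = 1 := by
    intro x hx
    rw [mem_closedBall, dist_eq_norm] at hx
    refine cutX_eq_one ?_
    have : ‖x - 0‖ ^ 2 ≤ R ^ 2 := by gcongr
    nlinarith
  have hg := hL.cut hC hl hχ0 hχ1 (hχC.hol0 hθ0.le hθ1.le) (by have := hχC.nonneg; linarith) hχz
  generalize hC' : C + _ * (2 * N ^ 2 * C + C) = C' at hg
  have hC'1 : 1 ≤ C' := by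
    rw [← hC']
    have := hχC.nonneg
    have : C ≤ C + 3 * (18 * Q * (1 + 2 * 1 * (1 + (R + 1))) ^ 3) * (2 * N ^ 2 * C + C) :=
      le_add_of_nonneg_right (by positivity)
    linarith
  obtain ⟨K, hK⟩ := solvable_of_gcoef hθ0 hθ1 hβ hlam hl hC'1 hT hg
  have hu : UniformContinuousOn f (closedBall 0 (R + 1)) :=
    (isCompact_closedBall _ _).uniformContinuousOn_of_continuous hf.continuousOn
  obtain ⟨d, hd, hfd⟩ := Metric.uniformContinuousOn_iff_le.1 hu ε hε
  obtain ⟨Ck, k, hk⟩ := exists_moll N hθ0.le hθ1.le (ρ := min d 1) (by positivity)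
  have hF := (hk.C2b_kInt hθ0 (min_le_right _ _) hf hM).1
  have hF' := hχC.mul hθ0.le hθ1.le hF
  set F : ES N → ℝ := fun x => χ x * kInt f k x with hFd
  generalize (20:ℝ) * _ * _ = CF at hF'
  have hXF : XB T θ CF fun _ => F :=
    ⟨fun _ _ => hF', fun x t _ s _ => by
      rw [sub_self, abs_zero]; exact mul_nonneg hF'.nonneg (abs_nonneg _)⟩
  have hY := hg.yb (zero_le_one.trans hC'1) hθ0 hθ1 hβ hXF
  have hY2 := hh.sub (hY.const_mul (-1))
  obtain ⟨w, hw, hws, hw0⟩ := hK _ _ (by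
    have := hF'.nonneg
    positivity) hY2
  have hX := hXF.add hw
  have hXs : Solves T (fun t x => (1 - χ x) • lapL N + χ x • A t x)
      (fun t x => χ x • B t x) (fun t x => χ x * c t x) h (fun t x => F x + w t x) := by
    intro t ht x
    refine ((hws t ht x).const_add (F x)).congr_deriv ?_
    have hc1 := (hw.sp t (Ioo_subset_Icc_self ht)).cd
    simp only [LA, D_add hF'.cd hc1, D2_add hF'.cd hc1, map_add]
    ring
  refine ⟨_, _, _, _, fun t x hx => ?_, ⟨_, hX⟩, hXs, ?_, fun x hx => ?_⟩
  · simp [hχo x hx]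
  · refine sup_bound (C := (N ^ 2 + 1) * C') (by positivity) hM0 hG hμ hX hXs
      (fun t ht x => ⟨⟨lam, C', hlam, by linarith, hg.ell t ht x⟩, ?_, ?_⟩) ?_ hh.b fun x => ?_
    · refine ((hg.ell t ht x).norm_le (by linarith)).trans ?_
      linarith
    · refine (hg.bB t ht x).trans ?_
      have : 0 ≤ N ^ 2 * C' := by positivity
      linarith
    · intro t ht x
      have h1 := mul_le_mul_of_nonneg_left (hcμ t ht x) (hχ0 x)
      have h2 := mul_le_mul_of_nonneg_right (hχ1 x) hμ
      linarith
    · rw [hw0, add_zero, hFd, abs_mul, abs_of_nonneg (hχ0 x)]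
      have h1 := mul_le_mul_of_nonneg_left (hk.kInt_abs_le hM x) (hχ0 x)
      have h2 := mul_le_mul_of_nonneg_right (hχ1 x) hM0
      linarith
  · rw [hw0, add_zero, hFd]
    simp only [hχo x hx, one_mul]
    refine hk.abs_kInt_sub_le hf fun y hy => ?_
    rw [mem_closedBall] at hx hy
    refine (hfd y ?_ x ?_ (hy.trans (min_le_left _ _)))
    · rw [mem_closedBall]
      linarith [dist_triangle y x 0, min_le_right d 1]
    · rw [mem_closedBall]; linarith

end Local

section Limit
variable {N : ℕ} {T θ β lam C R G M ε : ℝ} {A : ℝ → ES N → H2 N →L[ℝ] ℝ}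
  {B : ℝ → ES N → V1 N →L[ℝ] ℝ} {c h : ℝ → ES N → ℝ} {f : ES N → ℝ}

/-- Bounded functions that solve the Cauchy problem on a ball, with an error in the datum. -/
def IsApprox (T θ R ε M : ℝ) (A : ℝ → ES N → H2 N →L[ℝ] ℝ) (B : ℝ → ES N → V1 N →L[ℝ] ℝ)
    (c h : ℝ → ES N → ℝ) (f : ES N → ℝ) (u : ℝ → ES N → ℝ) : Prop :=
  ∃ A' B' c', (∀ t, ∀ x ∈ closedBall 0 R, A' t x = A t x ∧ B' t x = B t x ∧ c' t x = c t x) ∧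
    (∃ Cu, XB T θ Cu u) ∧ Solves T A' B' c' h u ∧ (∀ t ∈ Icc 0 T, ∀ x, |u t x| ≤ M) ∧
    ∀ x ∈ closedBall 0 R, |u 0 x - f x| ≤ ε

lemma LA_congr {φ ψ : ES N → ℝ} {x : ES N} (hφ : φ =ᶠ[𝓝 x] ψ) (t : ℝ) :
    LA A B c φ t x = LA A B c ψ t x := by
  simp only [LA, D, D2, hφ.fderiv_eq, hφ.fderiv.fderiv_eq, hφ.eq_of_nhds]

lemma XB.zero (hC : 0 ≤ C) : XB (N := N) T θ C fun _ _ => 0 := by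
  have h1 : D (fun _ : ES N => (0:ℝ)) = fun _ => 0 := by ext1 x; simp [D]
  have h2 : D2 (fun _ : ES N => (0:ℝ)) = fun _ => 0 := by
    ext1 x; show fderiv ℝ (D fun _ : ES N => (0:ℝ)) x = 0; rw [h1]; simp
  refine ⟨fun _ _ => ⟨contDiff_const, fun x => by simpa using hC, fun x => ?_, fun x => ?_,
    fun x y => ?_⟩, fun x t _ s _ => ?_⟩
  · rw [h1, norm_zero]; exact hC
  · rw [h2, norm_zero]; exact hC
  · rw [h2, sub_self, norm_zero]; positivity
  · rw [sub_self, abs_zero]; positivity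

lemma closedBall_subset_zero (x0 : ES N) {r R : ℝ} (h : ‖x0‖ + r ≤ R) :
    closedBall x0 r ⊆ closedBall 0 R := fun x hx => by
  rw [mem_closedBall] at hx ⊢
  have := dist_triangle x x0 0
  rw [dist_zero_right x0] at this
  linarith

/-- Interior regularity of limits of approximate solutions. -/
lemma exists_local_limit (hθ0 : 0 < θ) (hθ1 : θ < 1) (hβ : 0 < β) (hlam : 0 < lam)
    (hL : ∀ R > 0, ∃ C ≥ 1, LCoef T θ β lam R C A B c) (hG : 0 ≤ G) (hh : YB T θ G h)
    (hM : 0 ≤ M) {Rn e : ℕ → ℝ} {u : ℕ → ℝ → ES N → ℝ} (U : Ultrafilter ℕ)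
    (hR : Tendsto Rn U atTop) (hu : ∀ n, IsApprox T θ (Rn n) (e n) M A B c h f (u n)) {t0 : ℝ}
    (ht0 : t0 ∈ Ioo 0 T) (x0 : ES N) :
    ∃ a b r K v, 0 ≤ a ∧ b ≤ T ∧ t0 ∈ Ioo a b ∧ 0 < r ∧ XB b θ K v ∧
      (∀ t ∈ Icc a b, ∀ x ∈ closedBall x0 r, Tendsto (fun n => u n t x) U (𝓝 (v t x))) ∧
      ∀ t ∈ Ioo a b, ∀ x ∈ ball x0 r,
        HasDerivAt (fun s => v s x) (LA A B c (v t) t x + h t x) t := by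
  obtain ⟨C, hC, hLC⟩ := hL (‖x0‖ + 1) (by positivity)
  have hC0 : 0 < C := by linarith
  obtain ⟨ε, hε, hI⟩ := interior_estimate N hθ0 hθ1 hlam hC
  obtain ⟨r, hr0, hr1, hr⟩ := exists_rpow_eq hθ0 (a := min 1 (ε / (2 * C))) (by positivity)
    (min_le_left _ _)
  obtain ⟨k, hk0, hk1, hk⟩ := exists_rpow_eq hβ (a := min 1 (ε / (2 * C))) (by positivity)
    (min_le_left _ _)
  have hCe : C * min 1 (ε / (2 * C)) ≤ ε / 2 := by
    calc _ ≤ C * (ε / (2 * C)) := by gcongr; exact min_le_right _ _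
      _ = ε / 2 := by field_simp
  obtain ⟨κ, hκ0, hκ1, hκ2, hκ3⟩ : ∃ κ : ℝ, 0 < κ ∧ 2 * κ ≤ k ∧ 2 * κ ≤ t0 ∧ t0 + κ ≤ T := by
    have h1 := ht0.1
    have h2 := sub_pos.2 ht0.2
    refine ⟨min (k / 2) (min (t0 / 2) (T - t0)), by positivity, ?_, ?_, ?_⟩
    · linarith [min_le_left (k / 2) (min (t0 / 2) (T - t0))]
    · linarith [min_le_right (k / 2) (min (t0 / 2) (T - t0)), min_le_left (t0 / 2) (T - t0)]
    · linarith [min_le_right (k / 2) (min (t0 / 2) (T - t0)), min_le_right (t0 / 2) (T - t0)]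
  obtain ⟨K, hK0, hK⟩ := hI r hr0 κ hκ0
  have hsub := closedBall_subset_zero x0 (add_le_add_right hr1 ‖x0‖)
  have hx0 : x0 ∈ closedBall (0 : ES N) (‖x0‖ + 1) := hsub (mem_closedBall_self hr0.le)
  have hIT : ∀ {t}, t ∈ Icc 0 (t0 + κ) → t ∈ Icc 0 T := fun ht => ⟨ht.1, ht.2.trans hκ3⟩
  have hv : ∀ n, ∃ v, XB (t0 + κ) θ (K * (M + G)) v ∧ (‖x0‖ + 1 ≤ Rn n →
      ∀ t ∈ Icc 0 (t0 + κ), t0 - κ ≤ t → ∀ x ∈ closedBall x0 (r / 2), v t x = u n t x) := by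
    intro n
    by_cases hn : ‖x0‖ + 1 ≤ Rn n
    swap
    · exact ⟨_, XB.zero (by positivity), fun h => absurd h hn⟩
    obtain ⟨A', B', c', he, ⟨Cu, hCu⟩, hs, hb, -⟩ := hu n
    have hco : ∀ t ∈ Icc 0 (t0 + κ), t0 - κ - κ ≤ t →
        (∀ x ∈ closedBall x0 r, ‖A' t x - A t0 x0‖ ≤ ε) ∧
        CoefOn θ C G (closedBall x0 r) (A' t) (B' t) (c' t) (h t) := by
      intro t ht hσ
      have hn' : ∀ x ∈ closedBall x0 r, A' t x = A t x ∧ B' t x = B t x ∧ c' t x = c t x :=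
        fun x hx => he t x (closedBall_subset_closedBall hn (hsub hx))
      refine ⟨fun x hx => ?_, fun x hx => ?_, fun x hx => ?_, fun x hx => hh.b t (hIT ht) x,
        fun x hx y hy => ?_, fun x hx y hy => ?_, fun x hx y hy => ?_, fun x hx y hy => ?_⟩
      · rw [(hn' x hx).1]
        have h1 : ‖x - x0‖ ^ θ ≤ r ^ θ := by
          rw [mem_closedBall, dist_eq_norm] at hx
          gcongr
        have h2 : |t - t0| ^ β ≤ k ^ β := by
          gcongr
          rw [abs_le]
          constructor <;> linarith [ht.2]
        calc ‖A t x - A t0 x0‖ = ‖(A t x - A t x0) + (A t x0 - A t0 x0)‖ := by abel_nf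
          _ ≤ C * r ^ θ + C * k ^ β := (norm_add_le _ _).trans (add_le_add
              ((hLC.hA t (hIT ht) x (hsub hx) x0 hx0).trans (by gcongr))
              ((hLC.tA x0 hx0 t (hIT ht) t0 (Ioo_subset_Icc_self ht0)).trans (by gcongr)))
          _ ≤ ε := by rw [hr, hk]; linarith
      · rw [(hn' x hx).2.1]; exact hLC.bB t (hIT ht) x (hsub hx)
      · rw [(hn' x hx).2.2]; exact hLC.bc t (hIT ht) x (hsub hx)
      · rw [(hn' x hx).1, (hn' y hy).1]; exact hLC.hA t (hIT ht) x (hsub hx) y (hsub hy)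
      · rw [(hn' x hx).2.1, (hn' y hy).2.1]; exact hLC.hB t (hIT ht) x (hsub hx) y (hsub hy)
      · rw [(hn' x hx).2.2, (hn' y hy).2.2]; exact hLC.hc t (hIT ht) x (hsub hx) y (hsub hy)
      · exact hh.hol t (hIT ht) x y
    obtain ⟨v, hv1, hv2⟩ := hK (t0 + κ) (t0 - κ) M G Cu (u n) A' B' c' h (A t0 x0) x0
      (by linarith [ht0.1]) hM hG (hCu.restrict hκ3)
      (fun t ht x => hs t ⟨ht.1, ht.2.trans_le hκ3⟩ x) (fun t ht x => hb t (hIT ht) x)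
      (hLC.ell t0 (Ioo_subset_Icc_self ht0) x0 hx0) hco (Or.inr (by linarith))
    exact ⟨v, hv1, fun _ => hv2⟩
  choose w hw1 hw2 using hv
  obtain ⟨v, hv, hvl⟩ := XB.exists_tendsto U hθ0 hw1
  have hev : ∀ᶠ n in (U : Filter ℕ), ‖x0‖ + 1 ≤ Rn n := hR.eventually_ge_atTop _
  refine ⟨t0 - κ, t0 + κ, r / 2, _, v, by linarith, hκ3, ⟨by linarith, by linarith⟩, by linarith,
    hv, fun t ht x hx => ?_, fun t ht x hx => ?_⟩
  · have ht' : t ∈ Icc 0 (t0 + κ) := ⟨by linarith [ht.1], ht.2⟩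
    refine (hvl t ht' x).1.congr' ?_
    filter_upwards [hev] with n hn
    exact hw2 n hn t ht' ht.1 x hx
  · have htI : Icc 0 T ∈ 𝓝 t := Icc_mem_nhds (by linarith [ht.1]) (by linarith [ht.2])
    have hxb : x ∈ closedBall x0 r := closedBall_subset_closedBall (by linarith)
      (ball_subset_closedBall hx)
    refine XTendsto.hasDerivAt (h := fun _ t => h t x) (a := t0 - κ) (b := t0 + κ) hθ0 hw1 hvl
      (by linarith) le_rfl ht ?_
      ((continuousOn_of_rpow_modulus hβ (hLC.tA x (hsub hxb))).continuousAt htI)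
      ((continuousOn_of_rpow_modulus hβ (hLC.tB x (hsub hxb))).continuousAt htI)
      ((continuousOn_of_rpow_modulus hβ (hLC.tc x (hsub hxb))).continuousAt htI)
      ((((hh.tc x).continuousAt htI).tendsto).comp tendsto_snd)
    filter_upwards [hev] with n hn s hs
    obtain ⟨A', B', c', he, -, hsol, -⟩ := hu n
    have hs0 : 0 ≤ s := by linarith [hs.1]
    have e1 : (fun y => u n s y) =ᶠ[𝓝 x] w n s := by
      filter_upwards [isOpen_ball.mem_nhds hx] with y hy
      exact (hw2 n hn s ⟨hs0, hs.2.le⟩ hs.1.le y (ball_subset_closedBall hy)).symm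
    have e2 : (fun s => w n s x) =ᶠ[𝓝 s] fun s => u n s x := by
      filter_upwards [isOpen_Ioo.mem_nhds hs] with t ht
      exact hw2 n hn t ⟨by linarith [ht.1], ht.2.le⟩ ht.1.le x (ball_subset_closedBall hx)
    have hd := hsol s ⟨by linarith [hs.1], hs.2.trans_le hκ3⟩ x
    obtain ⟨i1, i2, i3⟩ := he s x (closedBall_subset_closedBall hn (hsub hxb))
    refine (hd.congr_of_eventuallyEq e2).congr_deriv ?_
    rw [← LA_congr e1, LA, LA, i1, i2, i3]

/-- Barrier estimate at the initial time. -/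
lemma IsApprox.initial_estimate (hlam : 0 < lam) (hC : 1 ≤ C) {x0 : ES N}
    (hL : LCoef T θ β lam (‖x0‖ + 1) C A B c) (hh : ∀ t ∈ Icc 0 T, ∀ x, |h t x| ≤ G)
    (hR : ‖x0‖ + 1 ≤ R) {u : ℝ → ES N → ℝ} (hu : IsApprox T θ R ε M A B c h f u)
    (hfM : |f x0| ≤ M) (hε : 0 ≤ ε) {Q : ℝ} (hQ : 2 * M ≤ Q)
    (hf : ∀ x ∈ closedBall x0 1, |f x - f x0| ≤ ε + Q * ‖x - x0‖ ^ 2) :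
    ∀ t ∈ Icc 0 T, ∀ x ∈ closedBall x0 1,
      |u t x - f x0| ≤ 2 * ε + (C * M + G + Q * (2 * (N ^ 2 * C) + 2 * C) + 1) * t +
        Q * ‖x - x0‖ ^ 2 := by
  obtain ⟨A', B', c', he, ⟨Cu, hCu⟩, hs, hb, h0⟩ := hu
  have hM : 0 ≤ M := (abs_nonneg _).trans hfM
  have hQ0 : 0 ≤ Q := by linarith
  have hC0 : 0 < C := by linarith
  have hsub := closedBall_subset_zero x0 (le_refl (‖x0‖ + 1))
  have key : ∀ a : ℝ, |a| ≤ 1 → ∀ t ∈ Icc 0 T, ∀ x ∈ closedBall x0 1,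
      a * u t x ≤ (a * f x0 + 2 * ε + (C * M + G + Q * (2 * (N ^ 2 * C) + 2 * C) + 1) * t) +
        Q * ‖x - x0‖ ^ 2 := by
    intro a ha t ht
    have hG : 0 ≤ G := (abs_nonneg _).trans (hh t ht 0)
    have hab : ∀ {y z : ℝ}, |y| ≤ z → a * y ≤ z := fun {y z} hy =>
      (le_abs_self _).trans ((abs_mul a y).trans_le
        ((mul_le_mul_of_nonneg_right ha (abs_nonneg y)).trans ((one_mul _).trans_le hy)))
    set E := C * M + G + Q * (2 * (N ^ 2 * C) + 2 * C) + 1 with hE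
    have hE0 : 0 ≤ E := by positivity
    refine barrier (a := fun _ => a) (a' := fun _ => 0) (q := fun _ => Q) (q' := fun _ => 0)
      (p := fun t => a * f x0 + 2 * ε + E * t) (p' := fun _ => E) (CA := N ^ 2 * C) (CB := C)
      hCu hs (fun t => hasDerivAt_const _ _)
      (fun t => by simpa using ((hasDerivAt_id t).const_mul E).const_add (a * f x0 + 2 * ε))
      (fun t => hasDerivAt_const _ _) (fun _ => hQ0) (fun t ht x hx => ?_) (fun x hx => ?_)
      (fun t ht x hx => ?_) (fun t ht x hx _ => ?_) t ht
    · have hx' := hsub (ball_subset_closedBall hx)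
      have ht' := Ioo_subset_Icc_self ht
      obtain ⟨i1, i2, -⟩ := he t x (closedBall_subset_closedBall hR hx')
      rw [i1, i2]
      exact ⟨⟨lam, C, hlam, hC0.le, hL.ell t ht' x hx'⟩, (hL.ell t ht' x hx').norm_le hC0.le,
        hL.bB t ht' x hx'⟩
    · have h1 := hab (h0 x (closedBall_subset_closedBall hR (hsub hx)))
      have h2 := hab (hf x hx)
      linarith
    · have hx1 : ‖x - x0‖ = 1 := by simpa [dist_eq_norm] using hx
      have h1 := hab (hb t ht x)
      have h2 := hab ((abs_neg (f x0)).trans_le hfM)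
      have h3 := mul_nonneg hE0 ht.1
      rw [hx1]
      linarith
    · have hx' := hsub (ball_subset_closedBall hx)
      have ht' := Ioo_subset_Icc_self ht
      obtain ⟨-, -, i3⟩ := he t x (closedBall_subset_closedBall hR hx')
      have hx1 : ‖x - x0‖ ≤ 1 := by
        have := ball_subset_closedBall hx
        rwa [mem_closedBall, dist_eq_norm] at this
      have h1 : |c' t x * u t x + h t x| ≤ C * M + G := by
        refine (abs_add_le _ _).trans (add_le_add ?_ (hh t ht' x))
        rw [abs_mul, i3]
        exact mul_le_mul (hL.bc t ht' x hx') (hb t ht' x) (abs_nonneg _) hC0.le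
      have h2 := hab h1
      have h3 : Q * (2 * (N ^ 2 * C) + 2 * C * ‖x - x0‖) ≤ Q * (2 * (N ^ 2 * C) + 2 * C) := by
        have := mul_le_mul_of_nonneg_left hx1 hC0.le
        exact mul_le_mul_of_nonneg_left (by linarith) hQ0
      linarith
  intro t ht x hx
  rw [abs_le']
  have h1 := key 1 (by simp) t ht x hx
  have h2 := key (-1) (by simp) t ht x hx
  constructor <;> linarith

lemma exists_quadratic_modulus (hf : Continuous f) (hM : ∀ x, |f x| ≤ M) (hε : 0 < ε) (x0 : ES N) :
    ∃ Q, 2 * M ≤ Q ∧ ∀ x, |f x - f x0| ≤ ε + Q * ‖x - x0‖ ^ 2 := by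
  have hM0 : 0 ≤ M := (abs_nonneg _).trans (hM 0)
  obtain ⟨d, hd, hfd⟩ := Metric.continuous_iff.1 hf x0 ε hε
  refine ⟨2 * M + 2 * M / d ^ 2, le_add_of_nonneg_right (by positivity), fun x => ?_⟩
  by_cases hx : dist x x0 < d
  · have := hfd x hx
    rw [Real.dist_eq] at this
    have : 0 ≤ (2 * M + 2 * M / d ^ 2) * ‖x - x0‖ ^ 2 := by positivity
    linarith
  · rw [not_lt, dist_eq_norm] at hx
    have h1 : |f x - f x0| ≤ 2 * M := (abs_sub _ _).trans (by linarith [hM x, hM x0])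
    have h2 : 2 * M ≤ 2 * M / d ^ 2 * ‖x - x0‖ ^ 2 := by
      rw [div_mul_eq_mul_div, le_div_iff₀ (by positivity)]
      gcongr
    have : 0 ≤ 2 * M * ‖x - x0‖ ^ 2 := by positivity
    linarith

/-- Existence for the Cauchy problem with locally regular coefficients and continuous datum. -/
theorem exists_bounded_solution (hθ0 : 0 < θ) (hθ1 : θ < 1) (hβ : 0 < β) (hlam : 0 < lam)
    (hl : lam ≤ 1) (hT : 0 ≤ T) (hL : ∀ R > 0, ∃ C ≥ 1, LCoef T θ β lam R C A B c) {μ : ℝ}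
    (hμ : 0 ≤ μ) (hcμ : ∀ t ∈ Icc 0 T, ∀ x, c t x ≤ μ) (hG : 0 ≤ G) (hh : YB T θ G h)
    (hf : Continuous f) (hM : ∀ x, |f x| ≤ M) :
    ∃ u : ℝ → ES N → ℝ, (∃ M', ∀ t ∈ Icc 0 T, ∀ x, |u t x| ≤ M') ∧ (∀ x, u 0 x = f x) ∧
      (∀ x0, ContinuousWithinAt (fun p : ℝ × ES N => u p.1 p.2) (Icc 0 T ×ˢ univ) (0, x0)) ∧
      ∀ t0 ∈ Ioo 0 T, ∀ x0, ∃ a b r K v, 0 ≤ a ∧ t0 ∈ Ioo a b ∧ 0 < r ∧ XB b θ K v ∧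
        (∀ t ∈ Icc a b, ∀ x ∈ closedBall x0 r, u t x = v t x) ∧
        ∀ t ∈ Ioo a b, ∀ x ∈ ball x0 r,
          HasDerivAt (fun s => v s x) (LA A B c (v t) t x + h t x) t := by
  have hM0 : 0 ≤ M := (abs_nonneg _).trans (hM 0)
  have hap : ∀ n : ℕ, ∃ u, IsApprox T θ n (1 / ((n:ℝ) + 1)) (Real.exp (μ * T) * (M + T * G))
      A B c h f u := by
    intro n
    obtain ⟨C, hC, hLC⟩ := hL ((n:ℝ) + 1) (by positivity)
    obtain ⟨A', B', c', u, hu⟩ := exists_approx hθ0 hθ1 hβ hlam hl hC hT n.cast_nonneg hLC hμ hcμ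
      hG hh hf hM (ε := 1 / ((n:ℝ) + 1)) (by positivity)
    exact ⟨u, A', B', c', hu⟩
  choose w hw using hap
  set M' := Real.exp (μ * T) * (M + T * G) with hM'
  have hMM' : M ≤ M' := by
    have h1 : 1 ≤ Real.exp (μ * T) := Real.one_le_exp (by positivity)
    have h2 : 0 ≤ T * G := by positivity
    rw [hM']
    nlinarith
  have hwb : ∀ n, ∀ t ∈ Icc 0 T, ∀ x, |w n t x| ≤ M' := fun n => by
    obtain ⟨A', B', c', -, -, -, hb, -⟩ := hw n
    exact hb
  set U := Filter.hyperfilter ℕ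
  have hUtop : (U : Filter ℕ) ≤ atTop := Nat.hyperfilter_le_atTop
  have hlim : ∀ t x, ∃ l, t ∈ Icc 0 T → Tendsto (fun n => w n t x) U (𝓝 l) := by
    intro t x
    by_cases ht : t ∈ Icc 0 T
    · obtain ⟨l, hl⟩ := U.exists_tendsto_of_bdd (f := fun n => w n t x) fun n => hwb n t ht x
      exact ⟨l, fun _ => hl⟩
    · exact ⟨0, fun h => absurd h ht⟩
  choose u hu using hlim
  have hini : ∀ x0 : ES N, ∀ ε > 0, ∃ Q E : ℝ, ∀ t ∈ Icc 0 T, ∀ x ∈ closedBall x0 1,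
      |u t x - f x0| ≤ 2 * ε + E * t + Q * ‖x - x0‖ ^ 2 := by
    intro x0 ε hε
    obtain ⟨Q, hQ, hQf⟩ := exists_quadratic_modulus hf (fun x => (hM x).trans hMM') hε x0
    obtain ⟨C, hC, hLC⟩ := hL (‖x0‖ + 1) (by positivity)
    refine ⟨Q, C * M' + G + Q * (2 * (N ^ 2 * C) + 2 * C) + 1,
      fun t ht x hx => le_of_tendsto ((hu t x ht).sub_const _).abs ?_⟩
    have e1 : ∀ᶠ n : ℕ in atTop, ‖x0‖ + 1 ≤ n := tendsto_natCast_atTop_atTop.eventually_ge_atTop _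
    have e2 : ∀ᶠ n : ℕ in atTop, 1 / ((n:ℝ) + 1) ≤ ε :=
      (tendsto_one_div_add_atTop_nhds_zero_nat (𝕜 := ℝ)).eventually_le_const hε
    filter_upwards [hUtop e1, hUtop e2] with n h1 h2
    obtain ⟨A', B', c', i1, i2, i3, i4, i5⟩ := hw n
    exact IsApprox.initial_estimate hlam hC hLC hh.b h1
      ⟨A', B', c', i1, i2, i3, i4, fun x hx => (i5 x hx).trans h2⟩ ((hM x0).trans hMM') hε.le hQ
      (fun x _ => hQf x) t ht x hx
  have h00 : (0:ℝ) ∈ Icc 0 T := ⟨le_rfl, hT⟩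
  have hu0 : ∀ x, u 0 x = f x := fun x => by
    refine eq_of_abs_sub_nonpos (le_of_forall_pos_le_add fun ε hε => ?_)
    obtain ⟨Q, E, hQ⟩ := hini x (ε / 2) (by positivity)
    have := hQ 0 h00 x (mem_closedBall_self zero_le_one)
    simp only [sub_self, norm_zero] at this
    linarith
  refine ⟨u, ⟨M', fun t ht x => le_of_tendsto (hu t x ht).abs
    (Eventually.of_forall fun n => hwb n t ht x)⟩, hu0, fun x0 => ?_, fun t0 ht0 x0 => ?_⟩
  · rw [Metric.continuousWithinAt_iff']
    intro ε hε
    obtain ⟨Q, E, hQ⟩ := hini x0 (ε / 4) (by positivity)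
    have hc : Continuous fun p : ℝ × ES N => 2 * (ε / 4) + E * p.1 + Q * ‖p.2 - x0‖ ^ 2 := by
      fun_prop
    have h1 : ∀ᶠ p in 𝓝[Icc 0 T ×ˢ univ] ((0:ℝ), x0),
        2 * (ε / 4) + E * p.1 + Q * ‖p.2 - x0‖ ^ 2 < ε :=
      nhdsWithin_le_nhds (hc.continuousAt.eventually_lt continuousAt_const (by
        simp only [mul_zero, add_zero, sub_self, norm_zero]; norm_num; linarith))
    have h2 : ∀ᶠ p in 𝓝[Icc 0 T ×ˢ univ] ((0:ℝ), x0), p.2 ∈ closedBall x0 1 :=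
      nhdsWithin_le_nhds (continuous_snd.continuousAt.eventually_mem
        (closedBall_mem_nhds x0 one_pos))
    filter_upwards [h1, h2, self_mem_nhdsWithin] with p i1 i2 i3
    rw [Real.dist_eq, hu0]
    exact (hQ p.1 i3.1 p.2 i2).trans_lt i1
  · obtain ⟨a, b, r, K, v, ha, hb, hab, hr, hv, hl, hd⟩ := exists_local_limit hθ0 hθ1 hβ hlam hL hG
      hh (hM0.trans hMM') U ((tendsto_natCast_atTop_atTop (R := ℝ)).mono_left hUtop) hw ht0 x0
    exact ⟨a, b, r, K, v, ha, hab, hr, hv, fun t ht x hx => tendsto_nhds_unique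
      (hu t x ⟨ha.trans ht.1, ht.2.trans hb⟩) (hl t ht x hx), hd⟩

end Limit

section Coefficients
variable {N : ℕ} {T δ α θ R : ℝ}

lemma rpow_le_mul_rpow {a : ℝ} (hα : 0 ≤ α) (hαδ : α ≤ δ) {x y : ES N}
    (hx : x ∈ closedBall 0 a) (hy : y ∈ closedBall 0 a) :
    ‖x - y‖ ^ δ ≤ (2 * a) ^ (δ - α) * ‖x - y‖ ^ α := by
  rw [mem_closedBall, dist_zero_right] at hx hy
  have h1 : ‖x - y‖ ≤ 2 * a := (norm_sub_le _ _).trans (by linarith)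
  calc ‖x - y‖ ^ δ = ‖x - y‖ ^ (δ - α) * ‖x - y‖ ^ α := by
        rw [← Real.rpow_add_of_nonneg (norm_nonneg _) (sub_nonneg.2 hαδ) hα, sub_add_cancel]
    _ ≤ _ := by gcongr

lemma ParabolicHolderOn.exists_bound {h : ℝ → ES N → ℝ} (hh : ParabolicHolderOn T δ R h)
    (hT : 0 ≤ T) (hR : 0 ≤ R) (hα : 0 ≤ α) (hαδ : α ≤ δ) :
    ∃ K, ∀ K' ≥ K, (∀ t ∈ Icc 0 T, ∀ x ∈ closedBall 0 R, |h t x| ≤ K') ∧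
      (∀ t ∈ Icc 0 T, ∀ x ∈ closedBall 0 R, ∀ y ∈ closedBall 0 R,
        |h t x - h t y| ≤ K' * ‖x - y‖ ^ α) ∧
      ∀ x ∈ closedBall 0 R, ∀ t ∈ Icc 0 T, ∀ s ∈ Icc 0 T,
        |h t x - h s x| ≤ K' * |t - s| ^ (δ / 2) := by
  obtain ⟨C, hC⟩ := hh
  have hδ : 0 ≤ δ := hα.trans hαδ
  have hC' : ∀ t ∈ Icc 0 T, ∀ s ∈ Icc 0 T, ∀ x ∈ closedBall 0 R, ∀ y ∈ closedBall 0 R,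
      |h t x - h s y| ≤ |C| * (|t - s| + ‖x - y‖ ^ 2) ^ (δ / 2) := fun t ht s hs x hx y hy =>
    (hC t ht s hs x hx y hy).trans (by gcongr; exact le_abs_self C)
  refine ⟨|h 0 0| + |C| * (T + R ^ 2) ^ (δ / 2) + |C| * (2 * R) ^ (δ - α) + |C|,
    fun K hK => ⟨fun t ht x hx => ?_, fun t ht x hx y hy => ?_, fun x hx t ht s hs => ?_⟩⟩
  all_goals
    have p1 : 0 ≤ |C| * (T + R ^ 2) ^ (δ / 2) := by positivity
    have p2 : 0 ≤ |C| * (2 * R) ^ (δ - α) := by positivity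
    have p3 : 0 ≤ |C| := abs_nonneg C
    have p4 : 0 ≤ |h 0 0| := abs_nonneg _
  · have h0 : (0 : ES N) ∈ closedBall 0 R := mem_closedBall_self hR
    have h1 := hC' t ht 0 ⟨le_rfl, hT⟩ x hx 0 h0
    have h2 : |h t x| ≤ |h t x - h 0 0| + |h 0 0| := by
      simpa using abs_add_le (h t x - h 0 0) (h 0 0)
    rw [mem_closedBall, dist_zero_right] at hx
    have h3 : |C| * (|t - 0| + ‖x - 0‖ ^ 2) ^ (δ / 2) ≤ |C| * (T + R ^ 2) ^ (δ / 2) := by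
      rw [sub_zero, sub_zero, abs_of_nonneg ht.1]
      gcongr
      · have := ht.1; positivity
      exact ht.2
    linarith
  · refine (hC' t ht t ht x hx y hy).trans ?_
    rw [sub_self, abs_zero, zero_add, ← Real.rpow_natCast, ← Real.rpow_mul (norm_nonneg _)]
    rw [show ((2:ℕ):ℝ) * (δ / 2) = δ by push_cast; ring]
    calc |C| * ‖x - y‖ ^ δ ≤ |C| * ((2 * R) ^ (δ - α) * ‖x - y‖ ^ α) := by
          gcongr; exact rpow_le_mul_rpow hα hαδ hx hy
      _ = |C| * (2 * R) ^ (δ - α) * ‖x - y‖ ^ α := by ring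
      _ ≤ _ := by gcongr; linarith
  · refine (hC' t ht s hs x hx x hx).trans ?_
    rw [sub_self, norm_zero, zero_pow two_ne_zero, add_zero]
    gcongr
    linarith

lemma continuousOn_of_parabolicHolder {h : ℝ → ES N → ℝ} (hδ : 0 < δ)
    (hh : ∀ R > 0, ParabolicHolderOn T δ R h) :
    ContinuousOn (fun p : ℝ × ES N => h p.1 p.2) (Icc 0 T ×ˢ univ) := by
  rintro ⟨s, y⟩ ⟨hs, -⟩
  obtain ⟨C, hC⟩ := hh (‖y‖ + 1) (by positivity)
  have hsub := closedBall_subset_zero y (le_refl (‖y‖ + 1))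
  rw [ContinuousWithinAt, tendsto_iff_norm_sub_tendsto_zero]
  have hc : Continuous fun p : ℝ × ES N => C * (|p.1 - s| + ‖p.2 - y‖ ^ 2) ^ (δ / 2) :=
    continuous_const.mul ((Real.continuous_rpow_const (by positivity)).comp (by fun_prop))
  have h0 : Tendsto (fun p : ℝ × ES N => C * (|p.1 - s| + ‖p.2 - y‖ ^ 2) ^ (δ / 2))
      (𝓝[Icc 0 T ×ˢ univ] (s, y)) (𝓝 0) := by
    have := (hc.tendsto (s, y)).mono_left (nhdsWithin_le_nhds (s := Icc 0 T ×ˢ univ))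
    simpa [Real.zero_rpow (by positivity : δ / 2 ≠ 0)] using this
  have h2 : ∀ᶠ p in 𝓝[Icc 0 T ×ˢ univ] (s, y), p.2 ∈ closedBall y 1 :=
    nhdsWithin_le_nhds (continuous_snd.continuousAt.eventually_mem
      (closedBall_mem_nhds y one_pos))
  refine squeeze_zero' (Eventually.of_forall fun _ => norm_nonneg _) ?_ h0
  filter_upwards [h2, self_mem_nhdsWithin] with p h1 h2
  exact hC p.1 h2.1 s hs p.2 (hsub h1) y (hsub (mem_closedBall_self zero_le_one))

/-- The functional `p ↦ ∑ b j * p e_j`. -/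
def drL (b : Fin N → ℝ) : V1 N →L[ℝ] ℝ :=
  ∑ j, b j • ContinuousLinearMap.apply ℝ ℝ (eb j)

lemma drL_apply (b : Fin N → ℝ) (p : V1 N) : drL b p = ∑ j, b j * p (eb j) := by
  simp [drL, sum_apply]

lemma norm_drL_le {b : Fin N → ℝ} {C : ℝ} (hC : 0 ≤ C) (h : ∀ j, |b j| ≤ C) :
    ‖drL b‖ ≤ N * C := by
  refine ContinuousLinearMap.opNorm_le_bound _ (by positivity) fun p => ?_
  rw [drL_apply]
  refine (norm_sum_le _ _).trans ((Finset.sum_le_card_nsmul _ _ (C * ‖p‖) fun j _ => ?_).trans ?_)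
  · rw [norm_mul]
    have := p.le_opNorm (eb j)
    rw [norm_eb, mul_one] at this
    exact mul_le_mul (h j) this (norm_nonneg _) hC
  · simp [mul_assoc]

lemma trL_sub (a a' : Fin N → Fin N → ℝ) : trL a - trL a' = trL fun i j => a i j - a' i j := by
  ext H
  simp only [sub_apply, trL_apply, sub_mul, Finset.sum_sub_distrib]

lemma drL_sub (b b' : Fin N → ℝ) : drL b - drL b' = drL fun j => b j - b' j := by
  ext H
  simp only [sub_apply, drL_apply, sub_mul, Finset.sum_sub_distrib]

variable {q : ℝ → ES N → Fin N → Fin N → ℝ} {b : ℝ → ES N → Fin N → ℝ} {c : ℝ → ES N → ℝ}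

lemma Hyp.exists_lCoef (H : Hyp N T q b c) (hα : 0 ≤ α) (hαδ : α ≤ H.δ) (hR : 0 < R) (T' : ℝ) :
    ∃ C ≥ 1, LCoef T' α (H.δ / 2) (min H.ν₀ 1) R C
      (fun t x => trL (q (max 0 (min t T)) x)) (fun t x => drL (b (max 0 (min t T)) x))
      fun t x => c (max 0 (min t T)) x := by
  have hT := H.T_pos.le
  choose Kq hq using fun p : Fin N × Fin N =>
    (H.holder_q R hR p.1 p.2).exists_bound hT hR.le hα hαδ
  choose Kb hb using fun j => (H.holder_b R hR j).exists_bound hT hR.le hα hαδ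
  obtain ⟨Kc, hc⟩ := (H.holder_c R hR).exists_bound hT hR.le hα hαδ
  obtain ⟨Mq, hMq⟩ := (Set.finite_range Kq).bddAbove
  obtain ⟨Mb, hMb⟩ := (Set.finite_range Kb).bddAbove
  set K := max 1 (max Mq (max Mb Kc)) with hK
  have hK1 : 1 ≤ K := le_max_left _ _
  have hK0 : 0 ≤ K := by linarith
  have hKr : max Mq (max Mb Kc) ≤ K := le_max_right _ _
  have hq' := fun i j => hq (i, j) K
    ((hMq ⟨(i, j), rfl⟩).trans ((le_max_left _ _).trans hKr))
  have hb' := fun j => hb j K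
    ((hMb ⟨j, rfl⟩).trans (((le_max_left _ _).trans (le_max_right _ _)).trans hKr))
  have hc' := hc K (((le_max_right _ _).trans (le_max_right _ _)).trans hKr)
  have hp := clamp_mem hT
  have e1 : ∀ {r : ℝ}, 0 ≤ r → N ^ 2 * (K * r) ≤ ((N:ℝ) ^ 2 + N + 1) * K * r := fun {r} hr => by
    have h1 : 0 ≤ (N:ℝ) * (K * r) := by positivity
    have h2 : 0 ≤ K * r := by positivity
    linarith
  have e2 : ∀ {r : ℝ}, 0 ≤ r → N * (K * r) ≤ ((N:ℝ) ^ 2 + N + 1) * K * r := fun {r} hr => by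
    have h1 : 0 ≤ (N:ℝ) ^ 2 * (K * r) := by positivity
    have h2 : 0 ≤ K * r := by positivity
    linarith
  have e3 : ∀ {r : ℝ}, 0 ≤ r → K * r ≤ ((N:ℝ) ^ 2 + N + 1) * K * r := fun {r} hr => by
    have h1 : 0 ≤ (N:ℝ) ^ 2 * (K * r) := by positivity
    have h2 : 0 ≤ N * (K * r) := by positivity
    linarith
  have e4 := e3 zero_le_one
  rw [mul_one, mul_one] at e4
  have et : ∀ t s : ℝ, |max 0 (min t T) - max 0 (min s T)| ^ (H.δ / 2) ≤ |t - s| ^ (H.δ / 2) :=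
    fun t s => Real.rpow_le_rpow (abs_nonneg _) abs_clamp_sub_le (by linarith [H.δ_mem.1])
  refine ⟨((N:ℝ) ^ 2 + N + 1) * K, hK1.trans e4, ⟨fun t _ x hx => ⟨_, H.q_symm _ (hp t) x,
    fun i j => ((hq' i j).1 _ (hp t) x hx).trans e4, fun ξ => ?_, rfl⟩, fun t _ x hx => ?_,
    fun t _ x hx => (hc'.1 _ (hp t) x hx).trans e4, fun t _ x hx y hy => ?_,
    fun t _ x hx y hy => ?_, fun t _ x hx y hy => (hc'.2.1 _ (hp t) x hx y hy).trans
      (e3 (by positivity)), fun x hx t _ s _ => ?_, fun x hx t _ s _ => ?_,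
    fun x hx t _ s _ => ?_⟩⟩
  · refine le_trans ?_ (H.ellip _ (hp t) x ξ)
    gcongr
    exact (min_le_left _ _).trans (H.ν_lb _ (hp t) x)
  · refine (norm_drL_le hK0 fun j => (hb' j).1 _ (hp t) x hx).trans ?_
    simpa using e2 zero_le_one
  · rw [trL_sub]
    exact (norm_trL_le (by positivity) fun i j => (hq' i j).2.1 _ (hp t) x hx y hy).trans
      (e1 (by positivity))
  · rw [drL_sub]
    exact (norm_drL_le (by positivity) fun j => (hb' j).2.1 _ (hp t) x hx y hy).trans
      (e2 (by positivity))
  · rw [trL_sub]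
    exact (norm_trL_le (by positivity) fun i j => ((hq' i j).2.2 x hx _ (hp t) _ (hp s)).trans
      (mul_le_mul_of_nonneg_left (et t s) hK0)).trans (e1 (by positivity))
  · rw [drL_sub]
    exact (norm_drL_le (by positivity) fun j => ((hb' j).2.2 x hx _ (hp t) _ (hp s)).trans
      (mul_le_mul_of_nonneg_left (et t s) hK0)).trans (e2 (by positivity))
  · exact ((hc'.2.2 x hx _ (hp t) _ (hp s)).trans
      (mul_le_mul_of_nonneg_left (et t s) hK0)).trans (e3 (by positivity))

lemma pd2_eq {φ : ES N → ℝ} (hφ : ContDiff ℝ 2 φ) (i j : Fin N) :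
    pd2 φ i j = fun x => D2 φ x (eb i) (eb j) := by
  ext x
  have h1 : DifferentiableAt ℝ (fderiv ℝ φ) x :=
    (contDiff_fderiv_of_two hφ).differentiable one_ne_zero x
  show fderiv ℝ (fun y => fderiv ℝ φ y (eb j)) x (eb i) = _
  rw [(h1.hasFDerivAt.clm_apply (hasFDerivAt_const (eb j) x)).fderiv]
  simp

lemma Aop_eq_LA {φ : ES N → ℝ} (hφ : ContDiff ℝ 2 φ) (t : ℝ) (x : ES N) :
    Aop q b c φ t x = LA (fun t x => trL (q t x)) (fun t x => drL (b t x)) c φ t x := by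
  simp only [Aop, LA, trL_apply, drL_apply, pd2_eq hφ]
  rfl

/-- Hölder functions with bounded norms satisfy uniform estimates for smaller exponents. -/
lemma exists_hol_of_cbNorm {g : ℝ → ES N → ℝ} (hθ : θ ∈ Ioo (0:ℝ) 1)
    (hg : (⨆ t ∈ Icc (0:ℝ) T, CbNorm θ (g t)) ≠ ⊤) (hα : 0 ≤ α) (hαθ : α ≤ θ) :
    ∃ G, 0 ≤ G ∧ ∀ t ∈ Icc 0 T, (∀ x, |g t x| ≤ G) ∧ Hol α G (g t) := by
  set S := ⨆ t ∈ Icc (0:ℝ) T, CbNorm θ (g t) with hS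
  have hfl : ⌊θ⌋₊ = 0 := Nat.floor_eq_zero.2 hθ.2
  have hG : 0 ≤ S.toReal := ENNReal.toReal_nonneg
  have key : ∀ t ∈ Icc 0 T, (∀ x, |g t x| ≤ S.toReal) ∧ ∀ x y,
      |g t x - g t y| ≤ S.toReal * ‖x - y‖ ^ θ := by
    intro t ht
    have h1 : CbNorm θ (g t) ≤ S := le_iSup₂_of_le t ht le_rfl
    have h2 : CbNorm θ (g t) = supNormE 0 (g t) + holderSemiE 0 θ (g t) := by
      simp [CbNorm, hfl, hθ.1.ne]
    rw [h2] at h1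
    have h3 : ∀ x, |g t x| ≤ S.toReal := fun x => by
      have := (le_iSup (fun x => ENNReal.ofReal ‖iteratedFDeriv ℝ 0 (g t) x‖) x).trans
        (le_self_add.trans h1)
      simpa using (ENNReal.ofReal_le_iff_le_toReal hg).1 this
    refine ⟨h3, fun x y => ?_⟩
    by_cases hxy : x = y
    · subst hxy
      simp only [sub_self, abs_zero]
      positivity
    · have := (le_iSup_of_le x (le_iSup₂ (f := fun y (_ : x ≠ y) => ENNReal.ofReal
        (‖iteratedFDeriv ℝ 0 (g t) x - iteratedFDeriv ℝ 0 (g t) y‖ / ‖x - y‖ ^ θ)) y hxy)).trans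
        (le_add_self.trans h1)
      have := (ENNReal.ofReal_le_iff_le_toReal hg).1 this
      have hp : 0 < ‖x - y‖ ^ θ := Real.rpow_pos_of_pos (norm_pos_iff.2 (sub_ne_zero.2 hxy)) _
      rw [div_le_iff₀ hp] at this
      refine le_trans (le_of_eq ?_) this
      have e : ‖iteratedFDeriv ℝ 0 (g t) x - iteratedFDeriv ℝ 0 (g t) y‖ = ‖g t x - g t y‖ := by
        simp only [iteratedFDeriv_zero_eq_comp, Function.comp_apply, ← map_sub,
          LinearIsometryEquiv.norm_map]
      rw [e, Real.norm_eq_abs]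
  refine ⟨2 * S.toReal, by positivity, fun t ht => ⟨fun x => ?_, fun x y => ?_⟩⟩
  · linarith [(key t ht).1 x]
  · rw [Real.norm_eq_abs]
    rcases le_total ‖x - y‖ 1 with h | h
    · calc _ ≤ S.toReal * ‖x - y‖ ^ θ := (key t ht).2 x y
        _ ≤ S.toReal * ‖x - y‖ ^ α := by
            refine mul_le_mul_of_nonneg_left ?_ hG
            rcases (norm_nonneg (x - y)).eq_or_lt with h0 | h0
            · rw [← h0, Real.zero_rpow hθ.1.ne']; exact Real.zero_rpow_nonneg _
            · exact Real.rpow_le_rpow_of_exponent_ge h0 h hαθ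
        _ ≤ _ := by gcongr; linarith
    · have h1 : |g t x - g t y| ≤ 2 * S.toReal :=
        (abs_sub _ _).trans (by linarith [(key t ht).1 x, (key t ht).1 y])
      have h2 : 1 ≤ ‖x - y‖ ^ α := Real.one_le_rpow h hα
      exact h1.trans (le_mul_of_one_le_right (by positivity) h2)

end Coefficients

section Regularity
variable {N : ℕ} {θ : ℝ}

/-- Functions which agree locally with an element of `XB` inherit its regularity. -/
lemma XB.regular_of_eqOn (hθ : 0 < θ) {a b r K t0 : ℝ} {x0 : ES N} {u v : ℝ → ES N → ℝ}
    (ha : 0 ≤ a) (ht0 : t0 ∈ Ioo a b) (hr : 0 < r) (hv : XB b θ K v)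
    (huv : ∀ t ∈ Icc a b, ∀ x ∈ closedBall x0 r, u t x = v t x) :
    ContinuousAt (fun p : ℝ × ES N => u p.1 p.2) (t0, x0) ∧ ContDiffAt ℝ 2 (u t0) x0 ∧
      ContinuousAt (fun p : ℝ × ES N => D (u p.1) p.2) (t0, x0) ∧
      ContinuousAt (fun p : ℝ × ES N => D2 (u p.1) p.2) (t0, x0) := by
  have hev : ∀ t ∈ Ioo a b, ∀ x ∈ ball x0 r, u t =ᶠ[𝓝 x] v t := fun t ht x hx => by
    filter_upwards [isOpen_ball.mem_nhds hx] with y hy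
    exact huv t (Ioo_subset_Icc_self ht) y (ball_subset_closedBall hy)
  have hnear : Ioo a b ×ˢ ball x0 r ∈ 𝓝 (t0, x0) :=
    prod_mem_nhds (Ioo_mem_nhds ht0.1 ht0.2) (ball_mem_nhds x0 hr)
  have hdom : Icc 0 b ×ˢ (univ : Set (ES N)) ∈ 𝓝 (t0, x0) :=
    prod_mem_nhds (Icc_mem_nhds (ha.trans_lt ht0.1) ht0.2) univ_mem
  refine ⟨(hv.continuousOn.continuousAt hdom).congr ?_,
    ((hv.sp t0 ⟨ha.trans ht0.1.le, ht0.2.le⟩).cd.contDiffAt).congr_of_eventuallyEq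
      (hev t0 ht0 x0 (mem_ball_self hr)),
    (hv.continuousOn_D.continuousAt hdom).congr ?_,
    ((hv.continuousOn_D2 hθ).continuousAt hdom).congr ?_⟩
  all_goals filter_upwards [hnear] with p hp
  · exact (hev _ hp.1 _ hp.2).eq_of_nhds.symm
  · exact (hev _ hp.1 _ hp.2).fderiv_eq.symm
  · exact (hev _ hp.1 _ hp.2).fderiv.fderiv_eq.symm

end Regularity

/-- Remark `rem-schauder`(ii). Under Hypotheses (H), for `θ ∈ (0,1)`,
`g ∈ C^{0,θ}([0,T] × ℝ^N)` and `f ∈ C_b(ℝ^N)` merely bounded and continuous, the Cauchy problem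
`D_t u = 𝒜 u + g` on `(0,T] × ℝ^N`, `u(0,·) = f`, admits a bounded classical solution: a bounded
continuous function on `[0,T] × ℝ^N`, continuously differentiable once in time and twice in
space on `(0,T] × ℝ^N`, satisfying the equation there and the initial condition. -/
theorem existence_continuous_datum {N : ℕ} {T : ℝ} {q : ℝ → ES N → Fin N → Fin N → ℝ}
    {b : ℝ → ES N → Fin N → ℝ} {c : ℝ → ES N → ℝ} (H : Hyp N T q b c)
    (θ : ℝ) (hθ : θ ∈ Ioo (0:ℝ) 1) (g : ℝ → ES N → ℝ)
    (hg_cont : ContinuousOn (fun p : ℝ × ES N => g p.1 p.2) (Icc (0:ℝ) T ×ˢ univ))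
    (hg_mem : ∀ t ∈ Icc (0:ℝ) T, MemCb θ (g t))
    (hg_sup : (⨆ t ∈ Icc (0:ℝ) T, CbNorm θ (g t)) ≠ ⊤)
    (f : ES N → ℝ) (hf_cont : Continuous f) (hf_bdd : ∃ M, ∀ x, |f x| ≤ M) :
    ∃ u : ℝ → ES N → ℝ,
      (∃ M, ∀ t ∈ Icc (0:ℝ) T, ∀ x, |u t x| ≤ M) ∧
      ContinuousOn (fun p : ℝ × ES N => u p.1 p.2) (Icc (0:ℝ) T ×ˢ univ) ∧
      (∀ t ∈ Ioc (0:ℝ) T, ContDiff ℝ 2 (u t)) ∧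
      (∀ x, ∀ t ∈ Ioc (0:ℝ) T, DifferentiableAt ℝ (fun t' => u t' x) t) ∧
      ContinuousOn (fun p : ℝ × ES N => deriv (fun t' => u t' p.2) p.1) (Ioc (0:ℝ) T ×ˢ univ) ∧
      (∀ i, ContinuousOn (fun p : ℝ × ES N => pd1 (u p.1) i p.2) (Ioc (0:ℝ) T ×ˢ univ)) ∧
      (∀ i j, ContinuousOn (fun p : ℝ × ES N => pd2 (u p.1) i j p.2) (Ioc (0:ℝ) T ×ˢ univ)) ∧
      (∀ t ∈ Ioc (0:ℝ) T, ∀ x, deriv (fun t' => u t' x) t = Aop q b c (u t) t x + g t x) ∧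
      (∀ x, u 0 x = f x) := by
  have hT := H.T_pos
  have hα : 0 < min θ H.δ := lt_min hθ.1 H.δ_mem.1
  have hα1 : min θ H.δ < 1 := (min_le_left _ _).trans_lt hθ.2
  obtain ⟨M, hM⟩ := hf_bdd
  obtain ⟨G, hG, hgG⟩ := exists_hol_of_cbNorm hθ hg_sup hα.le (min_le_left θ H.δ)
  have hp := clamp_mem hT.le
  have hh : YB (T + 1) (min θ H.δ) G fun t x => g (max 0 (min t T)) x :=
    ⟨fun t _ => (hgG _ (hp t)).1, fun t _ => (hgG _ (hp t)).2, fun x =>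
      hg_cont.comp (f := fun t : ℝ => (max 0 (min t T), x)) (by fun_prop)
        fun t _ => ⟨hp t, mem_univ _⟩⟩
  obtain ⟨u, ⟨M', hM'⟩, hu0, hcu, hu⟩ := exists_bounded_solution hα hα1 (half_pos H.δ_mem.1)
    (lt_min H.ν₀_pos one_pos) (min_le_right _ _) (by linarith : 0 ≤ T + 1)
    (fun R hR => H.exists_lCoef hα.le (min_le_right _ _) hR (T + 1)) (le_max_right H.c₀ 0)
    (fun t _ x => (H.c_ub _ (hp t) x).trans (le_max_left _ _)) hG hh hf_cont hM
  have hreg : ∀ t ∈ Ioc 0 T, ∀ x,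
      ContinuousAt (fun p : ℝ × ES N => u p.1 p.2) (t, x) ∧ ContDiffAt ℝ 2 (u t) x ∧
      ContinuousAt (fun p : ℝ × ES N => D (u p.1) p.2) (t, x) ∧
      ContinuousAt (fun p : ℝ × ES N => D2 (u p.1) p.2) (t, x) := fun t ht x => by
    obtain ⟨a, d, r, K, v, ha, htd, hr, hv, huv, -⟩ := hu t ⟨ht.1, by linarith [ht.2]⟩ x
    exact hv.regular_of_eqOn hα ha htd hr huv
  have hcd : ∀ t ∈ Ioc 0 T, ContDiff ℝ 2 (u t) := fun t ht =>
    contDiff_iff_contDiffAt.2 fun x => (hreg t ht x).2.1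
  have hder : ∀ t ∈ Ioc 0 T, ∀ x,
      HasDerivAt (fun s => u s x) (Aop q b c (u t) t x + g t x) t := fun t ht x => by
    obtain ⟨a, d, r, K, v, ha, htd, hr, hv, huv, hvd⟩ := hu t ⟨ht.1, by linarith [ht.2]⟩ x
    have h1 := hvd t htd x (mem_ball_self hr)
    have h2 : u t =ᶠ[𝓝 x] v t := by
      filter_upwards [ball_mem_nhds x hr] with y hy
      exact huv t (Ioo_subset_Icc_self htd) y (ball_subset_closedBall hy)
    have h3 : (fun s => u s x) =ᶠ[𝓝 t] fun s => v s x := by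
      filter_upwards [Ioo_mem_nhds htd.1 htd.2] with s hs
      exact huv s (Ioo_subset_Icc_self hs) x (mem_closedBall_self hr.le)
    refine (h1.congr_of_eventuallyEq h3).congr_deriv ?_
    rw [Aop_eq_LA (hcd t ht), ← LA_congr h2]
    simp only [LA, clamp_eq (Ioc_subset_Icc_self ht)]
  have hsub : Ioc 0 T ×ˢ (univ : Set (ES N)) ⊆ Icc 0 T ×ˢ univ :=
    prod_mono Ioc_subset_Icc_self Subset.rfl
  have hc0 : ContinuousOn (fun p : ℝ × ES N => u p.1 p.2) (Icc 0 T ×ˢ univ) := by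
    rintro ⟨t, x⟩ ⟨ht, -⟩
    rcases ht.1.eq_or_lt with h0 | h0
    · have h0' : t = 0 := h0.symm
      subst h0'
      exact (hcu x).mono (prod_mono (Icc_subset_Icc le_rfl (by linarith)) Subset.rfl)
    · exact (hreg t ⟨h0, ht.2⟩ x).1.continuousWithinAt
  have hc1 : ∀ i, ContinuousOn (fun p : ℝ × ES N => pd1 (u p.1) i p.2) (Ioc 0 T ×ˢ univ) :=
    fun i p hp => ((hreg p.1 hp.1 p.2).2.2.1.clm_apply
      (continuousAt_const (y := eb i))).continuousWithinAt
  have hc2 : ∀ i j, ContinuousOn (fun p : ℝ × ES N => pd2 (u p.1) i j p.2)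
      (Ioc 0 T ×ˢ univ) := fun i j => by
    refine ContinuousOn.congr (f := fun p : ℝ × ES N => D2 (u p.1) p.2 (eb i) (eb j))
      (fun p hp => (((hreg p.1 hp.1 p.2).2.2.2.clm_apply
        (continuousAt_const (y := eb i))).clm_apply
        (continuousAt_const (y := eb j))).continuousWithinAt) fun p hp => ?_
    rw [pd2_eq (hcd p.1 hp.1)]
  have hcq := fun i j => (continuousOn_of_parabolicHolder H.δ_mem.1
    fun R hR => H.holder_q R hR i j).mono hsub
  have hcb := fun j => (continuousOn_of_parabolicHolder H.δ_mem.1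
    fun R hR => H.holder_b R hR j).mono hsub
  have hcc := (continuousOn_of_parabolicHolder H.δ_mem.1 H.holder_c).mono hsub
  refine ⟨u, ⟨M', fun t ht => hM' t ⟨ht.1, by linarith [ht.2]⟩⟩, hc0, hcd,
    fun x t ht => (hder t ht x).differentiableAt, ?_, hc1, hc2,
    fun t ht x => (hder t ht x).deriv, hu0⟩
  refine ContinuousOn.congr (f := fun p : ℝ × ES N => Aop q b c (u p.1) p.1 p.2 + g p.1 p.2) ?_
    fun p hp => (hder p.1 hp.1 p.2).deriv
  exact (((continuousOn_finsetSum _ fun i _ => continuousOn_finsetSum _ fun j _ =>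
    (hcq i j).mul (hc2 i j)).add (continuousOn_finsetSum _ fun j _ =>
    (hcb j).mul (hc1 j))).add (hcc.mul (hc0.mono hsub))).add (hg_cont.mono hsub)
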